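/- Let k be a totally real number field with ring of integers O_k, and let F ∈ O_k[t] be a polynomial. Then the following are equivalent: (i) for every ring embedding σ : k → ℝ and every x ∈ k, σ(F(x)) ≥ 0; (ii) there exist a nonzero integer g and polynomials F₁,…,F₅ ∈ O_k[t] with g²·F = F₁² + F₂² + F₃² + F₄² + F₅². Moreover, for any fixed nonzero g ∈ ℤ and fixed F ∈ O_k[t], there are only finitely many 5-tuples (F₁,…,F₅) ∈ O_k[t]⁵ satisfying g²·F = F₁² + … + F₅². -/

import Mathlib

set_option linter.unusedSectionVars false

namespace FiveSquares

section IdealZeta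

open Filter Ideal NumberField Topology nonZeroDivisors

variable (K : Type*) [Field K] [NumberField K]

/-- Number of integral ideals of norm `n`. -/
noncomputable def idealCount (n : ℕ) : ℕ := Nat.card {I : Ideal (𝓞 K) // absNorm I = n}

theorem tendsto_sum_idealCount :
    Tendsto (fun n : ℕ ↦ (∑ k ∈ Finset.Icc 1 n, (idealCount K k : ℝ)) / n) atTop
      (𝓝 (dedekindZeta_residue K)) := by
  refine ((Ideal.tendsto_norm_le_div_atTop₀ K).comp tendsto_natCast_atTop_atTop).congr fun n ↦ ?_
  simp only [Function.comp_apply, Nat.cast_le, ← Nat.cast_sum, idealCount]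
  congr
  rw [← add_left_inj 1, ← card_norm_le_eq_card_norm_le_add_one,
    show Finset.Icc 1 n = Finset.Ioc 0 n from Finset.Icc_succ_left_eq_Ioc _ _,
    show 1 = Nat.card {I : Ideal (𝓞 K) // absNorm I = 0} by simp [Ideal.absNorm_eq_zero_iff],
    Finset.sum_Ioc_add_eq_sum_Icc (n.zero_le),
    ← Finset.card_preimage_eq_sum_card_image_eq (fun k _ ↦ finite_setOfPred_absNorm_eq k)]
  simp [Set.coe_eq_subtype]

theorem lseriesSummable_idealCount {s : ℝ} (hs : 1 < s) :
    LSeriesSummable (fun n ↦ ((idealCount K n : ℝ) : ℂ)) s := by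
  refine LSeriesSummable_of_sum_norm_bigO_and_nonneg (r := 1) ?_ (fun _ ↦ Nat.cast_nonneg _)
    zero_le_one (by simpa using hs)
  have h := (tendsto_sum_idealCount K).isBigO_one ℝ
  have h2 := h.mul (Asymptotics.isBigO_refl (fun n : ℕ ↦ (n : ℝ)) atTop)
  refine (h2.congr' ?_ ?_)
  · filter_upwards [eventually_ne_atTop 0] with n hn
    field_simp
  · filter_upwards with n
    simp

theorem hasSum_idealCount {s : ℝ} (hs : 1 < s) :
    Summable (fun n : ℕ ↦ (idealCount K n : ℝ) * (n : ℝ) ^ (-s)) ∧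
    ((∑' n : ℕ, (idealCount K n : ℝ) * (n : ℝ) ^ (-s) : ℝ) : ℂ) = dedekindZeta K s := by
  have h := lseriesSummable_idealCount K hs
  have e : ∀ n : ℕ, LSeries.term (fun n ↦ ((idealCount K n : ℝ) : ℂ)) s n =
      (((idealCount K n : ℝ) * (n : ℝ) ^ (-s) : ℝ) : ℂ) := by
    intro n
    rcases eq_or_ne n 0 with rfl | hn
    · simp only [LSeries.term_zero, CharP.cast_eq_zero]
      rw [Real.zero_rpow (by linarith)]; simp
    · rw [LSeries.term_of_ne_zero hn]
      push_cast
      rw [Complex.ofReal_cpow (by positivity)]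
      push_cast
      rw [Complex.cpow_neg, div_eq_mul_inv]
  constructor
  · unfold LSeriesSummable at h
    simp_rw [funext e] at h
    exact Complex.summable_ofReal.mp h
  · rw [Complex.ofReal_tsum, dedekindZeta, LSeries]
    refine tsum_congr fun n ↦ ?_
    rw [← e]
    simp [idealCount]

/-- The norm of a nonzero ideal, raised to `-s`. -/
noncomputable def npow (s : ℝ) (I : (Ideal (𝓞 K))⁰) : ℝ := (absNorm (I : Ideal (𝓞 K)) : ℝ) ^ (-s)

variable {K}

theorem absNorm_pos (I : (Ideal (𝓞 K))⁰) : 0 < absNorm (I : Ideal (𝓞 K)) :=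
  absNorm_pos_of_nonZeroDivisors I

theorem npow_pos (s : ℝ) (I : (Ideal (𝓞 K))⁰) : 0 < npow K s I :=
  Real.rpow_pos_of_pos (by exact_mod_cast absNorm_pos I) _

theorem npow_mul (s : ℝ) (I J : (Ideal (𝓞 K))⁰) : npow K s (I * J) = npow K s I * npow K s J := by
  simp only [npow, Submonoid.coe_mul, map_mul, Nat.cast_mul]
  rw [Real.mul_rpow] <;> positivity

variable (K)

theorem hasSum_npow {s : ℝ} (hs : 1 < s) :
    Summable (npow K s) ∧ ((∑' I, npow K s I : ℝ) : ℂ) = dedekindZeta K s := by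
  obtain ⟨h1, h2⟩ := hasSum_idealCount K hs
  let N : (Ideal (𝓞 K))⁰ → ℕ := fun I ↦ absNorm (I : Ideal (𝓞 K))
  let e := Equiv.sigmaFiberEquiv N
  have hfin : ∀ n, Finite {I // N I = n} := fun n ↦ by
    have : Set.Finite {I : Ideal (𝓞 K) | absNorm I = n} := finite_setOfPred_absNorm_eq n
    have := this.to_subtype
    exact Finite.of_injective (fun I : {I // N I = n} ↦
      (⟨(I.1 : Ideal (𝓞 K)), I.2⟩ : {I : Ideal (𝓞 K) | absNorm I = n}))
      (fun a b h ↦ Subtype.ext (Subtype.ext (by simpa using h)))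
  have hf : ∀ n, HasSum (fun I : {I // N I = n} ↦ npow K s (e ⟨n, I⟩))
      ((idealCount K n : ℝ) * (n : ℝ) ^ (-s)) := by
    intro n
    have := Fintype.ofFinite {I // N I = n}
    have h3 : ∀ I : {I // N I = n}, npow K s (e ⟨n, I⟩) = (n : ℝ) ^ (-s) := by
      rintro ⟨I, rfl⟩
      rfl
    simp_rw [h3]
    rcases eq_or_ne n 0 with rfl | hn
    · rw [Nat.cast_zero, Real.zero_rpow (by linarith), mul_zero]
      exact hasSum_zero
    · have hc : (idealCount K n : ℝ) = Fintype.card {I // N I = n} := by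
        rw [idealCount, ← Nat.card_eq_fintype_card]
        congr 1
        refine Nat.card_congr ⟨fun I ↦ ⟨⟨I.1, mem_nonZeroDivisors_of_ne_zero ?_⟩, I.2⟩,
          fun I ↦ ⟨I.1, I.2⟩, fun _ ↦ rfl, fun _ ↦ rfl⟩
        intro h
        apply hn
        rw [← I.2, h]
        simp
      rw [hc]
      convert hasSum_fintype (fun _ : {I // N I = n} ↦ (n : ℝ) ^ (-s))
      simp
  have hsum : Summable (fun p : (Σ n, {I // N I = n}) ↦ npow K s (e p)) := by
    refine (summable_sigma_of_nonneg (fun p ↦ (npow_pos s _).le)).mpr ⟨fun n ↦ (hf n).summable, ?_⟩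
    simp_rw [fun n ↦ (hf n).tsum_eq]
    exact h1
  refine ⟨e.summable_iff.mp hsum, ?_⟩
  rw [← h2, ← e.tsum_eq, hsum.tsum_sigma]
  simp_rw [fun n ↦ (hf n).tsum_eq]

theorem tendsto_sub_one_mul_tsum_npow :
    Tendsto (fun s : ℝ ↦ (s - 1) * ∑' I, npow K s I) (𝓝[>] 1) (𝓝 (dedekindZeta_residue K)) := by
  have h := tendsto_sub_one_mul_dedekindZeta_nhdsGT K
  have h2 := (Complex.continuous_re.tendsto _).comp h
  simp only [Complex.ofReal_re] at h2
  refine h2.congr' ?_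
  filter_upwards [self_mem_nhdsWithin] with s hs
  simp only [Function.comp]
  rw [← (hasSum_npow K hs).2, ← Complex.ofReal_one, ← Complex.ofReal_sub, ← Complex.ofReal_mul,
    Complex.ofReal_re]

end IdealZeta

section Tent

/-- The tent function, whose integer translates form a partition of unity. -/
noncomputable def tent (t : ℝ) : ℝ := max 0 (1 - |t|)

theorem tent_nonneg (t : ℝ) : 0 ≤ tent t := le_max_left _ _

theorem tent_le_one (t : ℝ) : tent t ≤ 1 := max_le zero_le_one (by linarith [abs_nonneg t])

theorem abs_lt_one_of_tent_ne_zero {t : ℝ} (h : tent t ≠ 0) : |t| < 1 := by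
  by_contra! h1
  exact h (max_eq_left (by linarith))

theorem abs_tent_sub_tent_le (s t : ℝ) : |tent s - tent t| ≤ |s - t| := by
  unfold tent
  have h := abs_max_sub_max_le_abs (1 - |s|) (1 - |t|) 0
  rw [max_comm 0, max_comm 0]
  refine h.trans ?_
  have h2 := abs_abs_sub_abs_le_abs_sub t s
  rw [abs_sub_comm t s] at h2
  rwa [show 1 - |s| - (1 - |t|) = |t| - |s| by ring]

theorem sum_tent (y : ℝ) : ∑ m ∈ ({-⌊y⌋, -⌊y⌋ - 1} : Finset ℤ), tent (y + m) = 1 := by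
  have h1 := Int.floor_le y
  have h2 := Int.lt_floor_add_one y
  rw [Finset.sum_pair (by omega)]
  have e1 : tent (y + ((-⌊y⌋ : ℤ) : ℝ)) = 1 - (y - ⌊y⌋) := by
    unfold tent
    push_cast
    rw [abs_of_nonneg (by linarith), max_eq_right (by linarith)]
    ring
  have e2 : tent (y + ((-⌊y⌋ - 1 : ℤ) : ℝ)) = y - ⌊y⌋ := by
    unfold tent
    push_cast
    rw [abs_of_nonpos (by linarith), max_eq_right (by linarith)]
    ring
  rw [e1, e2]
  ring

theorem tent_eq_zero {y : ℝ} {m : ℤ} (h : m ∉ ({-⌊y⌋, -⌊y⌋ - 1} : Finset ℤ)) :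
    tent (y + m) = 0 := by
  by_contra h0
  have := abs_lt.mp (abs_lt_one_of_tent_ne_zero h0)
  apply h
  have h3 : ⌊y + m⌋ = ⌊y⌋ + m := Int.floor_add_intCast y m
  have h4 : -1 ≤ ⌊y + m⌋ := Int.le_floor.mpr (by push_cast; linarith)
  have h5 : ⌊y + m⌋ < 1 := Int.floor_lt.mpr (by push_cast; linarith)
  simp only [Finset.mem_insert, Finset.mem_singleton]
  omega

theorem hasSum_prod_tent {J : Type*} [Fintype J] (y : J → ℝ) :
    HasSum (fun e : J → ℤ ↦ ∏ i, tent (y i + e i)) 1 := by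
  classical
  let S : J → Finset ℤ := fun i ↦ {-⌊y i⌋, -⌊y i⌋ - 1}
  have h : ∑ e ∈ Fintype.piFinset S, ∏ i, tent (y i + e i) = 1 := by
    rw [← Finset.prod_univ_sum S (fun i m ↦ tent (y i + m))]
    exact Finset.prod_eq_one fun i _ ↦ sum_tent (y i)
  rw [← h]
  refine hasSum_sum_of_ne_finset_zero fun e he ↦ ?_
  simp only [Fintype.mem_piFinset, not_forall] at he
  obtain ⟨i, hi⟩ := he
  exact Finset.prod_eq_zero (Finset.mem_univ i) (tent_eq_zero hi)

theorem abs_prod_sub_prod_le {J : Type*} (S : Finset J) (a b : J → ℝ) (ha : ∀ i, |a i| ≤ 1)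
    (hb : ∀ i, |b i| ≤ 1) : |∏ i ∈ S, a i - ∏ i ∈ S, b i| ≤ ∑ i ∈ S, |a i - b i| := by
  classical
  induction S using Finset.induction_on with
  | empty => simp
  | insert i S hi ih =>
    rw [Finset.prod_insert hi, Finset.prod_insert hi, Finset.sum_insert hi]
    have e : a i * ∏ j ∈ S, a j - b i * ∏ j ∈ S, b j =
      (a i - b i) * ∏ j ∈ S, a j + b i * (∏ j ∈ S, a j - ∏ j ∈ S, b j) := by ring
    rw [e]
    refine (abs_add_le _ _).trans (add_le_add ?_ ?_)
    · rw [abs_mul, Finset.abs_prod]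
      exact mul_le_of_le_one_right (abs_nonneg _)
        (Finset.prod_le_one (fun _ _ ↦ abs_nonneg _) fun j _ ↦ ha j)
    · rw [abs_mul]
      exact (mul_le_of_le_one_left (abs_nonneg _) (hb i)).trans ih

end Tent

theorem hasSum_comp_snd {A B : Type*} [Finite A] {f : B → ℝ} (hf : 0 ≤ f) (h : HasSum f 1) :
    HasSum (fun p : A × B ↦ f p.2) (Nat.card A) := by
  have := Fintype.ofFinite A
  have h1 : HasSum (fun _ : A ↦ (1 : ℝ)) (Nat.card A) := by
    have h2 : ∑ _x : A, (1 : ℝ) = Nat.card A := by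
      rw [Finset.sum_const, nsmul_one, Finset.card_univ, ← Nat.card_eq_fintype_card]
    rw [← h2]
    exact hasSum_fintype _
  have h2 : (0 : A → ℝ) ≤ fun _ ↦ (1 : ℝ) := fun _ ↦ zero_le_one
  have h3 := h1.mul h (Summable.mul_of_nonneg h1.summable h.summable h2 hf)
  simpa using h3

section Weight

open scoped Classical

open NumberField NumberField.InfinitePlace NumberField.Units NumberField.Units.dirichletUnitTheorem
  NumberField.mixedEmbedding NumberField.mixedEmbedding.fundamentalCone Module

variable {K : Type*} [Field K] [NumberField K]

/-- Logarithmic vector. -/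
noncomputable def logVec (x : K) : InfinitePlace K → ℝ := fun v ↦ v.mult * Real.log (v x)

theorem logVec_mul {x y : K} (hx : x ≠ 0) (hy : y ≠ 0) : logVec (x * y) = logVec x + logVec y := by
  ext v
  simp only [logVec, map_mul, Pi.add_apply]
  rw [Real.log_mul ((map_ne_zero v).mpr hx) ((map_ne_zero v).mpr hy)]
  ring

theorem logVec_zpow (x : K) (n : ℤ) : logVec (x ^ n) = (n : ℝ) • logVec x := by
  ext v
  simp only [logVec, map_zpow₀, Pi.smul_apply, smul_eq_mul, Real.log_zpow]
  ring

theorem logVec_one : logVec (1 : K) = 0 := by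
  ext v
  simp [logVec]

theorem logVec_prod {ι : Type*} (S : Finset ι) (f : ι → K) (hf : ∀ i, f i ≠ 0) :
    logVec (∏ i ∈ S, f i) = ∑ i ∈ S, logVec (f i) := by
  classical
  induction S using Finset.induction_on with
  | empty => simp [logVec_one]
  | insert i S hi ih =>
    rw [Finset.prod_insert hi, Finset.sum_insert hi,
      logVec_mul (hf i) (Finset.prod_ne_zero_iff.mpr fun j _ ↦ hf j), ih]

/-- Coordinates of the logarithmic vector with respect to fundamental units. -/
noncomputable def logCoord (x : K) (i : {w : InfinitePlace K // w ≠ w₀}) : ℝ :=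
  (completeBasis K).repr (logVec x) i

/-- A compactly supported weight forming a partition of unity under the unit action. -/
noncomputable def weight (x : K) : ℝ :=
  ∏ i : {w : InfinitePlace K // w ≠ w₀}, tent (logCoord x i)

theorem weight_nonneg (x : K) : 0 ≤ weight x := Finset.prod_nonneg fun _ _ ↦ tent_nonneg _

theorem weight_le_one (x : K) : weight x ≤ 1 :=
  Finset.prod_le_one (fun _ _ ↦ tent_nonneg _) fun _ _ ↦ tent_le_one _

theorem logVec_fundSystem (i : {w : InfinitePlace K // w ≠ w₀}) :
    logVec ((fundSystem K (equivFinRank.symm i) : (𝓞 K)ˣ) : K) = completeBasis K i := by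
  rw [completeBasis_apply_of_ne]
  ext v
  rw [expMap_symm_apply, normAtAllPlaces_mixedEmbedding, logVec]

theorem logVec_torsion (ζ : torsion K) : logVec (((ζ : (𝓞 K)ˣ) : 𝓞 K) : K) = 0 := by
  ext v
  have h := (mem_torsion K).mp ζ.2 v
  simp [logVec, h]

theorem logCoord_unit_mul (ζ : torsion K) (e : {w : InfinitePlace K // w ≠ w₀} → ℤ) {x : K}
    (hx : x ≠ 0) (i : {w : InfinitePlace K // w ≠ w₀}) :
    logCoord ((((ζ : (𝓞 K)ˣ) * ∏ j, fundSystem K j ^ (e (equivFinRank j)) : (𝓞 K)ˣ) : K) * x) i =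
      logCoord x i + e i := by
  unfold logCoord
  rw [logVec_mul (by exact coe_ne_zero _) hx]
  have h : logVec ((((ζ : (𝓞 K)ˣ) * ∏ j, fundSystem K j ^ (e (equivFinRank j)) : (𝓞 K)ˣ) : K)) =
      ∑ j, (e j : ℝ) • completeBasis K (j : InfinitePlace K) := by
    rw [Units.val_mul, map_mul, logVec_mul (coe_ne_zero _) (coe_ne_zero _), logVec_torsion,
      zero_add, Units.coe_prod, map_prod, logVec_prod _ _ fun j ↦ coe_ne_zero _,
      ← equivFinRank.sum_comp]
    refine Finset.sum_congr rfl fun j _ ↦ ?_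
    rw [Units.coe_zpow, logVec_zpow, ← logVec_fundSystem, Equiv.symm_apply_apply]
  rw [h, map_add, map_sum, Finsupp.add_apply, Finsupp.finsetSum_apply, add_comm]
  congr 1
  simp_rw [map_smul, Basis.repr_self, Finsupp.smul_apply, smul_eq_mul]
  rw [Finset.sum_eq_single i]
  · simp
  · intro j _ hj
    rw [Finsupp.single_apply, if_neg (fun h ↦ hj (Subtype.ext h)), mul_zero]
  · simp

variable (K) in
/-- The parametrisation of units by torsion and exponents. -/
noncomputable def unitsEquiv : (torsion K × ({w : InfinitePlace K // w ≠ w₀} → ℤ)) ≃ (𝓞 K)ˣ :=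
  Equiv.ofBijective (fun p ↦ (p.1 : (𝓞 K)ˣ) * ∏ j, fundSystem K j ^ (p.2 (equivFinRank j))) <| by
    constructor
    · rintro ⟨a, e⟩ ⟨b, f⟩ h
      obtain ⟨c, -, hc⟩ := exist_unique_eq_mul_prod K
        ((a : (𝓞 K)ˣ) * ∏ j, fundSystem K j ^ (e (equivFinRank j)))
      have h1 := hc (a, fun j ↦ e (equivFinRank j)) rfl
      have h2 := hc (b, fun j ↦ f (equivFinRank j)) h
      have h3 := h1.trans h2.symm
      simp only [Prod.mk.injEq] at h3
      refine Prod.ext h3.1 (funext fun i ↦ ?_)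
      have := congrFun h3.2 (equivFinRank.symm i)
      simpa using this
    · intro u
      obtain ⟨⟨a, e⟩, hc, -⟩ := exist_unique_eq_mul_prod K u
      refine ⟨(a, fun j ↦ e (equivFinRank.symm j)), ?_⟩
      simp only [Equiv.symm_apply_apply]
      exact hc.symm

theorem unitsEquiv_apply (p : torsion K × ({w : InfinitePlace K // w ≠ w₀} → ℤ)) :
    unitsEquiv K p = (p.1 : (𝓞 K)ˣ) * ∏ j, fundSystem K j ^ (p.2 (equivFinRank j)) := rfl

theorem weight_unitsEquiv_mul {x : K} (hx : x ≠ 0)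
    (p : torsion K × ({w : InfinitePlace K // w ≠ w₀} → ℤ)) :
    weight ((unitsEquiv K p : K) * x) = ∏ i, tent (logCoord x i + p.2 i) := by
  rw [unitsEquiv_apply]
  exact Finset.prod_congr rfl fun i _ ↦ by rw [logCoord_unit_mul p.1 p.2 hx i]

theorem hasSum_weight {x : K} (hx : x ≠ 0) :
    HasSum (fun u : (𝓞 K)ˣ ↦ weight ((u : K) * x)) (torsionOrder K) := by
  rw [← Equiv.hasSum_iff (unitsEquiv K)]
  have h2 := hasSum_comp_snd (A := torsion K)
    (fun _ ↦ Finset.prod_nonneg fun _ _ ↦ tent_nonneg _) (hasSum_prod_tent (logCoord x))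
  have h4 : (fun u : (𝓞 K)ˣ ↦ weight ((u : K) * x)) ∘ unitsEquiv K = 
      fun p : torsion K × ({w : InfinitePlace K // w ≠ w₀} → ℤ) ↦
        ∏ i, tent (logCoord x i + p.2 i) :=
    funext fun p ↦ weight_unitsEquiv_mul hx p
  rw [h4]
  exact h2

end Weight

section Lipschitz

open scoped Classical

open NumberField NumberField.InfinitePlace NumberField.Units NumberField.Units.dirichletUnitTheorem
  NumberField.mixedEmbedding NumberField.mixedEmbedding.fundamentalCone Module

variable (K : Type*) [Field K] [NumberField K]

theorem exists_abs_logCoord_sub_le : ∃ C : ℝ, 0 ≤ C ∧ ∀ (x y : K) (η : ℝ),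
    (∀ v : InfinitePlace K, |Real.log (v x) - Real.log (v y)| ≤ η) →
    ∀ i, |logCoord x i - logCoord y i| ≤ C * η := by
  let f (i : {w : InfinitePlace K // w ≠ w₀}) := (completeBasis K).coord i
  let c (i : {w : InfinitePlace K // w ≠ w₀}) (v : InfinitePlace K) : ℝ :=
    v.mult * |f i (fun j ↦ if v = j then 1 else 0)|
  have hc (i v) : 0 ≤ c i v := by positivity
  refine ⟨∑ i, ∑ v, c i v, Finset.sum_nonneg fun i _ ↦ Finset.sum_nonneg fun v _ ↦ hc i v,
    fun x y η h i ↦ ?_⟩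
  have hη : 0 ≤ η := (abs_nonneg _).trans (h w₀)
  have h1 : logCoord x i - logCoord y i = f i (logVec x - logVec y) := by
    rw [map_sub]; rfl
  rw [h1, LinearMap.pi_apply_eq_sum_univ (f i)]
  calc _ ≤ ∑ v, |(logVec x - logVec y) v • f i (fun j ↦ if v = j then 1 else 0)| :=
        Finset.abs_sum_le_sum_abs _ _
    _ ≤ ∑ v, c i v * η := by
        refine Finset.sum_le_sum fun v _ ↦ ?_
        rw [smul_eq_mul, abs_mul]
        have : |(logVec x - logVec y) v| ≤ v.mult * η := by
          simp only [logVec, Pi.sub_apply]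
          rw [← mul_sub, abs_mul, Nat.abs_cast]
          exact mul_le_mul_of_nonneg_left (h v) (by positivity)
        calc _ ≤ v.mult * η * |f i (fun j ↦ if v = j then 1 else 0)| :=
              mul_le_mul_of_nonneg_right this (abs_nonneg _)
          _ = _ := by simp only [c]; ring
    _ = (∑ v, c i v) * η := by rw [Finset.sum_mul]
    _ ≤ _ := mul_le_mul_of_nonneg_right
        (Finset.single_le_sum (f := fun i ↦ ∑ v, c i v)
          (fun i _ ↦ Finset.sum_nonneg fun v _ ↦ hc i v) (Finset.mem_univ i)) hη

theorem exists_log_le_log_add : ∃ C : ℝ, 0 ≤ C ∧ ∀ x : K, weight x ≠ 0 →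
    ∀ v w : InfinitePlace K, Real.log (v x) ≤ Real.log (w x) + C := by
  let B := completeBasis K
  let D : ℝ := ∑ i : {w : InfinitePlace K // w ≠ w₀}, ∑ v, |B i v| / v.mult
  have hD (v : InfinitePlace K) :
      ∑ i : {w : InfinitePlace K // w ≠ w₀}, |B i v| / v.mult ≤ D :=
    Finset.sum_le_sum fun i _ ↦ Finset.single_le_sum (f := fun v ↦ |B i v| / v.mult)
      (fun v _ ↦ by positivity) (Finset.mem_univ v)
  have hD0 : 0 ≤ D := Finset.sum_nonneg fun i _ ↦ Finset.sum_nonneg fun v _ ↦ by positivity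
  refine ⟨2 * D, by linarith, fun x hx v w ↦ ?_⟩
  have key (v : InfinitePlace K) : |Real.log (v x) - B.repr (logVec x) w₀| ≤ D := by
    have h1 : logVec x v = ∑ i, B.repr (logVec x) i * B i v := by
      conv_lhs => rw [← B.sum_repr (logVec x)]
      rw [Finset.sum_apply]
      simp
    rw [← Fintype.sum_subtype_add_sum_subtype (fun i : InfinitePlace K ↦ i ≠ w₀)] at h1
    have h2 : ∑ i : {i : InfinitePlace K // ¬ i ≠ w₀}, B.repr (logVec x) i * B i v =
        B.repr (logVec x) w₀ * v.mult := by
      have : ∀ i : {i : InfinitePlace K // ¬ i ≠ w₀}, i = ⟨w₀, by simp⟩ := fun i ↦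
        Subtype.ext (not_not.mp i.2)
      rw [Fintype.sum_eq_single ⟨w₀, by simp⟩ (fun i hi ↦ absurd (this i) hi)]
      simp only [B]
      rw [completeBasis_apply_of_eq]
    rw [h2] at h1
    have hv : (0 : ℝ) < v.mult := by exact_mod_cast v.mult_pos
    have h3 : Real.log (v x) - B.repr (logVec x) w₀ =
        (∑ i : {w : InfinitePlace K // w ≠ w₀}, B.repr (logVec x) i * B i v) / v.mult := by
      rw [eq_div_iff hv.ne']
      simp only [logVec] at h1 ⊢
      linarith
    rw [h3, Finset.sum_div]
    refine (Finset.abs_sum_le_sum_abs _ _).trans ((Finset.sum_le_sum fun i _ ↦ ?_).trans (hD v))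
    rw [abs_div, abs_mul, Nat.abs_cast]
    have h4 : |B.repr (logVec x) i| ≤ 1 :=
      (abs_lt_one_of_tent_ne_zero (Finset.prod_ne_zero_iff.mp hx i (Finset.mem_univ i))).le
    gcongr
    exact mul_le_of_le_one_left (abs_nonneg _) h4
  have h1 := abs_le.mp (key v)
  have h2 := abs_le.mp (key w)
  linarith

theorem abs_log_sub_log_le {a b δ : ℝ} (ha : 0 < a) (h : |b - a| ≤ δ) (hδ : 2 * δ ≤ a) :
    |Real.log b - Real.log a| ≤ 2 * δ / a := by
  have h1 := abs_le.mp h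
  have h2 : 0 ≤ δ := (abs_nonneg _).trans h
  have hb : 0 < b := by linarith
  rw [abs_le]
  constructor
  · have := Real.log_le_sub_one_of_pos (div_pos ha hb)
    rw [Real.log_div ha.ne' hb.ne'] at this
    have h3 : a / b - 1 ≤ 2 * δ / a := by
      rw [div_sub_one hb.ne', div_le_div_iff₀ hb ha]
      nlinarith
    linarith
  · have := Real.log_le_sub_one_of_pos (div_pos hb ha)
    rw [Real.log_div hb.ne' ha.ne'] at this
    have h3 : b / a - 1 ≤ 2 * δ / a := by
      rw [div_sub_one ha.ne']
      gcongr
      linarith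
    linarith

theorem abs_exp_neg_sub_exp_neg_le {p q m : ℝ} (hp : m ≤ p) (hq : m ≤ q) :
    |Real.exp (-p) - Real.exp (-q)| ≤ Real.exp (-m) * |p - q| := by
  wlog h : p ≤ q generalizing p q
  · rw [abs_sub_comm, abs_sub_comm p]
    exact this hq hp (not_le.mp h).le
  have h1 : Real.exp (-q) ≤ Real.exp (-p) := Real.exp_le_exp.mpr (by linarith)
  rw [abs_of_nonneg (by linarith), abs_of_nonpos (by linarith)]
  have h2 : Real.exp (-q) = Real.exp (-p) * Real.exp (p - q) := by
    rw [← Real.exp_add]; ring_nf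
  have h3 : Real.exp (-p) ≤ Real.exp (-m) := Real.exp_le_exp.mpr (by linarith)
  have h4 := Real.add_one_le_exp (p - q)
  have h5 := Real.exp_pos (-p)
  rw [h2]
  nlinarith

variable {K}

/-- The logarithm of the absolute norm. -/
noncomputable def logNorm (x : K) : ℝ := ∑ v : InfinitePlace K, logVec x v

theorem exp_neg_mul_logNorm {x : K} (hx : x ≠ 0) (s : ℝ) :
    Real.exp (-(s * logNorm x)) = (|Algebra.norm ℚ x| : ℝ) ^ (-s) := by
  have h : logNorm x = Real.log |(Algebra.norm ℚ x : ℝ)| := by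
    have h1 := prod_eq_abs_norm x
    push_cast at h1
    rw [← h1, Real.log_prod (fun _ _ ↦ pow_ne_zero _ ((_root_.map_ne_zero _).mpr hx))]
    simp [logNorm, logVec]
  rw [h, Real.rpow_def_of_pos (abs_pos.mpr (by exact_mod_cast Algebra.norm_ne_zero_iff.mpr hx))]
  ring_nf

theorem exists_place_eq_norm (x : K) : ∃ v : InfinitePlace K, v x = ‖mixedEmbedding K x‖ := by
  rw [norm_eq_sup'_normAtPlace]
  obtain ⟨v, -, hv⟩ := Finset.exists_mem_eq_sup' (Finset.univ_nonempty (α := InfinitePlace K))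
    (fun w ↦ normAtPlace w (mixedEmbedding K x))
  exact ⟨v, by rw [hv, normAtPlace_apply]⟩

/-- The weighted norm power. -/
noncomputable def phi (s : ℝ) (x : K) : ℝ := weight x * Real.exp (-(s * logNorm x))

end Lipschitz

section Lipschitz

open scoped Classical

open NumberField NumberField.InfinitePlace NumberField.Units NumberField.Units.dirichletUnitTheorem
  NumberField.mixedEmbedding NumberField.mixedEmbedding.fundamentalCone Module

variable (K : Type*) [Field K] [NumberField K]

theorem exists_abs_phi_sub_le_of_weight_ne_zero {A : ℝ} (hA : 0 ≤ A) :
    ∃ C R : ℝ, 0 ≤ C ∧ 1 ≤ R ∧ ∀ s : ℝ, 1 < s → s ≤ 2 → ∀ x a : K,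
      (∀ v : InfinitePlace K, v a ≤ A) → weight x ≠ 0 → R ≤ ‖mixedEmbedding K x‖ →
      |phi s (x + a) - phi s x| ≤ C / ‖mixedEmbedding K x‖ ^ (finrank ℚ K + 1) := by
  obtain ⟨C₂, hC₂, h₂⟩ := exists_log_le_log_add K
  obtain ⟨C₃, hC₃, h₃⟩ := exists_abs_logCoord_sub_le K
  set d := finrank ℚ K
  set E := Real.exp C₂
  have hE : 0 < E := Real.exp_pos _
  set n : ℝ := ((Fintype.card {w : InfinitePlace K // w ≠ w₀} : ℕ) : ℝ)
  refine ⟨(n * C₃ + 2 * d) * (2 * A * E) * (2 * E) ^ d, 1 + 2 * A * E + 2 * E, by positivity,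
    by nlinarith [mul_nonneg hA hE.le], fun s hs1 hs2 x a ha hx hR ↦ ?_⟩
  set r := ‖mixedEmbedding K x‖
  have hr : 0 < r := by nlinarith [mul_nonneg hA hE.le]
  obtain ⟨v₀, hv₀⟩ := exists_place_eq_norm x
  have hx0 : x ≠ 0 := by
    rintro rfl
    rw [map_zero] at hv₀
    exact hr.ne hv₀
  have hv (v : InfinitePlace K) : r / E ≤ v x := by
    have hpos : 0 < v x := v.pos_iff.mpr hx0
    rw [div_le_iff₀ hE]
    have h1 := h₂ x hx v₀ v
    rw [hv₀] at h1
    have h2 := Real.exp_le_exp.mpr h1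
    rwa [Real.exp_log hr, Real.exp_add, Real.exp_log hpos] at h2
  have hrA : 2 * A ≤ r / E := by
    rw [le_div_iff₀ hE]; nlinarith [mul_nonneg hA hE.le]
  set ρ := r / (2 * E)
  have hρ : 1 ≤ ρ := by
    rw [le_div_iff₀ (by positivity)]; nlinarith [mul_nonneg hA hE.le]
  have hρ2 : r / E = 2 * ρ := by simp only [ρ]; field_simp
  set η := 2 * A * E / r
  have hη : 0 ≤ η := by positivity
  have hdiff (v : InfinitePlace K) : |v (x + a) - v x| ≤ A := by
    rw [abs_le]
    have h1 := v.1.add_le x a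
    have h2 := v.1.add_le (x + a) (-a)
    rw [add_neg_cancel_right, v.1.map_neg] at h2
    have h3 := ha v
    constructor
    · have : v x ≤ v (x + a) + v a := h2
      linarith
    · have : v (x + a) ≤ v x + v a := h1
      linarith
  have hlog (v : InfinitePlace K) : |Real.log (v (x + a)) - Real.log (v x)| ≤ η := by
    have hpos : 0 < v x := v.pos_iff.mpr hx0
    refine (abs_log_sub_log_le hpos (hdiff v) (hrA.trans (hv v))).trans ?_
    calc 2 * A / v x ≤ 2 * A / (r / E) := by gcongr; exact hv v
      _ = η := by simp only [η]; field_simp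
  have hlow (v : InfinitePlace K) : ρ ≤ v (x + a) ∧ ρ ≤ v x := by
    have h1 := abs_le.mp (hdiff v)
    have h2 := hv v
    constructor <;> linarith
  have hsum : ∑ v : InfinitePlace K, (v.mult : ℝ) = d := by
    rw [← Nat.cast_sum, sum_mult_eq]
  have hlN (z : K) (hz : ∀ v : InfinitePlace K, ρ ≤ v z) : d * Real.log ρ ≤ logNorm z := by
    rw [← hsum, Finset.sum_mul]
    exact Finset.sum_le_sum fun v _ ↦ mul_le_mul_of_nonneg_left
      (Real.log_le_log (by linarith) (hz v)) (by positivity)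
  have hlogρ : 0 ≤ d * Real.log ρ := mul_nonneg (by positivity) (Real.log_nonneg hρ)
  have hp := hlN (x + a) fun v ↦ (hlow v).1
  have hq := hlN x fun v ↦ (hlow v).2
  have hp' : d * Real.log ρ ≤ s * logNorm (x + a) := by nlinarith
  have hq' : d * Real.log ρ ≤ s * logNorm x := by nlinarith
  have hm : Real.exp (-(d * Real.log ρ)) = (2 * E) ^ d / r ^ d := by
    rw [Real.exp_neg, Real.exp_nat_mul, Real.exp_log (by linarith), ← div_pow, ← inv_pow]
    simp only [ρ, inv_div]
  have hpq : |s * logNorm (x + a) - s * logNorm x| ≤ 2 * d * η := by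
    rw [← mul_sub, abs_mul, abs_of_pos (by linarith : 0 < s)]
    have : |logNorm (x + a) - logNorm x| ≤ d * η := by
      unfold logNorm
      rw [← Finset.sum_sub_distrib, ← hsum, Finset.sum_mul]
      refine (Finset.abs_sum_le_sum_abs _ _).trans (Finset.sum_le_sum fun v _ ↦ ?_)
      simp only [logVec]
      rw [← mul_sub, abs_mul, Nat.abs_cast]
      exact mul_le_mul_of_nonneg_left (hlog v) (by positivity)
    calc _ ≤ 2 * (d * η) := mul_le_mul hs2 this (abs_nonneg _) (by norm_num)
      _ = _ := by ring
  have hw : |weight (x + a) - weight x| ≤ n * C₃ * η := by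
    unfold weight
    refine (abs_prod_sub_prod_le _ _ _ (fun i ↦ ?_) (fun i ↦ ?_)).trans ?_
    · rw [abs_of_nonneg (tent_nonneg _)]; exact tent_le_one _
    · rw [abs_of_nonneg (tent_nonneg _)]; exact tent_le_one _
    · refine (Finset.sum_le_sum fun i _ ↦ (abs_tent_sub_tent_le _ _).trans
        (h₃ _ _ η hlog i)).trans ?_
      rw [Finset.sum_const, nsmul_eq_mul, Finset.card_univ, mul_assoc]
  have h1 : phi s (x + a) - phi s x = (weight (x + a) - weight x) *
      Real.exp (-(s * logNorm (x + a))) + weight x *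
      (Real.exp (-(s * logNorm (x + a))) - Real.exp (-(s * logNorm x))) := by
    unfold phi; ring
  rw [h1]
  have h4 : |(weight (x + a) - weight x) * Real.exp (-(s * logNorm (x + a)))| ≤
      n * C₃ * η * ((2 * E) ^ d / r ^ d) := by
    rw [abs_mul, Real.abs_exp, ← hm]
    exact mul_le_mul hw (Real.exp_le_exp.mpr (by linarith)) (Real.exp_pos _).le (by positivity)
  have h5 : |weight x * (Real.exp (-(s * logNorm (x + a))) - Real.exp (-(s * logNorm x)))| ≤
      (2 * E) ^ d / r ^ d * (2 * d * η) := by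
    rw [abs_mul, abs_of_nonneg (weight_nonneg x), ← hm]
    refine (mul_le_of_le_one_left (abs_nonneg _) (weight_le_one x)).trans ?_
    refine (abs_exp_neg_sub_exp_neg_le hp' hq').trans ?_
    exact mul_le_mul_of_nonneg_left hpq (Real.exp_pos _).le
  refine (abs_add_le _ _).trans ((add_le_add h4 h5).trans (le_of_eq ?_))
  simp only [η]
  field_simp
  ring

theorem exists_abs_phi_sub_le {A : ℝ} (hA : 0 ≤ A) :
    ∃ C R : ℝ, 0 ≤ C ∧ 1 ≤ R ∧ ∀ s : ℝ, 1 < s → s ≤ 2 → ∀ x a : K,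
      (∀ v : InfinitePlace K, v a ≤ A) → R ≤ ‖mixedEmbedding K x‖ →
      |phi s (x + a) - phi s x| ≤ C / ‖mixedEmbedding K x‖ ^ (finrank ℚ K + 1) := by
  obtain ⟨C, R, hC, hR, h⟩ := exists_abs_phi_sub_le_of_weight_ne_zero K hA
  set d := finrank ℚ K
  refine ⟨2 ^ (d + 1) * C, 2 * R + 2 * A, by positivity, by linarith,
    fun s hs1 hs2 x a ha hx ↦ ?_⟩
  set r := ‖mixedEmbedding K x‖
  have hr : 0 < r := by linarith
  by_cases hwx : weight x = 0
  · by_cases hwy : weight (x + a) = 0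
    · rw [phi, phi, hwx, hwy, zero_mul, zero_mul, sub_zero, abs_zero]
      positivity
    · have h1 : r ≤ ‖mixedEmbedding K (x + a)‖ + A := by
        have h2 : mixedEmbedding K x = mixedEmbedding K (x + a) - mixedEmbedding K a := by
          rw [map_add, add_sub_cancel_right]
        simp only [r]
        rw [h2]
        refine (norm_sub_le _ _).trans (add_le_add_right ?_ _)
        obtain ⟨v, hv⟩ := exists_place_eq_norm a
        exact hv ▸ ha v
      have h2 := h s hs1 hs2 (x + a) (-a) (fun v ↦ by
        have : v (-a) = v a := v.1.map_neg a
        rw [this]; exact ha v) hwy (by linarith)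
      rw [add_neg_cancel_right, abs_sub_comm] at h2
      refine h2.trans ?_
      have h3 : r / 2 ≤ ‖mixedEmbedding K (x + a)‖ := by linarith
      calc C / ‖mixedEmbedding K (x + a)‖ ^ (d + 1) ≤ C / (r / 2) ^ (d + 1) := by gcongr
        _ = _ := by rw [div_pow]; field_simp
  · refine (h s hs1 hs2 x a ha hwx (by linarith)).trans ?_
    gcongr
    exact le_mul_of_one_le_left hC (one_le_pow₀ one_le_two)

end Lipschitz

section Classes

open scoped nonZeroDivisors Classical

open NumberField NumberField.InfinitePlace NumberField.mixedEmbedding Module Ideal Filter Topology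

variable (K : Type*) [Field K] [NumberField K]

theorem summable_div_norm_pow (C : ℝ) :
    Summable fun x : 𝓞 K ↦ C / ‖mixedEmbedding K (x : K)‖ ^ (finrank ℚ K + 1) := by
  have h := ZLattice.summable_norm_rpow (mixedEmbedding.integerLattice K) (-(finrank ℚ K + 1 : ℝ))
    (by
      have h1 := ZLattice.rank ℝ (mixedEmbedding.integerLattice K)
      rw [h1, mixedEmbedding.finrank]
      linarith)
  let e : 𝓞 K → mixedEmbedding.integerLattice K := fun x ↦ ⟨mixedEmbedding K (x : K), ⟨x, rfl⟩⟩
  have he : Function.Injective e := fun x y hxy ↦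
    RingOfIntegers.ext (mixedEmbedding_injective K (congrArg Subtype.val hxy))
  have h2 := (h.comp_injective he).mul_left C
  refine h2.congr fun x ↦ ?_
  have h3 : ‖e x‖ = ‖mixedEmbedding K (x : K)‖ := rfl
  simp only [Function.comp]
  rw [h3, Real.rpow_neg (norm_nonneg _), div_eq_mul_inv]
  norm_cast

theorem finite_norm_lt (R : ℝ) : {x : 𝓞 K | ‖mixedEmbedding K (x : K)‖ < R}.Finite := by
  have h := summable_div_norm_pow K 1
  by_contra hinf
  have h1 := h.tendsto_cofinite_zero
  have h0 : 0 < R := by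
    by_contra! h0
    refine hinf ?_
    convert Set.finite_empty
    ext x
    simp only [Set.mem_ofPred_eq, Set.mem_empty_iff_false, iff_false, not_lt]
    exact h0.trans (norm_nonneg _)
  have h2 : ∀ᶠ x : 𝓞 K in cofinite, 1 / ‖mixedEmbedding K (x : K)‖ ^ (finrank ℚ K + 1) <
      1 / R ^ (finrank ℚ K + 1) := h1.eventually (gt_mem_nhds (by positivity))
  rw [eventually_cofinite] at h2
  refine hinf ((h2.union (Set.finite_singleton (0 : 𝓞 K))).subset fun x hx ↦ ?_)
  by_cases hx0 : x = 0
  · exact Or.inr hx0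
  · left
    simp only [Set.mem_ofPred_eq, not_lt] at hx ⊢
    have : 0 < ‖mixedEmbedding K (x : K)‖ := norm_pos_iff.mpr fun h ↦ hx0
      (RingOfIntegers.ext (mixedEmbedding_injective K (by rw [h]; simp)))
    gcongr

variable {K}

theorem phi_nonneg (s : ℝ) (x : K) : 0 ≤ phi s x := mul_nonneg (weight_nonneg x) (Real.exp_pos _).le

theorem one_le_abs_norm {x : 𝓞 K} (hx : x ≠ 0) : 1 ≤ |(Algebra.norm ℚ (x : K) : ℝ)| := by
  rw [← Algebra.coe_norm_int]
  have h : Algebra.norm ℤ x ≠ 0 := Algebra.norm_ne_zero_iff.mpr hx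
  have := Int.one_le_abs h
  push_cast
  exact_mod_cast this

theorem phi_zero (s : ℝ) : phi s (0 : K) = 1 := by
  have h : logVec (0 : K) = 0 := by
    ext v
    simp [logVec]
  have h2 : ∀ i, logCoord (0 : K) i = 0 := fun i ↦ by simp [logCoord, h]
  simp [phi, weight, h2, logNorm, h, tent]

theorem phi_le_one {s : ℝ} (hs : 0 ≤ s) (x : 𝓞 K) : phi s (x : K) ≤ 1 := by
  by_cases hx : x = 0
  · have h0 : ((0 : 𝓞 K) : K) = 0 := rfl
    rw [hx, h0, phi_zero]
  have hx' : (x : K) ≠ 0 := RingOfIntegers.coe_ne_zero_iff.mpr hx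
  unfold phi
  refine mul_le_one₀ (weight_le_one _) (Real.exp_pos _).le ?_
  rw [exp_neg_mul_logNorm hx']
  exact Real.rpow_le_one_of_one_le_of_nonpos (one_le_abs_norm hx) (by linarith)

variable (K) in
theorem exists_summable_bound (A : ℝ) (hA : 0 ≤ A) : ∃ g : 𝓞 K → ℝ, Summable g ∧ ∀ s : ℝ, 1 < s → s ≤ 2 →
    ∀ x a : 𝓞 K, (∀ v : InfinitePlace K, v (a : K) ≤ A) →
      |phi s ((x + a : 𝓞 K) : K) - phi s (x : K)| ≤ g x := by
  obtain ⟨C, R, hC, hR, h⟩ := exists_abs_phi_sub_le K hA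
  have hfin := finite_norm_lt K R
  refine ⟨fun x ↦ C / ‖mixedEmbedding K (x : K)‖ ^ (finrank ℚ K + 1) +
    Set.indicator {x : 𝓞 K | ‖mixedEmbedding K (x : K)‖ < R} 1 x,
    (summable_div_norm_pow K C).add (summable_of_hasFiniteSupport (hfin.subset
      Set.support_indicator_subset)), fun s hs1 hs2 x a ha ↦ ?_⟩
  by_cases hx : ‖mixedEmbedding K (x : K)‖ < R
  · beta_reduce
    rw [Set.indicator_of_mem (by exact hx), Pi.one_apply]
    have h1 := phi_le_one (by linarith : 0 ≤ s) x
    have h2 := phi_le_one (by linarith : 0 ≤ s) (x + a)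
    have h3 := phi_nonneg s (x : K)
    have h4 := phi_nonneg s ((x + a : 𝓞 K) : K)
    have : 0 ≤ C / ‖mixedEmbedding K (x : K)‖ ^ (finrank ℚ K + 1) := by positivity
    rw [abs_le]
    constructor <;> linarith
  · beta_reduce
    rw [Set.indicator_of_notMem (by exact hx), add_zero]
    exact h s hs1 hs2 x a ha (not_lt.mp hx)

theorem exists_abs_tsum_sub_le (𝔟 : Ideal (𝓞 K)) (hb : 𝔟 ≠ ⊥) : ∃ B : ℝ, ∀ s : ℝ, 1 < s → s ≤ 2 →
    (Summable fun x : 𝓞 K ↦ phi s (x : K)) →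
    |∑' x : 𝓞 K, phi s (x : K) - absNorm 𝔟 * ∑' x : 𝔟, phi s ((x : 𝓞 K) : K)| ≤ B := by
  have : Finite (𝓞 K ⧸ 𝔟) := Ideal.finiteQuotientOfFreeOfNeBot 𝔟 hb
  have := Fintype.ofFinite (𝓞 K ⧸ 𝔟)
  let ρ : 𝓞 K ⧸ 𝔟 → 𝓞 K := Quotient.out
  have hρ (q : 𝓞 K ⧸ 𝔟) : Ideal.Quotient.mk 𝔟 (ρ q) = q := Quotient.out_eq q
  let A : ℝ := ∑ q, ∑ v : InfinitePlace K, v (ρ q : K)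
  have hA : ∀ q, ∀ v : InfinitePlace K, v (ρ q : K) ≤ A := fun q v ↦
    (Finset.single_le_sum (f := fun v : InfinitePlace K ↦ v (ρ q : K)) (fun v _ ↦ apply_nonneg v _)
      (Finset.mem_univ v)).trans (Finset.single_le_sum
        (f := fun q ↦ ∑ v : InfinitePlace K, v (ρ q : K))
        (fun q _ ↦ Finset.sum_nonneg fun v _ ↦ apply_nonneg v _) (Finset.mem_univ q))
  have hA0 : 0 ≤ A := Finset.sum_nonneg fun q _ ↦ Finset.sum_nonneg fun v _ ↦ apply_nonneg v _
  obtain ⟨g, hg, hgb⟩ := exists_summable_bound K A hA0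
  let e : (𝓞 K ⧸ 𝔟) × 𝔟 ≃ 𝓞 K :=
    { toFun := fun p ↦ p.2 + ρ p.1
      invFun := fun x ↦ (Ideal.Quotient.mk 𝔟 x, ⟨x - ρ (Ideal.Quotient.mk 𝔟 x), by
        rw [← Ideal.Quotient.eq, hρ]⟩)
      left_inv := by
        rintro ⟨q, b⟩
        have h1 : Ideal.Quotient.mk 𝔟 ((b : 𝓞 K) + ρ q) = q := by
          rw [map_add, hρ, Ideal.Quotient.eq_zero_iff_mem.mpr b.2, zero_add]
        refine Prod.ext h1 (Subtype.ext ?_)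
        simp only [h1]
        ring
      right_inv := fun x ↦ by simp }
  refine ⟨∑ _q : 𝓞 K ⧸ 𝔟, ∑' b : 𝔟, g b, fun s hs1 hs2 hsum ↦ ?_⟩
  have h1 : ∑' x : 𝓞 K, phi s (x : K) =
      ∑ q, ∑' b : 𝔟, phi s (((b : 𝓞 K) + ρ q : 𝓞 K) : K) := by
    rw [← e.tsum_eq]
    exact ((e.summable_iff.mpr hsum).tsum_prod).trans (tsum_fintype _)
  have hsb : Summable fun b : 𝔟 ↦ phi s ((b : 𝓞 K) : K) := hsum.comp_injective Subtype.val_injective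
  have hsq (q : 𝓞 K ⧸ 𝔟) : Summable fun b : 𝔟 ↦ phi s (((b : 𝓞 K) + ρ q : 𝓞 K) : K) :=
    hsum.comp_injective (i := fun b : 𝔟 ↦ (b : 𝓞 K) + ρ q)
      (fun b c h ↦ Subtype.ext (add_right_cancel h))
  have h2 : (absNorm 𝔟 : ℝ) * ∑' x : 𝔟, phi s ((x : 𝓞 K) : K) =
      ∑ _q : 𝓞 K ⧸ 𝔟, ∑' b : 𝔟, phi s ((b : 𝓞 K) : K) := by
    rw [Finset.sum_const, nsmul_eq_mul, Finset.card_univ, absNorm_apply,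
      Submodule.cardQuot_apply, Nat.card_eq_fintype_card]
  rw [h1, h2, ← Finset.sum_sub_distrib]
  refine (Finset.abs_sum_le_sum_abs _ _).trans (Finset.sum_le_sum fun q _ ↦ ?_)
  rw [← (hsq q).tsum_sub hsb]
  have hgs : Summable fun b : 𝔟 ↦ g b := hg.comp_injective Subtype.val_injective
  have := tsum_of_norm_bounded (f := fun b : 𝔟 ↦ phi s (((b : 𝓞 K) + ρ q : 𝓞 K) : K) -
    phi s ((b : 𝓞 K) : K)) hgs.hasSum fun b ↦ hgb s hs1 hs2 b (ρ q) (hA q)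
  exact this

end Classes

section ClassZeta

open scoped nonZeroDivisors Classical

open NumberField NumberField.InfinitePlace NumberField.mixedEmbedding Module Ideal Filter Topology

variable {K : Type*} [Field K] [NumberField K]

theorem phi_unit_mul (s : ℝ) (u : (𝓞 K)ˣ) {g : 𝓞 K} (hg : g ≠ 0) (I : (Ideal (𝓞 K))⁰)
    (hI : (I : Ideal (𝓞 K)) = Ideal.span {g}) :
    phi s ((u * g : 𝓞 K) : K) = npow K s I * weight ((u : K) * (g : K)) := by
  have hg' : (g : K) ≠ 0 := RingOfIntegers.coe_ne_zero_iff.mpr hg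
  have hu : ((u : 𝓞 K) : K) ≠ 0 := Units.coe_ne_zero u
  have hc : ((u * g : 𝓞 K) : K) = (u : K) * (g : K) := rfl
  rw [hc, phi, exp_neg_mul_logNorm (mul_ne_zero hu hg'), npow, mul_comm, hI,
    absNorm_span_singleton]
  congr 2
  rw [map_mul, Rat.cast_mul, abs_mul]
  have h1 : |(Algebra.norm ℚ ((u : 𝓞 K) : K) : ℝ)| = 1 := by
    exact_mod_cast NumberField.Units.norm K u
  rw [h1, one_mul, ← Algebra.coe_norm_int]
  rw [Nat.cast_natAbs]
  push_cast
  rfl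

/-- The type of nonzero principal ideals. -/
abbrev PrincipalIdeals (K : Type*) [Field K] [NumberField K] :=
  {I : (Ideal (𝓞 K))⁰ // ClassGroup.mk0 I = 1}

theorem exists_generator (I : PrincipalIdeals K) :
    ∃ g : 𝓞 K, g ≠ 0 ∧ ((I : (Ideal (𝓞 K))⁰) : Ideal (𝓞 K)) = Ideal.span {g} := by
  have h := (ClassGroup.mk0_eq_one_iff I.1.2).mp I.2
  obtain ⟨g, hg⟩ := h
  refine ⟨g, ?_, hg⟩
  rintro rfl
  exact nonZeroDivisors.coe_ne_zero I.1 (by rw [hg]; simp)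

/-- A chosen generator. -/
noncomputable def gen (I : PrincipalIdeals K) : 𝓞 K := (exists_generator I).choose

theorem gen_ne_zero (I : PrincipalIdeals K) : gen I ≠ 0 := (exists_generator I).choose_spec.1

theorem eq_span_gen (I : PrincipalIdeals K) :
    ((I : (Ideal (𝓞 K))⁰) : Ideal (𝓞 K)) = Ideal.span {gen I} := (exists_generator I).choose_spec.2

theorem unit_mul_gen_bijective :
    Function.Bijective (fun p : PrincipalIdeals K × (𝓞 K)ˣ ↦
      (⟨p.2 * gen p.1, mul_ne_zero p.2.ne_zero (gen_ne_zero p.1)⟩ : {x : 𝓞 K // x ≠ 0})) := by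
  constructor
  · rintro ⟨I, u⟩ ⟨J, v⟩ h
    have h1 : (u : 𝓞 K) * gen I = v * gen J := congrArg Subtype.val h
    have h2 : I = J := by
      refine Subtype.ext (Subtype.ext ?_)
      rw [eq_span_gen, eq_span_gen, Ideal.span_singleton_eq_span_singleton]
      refine ⟨u * v⁻¹, ?_⟩
      rw [Units.val_mul, ← mul_assoc, mul_comm (gen I), h1, mul_right_comm]
      simp
    subst h2
    refine Prod.ext rfl (Units.ext ?_)
    exact mul_right_cancel₀ (gen_ne_zero I) h1
  · rintro ⟨x, hx⟩
    let I : PrincipalIdeals K := ⟨⟨Ideal.span {x}, mem_nonZeroDivisors_of_ne_zero (by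
      simpa using hx)⟩, (ClassGroup.mk0_eq_one_iff _).mpr ⟨x, rfl⟩⟩
    have h1 : Ideal.span {gen I} = Ideal.span {x} := (eq_span_gen I).symm
    obtain ⟨u, hu⟩ := Ideal.span_singleton_eq_span_singleton.mp h1
    refine ⟨(I, u), Subtype.ext ?_⟩
    exact (mul_comm _ _).trans hu

variable (K) in
theorem summable_npow {s : ℝ} (hs : 1 < s) : Summable (npow K s) := (hasSum_npow K hs).1

theorem hasSum_phi_ne_zero {s : ℝ} (hs : 1 < s) (𝔟 : Ideal (𝓞 K)) :
    HasSum (fun x : {x : 𝓞 K // x ≠ 0} ↦ if (x : 𝓞 K) ∈ 𝔟 then phi s ((x : 𝓞 K) : K) else 0)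
      (Units.torsionOrder K * ∑' I : PrincipalIdeals K, if (I.1 : Ideal (𝓞 K)) ≤ 𝔟 then npow K s I else 0) := by
  let e := Equiv.ofBijective _ (unit_mul_gen_bijective (K := K))
  rw [← e.hasSum_iff]
  have h0 : ∀ p : PrincipalIdeals K × (𝓞 K)ˣ,
      ((fun x : {x : 𝓞 K // x ≠ 0} ↦ if (x : 𝓞 K) ∈ 𝔟 then phi s ((x : 𝓞 K) : K) else 0) ∘ e) p =
      (if (p.1.1 : Ideal (𝓞 K)) ≤ 𝔟 then npow K s p.1 else 0) *
        weight ((p.2 : K) * (gen p.1 : K)) := by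
    rintro ⟨I, u⟩
    have h1 : ((e (I, u) : {x : 𝓞 K // x ≠ 0}) : 𝓞 K) = u * gen I := rfl
    have h2 : (u : 𝓞 K) * gen I ∈ 𝔟 ↔ (I.1 : Ideal (𝓞 K)) ≤ 𝔟 := by
      rw [eq_span_gen, Ideal.span_singleton_le_iff_mem, Ideal.unit_mul_mem_iff_mem _ u.isUnit]
    simp only [Function.comp, h1, h2]
    split_ifs
    · exact phi_unit_mul s u (gen_ne_zero I) I (eq_span_gen I)
    · rw [zero_mul]
  rw [funext h0]
  have hnn : 0 ≤ fun p : PrincipalIdeals K × (𝓞 K)ˣ ↦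
      (if (p.1.1 : Ideal (𝓞 K)) ≤ 𝔟 then npow K s p.1 else 0) *
        weight ((p.2 : K) * (gen p.1 : K)) := fun p ↦
    mul_nonneg (by split_ifs; exacts [(npow_pos s _).le, le_rfl]) (weight_nonneg _)
  have hfib (I : PrincipalIdeals K) : HasSum (fun u : (𝓞 K)ˣ ↦
      (if (I.1 : Ideal (𝓞 K)) ≤ 𝔟 then npow K s I else 0) * weight ((u : K) * (gen I : K)))
      ((if (I.1 : Ideal (𝓞 K)) ≤ 𝔟 then npow K s I else 0) * Units.torsionOrder K) :=
    (hasSum_weight (RingOfIntegers.coe_ne_zero_iff.mpr (gen_ne_zero I))).mul_left _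
  have hs1 : Summable fun I : PrincipalIdeals K ↦
      (if (I.1 : Ideal (𝓞 K)) ≤ 𝔟 then npow K s I else 0) := by
    refine Summable.of_nonneg_of_le (fun I ↦ ?_) (fun I ↦ ?_)
      ((summable_npow K hs).comp_injective (i := fun I : PrincipalIdeals K ↦ I.1)
        Subtype.val_injective)
    · split_ifs
      exacts [(npow_pos s _).le, le_rfl]
    · simp only [Function.comp]
      split_ifs
      exacts [le_rfl, (npow_pos s _).le]
  have hsum := (summable_prod_of_nonneg hnn).mpr ⟨fun I ↦ (hfib I).summable, by
    simp_rw [fun I ↦ (hfib I).tsum_eq]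
    exact hs1.mul_right _⟩
  have h3 := hsum.hasSum
  rw [(h3.prod_fiberwise hfib).unique (hs1.hasSum.mul_right _), mul_comm] at h3
  exact h3

/-- The partial zeta function of an ideal class. -/
noncomputable def classZeta (s : ℝ) (C : ClassGroup (𝓞 K)) : ℝ :=
  ∑' I : (Ideal (𝓞 K))⁰, if ClassGroup.mk0 I = C then npow K s I else 0

theorem summable_ite_npow {s : ℝ} (hs : 1 < s) (p : (Ideal (𝓞 K))⁰ → Prop) :
    Summable fun I ↦ if p I then npow K s I else 0 := by
  refine Summable.of_nonneg_of_le (fun I ↦ ?_) (fun I ↦ ?_) (summable_npow K hs)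
  · split_ifs
    exacts [(npow_pos s _).le, le_rfl]
  · split_ifs
    exacts [le_rfl, (npow_pos s _).le]

theorem tsum_principal (s : ℝ) (𝔟 : (Ideal (𝓞 K))⁰) :
    (∑' I : PrincipalIdeals K, if (I.1 : Ideal (𝓞 K)) ≤ 𝔟 then npow K s I else 0) =
      npow K s 𝔟 * classZeta s (ClassGroup.mk0 𝔟)⁻¹ := by
  have h1 := tsum_subtype {I : (Ideal (𝓞 K))⁰ | ClassGroup.mk0 I = 1}
    (fun I ↦ if (I : Ideal (𝓞 K)) ≤ 𝔟 then npow K s I else 0)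
  refine h1.trans ?_
  have hinj : Function.Injective fun J : (Ideal (𝓞 K))⁰ ↦ 𝔟 * J := fun J J' h ↦
    mul_left_cancel h
  rw [← hinj.tsum_eq, classZeta, ← tsum_mul_left]
  · refine tsum_congr fun J ↦ ?_
    have h2 : (𝔟 * J) ∈ {I : (Ideal (𝓞 K))⁰ | ClassGroup.mk0 I = 1} ↔
        ClassGroup.mk0 J = (ClassGroup.mk0 𝔟)⁻¹ := by
      rw [Set.mem_ofPred_eq, map_mul, mul_comm, mul_eq_one_iff_eq_inv]
    have h3 : ((𝔟 * J : (Ideal (𝓞 K))⁰) : Ideal (𝓞 K)) ≤ 𝔟 := Ideal.mul_le_left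
    simp only [Set.indicator_apply, h2, if_pos h3, npow_mul]
    split_ifs <;> simp
  · intro I hI
    rw [Function.mem_support, Set.indicator_apply] at hI
    split_ifs at hI with h2 h3
    · obtain ⟨J, hJ⟩ := Ideal.dvd_iff_le.mpr h3
      have hJ0 : J ≠ 0 := by
        rintro rfl
        exact nonZeroDivisors.coe_ne_zero I (by rw [hJ, mul_zero])
      exact ⟨⟨J, mem_nonZeroDivisors_of_ne_zero hJ0⟩, Subtype.ext hJ.symm⟩
    all_goals exact absurd rfl hI

theorem hasSum_indicator_phi {s : ℝ} (hs : 1 < s) (𝔟 : (Ideal (𝓞 K))⁰) :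
    HasSum (Set.indicator ((𝔟 : Ideal (𝓞 K)) : Set (𝓞 K)) (fun x ↦ phi s (x : K)))
      (1 + Units.torsionOrder K * (npow K s 𝔟 * classZeta s (ClassGroup.mk0 𝔟)⁻¹)) := by
  have h := hasSum_phi_ne_zero hs (𝔟 : Ideal (𝓞 K))
  rw [tsum_principal] at h
  let F : 𝓞 K → ℝ := fun x ↦ if x ∈ (𝔟 : Ideal (𝓞 K)) then phi s (x : K) else 0
  have h1 : HasSum (Set.indicator {x : 𝓞 K | x ≠ 0} F) _ := hasSum_subtype_iff_indicator.mp h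
  have h2 := (hasSum_ite_eq (0 : 𝓞 K) (1 : ℝ)).add h1
  have h3 : (fun b : 𝓞 K ↦ (if b = 0 then (1 : ℝ) else 0) + Set.indicator {x : 𝓞 K | x ≠ 0} F b) =
      Set.indicator ((𝔟 : Ideal (𝓞 K)) : Set (𝓞 K)) (fun x ↦ phi s (x : K)) := by
    funext x
    simp only [Set.indicator_apply, Set.mem_ofPred_eq, F, SetLike.mem_coe]
    by_cases hx : x = 0
    · simpa [hx] using (phi_zero s).symm
    · simp [hx]
  rwa [h3] at h2

theorem hasSum_phi {s : ℝ} (hs : 1 < s) (𝔟 : (Ideal (𝓞 K))⁰) :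
    HasSum (fun x : (𝔟 : Ideal (𝓞 K)) ↦ phi s ((x : 𝓞 K) : K))
      (1 + Units.torsionOrder K * (npow K s 𝔟 * classZeta s (ClassGroup.mk0 𝔟)⁻¹)) :=
  hasSum_subtype_iff_indicator.mpr (hasSum_indicator_phi hs 𝔟)

theorem hasSum_phi_one {s : ℝ} (hs : 1 < s) :
    HasSum (fun x : 𝓞 K ↦ phi s (x : K))
      (1 + Units.torsionOrder K * classZeta s (1 : ClassGroup (𝓞 K))) := by
  have h := hasSum_indicator_phi hs (1 : (Ideal (𝓞 K))⁰)
  have hn1 : npow K s 1 = 1 := by simp [npow]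
  have h1 : (((1 : (Ideal (𝓞 K))⁰) : Ideal (𝓞 K)) : Set (𝓞 K)) = Set.univ := by
    rw [Submonoid.coe_one, Ideal.one_eq_top]
    rfl
  rwa [map_one, inv_one, hn1, one_mul, h1, Set.indicator_univ] at h

theorem classZeta_nonneg (s : ℝ) (C : ClassGroup (𝓞 K)) : 0 ≤ classZeta s C :=
  tsum_nonneg fun I ↦ by
    split_ifs
    exacts [(npow_pos s _).le, le_rfl]

theorem exists_abs_classZeta_sub_le (C : ClassGroup (𝓞 K)) :
    ∃ B : ℝ, ∀ᶠ s in 𝓝[>] (1 : ℝ), |classZeta s (1 : ClassGroup (𝓞 K)) - classZeta s C| ≤ B := by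
  obtain ⟨𝔟, h𝔟⟩ := ClassGroup.mk0_surjective C⁻¹
  obtain ⟨B, hB⟩ := exists_abs_tsum_sub_le (𝔟 : Ideal (𝓞 K)) (nonZeroDivisors.coe_ne_zero 𝔟)
  set N : ℝ := ((absNorm (𝔟 : Ideal (𝓞 K)) : ℕ) : ℝ)
  have hN : 1 ≤ N := by exact Nat.one_le_cast.mpr (absNorm_pos 𝔟)
  set w : ℝ := ((Units.torsionOrder K : ℕ) : ℝ)
  have hw : 1 ≤ w := by exact Nat.one_le_cast.mpr (Units.torsionOrder_pos K)
  obtain ⟨R, hR⟩ : ∃ R, R = NumberField.dedekindZeta_residue K + 1 := ⟨_, rfl⟩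
  have hlim : ∀ᶠ s in 𝓝[>] (1 : ℝ), (s - 1) * ∑' I, npow K s I < R :=
    (tendsto_sub_one_mul_tsum_npow K).eventually_lt_const (by linarith)
  have h2 : ∀ᶠ s in 𝓝[>] (1 : ℝ), s < 2 := eventually_nhdsWithin_of_eventually_nhds
    (gt_mem_nhds one_lt_two)
  refine ⟨B + (N + 1) + Real.log N * R, ?_⟩
  filter_upwards [hlim, h2, self_mem_nhdsWithin] with s hs hs2 hs1
  have hs1 : 1 < s := hs1
  have e2 := hasSum_phi hs1 𝔟
  rw [h𝔟, inv_inv] at e2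
  have e1' := hasSum_phi_one (K := K) hs1
  have h4 := hB s hs1 hs2.le e1'.summable
  rw [e1'.tsum_eq, e2.tsum_eq] at h4
  have hZ : classZeta s C ≤ ∑' I, npow K s I := by
    refine (summable_ite_npow hs1 _).tsum_le_tsum (fun I ↦ ?_) (summable_npow K hs1)
    split_ifs
    exacts [le_rfl, (npow_pos s _).le]
  have hZ0 := classZeta_nonneg s C
  have hNs : N * npow K s 𝔟 = Real.exp (-((s - 1) * Real.log N)) := by
    have : npow K s 𝔟 = N ^ (-s) := rfl
    rw [this, Real.rpow_def_of_pos (by linarith)]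
    nth_rw 1 [← Real.exp_log (by linarith : 0 < N)]
    rw [← Real.exp_add]
    ring_nf
  have h5 := Real.add_one_le_exp (-((s - 1) * Real.log N))
  have hlog : 0 ≤ Real.log N := Real.log_nonneg hN
  have h6 : Real.exp (-((s - 1) * Real.log N)) ≤ 1 :=
    Real.exp_le_one_iff.mpr (by nlinarith)
  rw [← hNs] at h5 h6
  have h7 : |(1 - N * npow K s 𝔟) * classZeta s C| ≤ Real.log N * R := by
    rw [abs_of_nonneg (mul_nonneg (by linarith) hZ0)]
    calc _ ≤ ((s - 1) * Real.log N) * ∑' I, npow K s I :=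
          mul_le_mul (by linarith) hZ hZ0 (mul_nonneg (by linarith) hlog)
      _ = Real.log N * ((s - 1) * ∑' I, npow K s I) := by ring
      _ ≤ _ := mul_le_mul_of_nonneg_left hs.le hlog
  have h8 : |classZeta s (1 : ClassGroup (𝓞 K)) - N * npow K s 𝔟 * classZeta s C| ≤ B + (N + 1) := by
    have h9 : |w * (classZeta s (1 : ClassGroup (𝓞 K)) - N * npow K s 𝔟 * classZeta s C)| ≤ B + (N + 1) := by
      rw [abs_le] at h4 ⊢
      constructor <;> nlinarith
    rw [abs_mul, abs_of_pos (by linarith)] at h9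
    exact (le_mul_of_one_le_left (abs_nonneg _) hw).trans h9
  rw [show classZeta s (1 : ClassGroup (𝓞 K)) - classZeta s C = (classZeta s (1 : ClassGroup (𝓞 K)) - N * npow K s 𝔟 * classZeta s C) -
    (1 - N * npow K s 𝔟) * classZeta s C by ring]
  refine (abs_sub _ _).trans ?_
  linarith

end ClassZeta

section Characters

theorem hasEnoughRootsOfUnity_int_two : HasEnoughRootsOfUnity ℤ 2 where
  prim := ⟨-1, by
    refine IsPrimitiveRoot.mk_of_lt _ two_pos (by norm_num) fun l h0 h2 ↦ ?_
    obtain rfl : l = 1 := by omega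
    norm_num⟩
  cyc := inferInstance

theorem exists_characters {C : Type*} [CommGroup C] [Finite C] (H : Subgroup C)
    (hH : ∀ c : C, c ^ 2 ∈ H) (hcard : 2 * Nat.card H < Nat.card C) :
    ∃ χ₁ χ₂ : C →* ℤˣ, (∀ c ∈ H, χ₁ c = 1) ∧ (∀ c ∈ H, χ₂ c = 1) ∧ χ₁ ≠ 1 ∧ χ₂ ≠ 1 ∧
      χ₁ * χ₂ ≠ 1 := by
  have hexp : Monoid.exponent (C ⧸ H) ∣ 2 := by
    refine Monoid.exponent_dvd_of_forall_pow_eq_one fun q ↦ ?_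
    obtain ⟨c, rfl⟩ := QuotientGroup.mk_surjective q
    exact (QuotientGroup.eq_one_iff _).mpr (hH c)
  have h2 := hasEnoughRootsOfUnity_int_two
  have : HasEnoughRootsOfUnity ℤ (Monoid.exponent (C ⧸ H)) := HasEnoughRootsOfUnity.of_dvd ℤ hexp
  have hc : Nat.card ((C ⧸ H) →* ℤˣ) = Nat.card (C ⧸ H) :=
    Nat.card_congr (CommGroup.monoidHom_mulEquiv_of_hasEnoughRootsOfUnity (C ⧸ H) ℤ).some.toEquiv
  have hlt : 2 < Nat.card ((C ⧸ H) →* ℤˣ) := by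
    rw [hc]
    have h3 := H.card_eq_card_quotient_mul_card_subgroup
    rw [h3] at hcard
    exact lt_of_mul_lt_mul_right hcard (Nat.zero_le _)
  have : Finite ((C ⧸ H) →* ℤˣ) := Nat.finite_of_card_ne_zero (by omega)
  have := Fintype.ofFinite ((C ⧸ H) →* ℤˣ)
  rw [Nat.card_eq_fintype_card] at hlt
  obtain ⟨ψ₁, ψ₂, ψ₃, h12, h13, h23⟩ := Fintype.two_lt_card_iff.mp hlt
  have key (φ₁ φ₂ : (C ⧸ H) →* ℤˣ) (h1 : φ₁ ≠ 1) (h2 : φ₂ ≠ 1) (h : φ₁ ≠ φ₂) :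
      ∃ χ₁ χ₂ : C →* ℤˣ, (∀ c ∈ H, χ₁ c = 1) ∧ (∀ c ∈ H, χ₂ c = 1) ∧ χ₁ ≠ 1 ∧ χ₂ ≠ 1 ∧
      χ₁ * χ₂ ≠ 1 := by
    have hc (φ : (C ⧸ H) →* ℤˣ) (c : C) (hc : c ∈ H) : φ.comp (QuotientGroup.mk' H) c = 1 := by
      have : (QuotientGroup.mk' H) c = 1 := (QuotientGroup.eq_one_iff _).mpr hc
      rw [MonoidHom.comp_apply, this, map_one]
    have hs := QuotientGroup.mk'_surjective H
    refine ⟨φ₁.comp (QuotientGroup.mk' H), φ₂.comp (QuotientGroup.mk' H), hc _, hc _,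
      fun h0 ↦ h1 ?_, fun h0 ↦ h2 ?_, fun h0 ↦ h ?_⟩
    · exact (MonoidHom.cancel_right hs).mp (h0.trans (MonoidHom.one_comp _).symm)
    · exact (MonoidHom.cancel_right hs).mp (h0.trans (MonoidHom.one_comp _).symm)
    · refine (MonoidHom.cancel_right hs).mp (MonoidHom.ext fun c ↦ ?_)
      have h3 := DFunLike.congr_fun h0 c
      rw [MonoidHom.mul_apply, MonoidHom.one_apply, mul_eq_one_iff_eq_inv] at h3
      rw [h3, Int.units_inv_eq_self]
  by_cases h1 : ψ₁ = 1
  · exact key ψ₂ ψ₃ (fun h ↦ h12 (h1.trans h.symm)) (fun h ↦ h13 (h1.trans h.symm)) h23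
  by_cases h2 : ψ₂ = 1
  · exact key ψ₁ ψ₃ h1 (fun h ↦ h23 (h2.trans h.symm)) h13
  · exact key ψ₁ ψ₂ h1 h2 h12

end Characters

section EulerProduct

open scoped nonZeroDivisors Classical

open NumberField Module Ideal Filter Topology IsDedekindDomain

variable {K : Type*} [Field K] [NumberField K]

/-- A maximal ideal as a nonzero ideal. -/
def primeIdeal (p : HeightOneSpectrum (𝓞 K)) : (Ideal (𝓞 K))⁰ :=
  ⟨p.asIdeal, mem_nonZeroDivisors_of_ne_zero p.ne_bot⟩

theorem tsum_coprime (f : (Ideal (𝓞 K))⁰ →* ℝ) (hf : Summable f)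
    (S : Finset (HeightOneSpectrum (𝓞 K))) :
    (∑' I, f I) * ∏ p ∈ S, (1 - f (primeIdeal p)) =
      ∑' I : (Ideal (𝓞 K))⁰, if ∀ p ∈ S, ¬ p.asIdeal ∣ (I : Ideal (𝓞 K)) then f I else 0 := by
  induction S using Finset.induction_on with
  | empty => simp
  | insert p S hp ih =>
    have hsum (q : (Ideal (𝓞 K))⁰ → Prop) [DecidablePred q] : Summable fun I ↦ if q I then f I else 0 := by
      have h := hf.indicator {I | q I}
      refine h.congr fun I ↦ ?_
      simp [Set.indicator_apply]
    rw [Finset.prod_insert hp, mul_comm (1 - _), ← mul_assoc, ih, mul_sub, mul_one, sub_eq_iff_eq_add,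
      mul_comm, ← tsum_mul_left]
    have h1 : (∑' I : (Ideal (𝓞 K))⁰, f (primeIdeal p) * if ∀ p ∈ S, ¬ p.asIdeal ∣ (I : Ideal (𝓞 K)) then f I else 0) =
        ∑' I : (Ideal (𝓞 K))⁰, if p.asIdeal ∣ (I : Ideal (𝓞 K)) ∧ ∀ p ∈ S, ¬ p.asIdeal ∣ (I : Ideal (𝓞 K))
          then f I else 0 := by
      have hinj : Function.Injective fun J : (Ideal (𝓞 K))⁰ ↦ primeIdeal p * J := fun J J' h ↦
        mul_left_cancel h
      rw [← hinj.tsum_eq (f := fun I : (Ideal (𝓞 K))⁰ ↦ if p.asIdeal ∣ (I : Ideal (𝓞 K)) ∧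
        ∀ p ∈ S, ¬ p.asIdeal ∣ (I : Ideal (𝓞 K)) then f I else 0)]
      · refine tsum_congr fun J ↦ ?_
        have hc : ((primeIdeal p * J : (Ideal (𝓞 K))⁰) : Ideal (𝓞 K)) = p.asIdeal * J := rfl
        have h2 : (p.asIdeal ∣ p.asIdeal * (J : Ideal (𝓞 K)) ∧
            ∀ q ∈ S, ¬ q.asIdeal ∣ p.asIdeal * (J : Ideal (𝓞 K))) ↔
            ∀ q ∈ S, ¬ q.asIdeal ∣ (J : Ideal (𝓞 K)) := by
          refine ⟨fun h q hq hd ↦ h.2 q hq (hd.mul_left _), fun h ↦ ⟨dvd_mul_right _ _,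
            fun q hq hd ↦ ?_⟩⟩
          rcases q.prime.dvd_or_dvd hd with h3 | h3
          · have h4 : q.asIdeal = p.asIdeal :=
              (p.isMaximal.eq_of_le q.isPrime.ne_top (Ideal.dvd_iff_le.mp h3)).symm
            exact hp (HeightOneSpectrum.ext h4 ▸ hq)
          · exact h q hq h3
        simp only [hc, h2, map_mul]
        split_ifs <;> simp
      · intro I hI
        rw [Function.mem_support] at hI
        split_ifs at hI with h2
        · obtain ⟨J, hJ⟩ := h2.1
          have hJ0 : J ≠ 0 := by
            rintro rfl
            exact nonZeroDivisors.coe_ne_zero I (by rw [hJ, mul_zero])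
          exact ⟨⟨J, mem_nonZeroDivisors_of_ne_zero hJ0⟩, Subtype.ext hJ.symm⟩
        · exact absurd rfl hI
    rw [h1, ← Summable.tsum_add (hsum _) (hsum _)]
    refine tsum_congr fun I ↦ ?_
    by_cases h3 : p.asIdeal ∣ (I : Ideal (𝓞 K)) <;> simp [h3]

theorem tendsto_tsum_mul_prod (f : (Ideal (𝓞 K))⁰ →* ℝ) (hf : Summable f) :
    Tendsto (fun S : Finset (HeightOneSpectrum (𝓞 K)) ↦
      (∑' I, f I) * ∏ p ∈ S, (1 - f (primeIdeal p))) atTop (𝓝 1) := by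
  simp_rw [tsum_coprime f hf]
  have h1 : (1 : ℝ) = ∑' I : (Ideal (𝓞 K))⁰, if I = 1 then f I else 0 := by
    rw [tsum_ite_eq, map_one]
  rw [h1]
  refine tendsto_tsum_of_dominated_convergence (G := ℝ) (bound := fun I ↦ |f I|) hf.abs (fun I ↦ ?_)
    (Eventually.of_forall fun S I ↦ ?_)
  · by_cases hI : I = 1
    · subst hI
      refine tendsto_const_nhds.congr fun S ↦ ?_
      have : ∀ p ∈ S, ¬ p.asIdeal ∣ ((1 : (Ideal (𝓞 K))⁰) : Ideal (𝓞 K)) := fun p _ h ↦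
        p.prime.not_isUnit (isUnit_of_dvd_one h)
      rw [if_pos rfl, if_pos this]
    · have h2 : (I : Ideal (𝓞 K)) ≠ ⊤ := fun h ↦ hI (Subtype.ext (h.trans Ideal.one_eq_top.symm))
      obtain ⟨M, hM, hIM⟩ := Ideal.exists_le_maximal _ h2
      let p : HeightOneSpectrum (𝓞 K) := ⟨M, hM.isPrime, fun h ↦
        nonZeroDivisors.coe_ne_zero I (le_bot_iff.mp (h ▸ hIM))⟩
      refine tendsto_const_nhds.congr' ?_
      filter_upwards [eventually_ge_atTop {p}] with S hS
      rw [if_neg hI, if_neg]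
      push Not
      exact ⟨p, hS (Finset.mem_singleton_self p), Ideal.dvd_iff_le.mpr hIM⟩
  · split_ifs
    · exact le_rfl
    · rw [norm_zero]
      exact abs_nonneg _

end EulerProduct

section LSeries

open scoped nonZeroDivisors Classical

open NumberField Module Ideal Filter Topology IsDedekindDomain

variable {K : Type*} [Field K] [NumberField K]

/-- The completely multiplicative function `I ↦ χ(I) N(I)^{-s}`. -/
noncomputable def twist (χ : ClassGroup (𝓞 K) →* ℤˣ) (s : ℝ) : (Ideal (𝓞 K))⁰ →* ℝ where
  toFun I := ((χ (ClassGroup.mk0 I) : ℤ) : ℝ) * npow K s I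
  map_one' := by simp [npow]
  map_mul' I J := by
    rw [npow_mul, map_mul, map_mul]
    push_cast
    ring

theorem twist_apply (χ : ClassGroup (𝓞 K) →* ℤˣ) (s : ℝ) (I : (Ideal (𝓞 K))⁰) :
    twist χ s I = ((χ (ClassGroup.mk0 I) : ℤ) : ℝ) * npow K s I := rfl

theorem abs_intCast_units (u : ℤˣ) : |((u : ℤ) : ℝ)| = 1 := by
  rcases Int.units_eq_one_or u with rfl | rfl <;> simp

theorem summable_twist (χ : ClassGroup (𝓞 K) →* ℤˣ) {s : ℝ} (hs : 1 < s) :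
    Summable (twist χ s) := by
  refine Summable.of_norm_bounded (summable_npow K hs) fun I ↦ ?_
  rw [twist_apply, norm_mul, Real.norm_eq_abs, abs_intCast_units, one_mul, Real.norm_eq_abs,
    abs_of_pos (npow_pos s I)]

theorem exists_abs_tsum_twist_le (χ : ClassGroup (𝓞 K) →* ℤˣ) (hχ : χ ≠ 1) :
    ∃ B : ℝ, ∀ᶠ s in 𝓝[>] (1 : ℝ), |∑' I, twist χ s I| ≤ B := by
  choose B hB using exists_abs_classZeta_sub_le (K := K)
  refine ⟨∑ C, B C, ?_⟩
  filter_upwards [eventually_all.mpr hB, self_mem_nhdsWithin] with s hs hs1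
  have h1 : (∑' I, twist χ s I) = ∑ C, ((χ C : ℤ) : ℝ) * classZeta s C := by
    simp_rw [classZeta, ← tsum_mul_left]
    rw [← Summable.tsum_finsetSum fun C _ ↦ (summable_ite_npow hs1 _).mul_left _]
    refine tsum_congr fun I ↦ ?_
    simp [twist_apply]
  have h2 : ∑ C, ((χ C : ℤ) : ℝ) = 0 := by
    have h0 : ∃ c, χ c ≠ 1 := by
      by_contra! h
      exact hχ (MonoidHom.ext h)
    obtain ⟨c, hc⟩ := h0
    have h3 : ∑ C, ((χ C : ℤ) : ℝ) = ((χ c : ℤ) : ℝ) * ∑ C, ((χ C : ℤ) : ℝ) := by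
      rw [Finset.mul_sum, ← Equiv.sum_comp (Equiv.mulLeft c)]
      simp
    rcases Int.units_eq_one_or (χ c) with h | h
    · exact absurd h hc
    · rw [h] at h3
      push_cast at h3
      linarith
  have h3 : ∑ C, ((χ C : ℤ) : ℝ) * classZeta s C =
      - ∑ C, ((χ C : ℤ) : ℝ) * (classZeta s (1 : ClassGroup (𝓞 K)) - classZeta s C) := by
    simp_rw [mul_sub, Finset.sum_sub_distrib, ← Finset.sum_mul]
    rw [h2]
    ring
  rw [h1, h3, abs_neg]
  refine (Finset.abs_sum_le_sum_abs _ _).trans (Finset.sum_le_sum fun C _ ↦ ?_)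
  rw [abs_mul, abs_intCast_units, one_mul]
  exact hs C

end LSeries

section NormClass

open scoped nonZeroDivisors Classical

open NumberField Module Ideal Filter Topology IsDedekindDomain

variable {K L : Type*} [Field K] [NumberField K] [Field L] [NumberField L] [Algebra K L]

variable (K) in
/-- The relative norm on nonzero ideals. -/
noncomputable def idealNorm : (Ideal (𝓞 L))⁰ →* (Ideal (𝓞 K))⁰ where
  toFun I := ⟨relNorm (𝓞 K) (I : Ideal (𝓞 L)), mem_nonZeroDivisors_of_ne_zero
    (relNorm_eq_bot_iff.not.mpr (nonZeroDivisors.coe_ne_zero I))⟩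
  map_one' := Subtype.ext (map_one _)
  map_mul' _ _ := Subtype.ext (map_mul _ _ _)

theorem coe_idealNorm (I : (Ideal (𝓞 L))⁰) :
    (idealNorm K I : Ideal (𝓞 K)) = relNorm (𝓞 K) (I : Ideal (𝓞 L)) := rfl

theorem mk0_idealNorm_congr {I J : (Ideal (𝓞 L))⁰} (h : ClassGroup.mk0 I = ClassGroup.mk0 J) :
    ClassGroup.mk0 (idealNorm K I) = ClassGroup.mk0 (idealNorm K J) := by
  obtain ⟨x, y, hx, hy, hxy⟩ := ClassGroup.mk0_eq_mk0_iff.mp h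
  refine ClassGroup.mk0_eq_mk0_iff.mpr ⟨Algebra.intNorm (𝓞 K) (𝓞 L) x,
    Algebra.intNorm (𝓞 K) (𝓞 L) y, Algebra.intNorm_ne_zero.mpr hx,
    Algebra.intNorm_ne_zero.mpr hy, ?_⟩
  rw [coe_idealNorm, coe_idealNorm, ← relNorm_singleton, ← relNorm_singleton, ← map_mul, ← map_mul,
    hxy]

variable (K L) in
/-- The norm on ideal classes. -/
noncomputable def normClass : ClassGroup (𝓞 L) →* ClassGroup (𝓞 K) where
  toFun C := ClassGroup.mk0 (idealNorm K (ClassGroup.mk0_surjective C).choose)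
  map_one' := by
    have h : ClassGroup.mk0 (idealNorm K (1 : (Ideal (𝓞 L))⁰)) = 1 := by rw [map_one, map_one]
    rw [← h]
    refine mk0_idealNorm_congr ?_
    rw [(ClassGroup.mk0_surjective (1 : ClassGroup (𝓞 L))).choose_spec, map_one]
  map_mul' C D := by
    rw [← map_mul, ← map_mul]
    refine mk0_idealNorm_congr ?_
    rw [map_mul, (ClassGroup.mk0_surjective _).choose_spec,
      (ClassGroup.mk0_surjective _).choose_spec, (ClassGroup.mk0_surjective _).choose_spec]

theorem normClass_mk0 (I : (Ideal (𝓞 L))⁰) :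
    normClass K L (ClassGroup.mk0 I) = ClassGroup.mk0 (idealNorm K I) :=
  mk0_idealNorm_congr (ClassGroup.mk0_surjective _).choose_spec

theorem finrank_ringOfIntegers : finrank (𝓞 K) (𝓞 L) = finrank K L :=
  (IsFractionRing.finrank_eq (𝓞 K) K (𝓞 L) L).symm

variable (K L) in
/-- Extension of nonzero ideals. -/
noncomputable def idealExt : (Ideal (𝓞 K))⁰ →* (Ideal (𝓞 L))⁰ where
  toFun I := ⟨Ideal.map (algebraMap (𝓞 K) (𝓞 L)) I, mem_nonZeroDivisors_of_ne_zero
    (Ideal.map_eq_bot_iff_of_injective (FaithfulSMul.algebraMap_injective (𝓞 K) (𝓞 L))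
      |>.not.mpr (nonZeroDivisors.coe_ne_zero I))⟩
  map_one' := Subtype.ext (by
    change Ideal.map (algebraMap (𝓞 K) (𝓞 L)) (1 : Ideal (𝓞 K)) = 1
    rw [Ideal.one_eq_top, Ideal.map_top, Ideal.one_eq_top])
  map_mul' I J := Subtype.ext (by
    simp only [Submonoid.coe_mul, Ideal.map_mul])

theorem idealNorm_idealExt (I : (Ideal (𝓞 K))⁰) :
    idealNorm K (idealExt K L I) = I ^ finrank K L :=
  Subtype.ext (by
    rw [← finrank_ringOfIntegers (K := K) (L := L)]
    exact relNorm_algebraMap (𝓞 L) (I : Ideal (𝓞 K)))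

/-- The prime below a prime. -/
noncomputable def below (K : Type*) [Field K] [NumberField K] [Algebra K L]
    (P : HeightOneSpectrum (𝓞 L)) : HeightOneSpectrum (𝓞 K) :=
  ⟨P.asIdeal.under (𝓞 K), inferInstance, Ideal.IsIntegral.comap_ne_bot _ P.ne_bot⟩

variable (L) in
/-- The finset of primes above a prime. -/
noncomputable def above (p : HeightOneSpectrum (𝓞 K)) : Finset (HeightOneSpectrum (𝓞 L)) :=
  have : Fintype (p.asIdeal.primesOver (𝓞 L)) := Fintype.ofFinite _
  (Finset.univ : Finset (p.asIdeal.primesOver (𝓞 L))).image fun q ↦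
    have := q.2.2
    ⟨q.1, q.2.1, Ideal.ne_bot_of_liesOver_of_ne_bot p.ne_bot q.1⟩

theorem mem_above {p : HeightOneSpectrum (𝓞 K)} {P : HeightOneSpectrum (𝓞 L)} :
    P ∈ above L p ↔ below K P = p := by
  simp only [above, Finset.mem_image, Finset.mem_univ, true_and]
  constructor
  · rintro ⟨q, rfl⟩
    exact HeightOneSpectrum.ext q.2.2.over.symm
  · rintro rfl
    exact ⟨⟨P.asIdeal, P.isPrime, ⟨rfl⟩⟩, rfl⟩

theorem sum_above (p : HeightOneSpectrum (𝓞 K)) :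
    ∑ P ∈ above L p, P.asIdeal.ramificationIdx (𝓞 K) * P.asIdeal.inertiaDeg (𝓞 K) =
      finrank K L := by
  have : Fintype (p.asIdeal.primesOver (𝓞 L)) := Fintype.ofFinite _
  rw [← finrank_ringOfIntegers (K := K) (L := L),
    ← sum_ramification_inertia_eq_finrank p.asIdeal (S := 𝓞 L), above, Finset.sum_image]
  · refine Finset.sum_congr ?_ fun _ _ ↦ rfl
    ext
    simp
  · intro q _ q' _ h
    exact Subtype.ext (congrArg HeightOneSpectrum.asIdeal h)

theorem idealNorm_primeIdeal (P : HeightOneSpectrum (𝓞 L)) :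
    idealNorm K (primeIdeal P) = primeIdeal (below K P) ^ P.asIdeal.inertiaDeg (𝓞 K) := by
  have := P.isMaximal
  have := (below K P).isMaximal
  have : P.asIdeal.LiesOver (below K P).asIdeal := ⟨rfl⟩
  exact Subtype.ext (relNorm_eq_pow_of_isMaximal P.asIdeal (below K P).asIdeal)

theorem npow_idealNorm (s : ℝ) (I : (Ideal (𝓞 L))⁰) : npow K s (idealNorm K I) = npow L s I := by
  rw [npow, npow, coe_idealNorm, absNorm_relNorm]

theorem npow_pow (s : ℝ) (I : (Ideal (𝓞 K))⁰) (n : ℕ) : npow K s (I ^ n) = npow K s I ^ n := by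
  induction n with
  | zero => simp [npow]
  | succ n ih => rw [pow_succ, npow_mul, ih, pow_succ]

theorem npow_primeIdeal (s : ℝ) (P : HeightOneSpectrum (𝓞 L)) :
    npow L s (primeIdeal P) =
      npow K s (primeIdeal (below K P)) ^ P.asIdeal.inertiaDeg (𝓞 K) := by
  rw [← npow_idealNorm (K := K), idealNorm_primeIdeal, npow_pow]

theorem npow_le_one {s : ℝ} (hs : 0 ≤ s) (I : (Ideal (𝓞 K))⁰) : npow K s I ≤ 1 :=
  Real.rpow_le_one_of_one_le_of_nonpos (Nat.one_le_cast.mpr (absNorm_pos I)) (by linarith)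

theorem euler_factor_le (hKL : finrank K L = 2) {s : ℝ} (hs : 0 ≤ s)
    (χ₁ χ₂ : ClassGroup (𝓞 K) →* ℤˣ) (h₁ : ∀ c ∈ (normClass K L).range, χ₁ c = 1)
    (h₂ : ∀ c ∈ (normClass K L).range, χ₂ c = 1) (p : HeightOneSpectrum (𝓞 K)) :
    (1 - twist 1 s (primeIdeal p)) * (1 - twist χ₁ s (primeIdeal p)) *
      ((1 - twist χ₂ s (primeIdeal p)) * (1 - twist (χ₁ * χ₂) s (primeIdeal p))) ≤
    ∏ P ∈ above L p, (1 - twist 1 s (primeIdeal P)) ^ 2 := by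
  set x := npow K s (primeIdeal p) with hx
  have hx0 : 0 < x := npow_pos s _
  have hx1 : x ≤ 1 := npow_le_one hs _
  have hsum := sum_above (L := L) p
  rw [hKL] at hsum
  have he (P : HeightOneSpectrum (𝓞 L)) : 0 < P.asIdeal.ramificationIdx (𝓞 K) :=
    have := P.isPrime
    Ideal.ramificationIdx_pos _ _
  have hf (P : HeightOneSpectrum (𝓞 L)) : 0 < P.asIdeal.inertiaDeg (𝓞 K) :=
    have := P.isPrime
    Ideal.inertiaDeg_pos _ _
  have hb : ∏ P ∈ above L p, (1 - twist 1 s (primeIdeal P)) ^ 2 =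
      ∏ P ∈ above L p, (1 - x ^ P.asIdeal.inertiaDeg (𝓞 K)) ^ 2 := by
    refine Finset.prod_congr rfl fun P hP ↦ ?_
    rw [twist_apply, npow_primeIdeal (K := K), mem_above.mp hP]
    simp [hx]
  have hχ (χ : ClassGroup (𝓞 K) →* ℤˣ) (h : ∀ c ∈ (normClass K L).range, χ c = 1)
      (P : HeightOneSpectrum (𝓞 L)) (hP : P ∈ above L p) (hP1 : P.asIdeal.inertiaDeg (𝓞 K) = 1) :
      χ (ClassGroup.mk0 (primeIdeal p)) = 1 := by
    refine h _ ⟨ClassGroup.mk0 (primeIdeal P), ?_⟩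
    rw [normClass_mk0, idealNorm_primeIdeal, hP1, pow_one, mem_above.mp hP]
  rw [hb]
  simp only [twist_apply, ← hx, MonoidHom.mul_apply, MonoidHom.one_apply]
  by_cases hex : ∃ P ∈ above L p, P.asIdeal.inertiaDeg (𝓞 K) = 1
  · obtain ⟨P, hP, hP1⟩ := hex
    rw [hχ χ₁ h₁ P hP hP1, hχ χ₂ h₂ P hP hP1]
    have hcard : (above L p).card ≤ 2 := by
      rw [← hsum, Finset.card_eq_sum_ones]
      exact Finset.sum_le_sum fun P _ ↦ Nat.mul_pos (he P) (hf P)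
    calc _ = ((1 - x) ^ 2) ^ 2 := by push_cast; ring
      _ ≤ ((1 - x) ^ 2) ^ (above L p).card :=
        pow_le_pow_of_le_one (sq_nonneg _) (by nlinarith) hcard
      _ ≤ _ := by
        rw [← Finset.prod_const]
        refine Finset.prod_le_prod (fun _ _ ↦ sq_nonneg _) fun P _ ↦ ?_
        have : x ^ P.asIdeal.inertiaDeg (𝓞 K) ≤ x := pow_le_of_le_one hx0.le hx1 (hf P).ne'
        exact pow_le_pow_left₀ (by linarith) (by linarith) 2
  · push Not at hex
    have hf2 (P) (hP : P ∈ above L p) : 2 ≤ P.asIdeal.inertiaDeg (𝓞 K) := by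
      have := hf P
      have := hex P hP
      omega
    have hcard : (above L p).card * 2 ≤ 2 := by
      nth_rw 2 [← hsum]
      rw [← smul_eq_mul, ← Finset.sum_const]
      exact Finset.sum_le_sum fun P hP ↦ (hf2 P hP).trans (Nat.le_mul_of_pos_left _ (he P))
    have hne : (above L p).card ≠ 0 := by
      intro h0
      rw [Finset.card_eq_zero.mp h0] at hsum
      simp at hsum
    obtain ⟨P, hP⟩ := Finset.card_eq_one.mp (by omega : (above L p).card = 1)
    have hP2 : P.asIdeal.inertiaDeg (𝓞 K) = 2 := by
      have := hf2 P (by simp [hP])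
      have h3 := he P
      rw [hP, Finset.sum_singleton] at hsum
      nlinarith
    rw [hP, Finset.prod_singleton, hP2]
    rcases Int.units_eq_one_or (χ₁ (ClassGroup.mk0 (primeIdeal p))) with h3 | h3 <;>
    rcases Int.units_eq_one_or (χ₂ (ClassGroup.mk0 (primeIdeal p))) with h4 | h4 <;>
    rw [h3, h4] <;> push_cast
    · have : 0 ≤ (1 - x) ^ 2 * x := by positivity
      nlinarith
    all_goals exact le_of_eq (by ring)

theorem tsum_npow_eq (M : Type*) [Field M] [NumberField M] (s : ℝ) :
    ∑' I, npow M s I = ∑' I, twist (1 : ClassGroup (𝓞 M) →* ℤˣ) s I :=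
  tsum_congr fun I ↦ by simp [twist_apply]

theorem zeta_sq_le (hKL : finrank K L = 2) {s : ℝ} (hs : 1 < s)
    (χ₁ χ₂ : ClassGroup (𝓞 K) →* ℤˣ) (h₁ : ∀ c ∈ (normClass K L).range, χ₁ c = 1)
    (h₂ : ∀ c ∈ (normClass K L).range, χ₂ c = 1) :
    (∑' I, npow L s I) ^ 2 ≤ (∑' I, npow K s I) * (∑' I, twist χ₁ s I) *
      ((∑' I, twist χ₂ s I) * (∑' I, twist (χ₁ * χ₂) s I)) := by
  have hnn : 0 ≤ ∑' I, npow L s I := tsum_nonneg fun I ↦ (npow_pos s I).le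
  rw [tsum_npow_eq] at hnn
  rw [tsum_npow_eq, tsum_npow_eq]
  let T (S : Finset (HeightOneSpectrum (𝓞 K))) : Finset (HeightOneSpectrum (𝓞 L)) :=
    S.biUnion (above L)
  have hT : Tendsto T atTop atTop := by
    refine tendsto_atTop.mpr fun U ↦ ?_
    filter_upwards [eventually_ge_atTop (U.image (below K))] with S hS P hP
    exact Finset.mem_biUnion.mpr ⟨below K P, hS (Finset.mem_image_of_mem _ hP), mem_above.mpr rfl⟩
  have tK := (tendsto_tsum_mul_prod _ (summable_twist (1 : ClassGroup (𝓞 K) →* ℤˣ) hs))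
  have t1 := (tendsto_tsum_mul_prod _ (summable_twist χ₁ hs))
  have t2 := (tendsto_tsum_mul_prod _ (summable_twist χ₂ hs))
  have t3 := (tendsto_tsum_mul_prod _ (summable_twist (χ₁ * χ₂) hs))
  have tL := ((tendsto_tsum_mul_prod _ (summable_twist (1 : ClassGroup (𝓞 L) →* ℤˣ) hs)).comp
    hT).pow 2
  have tR := (tK.mul t1).mul (t2.mul t3)
  norm_num at tL tR
  set ζ := ∑' I, twist (1 : ClassGroup (𝓞 K) →* ℤˣ) s I
  set Z := ∑' I, twist (1 : ClassGroup (𝓞 L) →* ℤˣ) s I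
  set L1 := ∑' I, twist χ₁ s I
  set L2 := ∑' I, twist χ₂ s I
  set L3 := ∑' I, twist (χ₁ * χ₂) s I
  set A : Finset (HeightOneSpectrum (𝓞 K)) → ℝ := fun S ↦ ∏ p ∈ S,
    ((1 - twist 1 s (primeIdeal p)) * (1 - twist χ₁ s (primeIdeal p)) *
      ((1 - twist χ₂ s (primeIdeal p)) * (1 - twist (χ₁ * χ₂) s (primeIdeal p)))) with hA
  set B : Finset (HeightOneSpectrum (𝓞 K)) → ℝ := fun S ↦ ∏ p ∈ S,
    ∏ P ∈ above L p, (1 - twist 1 s (primeIdeal P)) ^ 2 with hB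
  have hAt : Tendsto (fun S ↦ (ζ * L1 * (L2 * L3)) * A S) atTop (𝓝 1) := by
    refine tR.congr fun S ↦ ?_
    simp only [hA, Finset.prod_mul_distrib]
    ring
  have hBt : Tendsto (fun S ↦ Z ^ 2 * B S) atTop (𝓝 1) := by
    refine tL.congr fun S ↦ ?_
    simp only [hB, T]
    rw [Finset.prod_biUnion, mul_pow, ← Finset.prod_pow]
    · simp only [Finset.prod_pow]
    · intro p _ q _ hpq
      refine Finset.disjoint_left.mpr fun P hP hQ ↦ hpq ?_
      exact (mem_above.mp hP).symm.trans (mem_above.mp hQ)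
  have hle (S) : A S ≤ B S := by
    refine Finset.prod_le_prod (fun p _ ↦ ?_) fun p _ ↦
      euler_factor_le hKL (by linarith) χ₁ χ₂ h₁ h₂ p
    have hx0 : 0 < npow K s (primeIdeal p) := npow_pos s _
    have hx1 : npow K s (primeIdeal p) ≤ 1 := npow_le_one (by linarith) _
    have h0 (χ : ClassGroup (𝓞 K) →* ℤˣ) : 0 ≤ 1 - twist χ s (primeIdeal p) := by
      rw [twist_apply]
      have := le_abs_self (((χ (ClassGroup.mk0 (primeIdeal p)) : ℤ) : ℝ))
      rw [abs_intCast_units] at this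
      nlinarith
    have := h0 1
    have := h0 χ₁
    have := h0 χ₂
    have := h0 (χ₁ * χ₂)
    positivity
  have hAnn (S) : 0 ≤ A S := by
    refine Finset.prod_nonneg (fun p _ ↦ ?_)
    have hx0 : 0 < npow K s (primeIdeal p) := npow_pos s _
    have hx1 : npow K s (primeIdeal p) ≤ 1 := npow_le_one (by linarith) _
    have h0 (χ : ClassGroup (𝓞 K) →* ℤˣ) : 0 ≤ 1 - twist χ s (primeIdeal p) := by
      rw [twist_apply]
      have := le_abs_self (((χ (ClassGroup.mk0 (primeIdeal p)) : ℤ) : ℝ))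
      rw [abs_intCast_units] at this
      nlinarith
    have := h0 1
    have := h0 χ₁
    have := h0 χ₂
    have := h0 (χ₁ * χ₂)
    positivity
  have hR0 : 0 < ζ * L1 * (L2 * L3) := by
    by_contra! h
    have := le_of_tendsto hAt (Eventually.of_forall fun S ↦
      mul_nonpos_of_nonpos_of_nonneg h (hAnn S))
    linarith
  have h3 : Tendsto (fun S ↦ Z ^ 2 * ((ζ * L1 * (L2 * L3)) * A S)) atTop (𝓝 (Z ^ 2 * 1)) :=
    hAt.const_mul _
  have h4 : Tendsto (fun S ↦ (ζ * L1 * (L2 * L3)) * (Z ^ 2 * B S)) atTop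
      (𝓝 ((ζ * L1 * (L2 * L3)) * 1)) := hBt.const_mul _
  rw [mul_one] at h3 h4
  refine le_of_tendsto_of_tendsto' h3 h4 fun S ↦ ?_
  have := mul_le_mul_of_nonneg_left (hle S) (mul_nonneg hR0.le (sq_nonneg Z))
  nlinarith

theorem card_classGroup_le (hKL : finrank K L = 2) :
    Nat.card (ClassGroup (𝓞 K)) ≤ 2 * Nat.card (normClass K L).range := by
  by_contra! hlt
  obtain ⟨χ₁, χ₂, h₁, h₂, n1, n2, n3⟩ := exists_characters (normClass K L).range (fun c ↦ by
    obtain ⟨I, rfl⟩ := ClassGroup.mk0_surjective c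
    refine ⟨ClassGroup.mk0 (idealExt K L I), ?_⟩
    rw [normClass_mk0, idealNorm_idealExt, hKL, map_pow]) hlt
  obtain ⟨B₁, b1⟩ := exists_abs_tsum_twist_le χ₁ n1
  obtain ⟨B₂, b2⟩ := exists_abs_tsum_twist_le χ₂ n2
  obtain ⟨B₃, b3⟩ := exists_abs_tsum_twist_le _ n3
  have tK := tendsto_sub_one_mul_tsum_npow K
  have tL := (tendsto_sub_one_mul_tsum_npow L).pow 2
  have hR : 0 < dedekindZeta_residue L ^ 2 := pow_pos (dedekindZeta_residue_pos L) 2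
  have hs0 : Tendsto (fun s : ℝ ↦ s - 1) (𝓝[>] 1) (𝓝 0) := by
    have : Tendsto (fun s : ℝ ↦ s - 1) (𝓝 1) (𝓝 (1 - 1)) := (continuous_sub_right 1).tendsto 1
    rw [sub_self] at this
    exact this.mono_left nhdsWithin_le_nhds
  have hub := (hs0.mul tK).mul_const (B₁ * (B₂ * B₃))
  rw [zero_mul, zero_mul] at hub
  refine absurd (le_of_tendsto_of_tendsto tL hub ?_) (not_le.mpr hR)
  filter_upwards [b1, b2, b3, self_mem_nhdsWithin] with s c1 c2 c3 hs1
  have hs1 : 1 < s := hs1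
  have h := zeta_sq_le hKL hs1 χ₁ χ₂ h₁ h₂
  have hz : 0 ≤ ∑' I, npow K s I := tsum_nonneg fun I ↦ (npow_pos s I).le
  have h5 : (∑' I, npow L s I) ^ 2 ≤ (∑' I, npow K s I) * (B₁ * (B₂ * B₃)) := by
    refine h.trans ?_
    rw [mul_assoc]
    refine mul_le_mul_of_nonneg_left ((le_abs_self _).trans ?_) hz
    rw [abs_mul, abs_mul]
    have := (abs_nonneg _).trans c1
    have := (abs_nonneg _).trans c2
    gcongr
  have h6 := mul_le_mul_of_nonneg_left h5 (sq_nonneg (s - 1))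
  nlinarith

end NormClass

section AbelianGroups

open Module

theorem index_le_card_of_forall_eq {A X : Type*} [CommGroup A] [Finite X] (B : Subgroup A)
    (f : A → X) (h : ∀ a b, f a = f b → a⁻¹ * b ∈ B) : B.index ≤ Nat.card X := by
  rw [Subgroup.index]
  refine Nat.card_le_card_of_injective (fun q : A ⧸ B => f q.out) fun p q hpq => ?_
  have := h _ _ hpq
  rwa [← QuotientGroup.eq, QuotientGroup.out_eq', QuotientGroup.out_eq'] at this

section TwoTorsion

/-- Multiplication by two. -/
abbrev two (M : Type*) [AddCommGroup M] : M →+ M := nsmulAddMonoidHom 2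

theorem index_range_two_of_finite (T : Type*) [AddCommGroup T] [Finite T] :
    (two T).range.index = Nat.card (two T).ker := by
  have h1 := (two T).ker.card_mul_index
  have h2 := (two T).range.card_mul_index
  rw [AddSubgroup.index_ker] at h1
  have h3 : 0 < Nat.card (two T).range := Nat.card_pos
  rw [← h1, mul_comm] at h2
  exact Nat.eq_of_mul_eq_mul_right h3 h2

theorem index_range_two_prod (M N : Type*) [AddCommGroup M] [AddCommGroup N] :
    (two (M × N)).range.index = (two M).range.index * (two N).range.index := by
  rw [← AddSubgroup.index_prod]
  congr 1
  ext ⟨x, y⟩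
  simp [AddSubgroup.mem_prod, AddMonoidHom.mem_range]

theorem card_ker_two_prod (M N : Type*) [AddCommGroup M] [AddCommGroup N] :
    Nat.card (two (M × N)).ker = Nat.card (two M).ker * Nat.card (two N).ker := by
  rw [← Nat.card_prod]
  refine Nat.card_congr ⟨fun x => (⟨x.1.1, ?_⟩, ⟨x.1.2, ?_⟩), fun x => ⟨(x.1.1, x.2.1), ?_⟩,
    fun _ => rfl, fun _ => rfl⟩
  · exact congrArg Prod.fst x.2
  · exact congrArg Prod.snd x.2
  · exact Prod.ext x.1.2 x.2.2

theorem index_range_two_congr {M N : Type*} [AddCommGroup M] [AddCommGroup N] (e : M ≃+ N) :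
    (two M).range.index = (two N).range.index := by
  rw [← AddSubgroup.index_map_equiv (two M).range e, AddEquiv.map_range_nsmulAddMonoidHom]

theorem card_ker_two_congr {M N : Type*} [AddCommGroup M] [AddCommGroup N] (e : M ≃+ N) :
    Nat.card (two M).ker = Nat.card (two N).ker := by
  refine Nat.card_congr (e.toEquiv.subtypeEquiv fun x => ?_)
  simp only [AddMonoidHom.mem_ker, nsmulAddMonoidHom_apply, AddEquiv.toEquiv_eq_coe,
    EquivLike.coe_coe]
  rw [← map_nsmul, map_eq_zero_iff e e.injective]

theorem finrank_of_finite_int (T : Type*) [AddCommGroup T] [Finite T] : finrank ℤ T = 0 := by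
  rw [finrank_eq_zero_iff]
  intro x
  exact ⟨Nat.card T, by simp [Nat.card_pos.ne'], by rw [natCast_zsmul]; exact card_nsmul_eq_zero'⟩

theorem finrank_range_add_ker {M N : Type*} [AddCommGroup M] [AddCommGroup N]
    [Module.Finite ℤ M] (f : M →ₗ[ℤ] N) :
    finrank ℤ f.range + finrank ℤ f.ker = finrank ℤ M := by
  rw [← f.quotKerEquivRange.finrank_eq, Submodule.finrank_quotient_add_finrank]

theorem index_range_two (M : Type*) [AddCommGroup M] [Module.Finite ℤ M] :
    (two M).range.index = 2 ^ finrank ℤ M * Nat.card (two M).ker := by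
  have : AddGroup.FG M := Module.Finite.iff_addGroup_fg.mp inferInstance
  obtain ⟨n, ι, _, p, hp, e, ⟨f⟩⟩ := AddCommGroup.equiv_free_prod_directSum_zmod M
  have : ∀ i, NeZero (p i ^ e i) := fun i => ⟨pow_ne_zero _ (hp i).ne_zero⟩
  classical
  have hfin : Finite (DirectSum ι fun i => ZMod (p i ^ e i)) :=
    Finite.of_equiv _ (DirectSum.addEquivProd fun i => ZMod (p i ^ e i)).symm.toEquiv
  rw [index_range_two_congr f, card_ker_two_congr f, index_range_two_prod, card_ker_two_prod,
    index_range_two_of_finite (DirectSum ι fun i => ZMod (p i ^ e i))]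
  have h1 : (two (Fin n →₀ ℤ)).range.index = 2 ^ n := by
    rw [AddSubgroup.index_range_nsmul]; simp
  have h2 : Nat.card (two (Fin n →₀ ℤ)).ker = 1 := by
    rw [AddMonoidHom.ker_eq_bot_iff _ |>.mpr]
    · simp
    · exact AddSubgroup.nsmulAddMonoidHom_injective_of_isTorsionFree two_ne_zero
  have h3 : finrank ℤ M = n := by
    rw [f.toIntLinearEquiv.finrank_eq]
    have h4 := finrank_range_add_ker (LinearMap.fst ℤ (Fin n →₀ ℤ)
      (DirectSum ι fun i => ZMod (p i ^ e i)))
    rw [LinearMap.range_eq_top.2 LinearMap.fst_surjective, finrank_top, LinearMap.ker_fst,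
      LinearMap.finrank_range_of_inj LinearMap.inr_injective,
      finrank_of_finite_int (DirectSum ι fun i => ZMod (p i ^ e i)),
      add_zero] at h4
    rw [← h4]; simp
  rw [h1, h2, h3, one_mul]

end TwoTorsion

section Herbrand

variable {M : Type*} [AddCommGroup M] [Module.Finite ℤ M] (s : M →+ M)

/-- The endomorphism `1 + s`. -/
def onePlus : M →+ M := AddMonoidHom.id M + s

/-- The endomorphism `1 - s`. -/
def oneMinus : M →+ M := AddMonoidHom.id M - s

theorem onePlus_apply (x : M) : onePlus s x = x + s x := rfl

theorem oneMinus_apply (x : M) : oneMinus s x = x - s x := rfl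

theorem relIndex_two (A : AddSubgroup M) :
    (A.map (two M)).relIndex A = 2 ^ finrank ℤ A * Nat.card (two A).ker := by
  have h : Module.Finite ℤ A.toIntSubmodule := inferInstance
  let φ : A.toIntSubmodule →ₗ[ℤ] A :=
    { toFun := fun x => x, map_add' := fun _ _ => rfl, map_smul' := fun _ _ => rfl }
  have : Module.Finite ℤ A := Module.Finite.of_surjective φ fun x => ⟨x, rfl⟩
  rw [← index_range_two A, AddSubgroup.relIndex, AddSubgroup.addSubgroupOf_map_nsmulAddMonoidHom_eq_range]

theorem finrank_toIntSubmodule (A : AddSubgroup M) :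
    finrank ℤ A = finrank ℤ A.toIntSubmodule :=
  (AddEquiv.refl A : A ≃+ A.toIntSubmodule).toIntLinearEquiv.finrank_eq

theorem finrank_ker_add (f : M →+ M) :
    finrank ℤ f.range + finrank ℤ f.ker = finrank ℤ M := by
  rw [finrank_toIntSubmodule, finrank_toIntSubmodule, ← finrank_range_add_ker f.toIntLinearMap]
  rfl

theorem herbrand (hs : ∀ x, s (s x) = x)
    (hA : Nat.card (two (oneMinus s).ker).ker = 2) (hB : Nat.card (two (onePlus s).ker).ker = 2) :
    (onePlus s).range.relIndex (oneMinus s).ker * 2 ^ finrank ℤ (onePlus s).ker =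
      (oneMinus s).range.relIndex (onePlus s).ker * 2 ^ finrank ℤ (oneMinus s).ker ∧
    (onePlus s).range.relIndex (oneMinus s).ker ≠ 0 ∧
    (oneMinus s).range.relIndex (onePlus s).ker ≠ 0 := by
  set A := (oneMinus s).ker with hAdef
  set B := (onePlus s).ker with hBdef
  have memA : ∀ x, x ∈ A ↔ s x = x := fun x => by
    rw [hAdef, AddMonoidHom.mem_ker, oneMinus_apply, sub_eq_zero, eq_comm]
  have memB : ∀ x, x ∈ B ↔ s x = -x := fun x => by
    rw [hBdef, AddMonoidHom.mem_ker, onePlus_apply, add_comm, add_eq_zero_iff_eq_neg]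
  have h1 : A.map (two M) = A.map (onePlus s) := by
    ext y
    simp only [AddSubgroup.mem_map, nsmulAddMonoidHom_apply, onePlus_apply]
    refine exists_congr fun x => and_congr_right fun hx => ?_
    rw [(memA x).1 hx, two_nsmul]
  have h2 : B.map (two M) = B.map (oneMinus s) := by
    ext y
    simp only [AddSubgroup.mem_map, nsmulAddMonoidHom_apply, oneMinus_apply]
    refine exists_congr fun x => and_congr_right fun hx => ?_
    rw [(memB x).1 hx, two_nsmul, sub_neg_eq_add]
  have h3 : (onePlus s).range ≤ A := by
    rintro _ ⟨x, rfl⟩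
    rw [memA, onePlus_apply, map_add, hs, add_comm]
  have h4 : (oneMinus s).range ≤ B := by
    rintro _ ⟨x, rfl⟩
    rw [memB, oneMinus_apply, map_sub, hs, neg_sub]
  have h5 : (A.map (onePlus s)).relIndex (onePlus s).range = (A ⊔ B).index := by
    rw [AddMonoidHom.range_eq_map, AddSubgroup.relIndex_map_map, top_sup_eq,
      AddSubgroup.relIndex_top_right]
  have h6 : (B.map (oneMinus s)).relIndex (oneMinus s).range = (A ⊔ B).index := by
    rw [AddMonoidHom.range_eq_map, AddSubgroup.relIndex_map_map, top_sup_eq,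
      AddSubgroup.relIndex_top_right, sup_comm]
  have h7 := AddSubgroup.relIndex_mul_relIndex _ _ _ (AddSubgroup.map_le_range (onePlus s) A) h3
  have h8 := AddSubgroup.relIndex_mul_relIndex _ _ _ (AddSubgroup.map_le_range (oneMinus s) B) h4
  rw [h5, ← h1, relIndex_two, hA] at h7
  rw [h6, ← h2, relIndex_two, hB] at h8
  have h9 : (A ⊔ B).index ≠ 0 := by
    intro h0
    rw [h0, zero_mul] at h7
    exact absurd h7.symm (by positivity)
  refine ⟨Nat.eq_of_mul_eq_mul_left (Nat.pos_of_ne_zero h9) ?_, fun h0 => ?_, fun h0 => ?_⟩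
  rotate_left
  · rw [h0, mul_zero] at h7
    exact absurd h7.symm (by positivity)
  · rw [h0, mul_zero] at h8
    exact absurd h8.symm (by positivity)
  refine Nat.eq_of_mul_eq_mul_right two_pos ?_
  calc _ = ((A ⊔ B).index * (onePlus s).range.relIndex A) * (2 ^ finrank ℤ B * 2) := by ring
    _ = (2 ^ finrank ℤ A * 2) * ((A ⊔ B).index * (oneMinus s).range.relIndex B) := by rw [h7, h8]
    _ = _ := by ring

end Herbrand

end AbelianGroups

section UnitIndex

open Module NumberField

theorem addIndex_le_card_of_forall_eq {A X : Type*} [AddCommGroup A] [Finite X] (B : AddSubgroup A)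
    (f : A → X) (h : ∀ a b, f a = f b → -a + b ∈ B) : B.index ≤ Nat.card X := by
  rw [AddSubgroup.index]
  refine Nat.card_le_card_of_injective (fun q : A ⧸ B => f q.out) fun p q hpq => ?_
  have := h _ _ hpq
  rwa [← QuotientAddGroup.eq, QuotientAddGroup.out_eq', QuotientAddGroup.out_eq'] at this

section Quadratic

variable {K L : Type*} [Field K] [Field L] [Algebra K L] (hKL : finrank K L = 2)
  {σ : L ≃ₐ[K] L} (hσ : σ ≠ 1)
include hKL hσ

theorem univ_gal [Fintype (L ≃ₐ[K] L)] [DecidableEq (L ≃ₐ[K] L)] :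
    (Finset.univ : Finset (L ≃ₐ[K] L)) = {1, σ} := by
  have : FiniteDimensional K L := FiniteDimensional.of_finrank_pos (by omega)
  symm
  apply Finset.eq_univ_of_card
  refine le_antisymm (Finset.card_le_univ _) ?_
  rw [Finset.card_pair hσ.symm, ← hKL]
  have h := AlgEquiv.card_le (F := K) (K := L)
  rw [← @Nat.card_eq_fintype_card _ (AlgEquiv.fintype K L)] at h
  rw [← Nat.card_eq_fintype_card]
  exact h

theorem isGalois_of_finrank_two : IsGalois K L := by
  have : FiniteDimensional K L := .of_finrank_pos (by omega)
  classical
  apply IsGalois.of_card_aut_eq_finrank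
  rw [Nat.card_eq_fintype_card, ← Finset.card_univ, univ_gal hKL hσ, Finset.card_pair hσ.symm, hKL]

theorem algebraMap_norm_of_finrank_two (x : L) : algebraMap K L (Algebra.norm K x) = x * σ x := by
  have : FiniteDimensional K L := .of_finrank_pos (by omega)
  have := isGalois_of_finrank_two hKL hσ
  classical
  rw [Algebra.norm_eq_prod_automorphisms, univ_gal hKL hσ, Finset.prod_pair hσ.symm]
  rfl

theorem involutive_of_finrank_two (x : L) : σ (σ x) = x := by
  have : FiniteDimensional K L := .of_finrank_pos (by omega)
  classical
  have h : σ * σ ∈ (Finset.univ : Finset (L ≃ₐ[K] L)) := Finset.mem_univ _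
  rw [univ_gal hKL hσ, Finset.mem_insert, Finset.mem_singleton] at h
  rcases h with h | h
  · exact DFunLike.congr_fun h x
  · exact absurd (mul_eq_left.1 h) hσ

theorem mem_range_of_fixed {x : L} (hx : σ x = x) : ∃ a : K, algebraMap K L a = x := by
  have : FiniteDimensional K L := .of_finrank_pos (by omega)
  have := isGalois_of_finrank_two hKL hσ
  classical
  refine (IsGalois.mem_range_algebraMap_iff_fixed x).2 fun τ => ?_
  have h : τ ∈ (Finset.univ : Finset (L ≃ₐ[K] L)) := Finset.mem_univ _
  rw [univ_gal hKL hσ, Finset.mem_insert, Finset.mem_singleton] at h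
  rcases h with rfl | rfl
  · rfl
  · exact hx

theorem hilbert90_of_finrank_two {γ : L} (hγ : γ * σ γ = 1) : ∃ β : L, β ≠ 0 ∧ γ * σ β = β := by
  by_cases h : γ = -1
  · obtain ⟨x, hx⟩ := DFunLike.ne_iff.1 hσ
    refine ⟨x - σ x, sub_ne_zero.2 (Ne.symm hx), ?_⟩
    rw [map_sub, involutive_of_finrank_two hKL hσ, h]; ring
  · refine ⟨1 + γ, fun h0 => h (by linear_combination h0), ?_⟩
    rw [map_add, map_one]; linear_combination hγ

end Quadratic

section Units

variable (K L : Type*) [Field K] [NumberField K] [Field L] [NumberField L] [Algebra K L]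

theorem two_rank_add_one [IsTotallyComplex K] : 2 * (Units.rank K + 1) = finrank ℚ K := by
  have h1 : 0 < Fintype.card (InfinitePlace K) := Fintype.card_pos
  rw [IsTotallyComplex.finrank, Units.rank, Nat.sub_add_cancel h1,
    InfinitePlace.card_eq_nrRealPlaces_add_nrComplexPlaces, IsTotallyComplex.nrRealPlaces_eq_zero,
    zero_add]

variable {L}

theorem card_ker_two_units (A : AddSubgroup (Additive (𝓞 L)ˣ)) (h : Additive.ofMul (-1) ∈ A) :
    Nat.card (two A).ker = 2 := by
  rw [Nat.card_eq_two_iff]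
  refine ⟨⟨0, by simp⟩, ⟨⟨Additive.ofMul (-1), h⟩, ?_⟩, ?_, ?_⟩
  · rw [AddMonoidHom.mem_ker]
    apply Subtype.ext
    change 2 • (Additive.ofMul (-1 : (𝓞 L)ˣ)) = 0
    rw [← ofMul_pow, neg_one_sq, ofMul_one]
  · intro h
    have h1 : (0 : Additive (𝓞 L)ˣ) = Additive.ofMul (-1) := congrArg (fun x => (x.1 : Additive (𝓞 L)ˣ)) h
    have h2 : (1 : 𝓞 L) = -1 := congrArg (fun x : Additive (𝓞 L)ˣ => ((x.toMul : (𝓞 L)ˣ) : 𝓞 L)) h1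
    exact (by norm_num : (1 : 𝓞 L) ≠ -1) h2
  · refine Set.eq_univ_of_forall fun ⟨⟨x, hxA⟩, hx⟩ => ?_
    have h1 : (2 : ℕ) • x = 0 := congrArg Subtype.val hx
    have h2 : (x.toMul : 𝓞 L) ^ 2 = 1 :=
      congrArg (fun x : Additive (𝓞 L)ˣ => ((x.toMul : (𝓞 L)ˣ) : 𝓞 L)) h1
    have h3 : x.toMul = 1 ∨ x.toMul = -1 := by
      rcases mul_self_eq_one_iff.1 ((pow_two _).symm.trans h2) with h | h
      · exact Or.inl (Units.ext h)
      · exact Or.inr (Units.ext (by rw [h]; rfl))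
    rcases h3 with h3 | h3
    · exact Or.inl (Subtype.ext (Subtype.ext h3))
    · exact Or.inr (Subtype.ext (Subtype.ext h3))

variable {K}

/-- The automorphism of the ring of integers induced by a field automorphism. -/
noncomputable def intAut (σ : L ≃ₐ[K] L) : 𝓞 L ≃ₐ[𝓞 K] 𝓞 L := galRestrict (𝓞 K) K L (𝓞 L) σ

theorem coe_intAut (σ : L ≃ₐ[K] L) (x : 𝓞 L) : ((intAut σ x : 𝓞 L) : L) = σ x :=
  algebraMap_galRestrict_apply (𝓞 K) σ x

/-- The action of an automorphism on units, written additively. -/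
noncomputable def unitAut (σ : L ≃ₐ[K] L) : Additive (𝓞 L)ˣ →+ Additive (𝓞 L)ˣ :=
  (Units.map (intAut σ : 𝓞 L →* 𝓞 L)).toAdditive

theorem coe_unitAut (σ : L ≃ₐ[K] L) (x : Additive (𝓞 L)ˣ) :
    (((unitAut σ x).toMul : 𝓞 L) : L) = σ ((x.toMul : 𝓞 L) : L) :=
  coe_intAut σ _

theorem unit_ext {x y : Additive (𝓞 L)ˣ} (h : ((x.toMul : 𝓞 L) : L) = ((y.toMul : 𝓞 L) : L)) :
    x = y :=
  Additive.toMul.injective (Units.ext (RingOfIntegers.ext h))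

theorem mem_ker_oneMinus_unitAut {σ : L ≃ₐ[K] L} {x : Additive (𝓞 L)ˣ} :
    x ∈ (oneMinus (unitAut σ)).ker ↔ σ ((x.toMul : 𝓞 L) : L) = ((x.toMul : 𝓞 L) : L) := by
  rw [AddMonoidHom.mem_ker, oneMinus_apply, sub_eq_zero, ← coe_unitAut]
  exact ⟨fun h => by rw [← h], fun h => (unit_ext h).symm⟩

theorem mem_ker_onePlus_unitAut {σ : L ≃ₐ[K] L} {x : Additive (𝓞 L)ˣ} :
    x ∈ (onePlus (unitAut σ)).ker ↔
      ((x.toMul : 𝓞 L) : L) * σ ((x.toMul : 𝓞 L) : L) = 1 := by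
  rw [AddMonoidHom.mem_ker, onePlus_apply, ← coe_unitAut]
  constructor
  · intro h
    have := congrArg (fun x : Additive (𝓞 L)ˣ => (((x.toMul : (𝓞 L)ˣ) : 𝓞 L) : L)) h
    simpa using this
  · intro h
    apply unit_ext
    simpa using h

variable (hKL : finrank K L = 2) {σ : L ≃ₐ[K] L} (hσ : σ ≠ 1)
include hKL hσ

theorem fixed_units_finrank_le : finrank ℤ (oneMinus (unitAut σ)).ker ≤ Units.rank K := by
  rw [← Units.finrank_eq]
  let f : Additive (𝓞 K)ˣ →+ (oneMinus (unitAut σ)).ker :=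
    ((Units.map (algebraMap (𝓞 K) (𝓞 L) : 𝓞 K →* 𝓞 L)).toAdditive).codRestrict _ fun x => by
      rw [mem_ker_oneMinus_unitAut]
      exact σ.commutes _
  have hf : Function.Surjective f := by
    rintro ⟨x, hx⟩
    rw [mem_ker_oneMinus_unitAut] at hx
    obtain ⟨a, ha⟩ := mem_range_of_fixed hKL hσ hx
    have hzint : IsIntegral ℤ a := by
      rw [← isIntegral_algebraMap_iff (algebraMap K L).injective, ha]
      exact RingOfIntegers.isIntegral_coe _
    have hzint' : IsIntegral ℤ a⁻¹ := by
      rw [← isIntegral_algebraMap_iff (algebraMap K L).injective, map_inv₀, ha]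
      have : (((x.toMul : 𝓞 L) : L))⁻¹ = ((x.toMul⁻¹ : (𝓞 L)ˣ) : 𝓞 L) := by
        apply inv_eq_of_mul_eq_one_right
        rw [← map_mul, Units.mul_inv, map_one]
      rw [this]
      exact RingOfIntegers.isIntegral_coe _
    have ha0 : a ≠ 0 := by
      rintro rfl
      rw [map_zero] at ha
      exact x.toMul.ne_zero (RingOfIntegers.ext ha.symm)
    let u : (𝓞 K)ˣ := ⟨⟨a, hzint⟩, ⟨a⁻¹, hzint'⟩, RingOfIntegers.ext (mul_inv_cancel₀ ha0),
      RingOfIntegers.ext (inv_mul_cancel₀ ha0)⟩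
    refine ⟨Additive.ofMul u, Subtype.ext (unit_ext ?_)⟩
    exact ha
  exact f.toIntLinearMap.finrank_le_finrank_of_surjective hf

theorem two_mul_herbrand_le [IsTotallyComplex K] :
    2 * (onePlus (unitAut σ)).range.relIndex (oneMinus (unitAut σ)).ker ≤
      (oneMinus (unitAut σ)).range.relIndex (onePlus (unitAut σ)).ker ∧
    (onePlus (unitAut σ)).range.relIndex (oneMinus (unitAut σ)).ker ≠ 0 := by
  have : IsTotallyComplex L := isTotallyComplex_of_algebra K L
  have hs : ∀ x, unitAut σ (unitAut σ x) = x := fun x => unit_ext (by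
    rw [coe_unitAut, coe_unitAut, involutive_of_finrank_two hKL hσ])
  obtain ⟨h, h0, -⟩ := herbrand (unitAut σ) hs
    (card_ker_two_units _ (mem_ker_oneMinus_unitAut.2 (by simp)))
    (card_ker_two_units _ (mem_ker_onePlus_unitAut.2 (by simp)))
  have hA := fixed_units_finrank_le hKL hσ
  have hN : finrank ℤ (onePlus (unitAut σ)).range ≤ finrank ℤ (oneMinus (unitAut σ)).ker := by
    rw [finrank_toIntSubmodule, finrank_toIntSubmodule]
    apply Submodule.finrank_mono
    rintro _ ⟨x, rfl⟩
    refine sub_eq_zero.2 ?_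
    change onePlus (unitAut σ) x = unitAut σ (onePlus (unitAut σ) x)
    rw [onePlus_apply, map_add, hs, add_comm]
  have hr := finrank_ker_add (onePlus (unitAut σ))
  rw [Units.finrank_eq] at hr
  have h1 := two_rank_add_one K
  have h2 := two_rank_add_one L
  rw [← finrank_mul_finrank ℚ K L, hKL] at h2
  have h3 : finrank ℤ (oneMinus (unitAut σ)).ker + 1 ≤ finrank ℤ (onePlus (unitAut σ)).ker := by
    omega
  refine ⟨?_, h0⟩
  refine Nat.le_of_mul_le_mul_right (c := 2 ^ finrank ℤ (oneMinus (unitAut σ)).ker) ?_ (by positivity)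
  rw [← h, mul_comm 2, mul_assoc, ← pow_succ']
  exact Nat.mul_le_mul_left _ (Nat.pow_le_pow_right two_pos h3)

end Units

end UnitIndex

section ClassGroups

open scoped nonZeroDivisors

open NumberField Module

/-- Descend a homomorphism on nonzero ideals to the class group. -/
noncomputable def classLift {R M : Type*} [CommRing R] [IsDedekindDomain R] [CommMonoid M]
    (φ : (Ideal R)⁰ →* M)
    (h : ∀ I J : (Ideal R)⁰, ClassGroup.mk0 I = ClassGroup.mk0 J → φ I = φ J) :
    ClassGroup R →* M where
  toFun C := φ (ClassGroup.mk0_surjective C).choose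
  map_one' := by
    rw [← map_one φ]
    exact h _ _ ((ClassGroup.mk0_surjective (1 : ClassGroup R)).choose_spec.trans (map_one _).symm)
  map_mul' C D := by
    rw [← map_mul]
    refine h _ _ ?_
    rw [map_mul, (ClassGroup.mk0_surjective _).choose_spec,
      (ClassGroup.mk0_surjective _).choose_spec, (ClassGroup.mk0_surjective _).choose_spec]

theorem classLift_mk0 {R M : Type*} [CommRing R] [IsDedekindDomain R] [CommMonoid M]
    (φ : (Ideal R)⁰ →* M)
    (h : ∀ I J : (Ideal R)⁰, ClassGroup.mk0 I = ClassGroup.mk0 J → φ I = φ J) (I : (Ideal R)⁰) :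
    classLift φ h (ClassGroup.mk0 I) = φ I :=
  h _ _ (ClassGroup.mk0_surjective _).choose_spec

variable {K L : Type*} [Field K] [NumberField K] [Field L] [NumberField L] [Algebra K L]

variable (K L) in
/-- Extension of ideal classes. -/
noncomputable def extClass : ClassGroup (𝓞 K) →* ClassGroup (𝓞 L) :=
  classLift (ClassGroup.mk0.comp (idealExt K L)) fun I J hIJ => by
    obtain ⟨x, y, hx, hy, hxy⟩ := ClassGroup.mk0_eq_mk0_iff.mp hIJ
    refine ClassGroup.mk0_eq_mk0_iff.mpr ⟨algebraMap _ _ x, algebraMap _ _ y,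
      fun h => hx (FaithfulSMul.algebraMap_injective (𝓞 K) (𝓞 L) (h.trans (map_zero _).symm)),
      fun h => hy (FaithfulSMul.algebraMap_injective (𝓞 K) (𝓞 L) (h.trans (map_zero _).symm)), ?_⟩
    have := congrArg (Ideal.map (algebraMap (𝓞 K) (𝓞 L))) hxy
    simp only [Ideal.map_mul, Ideal.map_span, Set.image_singleton] at this
    exact this

theorem extClass_mk0 (I : (Ideal (𝓞 K))⁰) :
    extClass K L (ClassGroup.mk0 I) = ClassGroup.mk0 (idealExt K L I) :=
  classLift_mk0 _ _ I

/-- The action of an automorphism on nonzero ideals. -/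
noncomputable def idealAut (σ : L ≃ₐ[K] L) : (Ideal (𝓞 L))⁰ →* (Ideal (𝓞 L))⁰ where
  toFun I := ⟨Ideal.map (intAut σ : 𝓞 L →+* 𝓞 L) I, mem_nonZeroDivisors_of_ne_zero
    (Ideal.map_eq_bot_iff_of_injective (f := (intAut σ : 𝓞 L →+* 𝓞 L)) (intAut σ).injective
      |>.not.mpr (nonZeroDivisors.coe_ne_zero I))⟩
  map_one' := Subtype.ext (by
    change Ideal.map (intAut σ : 𝓞 L →+* 𝓞 L) (1 : Ideal (𝓞 L)) = 1
    rw [Ideal.one_eq_top, Ideal.map_top])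
  map_mul' I J := Subtype.ext (by
    simp only [Submonoid.coe_mul, Ideal.map_mul])

theorem coe_idealAut (σ : L ≃ₐ[K] L) (I : (Ideal (𝓞 L))⁰) :
    (idealAut σ I : Ideal (𝓞 L)) = Ideal.map (intAut σ : 𝓞 L →+* 𝓞 L) I := rfl

theorem idealNorm_idealAut (σ : L ≃ₐ[K] L) (I : (Ideal (𝓞 L))⁰) :
    idealNorm K (idealAut σ I) = idealNorm K I :=
  Subtype.ext (Ideal.relNorm_map_algEquiv (intAut σ) (I : Ideal (𝓞 L)))

theorem idealAut_idealExt (σ : L ≃ₐ[K] L) (I : (Ideal (𝓞 K))⁰) :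
    idealAut σ (idealExt K L I) = idealExt K L I := Subtype.ext (by
  change Ideal.map _ (Ideal.map _ _) = Ideal.map _ _
  rw [Ideal.map_map]
  congr 1
  ext x
  simp)

theorem map_span_singleton_mul (σ : L ≃ₐ[K] L) {x y : 𝓞 L} {I J : (Ideal (𝓞 L))⁰}
    (h : Ideal.span {x} * (I : Ideal (𝓞 L)) = Ideal.span {y} * J) :
    Ideal.span {intAut σ x} * (idealAut σ I : Ideal (𝓞 L)) =
      Ideal.span {intAut σ y} * idealAut σ J := by
  have := congrArg (Ideal.map (intAut σ : 𝓞 L →+* 𝓞 L)) h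
  simp only [Ideal.map_mul, Ideal.map_span, Set.image_singleton] at this
  exact this

/-- The action of an automorphism on ideal classes. -/
noncomputable def classAut (σ : L ≃ₐ[K] L) : ClassGroup (𝓞 L) →* ClassGroup (𝓞 L) :=
  classLift (ClassGroup.mk0.comp (idealAut σ)) fun I J hIJ => by
    obtain ⟨x, y, hx, hy, hxy⟩ := ClassGroup.mk0_eq_mk0_iff.mp hIJ
    exact ClassGroup.mk0_eq_mk0_iff.mpr ⟨intAut σ x, intAut σ y,
      (map_ne_zero_iff _ (intAut σ).injective).2 hx, (map_ne_zero_iff _ (intAut σ).injective).2 hy,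
      map_span_singleton_mul σ hxy⟩

theorem classAut_mk0 (σ : L ≃ₐ[K] L) (I : (Ideal (𝓞 L))⁰) :
    classAut σ (ClassGroup.mk0 I) = ClassGroup.mk0 (idealAut σ I) :=
  classLift_mk0 _ _ I

theorem norm_associated_of_span_mul {x y : 𝓞 L} {I J : (Ideal (𝓞 L))⁰}
    (h : Ideal.span {x} * (I : Ideal (𝓞 L)) = Ideal.span {y} * J) :
    Ideal.span {Algebra.intNorm (𝓞 K) (𝓞 L) x} * (idealNorm K I : Ideal (𝓞 K)) =
      Ideal.span {Algebra.intNorm (𝓞 K) (𝓞 L) y} * idealNorm K J := by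
  rw [coe_idealNorm, coe_idealNorm, ← Ideal.relNorm_singleton, ← Ideal.relNorm_singleton,
    ← map_mul, ← map_mul, h]

variable (hKL : finrank K L = 2) {σ : L ≃ₐ[K] L} (hσ : σ ≠ 1)
include hKL hσ

theorem intAut_intAut (x : 𝓞 L) : intAut σ (intAut σ x) = x :=
  RingOfIntegers.ext (by rw [coe_intAut, coe_intAut, involutive_of_finrank_two hKL hσ])

theorem idealAut_idealAut (I : (Ideal (𝓞 L))⁰) : idealAut σ (idealAut σ I) = I := Subtype.ext (by
  rw [coe_idealAut, coe_idealAut, Ideal.map_map]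
  convert Ideal.map_id _
  ext x
  exact congrArg _ (intAut_intAut hKL hσ x))

theorem exists_intAut_mul_eq {γ : L} (hγ : γ * σ γ = 1) :
    ∃ β : 𝓞 L, β ≠ 0 ∧ γ * (intAut σ β : L) = β := by
  obtain ⟨β, hβ, h⟩ := hilbert90_of_finrank_two hKL hσ hγ
  obtain ⟨m, hm, hzint⟩ := ((IsFractionRing.isAlgebraic_iff ℤ ℚ L).2
    (Algebra.IsAlgebraic.isAlgebraic (R := ℚ) β)).exists_integral_multiple
  obtain ⟨b, hb⟩ : ∃ b : 𝓞 L, (b : L) = m • β := ⟨⟨_, hzint⟩, rfl⟩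
  refine ⟨b, ?_, ?_⟩
  · rintro rfl
    have : m • β = 0 := hb.symm
    rcases smul_eq_zero.1 this with h | h
    · exact hm h
    · exact hβ h
  · rw [coe_intAut, hb, map_zsmul, mul_smul_comm, h]

theorem idealExt_idealNorm
    (H : ∀ I : (Ideal (𝓞 L))⁰, idealAut σ I = I → ∃ J, idealExt K L J = I) (I : (Ideal (𝓞 L))⁰) :
    idealExt K L (idealNorm K I) = I * idealAut σ I := by
  obtain ⟨J, hJ⟩ := H (I * idealAut σ I) (by rw [map_mul, idealAut_idealAut hKL hσ, mul_comm])
  have h := congrArg (idealNorm K) hJ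
  rw [idealNorm_idealExt, hKL, map_mul, idealNorm_idealAut, ← pow_two] at h
  have : J = idealNorm K I := by
    have h' : (J : Ideal (𝓞 K)) ^ 2 = (idealNorm K I : Ideal (𝓞 K)) ^ 2 := congrArg Subtype.val h
    exact Subtype.ext (pow_left_injective two_ne_zero h')
  rw [← this, hJ]

end ClassGroups

section UnramifiedNorm

open scoped nonZeroDivisors

open NumberField Module

variable {K L : Type*} [Field K] [NumberField K] [Field L] [NumberField L] [Algebra K L]

/-- A nonzero principal ideal. -/
noncomputable def principal (x : 𝓞 L) (hx : x ≠ 0) : (Ideal (𝓞 L))⁰ :=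
  ⟨Ideal.span {x}, mem_nonZeroDivisors_of_ne_zero (by simpa using hx)⟩

theorem mk0_principal (x : 𝓞 L) (hx : x ≠ 0) : ClassGroup.mk0 (principal x hx) = 1 :=
  (ClassGroup.mk0_eq_one_iff (principal x hx).2).2 ⟨x, rfl⟩

theorem coe_toMul_add (u v : Additive (𝓞 L)ˣ) :
    (((u + v).toMul : 𝓞 L) : L) = ((u.toMul : 𝓞 L) : L) * ((v.toMul : 𝓞 L) : L) := rfl

/-- Units which are fixed by `σ` and are norms of elements of the field. -/
noncomputable def normUnits (σ : L ≃ₐ[K] L) : AddSubgroup (Additive (𝓞 L)ˣ) where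
  carrier := {u | ∃ x : L, x * σ x = ((u.toMul : 𝓞 L) : L)}
  zero_mem' := ⟨1, by simp⟩
  add_mem' := by
    rintro u v ⟨x, hx⟩ ⟨y, hy⟩
    refine ⟨x * y, ?_⟩
    rw [coe_toMul_add, map_mul, ← hx, ← hy]; ring
  neg_mem' := by
    rintro u ⟨x, hx⟩
    refine ⟨x⁻¹, ?_⟩
    rw [map_inv₀, ← mul_inv, hx]
    apply inv_eq_of_mul_eq_one_right
    rw [← map_mul, toMul_neg, Units.mul_inv, map_one]

variable (hKL : finrank K L = 2) {σ : L ≃ₐ[K] L} (hσ : σ ≠ 1)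
  (H : ∀ I : (Ideal (𝓞 L))⁰, idealAut σ I = I → ∃ J, idealExt K L J = I)
include hKL hσ H

theorem relIndex_oneMinus_le :
    (oneMinus (unitAut σ)).range.relIndex (onePlus (unitAut σ)).ker ≤
      Nat.card (extClass K L).ker := by
  have key : ∀ u : (onePlus (unitAut σ)).ker, ∃ (β : 𝓞 L) (J : (Ideal (𝓞 K))⁰), β ≠ 0 ∧
      ((u.1.toMul : 𝓞 L) : L) * (intAut σ β : L) = β ∧
      (idealExt K L J : Ideal (𝓞 L)) = Ideal.span {β} := by
    rintro ⟨u, hu⟩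
    obtain ⟨β, hβ, h⟩ := exists_intAut_mul_eq hKL hσ (mem_ker_onePlus_unitAut.1 hu)
    have hmem : Ideal.span {β} ∈ (Ideal (𝓞 L))⁰ :=
      mem_nonZeroDivisors_of_ne_zero (by simpa using hβ)
    obtain ⟨J, hJ⟩ := H ⟨Ideal.span {β}, hmem⟩ (by
      apply Subtype.ext
      rw [coe_idealAut]
      simp only [Ideal.map_span, Set.image_singleton]
      rw [Ideal.span_singleton_eq_span_singleton]
      refine ⟨u.toMul, RingOfIntegers.ext ?_⟩
      rw [mul_comm]; exact h)
    exact ⟨β, J, hβ, h, congrArg Subtype.val hJ⟩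
  choose β J hβ hu hJ using key
  have hker : ∀ u, ClassGroup.mk0 (J u) ∈ (extClass K L).ker := fun u => by
    rw [MonoidHom.mem_ker, extClass_mk0]
    refine (ClassGroup.mk0_eq_one_iff (idealExt K L (J u)).2).2 ?_
    rw [hJ]
    exact ⟨β u, rfl⟩
  refine addIndex_le_card_of_forall_eq _ (fun u => (⟨_, hker u⟩ : (extClass K L).ker)) ?_
  intro a b hab
  obtain ⟨x, y, hx, hy, hxy⟩ := ClassGroup.mk0_eq_mk0_iff.mp (congrArg Subtype.val hab)
  have h1 := congrArg (Ideal.map (algebraMap (𝓞 K) (𝓞 L))) hxy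
  simp only [Ideal.map_mul, Ideal.map_span, Set.image_singleton] at h1
  change _ * (idealExt K L (J a) : Ideal (𝓞 L)) = _ * (idealExt K L (J b) : Ideal (𝓞 L)) at h1
  rw [hJ, hJ, Ideal.span_singleton_mul_span_singleton, Ideal.span_singleton_mul_span_singleton,
    Ideal.span_singleton_eq_span_singleton] at h1
  obtain ⟨e, he⟩ := h1
  rw [AddSubgroup.mem_addSubgroupOf]
  refine ⟨Additive.ofMul e, ?_⟩
  have he1 : (algebraMap (𝓞 K) (𝓞 L) x : L) * β a * (e : 𝓞 L) =
      (algebraMap (𝓞 K) (𝓞 L) y : L) * β b := congrArg (fun z : 𝓞 L => (z : L)) he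
  have he2 := congrArg σ he1
  have hc : ∀ z : 𝓞 K, σ (algebraMap (𝓞 K) (𝓞 L) z : L) = (algebraMap (𝓞 K) (𝓞 L) z : L) :=
    fun z => σ.commutes _
  rw [map_mul, map_mul, map_mul, hc, hc] at he2
  simp only [coe_intAut] at hu
  have hx' : (algebraMap (𝓞 K) (𝓞 L) x : L) ≠ 0 := fun h => hx
    (FaithfulSMul.algebraMap_injective (𝓞 K) (𝓞 L)
      ((RingOfIntegers.ext h).trans (map_zero _).symm))
  have hβ' : σ (β a : L) ≠ 0 := fun h =>
    (map_ne_zero_iff _ (intAut σ).injective).2 (hβ a)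
      (RingOfIntegers.ext ((coe_intAut σ _).trans h))
  have h2 : a.1 + Additive.ofMul e = b.1 + unitAut σ (Additive.ofMul e) := by
    apply unit_ext
    rw [coe_toMul_add, coe_toMul_add, coe_unitAut]
    refine mul_left_cancel₀ (mul_ne_zero hx' hβ') ?_
    have ha := hu a
    have hb := hu b
    change _ * (_ * ((e : 𝓞 L) : L)) = _ * (_ * σ ((e : 𝓞 L) : L))
    linear_combination (e : 𝓞 L) * (algebraMap (𝓞 K) (𝓞 L) x : L) * ha + he1 -
      ((b.1.toMul : 𝓞 L) : L) * he2 - (algebraMap (𝓞 K) (𝓞 L) y : L) * hb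
  rw [oneMinus_apply]
  change _ = -a.1 + b.1
  calc _ = -a.1 + (a.1 + Additive.ofMul e) - unitAut σ (Additive.ofMul e) := by abel
    _ = _ := by rw [h2]; abel

omit H in
theorem algebraMap_intNorm_eq (x : 𝓞 L) :
    ((algebraMap (𝓞 K) (𝓞 L) (Algebra.intNorm (𝓞 K) (𝓞 L) x) : 𝓞 L) : L) = (x : L) * σ x := by
  rw [← algebraMap_norm_of_finrank_two hKL hσ, ← Algebra.algebraMap_intNorm (A := 𝓞 K) (K := K) (L := L) (B := 𝓞 L)]
  rfl

omit H in
theorem exists_unit_of_fixed_class {I : (Ideal (𝓞 L))⁰}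
    (h : ClassGroup.mk0 I = ClassGroup.mk0 (idealAut σ I)) :
    ∃ (x y : 𝓞 L) (η : normUnits σ), x ≠ 0 ∧ y ≠ 0 ∧
      Ideal.span {x} * (I : Ideal (𝓞 L)) = Ideal.span {y} * idealAut σ I ∧
      (x : L) * σ x * ((η.1.toMul : 𝓞 L) : L) = y * σ y := by
  obtain ⟨x, y, hx, hy, hxy⟩ := ClassGroup.mk0_eq_mk0_iff.mp h
  have h1 := norm_associated_of_span_mul (K := K) hxy
  rw [idealNorm_idealAut] at h1
  have h2 := mul_right_cancel₀ (nonZeroDivisors.coe_ne_zero _) h1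
  rw [Ideal.span_singleton_eq_span_singleton] at h2
  obtain ⟨v, hv⟩ := h2
  have h3 : (x : L) * σ x * ((algebraMap (𝓞 K) (𝓞 L) v : 𝓞 L) : L) = y * σ y := by
    rw [← algebraMap_intNorm_eq hKL hσ, ← algebraMap_intNorm_eq hKL hσ, ← hv, map_mul]
    rfl
  have hx' : (x : L) ≠ 0 := fun h => hx (RingOfIntegers.ext h)
  refine ⟨x, y, ⟨Additive.ofMul (Units.map (algebraMap (𝓞 K) (𝓞 L) : 𝓞 K →* 𝓞 L) v),
    (y : L) / x, ?_⟩, hx, hy, hxy, h3⟩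
  rw [map_div₀, div_mul_div_comm, div_eq_iff (mul_ne_zero hx' ((map_ne_zero σ).2 hx')), ← h3,
    mul_comm]
  rfl

omit H in
theorem fixed_of_mem_normUnits {η : Additive (𝓞 L)ˣ} (h : η ∈ normUnits σ) :
    σ ((η.toMul : 𝓞 L) : L) = ((η.toMul : 𝓞 L) : L) := by
  obtain ⟨x, hx⟩ := h
  rw [← hx, map_mul, involutive_of_finrank_two hKL hσ, mul_comm]

theorem relIndex_fixed_classes_le
    (hfin : (onePlus (unitAut σ)).range.relIndex (normUnits σ) ≠ 0) :
    (extClass K L).range.relIndex (MonoidHom.ker (MonoidHom.id _ / classAut σ)) ≤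
      (onePlus (unitAut σ)).range.relIndex (normUnits σ) := by
  have key : ∀ c : MonoidHom.ker (MonoidHom.id (ClassGroup (𝓞 L)) / classAut σ),
      ∃ (I : (Ideal (𝓞 L))⁰) (x y : 𝓞 L) (η : normUnits σ), ClassGroup.mk0 I = c.1 ∧
      x ≠ 0 ∧ y ≠ 0 ∧
      Ideal.span {x} * (I : Ideal (𝓞 L)) = Ideal.span {y} * idealAut σ I ∧
      (x : L) * σ x * ((η.1.toMul : 𝓞 L) : L) = y * σ y := by
    rintro ⟨c, hc⟩
    obtain ⟨I, rfl⟩ := ClassGroup.mk0_surjective c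
    rw [MonoidHom.mem_ker, MonoidHom.div_apply, MonoidHom.id_apply, classAut_mk0, div_eq_one] at hc
    exact ⟨I, (exists_unit_of_fixed_class hKL hσ hc).imp fun x hx => hx.imp fun y hy =>
      hy.imp fun η hη => ⟨rfl, hη⟩⟩
  choose I x y η hI hx hy hxy hη using key
  have hX : Finite (normUnits σ ⧸ (onePlus (unitAut σ)).range.addSubgroupOf (normUnits σ)) :=
    Nat.finite_of_card_ne_zero hfin
  refine index_le_card_of_forall_eq _ (fun c => (QuotientAddGroup.mk (η c) :
    normUnits σ ⧸ (onePlus (unitAut σ)).range.addSubgroupOf (normUnits σ))) ?_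
  intro a b hab
  rw [QuotientAddGroup.eq, AddSubgroup.mem_addSubgroupOf] at hab
  obtain ⟨e, he⟩ := hab
  rw [Subgroup.mem_subgroupOf]
  have hb2 : b.1 * b.1 ∈ (extClass K L).range := by
    refine ⟨ClassGroup.mk0 (idealNorm K (I b)), ?_⟩
    have hb := b.2
    rw [MonoidHom.mem_ker, MonoidHom.div_apply, MonoidHom.id_apply, div_eq_one] at hb
    rw [extClass_mk0, idealExt_idealNorm hKL hσ H, map_mul, ← classAut_mk0, hI, ← hb]
  have hab : a.1 * b.1 ∈ (extClass K L).range := by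
    have he' : ((η b).1.toMul : 𝓞 L) = ((η a).1.toMul : 𝓞 L) * ((e.toMul : 𝓞 L) *
        ((unitAut σ e).toMul : 𝓞 L)) := by
      have h1 : (η b).1 = (η a).1 + (e + unitAut σ e) := by
        rw [onePlus_apply] at he
        have h2 : e + unitAut σ e = -(η a).1 + (η b).1 := he
        rw [h2]; abel
      rw [h1]; rfl
    have he2 : (((η b).1.toMul : 𝓞 L) : L) = (((η a).1.toMul : 𝓞 L) : L) *
        (((e.toMul : 𝓞 L) : L) * σ ((e.toMul : 𝓞 L) : L)) := by
      rw [← coe_unitAut, he']; rfl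
    have hfix := fixed_of_mem_normUnits hKL hσ (η a).2
    have hne : ∀ z : 𝓞 L, z ≠ 0 → (z : L) ≠ 0 := fun z hz h => hz (RingOfIntegers.ext h)
    have hya := hne _ (hy a)
    have hyb := hne _ (hy b)
    have hsya := (map_ne_zero σ).2 hya
    have hsyb := (map_ne_zero σ).2 hyb
    have hγ : ((x a : L) * x b * ((η a).1.toMul : 𝓞 L) * (e.toMul : 𝓞 L) / (y a * y b)) *
        σ ((x a : L) * x b * ((η a).1.toMul : 𝓞 L) * (e.toMul : 𝓞 L) / (y a * y b)) = 1 := by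
      rw [map_div₀, map_mul, map_mul, map_mul, map_mul, hfix, div_mul_div_comm,
        div_eq_one_iff_eq (by positivity)]
      have ha := hη a
      have hb := hη b
      rw [he2] at hb
      linear_combination ((x b : L) * σ (x b) * (((η a).1.toMul : 𝓞 L) *
        (((e.toMul : 𝓞 L) : L) * σ ((e.toMul : 𝓞 L) : L)))) * ha + (y a : L) * σ (y a) * hb
    obtain ⟨β, hβ, hγβ⟩ := exists_intAut_mul_eq hKL hσ hγ
    have h3 : x a * x b * intAut σ β * (((η a).1.toMul * e.toMul : (𝓞 L)ˣ) : 𝓞 L) =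
        y a * y b * β := by
      apply RingOfIntegers.ext
      rw [div_mul_eq_mul_div, div_eq_iff (mul_ne_zero hya hyb)] at hγβ
      calc _ = (x a : L) * x b * ((η a).1.toMul : 𝓞 L) * (e.toMul : 𝓞 L) * (intAut σ β : L) := by
            change (x a : L) * x b * (intAut σ β : L) * (((η a).1.toMul : 𝓞 L) * (e.toMul : 𝓞 L)) = _
            ring
        _ = _ := by rw [hγβ, mul_comm]; rfl
    have h4 : Ideal.span {x a * x b} * Ideal.span {intAut σ β} =
        Ideal.span {y a * y b} * Ideal.span {β} := by
      rw [Ideal.span_singleton_mul_span_singleton, Ideal.span_singleton_mul_span_singleton,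
        Ideal.span_singleton_eq_span_singleton]
      exact ⟨_, h3⟩
    have h5 : Ideal.span {x a * x b} * ((I a * I b : (Ideal (𝓞 L))⁰) : Ideal (𝓞 L)) =
        Ideal.span {y a * y b} * (idealAut σ (I a * I b) : (Ideal (𝓞 L))⁰) := by
      rw [map_mul, Submonoid.coe_mul, Submonoid.coe_mul,
        ← Ideal.span_singleton_mul_span_singleton, ← Ideal.span_singleton_mul_span_singleton,
        mul_mul_mul_comm, hxy, hxy, mul_mul_mul_comm]
    have h6 : idealAut σ (principal β hβ * (I a * I b)) = principal β hβ * (I a * I b) := by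
      rw [map_mul]
      apply Subtype.ext
      have hx0 : Ideal.span {x a * x b} ≠ 0 := by
        rw [Ne, Ideal.zero_eq_bot, Ideal.span_singleton_eq_bot]
        exact mul_ne_zero (hx a) (hx b)
      have h7 : (idealAut σ (principal β hβ) : Ideal (𝓞 L)) = Ideal.span {intAut σ β} := by
        rw [coe_idealAut]
        simp only [principal, Ideal.map_span, Set.image_singleton]
        rfl
      refine mul_left_cancel₀ hx0 ?_
      rw [Submonoid.coe_mul, Submonoid.coe_mul, h7, ← mul_assoc, h4, mul_right_comm, ← h5]
      change _ = _ * (Ideal.span {β} * _)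
      ring
    obtain ⟨J, hJ⟩ := H _ h6
    refine ⟨ClassGroup.mk0 J, ?_⟩
    rw [extClass_mk0, hJ, map_mul, mk0_principal, one_mul, map_mul, hI, hI]
  have : ((a⁻¹ * b : MonoidHom.ker (MonoidHom.id (ClassGroup (𝓞 L)) / classAut σ)) :
      ClassGroup (𝓞 L)) = (a.1 * b.1)⁻¹ * (b.1 * b.1) := by
    change a.1⁻¹ * b.1 = _
    rw [mul_inv]
    simp [mul_assoc]
  rw [this]
  exact mul_mem (inv_mem hab) hb2

theorem units_and_classes_norm [IsTotallyComplex K] :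
    (∀ u : Additive (𝓞 L)ˣ, u ∈ (oneMinus (unitAut σ)).ker → u ∈ normUnits σ) ∧
      ∀ c : ClassGroup (𝓞 L), normClass K L c = 1 → ∃ d, d / classAut σ d = c := by
  obtain ⟨h2, h0⟩ := two_mul_herbrand_le hKL hσ
  have h1 := relIndex_oneMinus_le hKL hσ H
  have hle1 : (onePlus (unitAut σ)).range ≤ normUnits σ := by
    rintro _ ⟨u, rfl⟩
    refine ⟨((u.toMul : 𝓞 L) : L), ?_⟩
    rw [onePlus_apply, coe_toMul_add, coe_unitAut]
  have hle2 : normUnits σ ≤ (oneMinus (unitAut σ)).ker := fun u hu =>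
    mem_ker_oneMinus_unitAut.2 (fixed_of_mem_normUnits hKL hσ hu)
  have hmt := AddSubgroup.relIndex_mul_relIndex _ _ _ hle1 hle2
  set m := (onePlus (unitAut σ)).range.relIndex (normUnits σ)
  set t := (normUnits σ).relIndex (oneMinus (unitAut σ)).ker
  have hm : m ≠ 0 := fun h => h0 (by rw [← hmt, h, zero_mul])
  have ht : t ≠ 0 := fun h => h0 (by rw [← hmt, h, mul_zero])
  have h3 := relIndex_fixed_classes_le hKL hσ H hm
  have h4 := card_classGroup_le hKL
  set φ : ClassGroup (𝓞 L) →* ClassGroup (𝓞 L) := MonoidHom.id _ / classAut σ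
  have hφ : φ.range ≤ (normClass K L).ker := by
    rintro _ ⟨c, rfl⟩
    obtain ⟨I, rfl⟩ := ClassGroup.mk0_surjective c
    rw [MonoidHom.mem_ker, MonoidHom.div_apply, MonoidHom.id_apply, map_div, classAut_mk0,
      normClass_mk0, normClass_mk0, idealNorm_idealAut, div_self']
  have hext : (extClass K L).range ≤ φ.ker := by
    rintro _ ⟨c, rfl⟩
    obtain ⟨I, rfl⟩ := ClassGroup.mk0_surjective c
    rw [MonoidHom.mem_ker, MonoidHom.div_apply, MonoidHom.id_apply, extClass_mk0, classAut_mk0,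
      idealAut_idealExt, div_self']
  have e1 : Nat.card φ.ker * Nat.card φ.range = Nat.card (ClassGroup (𝓞 L)) := by
    rw [← Subgroup.index_ker, Subgroup.card_mul_index]
  have e2 : Nat.card (normClass K L).ker * Nat.card (normClass K L).range =
      Nat.card (ClassGroup (𝓞 L)) := by
    rw [← Subgroup.index_ker, Subgroup.card_mul_index]
  have e3 : Nat.card (extClass K L).ker * Nat.card (extClass K L).range =
      Nat.card (ClassGroup (𝓞 K)) := by
    rw [← Subgroup.index_ker, Subgroup.card_mul_index]
  have e4 : Nat.card (extClass K L).range * (extClass K L).range.relIndex φ.ker =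
      Nat.card φ.ker := by
    rw [← Subgroup.relIndex_bot_left, ← Subgroup.relIndex_bot_left φ.ker]
    exact Subgroup.relIndex_mul_relIndex _ _ _ bot_le hext
  have e5 : Nat.card φ.range ≤ Nat.card (normClass K L).ker := Subgroup.card_le_of_le hφ
  have p1 : 0 < Nat.card φ.range := Nat.card_pos
  have p2 : 0 < Nat.card (normClass K L).range := Nat.card_pos
  have p3 : 0 < Nat.card (extClass K L).range := Nat.card_pos
  have e6 : Nat.card (normClass K L).range ≤ Nat.card φ.ker := by
    by_contra hlt
    push Not at hlt
    have := Nat.mul_lt_mul_of_le_of_lt e5 hlt Nat.card_pos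
    rw [e2, mul_comm, e1] at this
    exact lt_irrefl _ this
  have e7 : Nat.card φ.ker ≤ Nat.card (extClass K L).range * m := by
    rw [← e4]; exact Nat.mul_le_mul_left _ h3
  have e8 : 2 * (m * t) * Nat.card (extClass K L).range ≤ Nat.card (ClassGroup (𝓞 K)) := by
    rw [← e3, hmt]
    exact Nat.mul_le_mul_right _ (h2.trans h1)
  have e9 : 2 * (m * t) * Nat.card (extClass K L).range ≤
      2 * (Nat.card (extClass K L).range * m) := by
    have := Nat.mul_le_mul_left 2 (e6.trans e7)
    exact (e8.trans h4).trans this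
  have hmA : 0 < 2 * (Nat.card (extClass K L).range * m) := by positivity
  have ht1 : t = 1 := by
    refine le_antisymm ?_ (Nat.pos_of_ne_zero ht)
    refine Nat.le_of_mul_le_mul_left ?_ hmA
    calc _ = 2 * (m * t) * Nat.card (extClass K L).range := by ring
      _ ≤ _ := by rw [mul_one]; exact e9
  have e10 : Nat.card (normClass K L).range = Nat.card φ.ker := by
    refine le_antisymm e6 ?_
    rw [ht1, mul_one] at e8
    have := e8.trans h4
    refine Nat.le_of_mul_le_mul_left ((Nat.mul_le_mul_left 2 e7).trans ?_) two_pos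
    calc _ = 2 * m * Nat.card (extClass K L).range := by ring
      _ ≤ _ := this
  have e11 : Nat.card φ.range = Nat.card (normClass K L).ker := by
    rw [← e10] at e1
    refine Nat.eq_of_mul_eq_mul_right p2 ?_
    rw [mul_comm, e1, e2]
  refine ⟨fun u hu => (AddSubgroup.relIndex_eq_one.1 ht1) hu, fun c hc => ?_⟩
  have := Subgroup.eq_of_le_of_card_ge hφ e11.ge
  obtain ⟨d, hd⟩ := this.ge hc
  exact ⟨d, hd⟩

/-- In an unramified quadratic extension of a totally complex number field, an element generating
the norm of an ideal is a norm. -/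
theorem exists_norm_eq [IsTotallyComplex K] {y : 𝓞 K} (hy : y ≠ 0) (I : Ideal (𝓞 L))
    (hI : Ideal.span {y} = Ideal.relNorm (𝓞 K) I) : ∃ α : L, Algebra.norm K α = y := by
  obtain ⟨hunit, hclass⟩ := units_and_classes_norm hKL hσ H
  have hI0 : I ≠ 0 := by
    rintro rfl
    rw [map_zero, Ideal.zero_eq_bot, Ideal.span_singleton_eq_bot] at hI
    exact hy hI
  set I' : (Ideal (𝓞 L))⁰ := ⟨I, mem_nonZeroDivisors_of_ne_zero hI0⟩
  have hN : normClass K L (ClassGroup.mk0 I') = 1 := by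
    rw [normClass_mk0]
    refine (ClassGroup.mk0_eq_one_iff (idealNorm K I').2).2 ?_
    rw [coe_idealNorm, ← hI]
    exact ⟨y, rfl⟩
  obtain ⟨d, hd⟩ := hclass _ hN
  obtain ⟨J, rfl⟩ := ClassGroup.mk0_surjective d
  rw [classAut_mk0, div_eq_iff_eq_mul, ← map_mul] at hd
  obtain ⟨x, z, hx, hz, hxz⟩ := ClassGroup.mk0_eq_mk0_iff.mp hd
  have h1 := norm_associated_of_span_mul (K := K) hxz
  rw [map_mul, idealNorm_idealAut, Submonoid.coe_mul, ← mul_assoc] at h1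
  have h2 := mul_right_cancel₀ (nonZeroDivisors.coe_ne_zero _) h1
  rw [coe_idealNorm, ← hI, Ideal.span_singleton_mul_span_singleton,
    Ideal.span_singleton_eq_span_singleton] at h2
  obtain ⟨u, hu⟩ := h2
  obtain ⟨w, hw⟩ := hunit (Additive.ofMul
    (Units.map (algebraMap (𝓞 K) (𝓞 L) : 𝓞 K →* 𝓞 L) u)) (mem_ker_oneMinus_unitAut.2 (σ.commutes _))
  have hz' : (z : L) ≠ 0 := fun h => hz (RingOfIntegers.ext h)
  refine ⟨w * x / z, ?_⟩
  apply (algebraMap K L).injective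
  have hn : ∀ a : 𝓞 L, (a : L) * σ a = algebraMap K L (Algebra.intNorm (𝓞 K) (𝓞 L) a : K) :=
    fun a => (algebraMap_intNorm_eq hKL hσ a).symm
  rw [algebraMap_norm_of_finrank_two hKL hσ, map_div₀, map_mul, div_mul_div_comm,
    div_eq_iff (mul_ne_zero hz' ((map_ne_zero σ).2 hz'))]
  calc _ = (w * σ w) * (x * σ x) := by ring
    _ = algebraMap K L ((u : 𝓞 K) : K) * algebraMap K L (Algebra.intNorm (𝓞 K) (𝓞 L) x : K) := by
      rw [hw, hn]; rfl
    _ = algebraMap K L ((Algebra.intNorm (𝓞 K) (𝓞 L) x * u : 𝓞 K) : K) := by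
      rw [← map_mul, mul_comm]; rfl
    _ = _ := by rw [hu, hn, ← map_mul, mul_comm]; rfl

end UnramifiedNorm

section UnramifiedIdeals

open scoped nonZeroDivisors

open NumberField Module IsDedekindDomain

variable {K L : Type*} [Field K] [NumberField K] [Field L] [NumberField L] [Algebra K L]

theorem idealNorm_eq_one {I : (Ideal (𝓞 L))⁰} (h : idealNorm K I = 1) : I = 1 := by
  apply Subtype.ext
  have h1 : Ideal.absNorm (Ideal.relNorm (𝓞 K) (I : Ideal (𝓞 L))) = 1 := by
    rw [← coe_idealNorm, h, Submonoid.coe_one, map_one]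
  rw [Ideal.absNorm_relNorm, Ideal.absNorm_eq_one_iff] at h1
  rw [h1, Submonoid.coe_one, Ideal.one_eq_top]

theorem eq_one_of_mul_eq_one_ideal {I J : (Ideal (𝓞 L))⁰} (h : I * J = 1) : J = 1 := by
  apply Subtype.ext
  rw [Submonoid.coe_one, Ideal.one_eq_top, ← top_le_iff, ← Ideal.one_eq_top]
  have h1 : (I : Ideal (𝓞 L)) * J = 1 := congrArg Subtype.val h
  rw [← h1]
  exact Ideal.mul_le_right (I := (I : Ideal (𝓞 L)))

/-- If the residue degree is one, the residue fields agree. -/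
theorem exists_sub_mem_of_inertiaDeg_eq_one (Q : HeightOneSpectrum (𝓞 L))
    (h : Q.asIdeal.inertiaDeg (𝓞 K) = 1) (x : 𝓞 L) :
    ∃ y : 𝓞 K, x - algebraMap (𝓞 K) (𝓞 L) y ∈ Q.asIdeal := by
  have := Q.isMaximal
  have := (below K Q).isMaximal
  have : Q.asIdeal.LiesOver (below K Q).asIdeal := ⟨rfl⟩
  let := Ideal.Quotient.field (below K Q).asIdeal
  rw [Ideal.inertiaDeg_eq_of_isMaximal (below K Q).asIdeal Q.asIdeal] at h
  obtain ⟨y, hy⟩ := (Algebra.finrank_eq_one_iff_bijective_algebraMap.1 h).2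
    (Ideal.Quotient.mk Q.asIdeal x)
  obtain ⟨y, rfl⟩ := Ideal.Quotient.mk_surjective y
  refine ⟨y, ?_⟩
  rw [Ideal.Quotient.algebraMap_mk_of_liesOver] at hy
  exact Ideal.Quotient.eq.1 hy.symm

theorem exists_idealExt_below_eq (Q : HeightOneSpectrum (𝓞 L)) :
    ∃ R, idealExt K L (primeIdeal (below K Q)) = primeIdeal Q * R := by
  have : Ideal.map (algebraMap (𝓞 K) (𝓞 L)) (below K Q).asIdeal ≤ Q.asIdeal := Ideal.map_comap_le
  obtain ⟨R, hR⟩ := Ideal.dvd_iff_le.2 this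
  have hR0 : R ≠ 0 := by
    rintro rfl
    rw [mul_zero] at hR
    exact nonZeroDivisors.coe_ne_zero (idealExt K L (primeIdeal (below K Q))) hR
  exact ⟨⟨R, mem_nonZeroDivisors_of_ne_zero hR0⟩, Subtype.ext hR⟩

variable (hKL : finrank K L = 2) {σ : L ≃ₐ[K] L} (hσ : σ ≠ 1)
include hKL

theorem eq_one_of_idealNorm_mul {P : HeightOneSpectrum (𝓞 K)} {I R : (Ideal (𝓞 L))⁰} {f : ℕ}
    (h : idealExt K L (primeIdeal P) = I * R) (hf : 2 ≤ f)
    (hI : idealNorm K I = primeIdeal P ^ f) : R = 1 := by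
  have h1 := congrArg (idealNorm K) h
  rw [idealNorm_idealExt, hKL, map_mul, hI, ← Nat.add_sub_cancel' hf, pow_add, mul_assoc] at h1
  exact idealNorm_eq_one (eq_one_of_mul_eq_one_ideal (mul_left_cancel (h1.symm.trans (mul_one _).symm)))

theorem idealExt_below_of_fixed (Q : HeightOneSpectrum (𝓞 L)) {x : 𝓞 L}
    (hx : intAut σ x - x ∉ Q.asIdeal) (hQ : idealAut σ (primeIdeal Q) = primeIdeal Q) :
    idealExt K L (primeIdeal (below K Q)) = primeIdeal Q := by
  obtain ⟨R, hR⟩ := exists_idealExt_below_eq (K := K) Q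
  have hN := idealNorm_primeIdeal (K := K) Q
  have := Q.isPrime
  have hpos := Ideal.inertiaDeg_pos Q.asIdeal (𝓞 K)
  rw [hR, eq_one_of_idealNorm_mul hKL hR ?_ hN, mul_one]
  by_contra hlt
  obtain ⟨y, hy⟩ := exists_sub_mem_of_inertiaDeg_eq_one Q (K := K) (by omega) x
  have h2 : intAut σ (x - algebraMap (𝓞 K) (𝓞 L) y) ∈ Q.asIdeal := by
    have h3 := congrArg Subtype.val hQ
    rw [coe_idealAut] at h3
    change _ = Q.asIdeal at h3
    rw [← h3]
    exact Ideal.mem_map_of_mem _ hy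
  rw [map_sub, AlgEquiv.commutes] at h2
  apply hx
  convert sub_mem h2 hy using 1
  ring

theorem idealExt_below_of_not_fixed (Q : HeightOneSpectrum (𝓞 L))
    (hQ : idealAut σ (primeIdeal Q) ≠ primeIdeal Q) :
    idealExt K L (primeIdeal (below K Q)) = primeIdeal Q * idealAut σ (primeIdeal Q) := by
  obtain ⟨R, hR⟩ := exists_idealExt_below_eq (K := K) Q
  have hN := idealNorm_primeIdeal (K := K) Q
  have := Q.isPrime
  have hpos := Ideal.inertiaDeg_pos Q.asIdeal (𝓞 K)
  have hR' := congrArg (idealAut σ) hR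
  rw [idealAut_idealExt, map_mul] at hR'
  have hσQ : (idealAut σ (primeIdeal Q) : Ideal (𝓞 L)).IsPrime := by
    rw [coe_idealAut]
    exact Ideal.map_isPrime_of_equiv (intAut σ) (I := Q.asIdeal)
  have hdvd : (idealAut σ (primeIdeal Q) : Ideal (𝓞 L)) ∣ Q.asIdeal * R := by
    change _ ∣ ((primeIdeal Q * R : (Ideal (𝓞 L))⁰) : Ideal (𝓞 L))
    rw [← hR, hR']
    exact Dvd.intro _ rfl
  rcases (Ideal.prime_of_isPrime (nonZeroDivisors.coe_ne_zero _) hσQ).dvd_or_dvd hdvd with h | h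
  · exfalso
    apply hQ
    have h1 := Ideal.dvd_iff_le.1 h
    have h2 := Q.isMaximal.eq_of_le hσQ.ne_top h1
    exact Subtype.ext h2.symm
  · obtain ⟨S, hS⟩ := h
    have hS0 : S ≠ 0 := by
      rintro rfl
      rw [mul_zero] at hS
      exact nonZeroDivisors.coe_ne_zero _ hS
    have hR2 : R = idealAut σ (primeIdeal Q) * ⟨S, mem_nonZeroDivisors_of_ne_zero hS0⟩ :=
      Subtype.ext hS
    rw [hR2, ← mul_assoc] at hR
    rw [hR, eq_one_of_idealNorm_mul hKL hR (f := 2 * Q.asIdeal.inertiaDeg (𝓞 K)) (by omega)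
      (by rw [map_mul, idealNorm_idealAut, hN, two_mul, pow_add]), mul_one]

include hσ

theorem exists_idealExt_eq_of_unramified
    (hun : ∀ Q : HeightOneSpectrum (𝓞 L), ∃ x : 𝓞 L, intAut σ x - x ∉ Q.asIdeal)
    (I : (Ideal (𝓞 L))⁰) (hI : idealAut σ I = I) : ∃ J, idealExt K L J = I := by
  obtain ⟨n, hn⟩ : ∃ n, Ideal.absNorm (I : Ideal (𝓞 L)) = n := ⟨_, rfl⟩
  induction n using Nat.strong_induction_on generalizing I with
  | _ n ih =>
  by_cases h1 : (I : Ideal (𝓞 L)) = ⊤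
  · exact ⟨1, by rw [map_one]; exact Subtype.ext (by rw [h1, Submonoid.coe_one, Ideal.one_eq_top])⟩
  obtain ⟨M, hM, hIM⟩ := Ideal.exists_le_maximal _ h1
  have hM0 : M ≠ ⊥ := fun h => nonZeroDivisors.coe_ne_zero I (le_bot_iff.1 (h ▸ hIM))
  set Q : HeightOneSpectrum (𝓞 L) := ⟨M, hM.isPrime, hM0⟩
  have key : ∃ A, (I : Ideal (𝓞 L)) =
      (idealExt K L (primeIdeal (below K Q)) : Ideal (𝓞 L)) * A := by
    by_cases hQ : idealAut σ (primeIdeal Q) = primeIdeal Q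
    · obtain ⟨x, hx⟩ := hun Q
      rw [idealExt_below_of_fixed hKL Q hx hQ]
      exact Ideal.dvd_iff_le.2 hIM
    · rw [idealExt_below_of_not_fixed hKL Q hQ]
      obtain ⟨A, hA⟩ := Ideal.dvd_iff_le.2 hIM
      have hσQ : (idealAut σ (primeIdeal Q) : Ideal (𝓞 L)).IsPrime := by
        rw [coe_idealAut]
        exact Ideal.map_isPrime_of_equiv (intAut σ) (I := Q.asIdeal)
      have hd : (idealAut σ (primeIdeal Q) : Ideal (𝓞 L)) ∣ M * A := by
        rw [← hA, ← hI, coe_idealAut, coe_idealAut]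
        exact Ideal.dvd_iff_le.2 (Ideal.map_mono hIM)
      rcases (Ideal.prime_of_isPrime (nonZeroDivisors.coe_ne_zero _) hσQ).dvd_or_dvd hd with h | h
      · exact absurd (Subtype.ext (hM.eq_of_le hσQ.ne_top (Ideal.dvd_iff_le.1 h)).symm) hQ
      · obtain ⟨B, rfl⟩ := h
        exact ⟨B, by rw [hA, ← mul_assoc]; rfl⟩
  obtain ⟨A, hA⟩ := key
  have hA0 : A ≠ 0 := by
    rintro rfl
    rw [mul_zero] at hA
    exact nonZeroDivisors.coe_ne_zero _ hA
  set A' : (Ideal (𝓞 L))⁰ := ⟨A, mem_nonZeroDivisors_of_ne_zero hA0⟩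
  have hA' : I = idealExt K L (primeIdeal (below K Q)) * A' := Subtype.ext hA
  have hfix : idealAut σ A' = A' := by
    rw [hA', map_mul, idealAut_idealExt] at hI
    exact mul_left_cancel hI
  have hlt : Ideal.absNorm A < n := by
    rw [← hn, hA, map_mul]
    have p1 : Ideal.absNorm A ≠ 0 := by rwa [Ne, Ideal.absNorm_eq_zero_iff]
    have p2 : Ideal.absNorm (idealExt K L (primeIdeal (below K Q)) : Ideal (𝓞 L)) ≠ 0 := by
      rw [Ne, Ideal.absNorm_eq_zero_iff]; exact nonZeroDivisors.coe_ne_zero _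
    have p3 : Ideal.absNorm (idealExt K L (primeIdeal (below K Q)) : Ideal (𝓞 L)) ≠ 1 := by
      rw [Ne, Ideal.absNorm_eq_one_iff]
      intro h
      have : (⊤ : Ideal (𝓞 L)) ≤ M := h ▸ Ideal.map_comap_le
      exact hM.ne_top (top_le_iff.1 this)
    have p4 : 2 ≤ Ideal.absNorm (idealExt K L (primeIdeal (below K Q)) : Ideal (𝓞 L)) := by omega
    nlinarith [Nat.pos_of_ne_zero p1]
  obtain ⟨J, hJ⟩ := ih _ hlt A' hfix rfl
  exact ⟨primeIdeal (below K Q) * J, by rw [map_mul, hJ, ← hA']⟩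

end UnramifiedIdeals

section SumOfTwoSquares

open scoped nonZeroDivisors

open NumberField Module IsDedekindDomain

theorem neg_one_of_isotropic {K : Type*} [Field K] {a b c d : K}
    (h : a ^ 2 + b ^ 2 + c ^ 2 + d ^ 2 = 0) (h0 : a ≠ 0 ∨ b ≠ 0) :
    ∃ x y : K, -1 = x ^ 2 + y ^ 2 := by
  by_cases hab : a ^ 2 + b ^ 2 = 0
  · have hb : b ≠ 0 := by
      rintro rfl
      rcases h0 with h0 | h0
      · exact h0 (by simpa using hab)
      · exact h0 rfl
    refine ⟨a / b, 0, ?_⟩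
    field_simp
    linear_combination -hab
  · refine ⟨(a * c + b * d) / (a ^ 2 + b ^ 2), (a * d - b * c) / (a ^ 2 + b ^ 2), ?_⟩
    field_simp
    linear_combination -(a ^ 2 + b ^ 2) * h

theorem exists_intValuation_eq_one {K : Type*} [Field K] [NumberField K]
    (P : HeightOneSpectrum (𝓞 K)) {x : K} (hx : P.valuation K x = 1) :
    ∃ n d : 𝓞 K, n ∉ P.asIdeal ∧ d ∉ P.asIdeal ∧ x * d = n := by
  obtain ⟨n, d, h⟩ := HeightOneSpectrum.exists_primeCompl_mul_eq_of_integer P x hx.le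
  refine ⟨n, d, ?_, d.2, h⟩
  rw [← HeightOneSpectrum.valuation_eq_one_iff_notMem (K := K), ← h, map_mul, hx, one_mul,
    HeightOneSpectrum.valuation_eq_one_iff_notMem]
  exact d.2

variable {K L : Type*} [Field K] [NumberField K] [Field L] [NumberField L] [Algebra K L]

theorem span_mem_mrange_of_forall (hKL : finrank K L = 2) {z : 𝓞 K} (hz : z ≠ 0)
    (h : ∀ P : HeightOneSpectrum (𝓞 K), z ∈ P.asIdeal → IsSquare (P.valuation K z) ∨
      ∃ I : Ideal (𝓞 L), Ideal.relNorm (𝓞 K) I = P.asIdeal) :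
    ∃ I : Ideal (𝓞 L), Ideal.relNorm (𝓞 K) I = Ideal.span {z} := by
  classical
  have hz0 : Ideal.span {z} ≠ 0 := by
    rwa [Ne, Ideal.zero_eq_bot, Ideal.span_singleton_eq_bot]
  change Ideal.span {z} ∈ MonoidHom.mrange (Ideal.relNorm (S := 𝓞 L) (𝓞 K)).toMonoidHom
  rw [← Ideal.prod_normalizedFactors_eq_self hz0, Finset.prod_multiset_count]
  refine Submonoid.prod_mem _ fun p hp => ?_
  rw [Multiset.mem_toFinset] at hp
  have hpp := UniqueFactorizationMonoid.prime_of_normalized_factor _ hp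
  set P : HeightOneSpectrum (𝓞 K) := ⟨p, Ideal.isPrime_of_prime hpp, hpp.ne_zero⟩
  have hmem : z ∈ P.asIdeal := by
    have := UniqueFactorizationMonoid.dvd_of_mem_normalizedFactors hp
    rwa [Ideal.dvd_span_singleton] at this
  rcases h P hmem with hsq | ⟨I, hI⟩
  · have hev : Even ((UniqueFactorizationMonoid.normalizedFactors (Ideal.span {z})).count p) := by
      have hcount : Multiset.count p (UniqueFactorizationMonoid.normalizedFactors (Ideal.span {z}))
          = (Associates.mk P.asIdeal).count (Associates.mk (Ideal.span {z})).factors := by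
        rw [Ideal.count_associates_factors_eq hz0 P.isPrime P.ne_bot]
      rw [hcount]
      rw [HeightOneSpectrum.valuation_of_algebraMap, P.intValuation_if_neg hz] at hsq
      obtain ⟨w, hw⟩ := hsq
      have hw0 : w ≠ 0 := by
        rintro rfl
        rw [mul_zero] at hw
        exact WithZero.exp_ne_zero hw
      rw [← WithZero.exp_log hw0, ← WithZero.exp_add, WithZero.exp_inj] at hw
      have : Even (-((Associates.mk P.asIdeal).count
        (Associates.mk (Ideal.span {z})).factors : ℤ)) := ⟨_, hw⟩
      rw [even_neg, Int.even_coe_nat] at this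
      exact this
    obtain ⟨m, hm⟩ := hev
    rw [hm]
    refine ⟨(idealExt K L (primeIdeal P) : Ideal (𝓞 L)) ^ m, ?_⟩
    have h1 : Ideal.relNorm (𝓞 K) (idealExt K L (primeIdeal P) : Ideal (𝓞 L)) = p ^ 2 := by
      rw [← coe_idealNorm, idealNorm_idealExt, hKL]; rfl
    change Ideal.relNorm (𝓞 K) _ = _
    rw [map_pow, h1, ← pow_mul]
    congr 1; ring
  · exact Submonoid.pow_mem _ (MonoidHom.mem_mrange.2 ⟨I, hI⟩) _

variable (hKL : finrank K L = 2) {σ : L ≃ₐ[K] L} (hσ : σ ≠ 1) {s m : ℤ} (hm : s + 1 = 4 * m)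
  {r : 𝓞 L} (hr : r ^ 2 = -(s : 𝓞 L)) (hσr : intAut σ r = -r)
include hm hr hσr

omit hm hr hσr in
theorem one_notMem (Q : HeightOneSpectrum (𝓞 L)) : (1 : 𝓞 L) ∉ Q.asIdeal :=
  fun h => Q.isPrime.ne_top ((Ideal.eq_top_iff_one _).2 h)

theorem exists_omega : ∃ ω : 𝓞 L, intAut σ ω - ω = -r ∧ ω ^ 2 - ω + m = 0 := by
  have hr' : (r : L) ^ 2 = -(s : L) := by
    have := congrArg (fun z : 𝓞 L => (z : L)) hr
    simpa using this
  have hm' : (s : L) + 1 = 4 * m := by exact_mod_cast congrArg (Int.cast : ℤ → L) hm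
  have h2 : (2 : L) ≠ 0 := two_ne_zero
  have heq : ((1 + (r : L)) / 2) ^ 2 - (1 + (r : L)) / 2 + m = 0 := by
    field_simp
    linear_combination hr' - hm'
  have hzint : IsIntegral ℤ ((1 + (r : L)) / 2) := by
    refine ⟨Polynomial.X ^ 2 - Polynomial.X + Polynomial.C m, ?_, ?_⟩
    · monicity!
    · rw [← heq]
      simp only [Polynomial.eval₂_add, Polynomial.eval₂_sub, Polynomial.eval₂_pow,
        Polynomial.eval₂_X, Polynomial.eval₂_C]
      simp
  obtain ⟨ω, hω⟩ : ∃ ω : 𝓞 L, (ω : L) = (1 + (r : L)) / 2 := ⟨⟨_, hzint⟩, rfl⟩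
  refine ⟨ω, RingOfIntegers.ext ?_, RingOfIntegers.ext ?_⟩
  · have h3 : σ (r : L) = -r := by rw [← coe_intAut, hσr]; simp
    have h4 : ((intAut σ ω - ω : 𝓞 L) : L) = (intAut σ ω : L) - ω := by simp
    rw [h4, coe_intAut, hω, map_div₀, map_add, map_one, h3, map_ofNat]
    have h5 : ((-r : 𝓞 L) : L) = -(r : L) := by simp
    rw [h5]
    field_simp
    ring
  · have h4 : ((ω ^ 2 - ω + m : 𝓞 L) : L) = (ω : L) ^ 2 - ω + m := by simp
    rw [h4, hω, heq]; simp

theorem exists_intAut_sub_notMem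
    (hs : ∀ P : HeightOneSpectrum (𝓞 K), (s : 𝓞 K) ∈ P.asIdeal → IsSquare (P.valuation K (s : K)))
    (hs0 : s ≠ 0)
    (Q : HeightOneSpectrum (𝓞 L)) : ∃ x : 𝓞 L, intAut σ x - x ∉ Q.asIdeal := by
  have hr2 : ∀ x : 𝓞 L, x ^ 2 ∈ Q.asIdeal → x ∈ Q.asIdeal := fun x hx =>
    Q.isPrime.mem_of_pow_mem 2 hx
  have h2s : (2 : 𝓞 L) ∈ Q.asIdeal → (s : 𝓞 L) ∈ Q.asIdeal → False := by
    intro h h'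
    apply one_notMem Q
    have hc : (s : 𝓞 L) + 1 = 4 * m := by exact_mod_cast congrArg (Int.cast : ℤ → 𝓞 L) hm
    have : (1 : 𝓞 L) = 2 * (2 * m) - s := by linear_combination hc
    rw [this]
    exact sub_mem (Ideal.mul_mem_right _ _ h) h'
  by_cases hsQ : (s : 𝓞 L) ∈ Q.asIdeal
  · have hsP : (s : 𝓞 K) ∈ (below K Q).asIdeal := by
      change algebraMap (𝓞 K) (𝓞 L) _ ∈ Q.asIdeal
      rwa [map_intCast]
    obtain ⟨w, hw⟩ := hs _ hsP
    obtain ⟨β, rfl⟩ := HeightOneSpectrum.valuation_surjective (K := K) (below K Q) w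
    have hsK : (s : K) ≠ 0 := Int.cast_ne_zero.2 hs0
    have hv : (below K Q).valuation K (-(s : K) / β ^ 2) = 1 := by
      rw [map_div₀, Valuation.map_neg, hw, map_pow, pow_two]
      refine div_self ?_
      rw [← hw]
      exact (Valuation.ne_zero_iff _).2 hsK
    have hβ : β ≠ 0 := by
      rintro rfl
      rw [map_zero, mul_zero] at hw
      exact (Valuation.ne_zero_iff _).2 hsK hw
    obtain ⟨n, d, hn, hd, hnd⟩ := exists_intValuation_eq_one _ hv
    have hr' : (r : L) ^ 2 = -(s : L) := by
      have := congrArg (fun z : 𝓞 L => (z : L)) hr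
      simpa using this
    have hx2 : ((r : L) / algebraMap K L β * algebraMap K L d) ^ 2 =
        (algebraMap (𝓞 K) (𝓞 L) (n * d) : 𝓞 L) := by
      have h1 := congrArg (algebraMap K L) hnd
      have h2 : ((algebraMap (𝓞 K) (𝓞 L) (n * d) : 𝓞 L) : L) =
          algebraMap K L n * algebraMap K L d := by
        rw [← map_mul]; rfl
      rw [h2, ← h1, map_mul, map_div₀, map_neg, map_intCast, map_pow]
      have hβ' : algebraMap K L β ≠ 0 := (map_ne_zero _).2 hβ
      field_simp
      linear_combination (algebraMap K L d) ^ 2 * hr'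
    have hzint : IsIntegral ℤ ((r : L) / algebraMap K L β * algebraMap K L d) := by
      refine IsIntegral.of_pow two_pos ?_
      rw [hx2]
      exact RingOfIntegers.isIntegral_coe _
    obtain ⟨x, hx⟩ : ∃ x : 𝓞 L, (x : L) = (r : L) / algebraMap K L β * algebraMap K L d :=
      ⟨⟨_, hzint⟩, rfl⟩
    have hx2' : x ^ 2 = algebraMap (𝓞 K) (𝓞 L) (n * d) := by
      apply RingOfIntegers.ext
      rw [← hx2, ← hx]; rfl
    have hσx : intAut σ x = -x := by
      apply RingOfIntegers.ext
      have h5 : ((-x : 𝓞 L) : L) = -(x : L) := by simp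
      have h3 : σ (r : L) = -r := by rw [← coe_intAut, hσr]; simp
      rw [coe_intAut, h5, hx, map_mul, map_div₀, h3, AlgEquiv.commutes, AlgEquiv.commutes]
      ring
    refine ⟨x, fun hmem => ?_⟩
    rw [hσx] at hmem
    have hxQ : x ∉ Q.asIdeal := by
      intro h
      have h6 : x ^ 2 ∈ Q.asIdeal := Ideal.pow_mem_of_mem _ h _ two_pos
      rw [hx2'] at h6
      have h7 : n * d ∈ (below K Q).asIdeal := h6
      rcases (below K Q).isPrime.mem_or_mem h7 with h | h
      · exact hn h
      · exact hd h
    have : (2 : 𝓞 L) * x ∈ Q.asIdeal := by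
      convert neg_mem hmem using 1
      ring
    rcases Q.isPrime.mem_or_mem this with h | h
    · exact h2s h hsQ
    · exact hxQ h
  · have hrQ : r ∉ Q.asIdeal := fun h => hsQ (by
      have h6 : r ^ 2 ∈ Q.asIdeal := Ideal.pow_mem_of_mem _ h _ two_pos
      rw [hr] at h6
      simpa using neg_mem h6)
    obtain ⟨ω, h1, -⟩ := exists_omega hm hr hσr
    exact ⟨ω, by rw [h1]; exact fun h => hrQ (by simpa using neg_mem h)⟩

include hKL in
theorem exists_relNorm_eq_of_root (hodd : Odd m) {P : HeightOneSpectrum (𝓞 K)}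
    (h2 : (2 : 𝓞 K) ∈ P.asIdeal) {x : 𝓞 K} (hx : x ^ 2 + x + 1 ∈ P.asIdeal) :
    ∃ I : Ideal (𝓞 L), Ideal.relNorm (𝓞 K) I = P.asIdeal := by
  obtain ⟨ω, h1, h0⟩ := exists_omega hm hr hσr
  have := P.isMaximal
  obtain ⟨Q, hQ⟩ : ∃ Q : HeightOneSpectrum (𝓞 L), below K Q = P := by
    obtain ⟨⟨Q, hQ1, hQ2⟩⟩ := (inferInstance : Nonempty (P.asIdeal.primesOver (𝓞 L)))
    exact ⟨⟨Q, hQ1, Ideal.ne_bot_of_liesOver_of_ne_bot P.ne_bot Q⟩,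
      HeightOneSpectrum.ext hQ2.over.symm⟩
  have h2Q : (2 : 𝓞 L) ∈ Q.asIdeal := by
    rw [← hQ] at h2
    change algebraMap (𝓞 K) (𝓞 L) _ ∈ Q.asIdeal at h2
    rwa [map_ofNat] at h2
  have hxQ : (algebraMap (𝓞 K) (𝓞 L) x) ^ 2 + algebraMap (𝓞 K) (𝓞 L) x + 1 ∈ Q.asIdeal := by
    rw [← hQ] at hx
    change algebraMap (𝓞 K) (𝓞 L) _ ∈ Q.asIdeal at hx
    rwa [map_add, map_add, map_pow, map_one] at hx
  obtain ⟨j, hj⟩ := hodd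
  set y := algebraMap (𝓞 K) (𝓞 L) x with hy
  have hmj : (m : 𝓞 L) = 2 * j + 1 := by rw [hj]; push_cast; ring
  have hsm : (s : 𝓞 L) + 1 = 4 * m := by exact_mod_cast congrArg (Int.cast : ℤ → 𝓞 L) hm
  have hrQ : r ∉ Q.asIdeal := by
    intro h
    apply one_notMem Q
    have h6 : r ^ 2 ∈ Q.asIdeal := Ideal.pow_mem_of_mem _ h _ two_pos
    rw [hr] at h6
    have : (1 : 𝓞 L) = 2 * (2 * m) + (-(s : 𝓞 L)) := by linear_combination hsm
    rw [this]
    exact add_mem (Ideal.mul_mem_right _ _ h2Q) h6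
  have hσω : intAut σ ω = ω - r := by linear_combination h1
  have hne : idealAut σ (primeIdeal Q) ≠ primeIdeal Q := by
    intro hfix
    have hstable : ∀ z ∈ Q.asIdeal, intAut σ z ∈ Q.asIdeal := by
      intro z hz
      have h3 := congrArg Subtype.val hfix
      rw [coe_idealAut] at h3
      change _ = Q.asIdeal at h3
      rw [← h3]
      exact Ideal.mem_map_of_mem _ hz
    have hσσ : ∀ z, z - ω ∈ Q.asIdeal → intAut σ z = z → False := by
      intro z hz hzz
      apply hrQ
      have h4 := hstable _ hz
      rw [map_sub, hzz, hσω] at h4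
      convert sub_mem h4 hz using 1
      ring
    have hprod : (y - ω) * ((1 - y) - ω) ∈ Q.asIdeal := by
      have : (y - ω) * ((1 - y) - ω) = 2 * (-j + y - ω) - (y ^ 2 + y + 1) + (2 * ω) := by
        rw [hmj] at h0
        linear_combination h0
      rw [this]
      exact add_mem (sub_mem (Ideal.mul_mem_right _ _ h2Q) hxQ) (Ideal.mul_mem_right _ _ h2Q)
    rcases Q.isPrime.mem_or_mem hprod with h | h
    · exact hσσ _ h (by rw [hy, AlgEquiv.commutes])
    · exact hσσ _ h (by rw [map_sub, map_one, hy, AlgEquiv.commutes])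
  have h7 := congrArg (idealNorm K) (idealExt_below_of_not_fixed hKL Q hne)
  rw [idealNorm_idealExt, hKL, map_mul, idealNorm_idealAut, ← pow_two, hQ] at h7
  have h8 : P.asIdeal ^ 2 = (idealNorm K (primeIdeal Q) : Ideal (𝓞 K)) ^ 2 := congrArg Subtype.val h7
  exact ⟨Q.asIdeal, (pow_left_injective two_ne_zero h8).symm⟩

omit hm hr hσr in
theorem neg_one_of_quadratic [IsTotallyComplex K] {c : ℤ} (hc : Odd c) {L : Type*} [Field L] [NumberField L]
    [Algebra K L] (hKL : finrank K L = 2) {r : L} (hr : r ^ 2 = -((c ^ 2 + 2 : ℤ) : L))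
    (hns : ¬ IsSquare (-((c ^ 2 + 2 : ℤ) : K)))
    (hs : ∀ P : HeightOneSpectrum (𝓞 K), ((c ^ 2 + 2 : ℤ) : 𝓞 K) ∈ P.asIdeal →
      IsSquare (P.valuation K ((c ^ 2 + 2 : ℤ) : K)))
    (h2 : ∀ P : HeightOneSpectrum (𝓞 K), (2 : 𝓞 K) ∈ P.asIdeal →
      IsSquare (P.valuation K (2 : K)) ∨ ∃ x : 𝓞 K, x ^ 2 + x + 1 ∈ P.asIdeal) :
    ∃ x y : K, -1 = x ^ 2 + y ^ 2 := by
  have : Algebra.IsQuadraticExtension K L := ⟨hKL⟩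
  have : IsGalois K L := ⟨⟩
  obtain ⟨σ, hσ⟩ : ∃ σ : L ≃ₐ[K] L, σ ≠ 1 := by
    have hcard := IsGalois.card_aut_eq_finrank K L
    rw [hKL] at hcard
    have : Nontrivial (L ≃ₐ[K] L) := Finite.one_lt_card_iff_nontrivial.1 (by rw [hcard]; norm_num)
    exact exists_ne 1
  have hzint : IsIntegral ℤ r := by
    refine IsIntegral.of_pow two_pos ?_
    rw [hr]
    exact (isIntegral_algebraMap (R := ℤ) (x := c ^ 2 + 2)).neg
  obtain ⟨r', hr'⟩ : ∃ r' : 𝓞 L, (r' : L) = r := ⟨⟨_, hzint⟩, rfl⟩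
  have hrr : r' ^ 2 = -((c ^ 2 + 2 : ℤ) : 𝓞 L) := by
    apply RingOfIntegers.ext
    have : ((r' ^ 2 : 𝓞 L) : L) = (r' : L) ^ 2 := by simp
    rw [this, hr', hr]
    have h4 : ((-((c ^ 2 + 2 : ℤ) : 𝓞 L) : 𝓞 L) : L) = -(((c ^ 2 + 2 : ℤ) : 𝓞 L) : L) := map_neg _ _
    rw [h4]
    exact congrArg _ (map_intCast (algebraMap (𝓞 L) L) _).symm
  have hσr : intAut σ r' = -r' := by
    apply RingOfIntegers.ext
    have : ((-r' : 𝓞 L) : L) = -(r' : L) := by simp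
    rw [coe_intAut, this, hr']
    have h1 : (σ r) ^ 2 = r ^ 2 := by rw [← map_pow, hr, map_neg, map_intCast]
    rcases sq_eq_sq_iff_eq_or_eq_neg.1 h1 with h | h
    · exfalso
      obtain ⟨x, hx⟩ := mem_range_of_fixed hKL hσ h
      apply hns
      refine ⟨x, (algebraMap K L).injective ?_⟩
      rw [map_mul, hx, ← pow_two, hr, map_neg, map_intCast]
    · exact h
  obtain ⟨j, hj⟩ := hc
  obtain ⟨i, hi⟩ : Even (j * (j + 1)) := Int.even_mul_succ_self j
  have hm : c ^ 2 + 2 + 1 = 4 * (2 * i + 1) := by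
    rw [hj]; linear_combination 4 * hi
  have hodd : Odd (2 * i + 1) := ⟨i, rfl⟩
  obtain ⟨I, hI⟩ := span_mem_mrange_of_forall (L := L) hKL (z := (2 : 𝓞 K)) two_ne_zero (fun P hP => by
    rcases h2 P hP with h | ⟨x, hx⟩
    · left
      have h4 : ((2 : 𝓞 K) : K) = 2 := map_ofNat (algebraMap (𝓞 K) K) 2
      rwa [h4]
    · exact Or.inr (exists_relNorm_eq_of_root hKL hm hrr hσr hodd hP hx))
  have H := exists_idealExt_eq_of_unramified hKL hσ
    (exists_intAut_sub_notMem hm hrr hσr hs (by positivity))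
  obtain ⟨α, hα⟩ := exists_norm_eq hKL hσ H (y := (-2 : 𝓞 K)) (neg_ne_zero.2 two_ne_zero) I
    (by rw [hI, Ideal.span_singleton_neg])
  have hr0 : r ≠ 0 := by
    rintro rfl
    have : (0 : L) = ((-(c ^ 2 + 2) : ℤ) : L) := by rw [Int.cast_neg, ← hr]; simp
    have h3 := Int.cast_eq_zero.1 this.symm
    nlinarith [sq_nonneg c]
  have hσr' : σ r = -r := by
    have := congrArg (fun z : 𝓞 L => (z : L)) hσr
    simp only [coe_intAut, hr'] at this
    rw [this]
    simp [hr']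
  obtain ⟨x, hx⟩ := mem_range_of_fixed hKL hσ (x := (α + σ α) / 2) (by
    rw [map_div₀, map_add, involutive_of_finrank_two hKL hσ, map_ofNat, add_comm])
  obtain ⟨y, hy⟩ := mem_range_of_fixed hKL hσ (x := (α - σ α) / (2 * r)) (by
    rw [map_div₀, map_sub, involutive_of_finrank_two hKL hσ, map_mul, map_ofNat, hσr']
    field_simp
    ring)
  have hxy : x ^ 2 + (c ^ 2 + 2) * y ^ 2 = -2 := by
    apply (algebraMap K L).injective
    have h4 : ((-2 : 𝓞 K) : K) = -2 :=
      (map_neg (algebraMap (𝓞 K) K) 2).trans (congrArg _ (map_ofNat (algebraMap (𝓞 K) K) 2))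
    rw [← h4, ← hα, algebraMap_norm_of_finrank_two hKL hσ]
    simp only [map_add, map_mul, map_pow, map_intCast, hx, hy, map_ofNat]
    have hr2 : r ^ 2 = -((c : L) ^ 2 + 2) := by rw [hr]; push_cast; ring
    have : ((c : L) ^ 2 + 2) = - r ^ 2 := by rw [hr2, neg_neg]
    rw [this]
    field_simp
    ring
  refine neg_one_of_isotropic (a := y + 1) (b := y - 1) (c := c * y) (d := x)
    (by linear_combination hxy) ?_
  by_contra hcon
  push Not at hcon
  have : (2 : K) = 0 := by linear_combination hcon.1 - hcon.2
  exact two_ne_zero this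

omit hm hr hσr in
/-- A local criterion for `-1` to be a sum of two squares. -/
theorem neg_one_of_local [IsTotallyComplex K] {c : ℤ} (hc : Odd c)
    (hs : ∀ P : HeightOneSpectrum (𝓞 K), ((c ^ 2 + 2 : ℤ) : 𝓞 K) ∈ P.asIdeal →
      IsSquare (P.valuation K ((c ^ 2 + 2 : ℤ) : K)))
    (h2 : ∀ P : HeightOneSpectrum (𝓞 K), (2 : 𝓞 K) ∈ P.asIdeal →
      IsSquare (P.valuation K (2 : K)) ∨ ∃ x : 𝓞 K, x ^ 2 + x + 1 ∈ P.asIdeal) :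
    ∃ x y : K, -1 = x ^ 2 + y ^ 2 := by
  by_cases hsq : IsSquare (-((c ^ 2 + 2 : ℤ) : K))
  · obtain ⟨r, hr⟩ := hsq
    refine neg_one_of_isotropic (a := 1) (b := 1) (c := c) (d := r) ?_ (Or.inl one_ne_zero)
    push_cast at hr
    linear_combination -hr
  · set f : Polynomial K := Polynomial.X ^ 2 - Polynomial.C (-((c ^ 2 + 2 : ℤ) : K)) with hf
    have hdeg : f.natDegree = 2 := Polynomial.natDegree_X_pow_sub_C
    have hirr : Irreducible f := by
      refine (Polynomial.irreducible_iff_roots_eq_zero_of_degree_le_three (by rw [hdeg])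
        (by rw [hdeg]; norm_num)).2 ?_
      refine Multiset.eq_zero_of_forall_notMem fun a ha => hsq ⟨a, ?_⟩
      have := (Polynomial.mem_roots'.1 ha).2
      simp only [hf, Polynomial.IsRoot.def, Polynomial.eval_sub, Polynomial.eval_pow,
        Polynomial.eval_X, Polynomial.eval_C] at this
      linear_combination -this
    have : Fact (Irreducible f) := ⟨hirr⟩
    have : Module.Finite K (AdjoinRoot f) := (AdjoinRoot.powerBasis hirr.ne_zero).finite
    have : CharZero (AdjoinRoot f) := charZero_of_injective_algebraMap (algebraMap K _).injective
    have : NumberField (AdjoinRoot f) :=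
      { to_finiteDimensional := Module.Finite.trans K _ }
    refine neg_one_of_quadratic hc (L := AdjoinRoot f) ?_ (r := AdjoinRoot.root f) ?_ hsq hs h2
    · rw [(AdjoinRoot.powerBasis hirr.ne_zero).finrank, AdjoinRoot.powerBasis_dim, hdeg]
    · have := AdjoinRoot.eval₂_root f
      rw [hf, Polynomial.eval₂_sub, Polynomial.eval₂_pow, Polynomial.eval₂_X,
        Polynomial.eval₂_C] at this
      rw [← map_intCast (AdjoinRoot.of f), ← map_neg]
      exact sub_eq_zero.1 this

end SumOfTwoSquares

section SumsOfSquares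

open Polynomial

/-- Being a sum of four squares. -/
def IsSumFour {R : Type*} [CommRing R] (x : R) : Prop :=
  ∃ a b c d : R, x = a ^ 2 + b ^ 2 + c ^ 2 + d ^ 2

theorem IsSumFour.mul {R : Type*} [CommRing R] {x y : R} (hx : IsSumFour x) (hy : IsSumFour y) :
    IsSumFour (x * y) := by
  obtain ⟨a, b, c, d, rfl⟩ := hx
  obtain ⟨x, y, z, w, rfl⟩ := hy
  exact ⟨a * x - b * y - c * z - d * w, a * y + b * x + c * w - d * z,
    a * z - b * w + c * x + d * y, a * w + b * z - c * y + d * x, by ring⟩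

theorem isSumFour_sq {R : Type*} [CommRing R] (x : R) : IsSumFour (x ^ 2) :=
  ⟨x, 0, 0, 0, by ring⟩

theorem IsSumFour.map {R S : Type*} [CommRing R] [CommRing S] (f : R →+* S) {x : R}
    (hx : IsSumFour x) : IsSumFour (f x) := by
  obtain ⟨a, b, c, d, rfl⟩ := hx
  exact ⟨f a, f b, f c, f d, by simp⟩

theorem IsSumFour.of_mul {F : Type*} [Field F] {x y : F} (hxy : IsSumFour (x * y))
    (hy : IsSumFour y) (h0 : y ≠ 0) : IsSumFour x := by
  have : x = x * y * y * (y⁻¹) ^ 2 := by field_simp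
  rw [this]
  exact (hxy.mul hy).mul (isSumFour_sq _)

variable {k : Type*} [Field k] (σ : k →+* ℝ)

include σ in
theorem eq_zero_of_sum_sq {n : ℕ} {a : Fin n → k} (h : ∑ i, a i ^ 2 = 0) (i : Fin n) : a i = 0 := by
  have h1 : ∑ i, (σ (a i)) ^ 2 = 0 := by
    rw [← map_zero σ, ← h, map_sum]
    exact Finset.sum_congr rfl fun i _ => (map_pow _ _ _).symm
  rw [Finset.sum_eq_zero_iff_of_nonneg fun i _ => sq_nonneg _] at h1
  have := h1 i (Finset.mem_univ _)
  exact (map_eq_zero σ).1 (pow_eq_zero_iff two_ne_zero |>.1 this)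

include σ in
/-- The degree and the leading coefficient of a sum of squares. -/
theorem leadingCoeff_sum_sq {n : ℕ} (A : Fin n → k[X]) (hA : ∃ i, A i ≠ 0) :
    ∃ i, A i ≠ 0 ∧ (∀ j, (A j).natDegree ≤ (A i).natDegree) ∧
      (∑ j, A j ^ 2).natDegree = 2 * (A i).natDegree ∧ ∑ j, A j ^ 2 ≠ 0 ∧
      (∑ j, A j ^ 2).leadingCoeff = ∑ j, (A j).coeff (A i).natDegree ^ 2 := by
  classical
  obtain ⟨i₀, hi₀⟩ := hA
  obtain ⟨i, hi, hmax⟩ := Finset.exists_max_image (Finset.univ.filter fun i => A i ≠ 0)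
    (fun i => (A i).natDegree) ⟨i₀, by simpa using hi₀⟩
  rw [Finset.mem_filter] at hi
  have hle : ∀ j, (A j).natDegree ≤ (A i).natDegree := by
    intro j
    by_cases hj : A j = 0
    · simp [hj]
    · exact hmax j (by simpa using hj)
  have hcoeff : (∑ j, A j ^ 2).coeff (2 * (A i).natDegree) =
      ∑ j, (A j).coeff (A i).natDegree ^ 2 := by
    rw [finsetSum_coeff]
    exact Finset.sum_congr rfl fun j _ => coeff_pow_of_natDegree_le (hle j)
  have hne : ∑ j, (A j).coeff (A i).natDegree ^ 2 ≠ 0 := fun h =>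
    hi.2 (leadingCoeff_eq_zero.1 (eq_zero_of_sum_sq σ h i))
  have hdeg : (∑ j, A j ^ 2).natDegree = 2 * (A i).natDegree := by
    refine le_antisymm ?_ (le_natDegree_of_ne_zero (by rwa [hcoeff]))
    refine natDegree_sum_le_of_forall_le _ _ fun j _ => ?_
    exact natDegree_pow_le.trans (Nat.mul_le_mul_left 2 (hle j))
  refine ⟨i, hi.2, hle, hdeg, ?_, ?_⟩
  · intro h
    rw [h, coeff_zero] at hcoeff
    exact hne hcoeff.symm
  · rw [leadingCoeff, hdeg, hcoeff]

include σ in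
/-- The Cassels–Pfister theorem for sums of squares. -/
theorem cassels_pfister {n : ℕ} {f : k[X]} {g : k[X]} (hg : g ≠ 0) {A : Fin n → k[X]}
    (h : g ^ 2 * f = ∑ i, A i ^ 2) : ∃ B : Fin n → k[X], f = ∑ i, B i ^ 2 := by
  obtain ⟨d, hd⟩ : ∃ d, g.natDegree = d := ⟨_, rfl⟩
  induction d using Nat.strong_induction_on generalizing g A with
  | _ d ih =>
  by_cases hR : ∀ i, A i % g = 0
  · refine ⟨fun i => A i / g, mul_left_cancel₀ (pow_ne_zero 2 hg) ?_⟩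
    rw [h, Finset.mul_sum]
    refine Finset.sum_congr rfl fun i _ => ?_
    have := EuclideanDomain.div_add_mod (A i) g
    rw [hR, add_zero] at this
    rw [← mul_pow, this]
  push Not at hR
  obtain ⟨i, hi, hmax, hdeg, hne, -⟩ := leadingCoeff_sum_sq σ (fun i => A i % g) hR
  set Q : Fin n → k[X] := fun i => A i / g
  have hR' : ∀ j, A j % g = A j - g * Q j := fun j =>
    eq_sub_of_add_eq' (EuclideanDomain.div_add_mod (A j) g)
  set S := ∑ j, A j * Q j
  set T := ∑ j, Q j ^ 2
  set a := T - f
  set b := 2 * (g * f - S)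
  have hgg : (a * g + b) * g = ∑ j, (A j % g) ^ 2 := by
    have : ∑ j, (A j % g) ^ 2 = (∑ j, A j ^ 2) - 2 * g * S + g ^ 2 * T := by
      rw [Finset.mul_sum, Finset.mul_sum, ← Finset.sum_sub_distrib, ← Finset.sum_add_distrib]
      exact Finset.sum_congr rfl fun j _ => by rw [hR']; ring
    rw [this, ← h]
    ring
  have hg' : a * g + b ≠ 0 := by
    intro h0
    rw [h0, zero_mul] at hgg
    exact hne hgg.symm
  refine ih _ ?_ hg' (A := fun j => a * A j + b * Q j) ?_ rfl
  · have h1 := congrArg natDegree hgg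
    rw [natDegree_mul hg' hg, hdeg] at h1
    have h2 : (A i % g).natDegree < g.natDegree :=
      natDegree_lt_natDegree hi (EuclideanDomain.mod_lt (A i) hg)
    omega
  · have : ∑ j, (a * A j + b * Q j) ^ 2 = a ^ 2 * (∑ j, A j ^ 2) + 2 * a * b * S + b ^ 2 * T := by
      rw [Finset.mul_sum, Finset.mul_sum, Finset.mul_sum, ← Finset.sum_add_distrib,
        ← Finset.sum_add_distrib]
      exact Finset.sum_congr rfl fun j _ => by ring
    rw [this, ← h]
    ring

/-- Being a sum of four squares in the fraction field. -/
def IsRatSumFour (p : k[X]) : Prop := ∃ g : k[X], g ≠ 0 ∧ IsSumFour (g ^ 2 * p)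

theorem IsSumFour.isRatSumFour {p : k[X]} (hp : IsSumFour p) : IsRatSumFour p :=
  ⟨1, one_ne_zero, by simpa using hp⟩

theorem IsRatSumFour.mul {p q : k[X]} (hp : IsRatSumFour p) (hq : IsRatSumFour q) :
    IsRatSumFour (p * q) := by
  obtain ⟨g, hg, hgp⟩ := hp
  obtain ⟨h, hh, hhq⟩ := hq
  refine ⟨g * h, mul_ne_zero hg hh, ?_⟩
  convert hgp.mul hhq using 1
  ring

theorem IsRatSumFour.of_mul {p q : k[X]} (hpq : IsRatSumFour (p * q)) (hq : IsRatSumFour q)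
    (h0 : q ≠ 0) : IsRatSumFour p := by
  obtain ⟨g, hg, hgp⟩ := hpq.mul hq
  refine ⟨g * q, mul_ne_zero hg h0, ?_⟩
  convert hgp using 1
  ring

include σ in
theorem IsRatSumFour.isSumFour {p : k[X]} (hp : IsRatSumFour p) : IsSumFour p := by
  obtain ⟨g, hg, a, b, c, d, h⟩ := hp
  obtain ⟨B, hB⟩ := cassels_pfister σ hg (A := ![a, b, c, d]) (by
    rw [h, Fin.sum_univ_four]; rfl)
  exact ⟨B 0, B 1, B 2, B 3, by rw [hB, Fin.sum_univ_four]⟩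

theorem isRatSumFour_of_factors (p : k[X]) (h0 : p ≠ 0) (hl : IsSumFour p.leadingCoeff)
    (h : ∀ q : k[X], q.Monic → Irreducible q → q ∣ p → IsRatSumFour q) : IsRatSumFour p := by
  obtain ⟨d, hd⟩ : ∃ d, p.natDegree = d := ⟨_, rfl⟩
  induction d using Nat.strong_induction_on generalizing p with
  | _ d ih =>
  by_cases hu : IsUnit p
  · obtain ⟨c, hc, rfl⟩ := isUnit_iff.1 hu
    rw [leadingCoeff_C] at hl
    exact (hl.map C).isRatSumFour
  · obtain ⟨q, hqm, hq, r, rfl⟩ := exists_monic_irreducible_factor p hu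
    have hr0 : r ≠ 0 := right_ne_zero_of_mul h0
    rw [leadingCoeff_mul, hqm.leadingCoeff, one_mul] at hl
    refine (h q hqm hq (dvd_mul_right _ _)).mul (ih _ ?_ r hr0 hl (fun s hs1 hs2 hs3 =>
      h s hs1 hs2 (hs3.trans (dvd_mul_left _ _))) rfl)
    rw [← hd, natDegree_mul hq.ne_zero hr0]
    have := hq.natDegree_pos
    omega

/-- `-1` is a sum of two squares modulo `p`. -/
def Splits (p : k[X]) : Prop := ∃ a b : k[X], p ∣ 1 + a ^ 2 + b ^ 2

include σ in
theorem Splits.isRatSumFour {p : k[X]} (hm : p.Monic) (hp : Irreducible p) (hs : Splits p) :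
    IsRatSumFour p := by
  obtain ⟨d, hd⟩ : ∃ d, p.natDegree = d := ⟨_, rfl⟩
  induction d using Nat.strong_induction_on generalizing p with
  | _ d ih =>
  obtain ⟨a₀, b₀, h₀⟩ := hs
  have hab : p ∣ 1 + (a₀ % p) ^ 2 + (b₀ % p) ^ 2 := by
    have h1 : a₀ % p = a₀ - p * (a₀ / p) :=
      eq_sub_of_add_eq' (EuclideanDomain.div_add_mod a₀ p)
    have h2 : b₀ % p = b₀ - p * (b₀ / p) :=
      eq_sub_of_add_eq' (EuclideanDomain.div_add_mod b₀ p)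
    rw [h1, h2]
    have : 1 + (a₀ - p * (a₀ / p)) ^ 2 + (b₀ - p * (b₀ / p)) ^ 2 = 1 + a₀ ^ 2 + b₀ ^ 2 +
        p * (p * (a₀ / p) ^ 2 - 2 * a₀ * (a₀ / p) + p * (b₀ / p) ^ 2 - 2 * b₀ * (b₀ / p)) := by ring
    rw [this]
    exact dvd_add h₀ (dvd_mul_right _ _)
  have ha : (a₀ % p).natDegree < p.natDegree := natDegree_mod_lt a₀ hp.natDegree_pos.ne'
  have hb : (b₀ % p).natDegree < p.natDegree := natDegree_mod_lt b₀ hp.natDegree_pos.ne'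
  set a := a₀ % p
  set b := b₀ % p
  obtain ⟨q, hq⟩ := hab
  obtain ⟨i, hi, hmax, hdeg, hne, hl⟩ := leadingCoeff_sum_sq σ ![1, a, b, 0] ⟨0, one_ne_zero⟩
  have hsum : ∑ j, ![1, a, b, 0] j ^ 2 = p * q := by
    rw [← hq, Fin.sum_univ_four]; simp
  rw [hsum] at hdeg hne hl
  have hq0 := right_ne_zero_of_mul hne
  have hlt : ∀ j, (![1, a, b, 0] j).natDegree < p.natDegree := by
    intro j
    fin_cases j
    · simpa using hp.natDegree_pos
    · exact ha
    · exact hb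
    · simpa using hp.natDegree_pos
  have hpq : IsRatSumFour (p * q) := by
    refine IsSumFour.isRatSumFour ⟨1, a, b, 0, ?_⟩
    rw [← hq]; ring
  refine hpq.of_mul (isRatSumFour_of_factors q hq0 ?_ fun r hrm hr hrq => ?_) hq0
  · rw [leadingCoeff_mul, hm.leadingCoeff, one_mul] at hl
    rw [hl, Fin.sum_univ_four]
    exact ⟨_, _, _, _, rfl⟩
  · refine ih _ ?_ hrm hr ⟨a, b, hq ▸ hrq.trans (dvd_mul_left _ _)⟩ rfl
    have h1 := natDegree_le_of_dvd hrq hq0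
    rw [natDegree_mul hp.ne_zero hq0] at hdeg
    have := hlt i
    omega

theorem splits_of_adjoinRoot {p : k[X]}
    (h : ∃ x y : AdjoinRoot p, -1 = x ^ 2 + y ^ 2) : Splits p := by
  obtain ⟨x, y, h⟩ := h
  obtain ⟨a, rfl⟩ := AdjoinRoot.mk_surjective x
  obtain ⟨b, rfl⟩ := AdjoinRoot.mk_surjective y
  refine ⟨a, b, AdjoinRoot.mk_eq_zero.1 ?_⟩
  rw [map_add, map_add, map_pow, map_pow, map_one]
  linear_combination -h

end SumsOfSquares

section Valued

open Polynomial

variable {K Γ : Type*} [Field K] [LinearOrderedCommGroupWithZero Γ] (w : Valuation K Γ)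

theorem valuation_eval_le {p : K[X]} {θ : K} {B : Γ} (hθ : w θ ≤ 1)
    (h : ∀ i, w (p.coeff i) ≤ B) : w (p.eval θ) ≤ B := by
  rw [eval_eq_sum_range]
  refine w.map_sum_le fun i _ => ?_
  rw [map_mul, map_pow]
  exact (mul_le_mul' (h i) (pow_le_one' hθ i)).trans_eq (mul_one B)

theorem valuation_eval_lt {p : K[X]} {θ : K} {B : Γ} (hB : B ≠ 0) (hθ : w θ ≤ 1)
    (h : ∀ i, w (p.coeff i) < B) : w (p.eval θ) < B := by
  rw [eval_eq_sum_range]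
  refine w.map_sum_lt hB fun i _ => ?_
  rw [map_mul, map_pow]
  exact (mul_le_mul' le_rfl (pow_le_one' hθ i)).trans_lt (by rw [mul_one]; exact h i)

theorem valuation_eval_le_pow {p : K[X]} {θ : K} {B : Γ} {n : ℕ} (hθ : 1 ≤ w θ)
    (hn : p.natDegree ≤ n) (h : ∀ i, w (p.coeff i) ≤ B) : w (p.eval θ) ≤ B * w θ ^ n := by
  rw [eval_eq_sum_range]
  refine w.map_sum_le fun i hi => ?_
  rw [map_mul, map_pow]
  exact mul_le_mul' (h i) (pow_le_pow_right' hθ ((Finset.mem_range_succ_iff.1 hi).trans hn))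

theorem valuation_eval_eq_pow {p : K[X]} {θ : K} {n : ℕ} (hθ : 1 < w θ)
    (hn : p.natDegree ≤ n) (h : ∀ i, w (p.coeff i) ≤ 1) (h1 : w (p.coeff n) = 1) :
    w (p.eval θ) = w θ ^ n := by
  have h0 : w θ ≠ 0 := (zero_lt_one.trans hθ).ne'
  rw [eval_eq_sum_range' (Nat.lt_succ_of_le hn), Finset.sum_range_succ]
  have hl : w (p.coeff n * θ ^ n) = w θ ^ n := by rw [map_mul, map_pow, h1, one_mul]
  rw [w.map_add_eq_of_lt_right, hl]
  rw [hl]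
  refine w.map_sum_lt (pow_ne_zero _ h0) fun i hi => ?_
  rw [map_mul, map_pow]
  refine (mul_le_mul' (h i) le_rfl).trans_lt ?_
  rw [one_mul]
  exact pow_lt_pow_right₀ hθ (Finset.mem_range.1 hi)

theorem valuation_coeff_mul_le {p q : K[X]} {A B : Γ} (hp : ∀ i, w (p.coeff i) ≤ A)
    (hq : ∀ i, w (q.coeff i) ≤ B) (i : ℕ) : w ((p * q).coeff i) ≤ A * B := by
  rw [coeff_mul]
  refine w.map_sum_le fun x _ => ?_
  rw [map_mul]
  exact mul_le_mul' (hp _) (hq _)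

theorem valuation_coeff_one_le (i : ℕ) : w ((1 : K[X]).coeff i) ≤ 1 := by
  rw [coeff_one]
  split_ifs <;> simp

theorem valuation_coeff_pow_le {p : K[X]} (hp : ∀ i, w (p.coeff i) ≤ 1) (n i : ℕ) :
    w ((p ^ n).coeff i) ≤ 1 := by
  induction n generalizing i with
  | zero => rw [pow_zero]; exact valuation_coeff_one_le w i
  | succ n ih =>
    rw [pow_succ]
    exact (valuation_coeff_mul_le w ih hp i).trans_eq (one_mul 1)

theorem valuation_coeff_add_le {p q : K[X]} {B : Γ} (hp : ∀ i, w (p.coeff i) ≤ B)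
    (hq : ∀ i, w (q.coeff i) ≤ B) (i : ℕ) : w ((p + q).coeff i) ≤ B := by
  rw [coeff_add]
  exact w.map_add_le (hp i) (hq i)

theorem exists_valuation_coeff_le (p : K[X]) : ∃ B : Γ, 1 ≤ B ∧ ∀ i, w (p.coeff i) ≤ B := by
  induction p using Polynomial.induction_on' with
  | add p q hp hq =>
    obtain ⟨A, hA, hA'⟩ := hp
    obtain ⟨B, hB, hB'⟩ := hq
    exact ⟨max A B, hA.trans (le_max_left _ _), valuation_coeff_add_le w
      (fun i => (hA' i).trans (le_max_left _ _)) fun i => (hB' i).trans (le_max_right _ _)⟩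
  | monomial n a =>
    refine ⟨max 1 (w a), le_max_left _ _, fun i => ?_⟩
    rw [coeff_monomial]
    split_ifs <;> simp

theorem isSquare_pow_of_not_isSquare {Γ : Type*} [LinearOrderedCommGroupWithZero Γ] {a : Γ} {e : ℕ}
    (ha : ¬ IsSquare a) (h : IsSquare (a ^ e)) (b : Γ) : IsSquare (b ^ e) := by
  rcases Nat.even_or_odd e with he | ⟨m, rfl⟩
  · exact he.isSquare_pow b
  · have ha0 : a ≠ 0 := by rintro rfl; exact ha (IsSquare.zero)
    obtain ⟨r, hr⟩ := h
    refine absurd ⟨r / a ^ m, ?_⟩ ha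
    rw [div_mul_div_comm, ← hr, ← pow_add, eq_div_iff (pow_ne_zero _ ha0), ← pow_succ']
    ring_nf

end Valued

section Local

open Polynomial NumberField IsDedekindDomain

universe u

variable {k : Type u} [Field k] [NumberField k] (v : HeightOneSpectrum (𝓞 k)) (f : k[X])

/-- At every place above `v` of a field in which `f` and `g ^ 2` take the same value at some point,
either all elements of `k` have even valuation, or the place is dyadic with a cube root of unity
in the residue field. -/
def LocallyEven (g : k[X]) : Prop :=
  ∀ (K : Type u) [Field K] [NumberField K] [Algebra k K] (θ : K),
    aeval θ f = aeval θ g ^ 2 → ∀ w : HeightOneSpectrum (𝓞 K), w.asIdeal.LiesOver v.asIdeal →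
      (∀ x : k, IsSquare (w.valuation K (algebraMap k K x))) ∨
        ((2 : 𝓞 K) ∈ w.asIdeal ∧ ∃ y : 𝓞 K, y ^ 2 + y + 1 ∈ w.asIdeal)

theorem exists_valuation_eq_pow {K : Type*} [Field K] [NumberField K] [Algebra k K]
    (w : HeightOneSpectrum (𝓞 K)) (hw : w.asIdeal.LiesOver v.asIdeal) :
    ∃ e : ℕ, e ≠ 0 ∧ ∀ x : k, w.valuation K (algebraMap k K x) = v.valuation k x ^ e :=
  ⟨_, Ideal.IsDedekindDomain.ramificationIdx'_ne_zero_of_liesOver w.asIdeal v.ne_bot,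
    fun x => (HeightOneSpectrum.valuation_liesOver K v w x).symm⟩

variable {v} in
theorem not_isSquare_uniformizer {x : k} (hx : v.valuation k x = WithZero.exp (-1 : ℤ)) :
    ¬ IsSquare (v.valuation k x) := by
  rintro ⟨r, hr⟩
  rw [hx] at hr
  have hr0 : r ≠ 0 := by rintro rfl; simp at hr
  rw [← WithZero.exp_log hr0, ← WithZero.exp_add, WithZero.exp_inj] at hr
  omega

variable {v f} in
theorem exists_locallyEven_of_factor {n m : ℕ} (hf : f.natDegree ≤ 2 * n) {P q z : k[X]} {y : k}
    (hP : P.Monic) (hPi : ∀ i, v.valuation k (P.coeff i) ≤ 1) (hPd : P.natDegree + 2 * m = n)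
    (hfe : f = P * q + C y + z) (hz : ∀ i, v.valuation k (z.coeff i) < v.valuation k y)
    (hy : ¬ IsSquare (v.valuation k y)) :
    ∃ g₀ : k[X], g₀.natDegree ≤ n ∧ ∀ g : k[X], g.natDegree ≤ n →
      (∀ i, v.valuation k ((g - g₀).coeff i) ≤ 1) → LocallyEven v f g := by
  obtain ⟨π, hπ⟩ := v.valuation_exists_uniformizer k
  have hπs := not_isSquare_uniformizer hπ
  have hπ1 : v.valuation k π < 1 := by rw [hπ]; exact WithZero.exp_lt_exp.2 (by norm_num)
  have hπ0 : v.valuation k π ≠ 0 := by rw [hπ]; exact WithZero.exp_ne_zero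
  have hy0 : v.valuation k y ≠ 0 := fun h => hy (h ▸ IsSquare.zero)
  obtain ⟨A, hA1, hA⟩ := exists_valuation_coeff_le (v.valuation k) f
  obtain ⟨B, hB1, hB⟩ := exists_valuation_coeff_le (v.valuation k) q
  obtain ⟨c, hc⟩ : ∃ c : k, A * B / (v.valuation k π ^ m * v.valuation k y) < v.valuation k c ∧
      A < v.valuation k c := by
    set D := max (A * B / (v.valuation k π ^ m * v.valuation k y)) A
    have hD : D ≠ 0 := (zero_lt_one.trans_le (hA1.trans (le_max_right _ _))).ne'
    obtain ⟨c, hc⟩ := v.valuation_surjective k (D * WithZero.exp (1 : ℤ))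
    have : D < v.valuation k c := by
      rw [hc]
      exact lt_mul_of_one_lt_right (zero_lt_iff.2 hD) (WithZero.exp_lt_exp.2 (by norm_num))
    exact ⟨c, (le_max_left _ _).trans_lt this, (le_max_right _ _).trans_lt this⟩
  have hc0 : v.valuation k c ≠ 0 := (zero_lt_iff.1 ((zero_lt_one.trans_le hA1).trans hc.2))
  have hck : c ≠ 0 := by rintro rfl; simp at hc0
  set ρ : k[X] := X ^ 2 - C π with hρ
  have hρm : ρ.Monic := monic_X_pow_sub_C π two_ne_zero
  have hρd : ρ.natDegree = 2 := natDegree_X_pow_sub_C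
  have hρi : ∀ i, v.valuation k (ρ.coeff i) ≤ 1 := fun i => by
    rw [hρ, coeff_sub, coeff_X_pow, coeff_C]
    refine (v.valuation k).map_sub_le ?_ ?_ <;> split_ifs <;> simp [hπ1.le]
  have hPρ : (P * ρ ^ m).Monic := hP.mul (hρm.pow m)
  have hPρd : (P * ρ ^ m).natDegree = n := by
    rw [hP.natDegree_mul (hρm.pow m), hρm.natDegree_pow, hρd, ← hPd, mul_comm m]
  have hPρi := fun i => (valuation_coeff_mul_le (v.valuation k) hPi
    (valuation_coeff_pow_le _ hρi m) i).trans_eq (one_mul 1)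
  refine ⟨C c * (P * ρ ^ m), (natDegree_C_mul_le _ _).trans hPρd.le, fun g hg hgi => ?_⟩
  intro K _ _ _ θ hθ w hw
  left
  obtain ⟨e, he0, he⟩ := exists_valuation_eq_pow v w hw
  set φ := algebraMap k K
  set W := w.valuation K
  suffices ∃ x : k, ¬ IsSquare (v.valuation k x) ∧ IsSquare (W (φ x)) by
    obtain ⟨x, hx, hx'⟩ := this
    intro x'
    rw [he] at hx' ⊢
    exact isSquare_pow_of_not_isSquare hx hx' _
  have hcoeff : ∀ (p : k[X]) (i : ℕ), W ((p.map φ).coeff i) = v.valuation k (p.coeff i) ^ e :=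
    fun p i => by rw [coeff_map, he]
  have hle : ∀ {p : k[X]} {D : WithZero (Multiplicative ℤ)}, (∀ i, v.valuation k (p.coeff i) ≤ D) →
      ∀ i, W ((p.map φ).coeff i) ≤ D ^ e := fun h i => by
    rw [hcoeff]; exact pow_le_pow_left' (h i) e
  set t := C c⁻¹ * (g - C c * (P * ρ ^ m)) with ht
  have hti' : ∀ i, v.valuation k (t.coeff i) ≤ A / v.valuation k c := fun i => by
    rw [ht, coeff_C_mul, map_mul, map_inv₀, inv_mul_eq_div]
    exact div_le_div_of_nonneg_right ((hgi i).trans hA1) (zero_le)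
  have hti : ∀ i, v.valuation k (t.coeff i) < 1 := fun i =>
    (hti' i).trans_lt ((div_lt_one₀ (zero_lt_iff.2 hc0)).2 hc.2)
  have hgt : g = C c * (P * ρ ^ m + t) := by
    rw [ht, mul_add, ← mul_assoc (C c) (C c⁻¹), ← C_mul, mul_inv_cancel₀ hck, C_1]
    ring
  simp only [aeval_def, ← eval_map] at hθ
  have hgθ : (g.map φ).eval θ = φ c * ((P.map φ).eval θ * (ρ.map φ).eval θ ^ m +
      (t.map φ).eval θ) := by
    rw [hgt]; simp
  have hWθ : W θ ≤ 1 := by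
    by_contra! h
    have h0 : W θ ≠ 0 := (zero_lt_one.trans h).ne'
    have h1 := valuation_eval_le_pow W h.le (natDegree_map_le.trans hf) (hle hA)
    have hnd : (P * ρ ^ m + t).natDegree ≤ n := by
      refine natDegree_add_le_of_degree_le hPρd.le ((natDegree_C_mul_le _ _).trans ?_)
      exact (natDegree_sub_le_of_le hg ((natDegree_C_mul_le _ _).trans hPρd.le)).trans (max_self n).le
    have h2 : W (((P * ρ ^ m + t).map φ).eval θ) = W θ ^ n := by
      refine valuation_eval_eq_pow W h (natDegree_map_le.trans hnd) (fun i => ?_) ?_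
      · refine (hle (D := 1) (fun i => ?_) i).trans_eq (one_pow e)
        exact valuation_coeff_add_le _ hPρi (fun i => (hti i).le) i
      · have hl : v.valuation k ((P * ρ ^ m).coeff n) = 1 := by
          have := hPρ.coeff_natDegree
          rw [hPρd] at this
          rw [this, map_one]
        rw [hcoeff, coeff_add, Valuation.map_add_eq_of_lt_left, hl, one_pow]
        rw [hl]; exact hti n
    have h3 : W ((f.map φ).eval θ) = (v.valuation k c ^ 2) ^ e * W θ ^ (2 * n) := by
      rw [hθ, hgt, Polynomial.map_mul, eval_mul, map_pow, map_mul, h2, map_C, eval_C, he, mul_pow,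
        ← pow_mul, ← pow_mul, ← pow_mul, mul_comm n, mul_comm e]
    rw [h3] at h1
    have h4 := le_of_mul_le_mul_right h1 (zero_lt_iff.2 (pow_ne_zero _ h0))
    refine h4.not_gt (pow_lt_pow_left₀ ?_ (zero_le) he0)
    rw [sq]
    exact hc.2.trans_le (le_mul_of_one_le_left' (hA1.trans hc.2.le))
  have hfθ : W ((f.map φ).eval θ) ≤ A ^ e := valuation_eval_le W hWθ (hle hA)
  by_cases hρθ : W ((ρ.map φ).eval θ) < W (φ π)
  · refine ⟨π, hπs, W θ, ?_⟩
    have h1 : (ρ.map φ).eval θ = θ ^ 2 - φ π := by simp [hρ]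
    have h2 : φ π = θ ^ 2 + -((ρ.map φ).eval θ) := by rw [h1]; ring
    rw [← map_mul, ← sq]
    nth_rewrite 1 [h2]
    have h3 : W (-((ρ.map φ).eval θ)) < W (θ ^ 2) := by
      by_contra! h
      rw [Valuation.map_neg] at h
      refine hρθ.not_ge ?_
      rw [h2]
      exact W.map_add_le h (W.map_neg _).le
    rw [Valuation.map_add_eq_of_lt_left _ h3]
  · push Not at hρθ
    refine ⟨y, hy, W ((g.map φ).eval θ), ?_⟩
    rw [← map_mul, ← sq, ← hθ]
    have hgA : W ((g.map φ).eval θ) ≤ A ^ e := by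
      by_contra! h
      refine hfθ.not_gt ?_
      rw [hθ, map_pow, sq]
      exact h.trans_le (le_mul_of_one_le_left' ((one_le_pow₀ hA1).trans h.le))
    have hq1 : W ((P.map φ).eval θ * (ρ.map φ).eval θ ^ m) ≤ A ^ e / v.valuation k c ^ e := by
      have : (P.map φ).eval θ * (ρ.map φ).eval θ ^ m =
          (g.map φ).eval θ / φ c - (t.map φ).eval θ := by
        rw [hgθ, mul_div_cancel_left₀ _ ((map_ne_zero φ).2 hck)]; ring
      rw [this]
      refine W.map_sub_le ?_ ?_
      · rw [map_div₀, he]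
        exact div_le_div_of_nonneg_right hgA (zero_le)
      · rw [← div_pow]
        exact valuation_eval_le W hWθ (hle hti')
    have hP0 : W ((P.map φ).eval θ) ≤ (A / (v.valuation k c * v.valuation k π ^ m)) ^ e := by
      rw [map_mul, map_pow] at hq1
      have h1 := (mul_le_mul' (le_refl (W ((P.map φ).eval θ))) (pow_le_pow_left' hρθ m)).trans hq1
      rw [he, ← le_div_iff₀ (zero_lt_iff.2 (pow_ne_zero _ (pow_ne_zero _ hπ0)))] at h1
      refine h1.trans_eq ?_
      rw [div_pow, mul_pow, div_div, pow_right_comm]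
    have hlt : W ((P.map φ).eval θ * (q.map φ).eval θ + (z.map φ).eval θ) < W (φ y) := by
      rw [he]
      refine W.map_add_lt ?_ ?_
      · rw [map_mul]
        refine (mul_le_mul' hP0 (valuation_eval_le W hWθ (hle hB))).trans_lt ?_
        rw [← mul_pow]
        refine pow_lt_pow_left₀ ?_ (zero_le) he0
        have h1 := hc.1
        have hp := zero_lt_iff.2 (pow_ne_zero m hπ0)
        have hc' := zero_lt_iff.2 hc0
        have hy' := zero_lt_iff.2 hy0
        rw [div_lt_iff₀ (mul_pos hp hy')] at h1
        rw [div_mul_eq_mul_div, div_lt_iff₀ (mul_pos hc' hp)]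
        refine h1.trans_eq ?_
        rw [mul_comm (v.valuation k y), mul_assoc]
      · refine valuation_eval_lt W (pow_ne_zero _ hy0) hWθ fun i => ?_
        rw [hcoeff]
        exact pow_lt_pow_left₀ (hz i) (zero_le) he0
    have hfy : (f.map φ).eval θ =
        φ y + ((P.map φ).eval θ * (q.map φ).eval θ + (z.map φ).eval θ) := by
      rw [hfe]; simp; ring
    rw [hfy, Valuation.map_add_eq_of_lt_left _ hlt]

end Local

section Local

open Polynomial NumberField IsDedekindDomain

universe u

variable {k : Type u} [Field k] [NumberField k] {v : HeightOneSpectrum (𝓞 k)} {f : k[X]}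

theorem locallyEven_of_eisenstein {n : ℕ} (hf : f.natDegree ≤ 2 * n) {g₀ B q z : k[X]} {ε π : k}
    (hg₀i : ∀ i, v.valuation k (g₀.coeff i) ≤ 1)
    (hB : B.natDegree ≤ n) (hBi : ∀ i, v.valuation k (B.coeff i) ≤ 1)
    (hBn : v.valuation k (B.coeff n) = 1) (hε : v.valuation k ε = 1)
    (hqi : ∀ i, v.valuation k (q.coeff i) ≤ 1) (hπ1 : v.valuation k π < 1)
    (hπ : ¬ IsSquare (v.valuation k π)) (hz : ∀ i, v.valuation k (z.coeff i) < v.valuation k π)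
    (hfe : f - g₀ ^ 2 = C ε * B ^ 2 + C π * (1 + B * q) + z) {g : k[X]} (hg : g.natDegree ≤ n)
    (hgi : ∀ i, v.valuation k ((g - g₀).coeff i) < v.valuation k π) : LocallyEven v f g := by
  intro K _ _ _ θ hθ w hw
  left
  obtain ⟨e, he0, he⟩ := exists_valuation_eq_pow v w hw
  set V := v.valuation k
  set φ := algebraMap k K
  set W := w.valuation K
  have hπ0 : V π ≠ 0 := fun h => hπ (h ▸ IsSquare.zero)
  suffices IsSquare (W (φ π)) by
    intro x'
    rw [he] at this ⊢
    exact isSquare_pow_of_not_isSquare hπ this _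
  have hcoeff : ∀ (p : k[X]) (i : ℕ), W ((p.map φ).coeff i) = V (p.coeff i) ^ e :=
    fun p i => by rw [coeff_map, he]
  have hle : ∀ {p : k[X]} {D : WithZero (Multiplicative ℤ)}, (∀ i, V (p.coeff i) ≤ D) →
      ∀ i, W ((p.map φ).coeff i) ≤ D ^ e := fun h i => by
    rw [hcoeff]; exact pow_le_pow_left' (h i) e
  set t := z - (g - g₀) * (g - g₀ + 2 * g₀) with ht
  have h2g : ∀ i, V ((2 * g₀ : k[X]).coeff i) ≤ 1 := by
    rw [two_mul]; exact valuation_coeff_add_le V hg₀i hg₀i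
  have hti : ∀ i, V (t.coeff i) < V π := fun i => by
    rw [ht, coeff_sub, coeff_mul]
    refine (V.map_sub _ _).trans_lt (max_lt (hz i) (V.map_sum_lt hπ0 fun x _ => ?_))
    rw [map_mul]
    exact (mul_le_mul' le_rfl (valuation_coeff_add_le V
      (fun j => ((hgi j).trans hπ1).le) h2g _)).trans_lt (by rw [mul_one]; exact hgi _)
  set h := C ε * B ^ 2 + (C π * (1 + B * q) + t) with hh
  have hfg : f - g ^ 2 = h := by
    rw [hh, ht]; linear_combination hfe
  have hBq : ∀ i, V ((1 + B * q).coeff i) ≤ 1 := valuation_coeff_add_le V (valuation_coeff_one_le V)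
    fun i => (valuation_coeff_mul_le V hBi hqi i).trans_eq (one_mul 1)
  have hsmall : ∀ i, V ((C π * (1 + B * q) + t).coeff i) < 1 := fun i => by
    rw [coeff_add, coeff_C_mul]
    refine V.map_add_lt ?_ ((hti i).trans hπ1)
    rw [map_mul]
    exact (mul_le_mul' le_rfl (hBq i)).trans_lt (by rwa [mul_one])
  have hsq : ∀ i, V ((C ε * B ^ 2).coeff i) ≤ 1 := fun i => by
    rw [coeff_C_mul, map_mul, hε, one_mul]
    exact valuation_coeff_pow_le V hBi 2 i
  have hlead : V (h.coeff (2 * n)) = 1 := by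
    have : V ((C ε * B ^ 2).coeff (2 * n)) = 1 := by
      rw [coeff_C_mul, map_mul, hε, one_mul, coeff_pow_of_natDegree_le hB, map_pow,
        hBn, one_pow]
    rw [hh, coeff_add, Valuation.map_add_eq_of_lt_left, this]
    rw [this]; exact hsmall _
  simp only [aeval_def, ← eval_map] at hθ
  have hθ0 : (h.map φ).eval θ = 0 := by
    rw [← hfg, Polynomial.map_sub, Polynomial.map_pow, eval_sub, eval_pow, hθ, sub_self]
  have hWθ : W θ ≤ 1 := by
    by_contra! hlt
    have := valuation_eval_eq_pow W (p := h.map φ) (n := 2 * n) hlt ?_ ?_ ?_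
    · rw [hθ0, map_zero] at this
      exact (pow_ne_zero _ (zero_lt_one.trans hlt).ne') this.symm
    · refine natDegree_map_le.trans ?_
      rw [← hfg]
      refine (natDegree_sub_le_of_le hf (natDegree_pow_le_of_le 2 hg)).trans (max_self _).le
    · intro i
      refine (hle (D := 1) (fun i => ?_) i).trans_eq (one_pow e)
      exact valuation_coeff_add_le V hsq (fun i => (hsmall i).le) i
    · rw [hcoeff, hlead, one_pow]
  have hexp : φ ε * (B.map φ).eval θ ^ 2 =
      -(φ π * (1 + (B.map φ).eval θ * (q.map φ).eval θ) + (t.map φ).eval θ) := by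
    have : φ ε * (B.map φ).eval θ ^ 2 + (φ π * (1 + (B.map φ).eval θ * (q.map φ).eval θ) +
        (t.map φ).eval θ) = (h.map φ).eval θ := by
      rw [hh]; simp
    rw [hθ0] at this
    exact eq_neg_of_add_eq_zero_left this
  have hWε : W (φ ε) = 1 := by rw [he, hε, one_pow]
  have hsq2 : W ((B.map φ).eval θ) * W ((B.map φ).eval θ) =
      W (φ π * (1 + (B.map φ).eval θ * (q.map φ).eval θ) + (t.map φ).eval θ) := by
    rw [← W.map_neg (_ + _), ← hexp, map_mul, hWε, one_mul, map_pow, sq]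
  have hWt : W ((t.map φ).eval θ) < W (φ π) := by
    rw [he]
    refine valuation_eval_lt W (pow_ne_zero _ hπ0) hWθ fun i => ?_
    rw [hcoeff]
    exact pow_lt_pow_left₀ (hti i) (zero_le) he0
  have hWq : W ((q.map φ).eval θ) ≤ 1 :=
    valuation_eval_le W hWθ fun i => (hle hqi i).trans_eq (one_pow e)
  have hWB1 : W ((B.map φ).eval θ) ≤ 1 :=
    valuation_eval_le W hWθ fun i => (hle hBi i).trans_eq (one_pow e)
  have hWπ : W (φ π) < 1 := by rw [he]; exact pow_lt_one₀ (zero_le) hπ1 he0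
  have hWB : W ((B.map φ).eval θ) < 1 := by
    refine lt_of_le_of_ne hWB1 fun h1 => ?_
    rw [h1, one_mul] at hsq2
    refine hsq2.not_gt (W.map_add_lt ?_ (hWt.trans hWπ))
    rw [map_mul]
    refine (mul_le_mul' le_rfl (W.map_add_le (map_one W).le ?_)).trans_lt (by rwa [mul_one])
    rw [map_mul]
    exact mul_le_one' hWB1 hWq
  refine ⟨W ((B.map φ).eval θ), ?_⟩
  have h1 : W (φ π * (1 + (B.map φ).eval θ * (q.map φ).eval θ)) = W (φ π) := by
    rw [map_mul, Valuation.map_add_eq_of_lt_left, map_one, mul_one]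
    rw [map_mul, map_one]
    exact (mul_le_mul' le_rfl hWq).trans_lt (by rwa [mul_one])
  rw [hsq2, Valuation.map_add_eq_of_lt_left, h1]
  rwa [h1]

end Local

section FiniteField

open Polynomial

variable {F : Type*} [Field F]

theorem exists_dvd_sq_sub_of_factors (ε : F) (p : F[X]) (h0 : p ≠ 0) (hs : Squarefree p)
    (h : ∀ q : F[X], Irreducible q → q ∣ p → ∃ a, q ∣ a ^ 2 - C ε) : ∃ a, p ∣ a ^ 2 - C ε := by
  induction p using WfDvdMonoid.induction_on_irreducible with
  | zero => exact absurd rfl h0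
  | unit u hu => exact ⟨0, hu.dvd⟩
  | mul q i hq0 hi ih =>
    obtain ⟨a, ha⟩ := ih hq0 (hs.squarefree_of_dvd (Dvd.intro_left _ rfl))
      fun r hr hrq => h r hr (hrq.mul_left _)
    obtain ⟨b, hb⟩ := h i hi (Dvd.intro _ rfl)
    have hc : IsCoprime i q := (hi.coprime_iff_not_dvd).2 fun hd =>
      hi.not_isUnit (hs i (mul_dvd_mul_left i hd))
    obtain ⟨u, w, huw⟩ := id hc
    refine ⟨b * (w * q) + a * (u * i), IsCoprime.mul_dvd hc ?_ ?_⟩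
    · have : (b * (w * q) + a * (u * i)) ^ 2 - C ε = (b ^ 2 - C ε) +
          i * ((a - b) * u * (b * (w * q) + a * (u * i) + b)) := by
        linear_combination (b * (b * (w * q) + a * (u * i) + b)) * huw
      rw [this]
      exact dvd_add hb (Dvd.intro _ rfl)
    · have : (b * (w * q) + a * (u * i)) ^ 2 - C ε = (a ^ 2 - C ε) +
          q * ((b - a) * w * (b * (w * q) + a * (u * i) + a)) := by
        linear_combination (a * (b * (w * q) + a * (u * i) + a)) * huw
      rw [this]
      exact dvd_add ha (Dvd.intro _ rfl)

theorem exists_dvd_sq_sub [Finite F] (ε : F) {q : F[X]} (hq : Irreducible q)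
    (hd : Even q.natDegree) : ∃ a, q ∣ a ^ 2 - C ε := by
  by_cases hε : ε = 0
  · exact ⟨0, by simp [hε]⟩
  have : Fact (Irreducible q) := ⟨hq⟩
  have : Module.Finite F (AdjoinRoot q) := (AdjoinRoot.powerBasis hq.ne_zero).finite
  have : Finite (AdjoinRoot q) := Module.finite_of_finite F
  have := Fintype.ofFinite F
  have := Fintype.ofFinite (AdjoinRoot q)
  by_cases h2 : ringChar (AdjoinRoot q) = 2
  · obtain ⟨r, hr⟩ := FiniteField.isSquare_of_char_two h2 (AdjoinRoot.of q ε)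
    obtain ⟨a, rfl⟩ := AdjoinRoot.mk_surjective r
    refine ⟨a, AdjoinRoot.mk_eq_zero.1 ?_⟩
    rw [map_sub, map_pow, AdjoinRoot.mk_C, hr, sq, sub_self]
  have hε' : AdjoinRoot.of q ε ≠ 0 := (_root_.map_ne_zero _).2 hε
  have hsq : IsSquare (AdjoinRoot.of q ε) := by
    rw [FiniteField.isSquare_iff h2 hε']
    have hcard : Fintype.card (AdjoinRoot q) = Fintype.card F ^ q.natDegree := by
      rw [Module.card_eq_pow_finrank (K := F), (AdjoinRoot.powerBasis hq.ne_zero).finrank,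
        AdjoinRoot.powerBasis_dim]
    have hodd := FiniteField.odd_card_of_char_ne_two h2
    obtain ⟨d, hd⟩ := hd
    rw [hcard, hd, pow_add] at hodd ⊢
    obtain ⟨j, hj⟩ := (Nat.odd_mul.1 (Nat.odd_iff.2 hodd)).1
    have hdvd : Fintype.card F - 1 ∣ 2 * j := by
      have := Nat.sub_dvd_pow_sub_pow (Fintype.card F) 1 d
      rwa [one_pow, hj, Nat.add_sub_cancel] at this
    have : Fintype.card F ^ d * Fintype.card F ^ d / 2 = 2 * j * (j + 1) := by
      rw [hj]
      have : (2 * j + 1) * (2 * j + 1) = 2 * (2 * j * (j + 1)) + 1 := by ring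
      omega
    obtain ⟨r, hr⟩ := hdvd.mul_right (j + 1)
    rw [this, hr, ← map_pow, pow_mul, FiniteField.pow_card_sub_one_eq_one ε hε, one_pow, map_one]
  obtain ⟨r, hr⟩ := hsq
  obtain ⟨a, rfl⟩ := AdjoinRoot.mk_surjective r
  refine ⟨a, AdjoinRoot.mk_eq_zero.1 ?_⟩
  rw [map_sub, map_pow, AdjoinRoot.mk_C, hr, sq, sub_self]

/-- Thue's lemma for polynomials. -/
theorem exists_dvd_sub_mul {p : F[X]} (hp : p ≠ 0) {n : ℕ} (hn : p.natDegree ≤ 2 * n) (a : F[X]) :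
    ∃ A B : F[X], (A ≠ 0 ∨ B ≠ 0) ∧ A.natDegree ≤ n ∧ B.natDegree ≤ n ∧ p ∣ A - a * B := by
  have : Module.Finite F (AdjoinRoot p) := (AdjoinRoot.powerBasis hp).finite
  let T : (degreeLT F (n + 1) × degreeLT F (n + 1)) →ₗ[F] AdjoinRoot p :=
    (AdjoinRoot.mkₐ p).toLinearMap ∘ₗ ((degreeLT F (n + 1)).subtype ∘ₗ LinearMap.fst F _ _ -
      LinearMap.mulLeft F a ∘ₗ (degreeLT F (n + 1)).subtype ∘ₗ LinearMap.snd F _ _)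
  have hker : LinearMap.ker T ≠ ⊥ := by
    refine LinearMap.ker_ne_bot_of_finrank_lt ?_
    rw [(AdjoinRoot.powerBasis hp).finrank, AdjoinRoot.powerBasis_dim, Module.finrank_prod,
      (degreeLTEquiv F (n + 1)).finrank_eq, Module.finrank_fin_fun]
    omega
  obtain ⟨⟨A, B⟩, hAB, h0⟩ := (Submodule.ne_bot_iff _).1 hker
  refine ⟨A, B, ?_, ?_, ?_, ?_⟩
  · by_contra! h
    exact h0 (Prod.ext (Subtype.ext h.1) (Subtype.ext h.2))
  · exact natDegree_le_iff_coeff_eq_zero.2 ((degree_lt_iff_coeff_zero _ _).1 (mem_degreeLT.1 A.2))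
  · exact natDegree_le_iff_coeff_eq_zero.2 ((degree_lt_iff_coeff_zero _ _).1 (mem_degreeLT.1 B.2))
  · have : T (A, B) = AdjoinRoot.mk p (A - a * B) := rfl
    rw [LinearMap.mem_ker, this, AdjoinRoot.mk_eq_zero] at hAB
    exact hAB

theorem eq_zero_of_sq_eq_mul_sq {ε : F} (hε : ¬ IsSquare ε) {A B : F[X]}
    (h : A ^ 2 - C ε * B ^ 2 = 0) : A = 0 ∧ B = 0 := by
  have hB : B = 0 := by
    by_contra hB
    have := congrArg leadingCoeff (sub_eq_zero.1 h)
    rw [leadingCoeff_pow, leadingCoeff_mul, leadingCoeff_C, leadingCoeff_pow] at this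
    refine hε ⟨A.leadingCoeff / B.leadingCoeff, ?_⟩
    have hB' := leadingCoeff_ne_zero.2 hB
    field_simp
    exact this.symm
  subst hB
  simpa using h

theorem exists_eq_sq_sub_mul_sq [Finite F] (h2 : (2 : F) ≠ 0) {p : F[X]} {n : ℕ}
    (hn : p.natDegree = 2 * n) (hs : Squarefree p)
    (h : ∀ q : F[X], Irreducible q → q ∣ p → Even q.natDegree) :
    ∃ (ε : F) (A B : F[X]), ε ≠ 0 ∧ A.natDegree ≤ n ∧ B.natDegree ≤ n ∧ B.coeff n ≠ 0 ∧
      IsCoprime A B ∧ p = A ^ 2 - C ε * B ^ 2 := by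
  have := Fintype.ofFinite F
  have hp := hs.ne_zero
  have hch : ringChar F ≠ 2 := fun h => h2 (by
    have := ringChar.Nat.cast_ringChar (R := F); rw [h] at this; exact_mod_cast this)
  obtain ⟨ε, hε⟩ := FiniteField.exists_nonsquare hch
  have hε0 : ε ≠ 0 := fun h => hε (h ▸ IsSquare.zero)
  have hε1 : 1 - ε ≠ 0 := fun h => hε ((sub_eq_zero.1 h) ▸ IsSquare.one)
  obtain ⟨a, ha⟩ := exists_dvd_sq_sub_of_factors ε p hp hs
    fun q hq hqp => exists_dvd_sq_sub ε hq (h q hq hqp)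
  obtain ⟨A, B, hAB, hA, hB, hdvd⟩ := exists_dvd_sub_mul hp hn.le a
  have hN : p ∣ A ^ 2 - C ε * B ^ 2 := by
    have : A ^ 2 - C ε * B ^ 2 = (A - a * B) * (A + a * B) + (a ^ 2 - C ε) * B ^ 2 := by ring
    rw [this]
    exact dvd_add (hdvd.mul_right _) (ha.mul_right _)
  obtain ⟨r, hr⟩ := hN
  have hr0 : r ≠ 0 := by
    rintro rfl
    rw [mul_zero] at hr
    have := eq_zero_of_sq_eq_mul_sq hε hr
    tauto
  have hNd : (A ^ 2 - C ε * B ^ 2).natDegree ≤ 2 * n :=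
    (natDegree_sub_le_of_le (natDegree_pow_le_of_le 2 hA) ((natDegree_C_mul_le _ _).trans
      (natDegree_pow_le_of_le 2 hB))).trans (max_self _).le
  have hrd : r.natDegree = 0 := by
    rw [hr, natDegree_mul hp hr0, hn] at hNd
    omega
  obtain ⟨c, rfl⟩ : ∃ c, r = C c := ⟨_, eq_C_of_natDegree_eq_zero hrd⟩
  have hc : c ≠ 0 := by simpa using hr0
  obtain ⟨x, y, hxy⟩ : ∃ x y : F, c⁻¹ = x ^ 2 - ε * y ^ 2 := by
    obtain ⟨x, y, hxy⟩ := FiniteField.exists_root_sum_quadratic (R := F)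
      (f := X ^ 2 - C c⁻¹) (g := C (-ε) * X ^ 2)
      (degree_X_pow_sub_C two_pos _) (degree_C_mul_X_pow 2 (neg_ne_zero.2 hε0))
      (FiniteField.odd_card_of_char_ne_two hch)
    refine ⟨x, y, ?_⟩
    simp only [eval_sub, eval_pow, eval_X, eval_C, eval_mul] at hxy
    linear_combination -hxy
  obtain ⟨A, B, hA, hB, hp'⟩ : ∃ A B : F[X], A.natDegree ≤ n ∧ B.natDegree ≤ n ∧
      p = A ^ 2 - C ε * B ^ 2 := by
    refine ⟨C x * A + C (ε * y) * B, C x * B + C y * A, ?_, ?_, ?_⟩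
    · exact natDegree_add_le_of_degree_le ((natDegree_C_mul_le _ _).trans hA)
        ((natDegree_C_mul_le _ _).trans hB)
    · exact natDegree_add_le_of_degree_le ((natDegree_C_mul_le _ _).trans hB)
        ((natDegree_C_mul_le _ _).trans hA)
    · have h1 : p = C c⁻¹ * (A ^ 2 - C ε * B ^ 2) := by
        rw [hr, mul_left_comm, ← C_mul, inv_mul_cancel₀ hc, C_1, mul_one]
      rw [h1, hxy, C_sub, C_mul, C_mul, C_pow, C_pow]
      ring
  obtain ⟨A, B, hA, hB, hBn, hp'⟩ : ∃ A B : F[X], A.natDegree ≤ n ∧ B.natDegree ≤ n ∧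
      B.coeff n ≠ 0 ∧ p = A ^ 2 - C ε * B ^ 2 := by
    by_cases hBn : B.coeff n = 0
    · have hAn : A.coeff n ≠ 0 := by
        intro hAn
        have : p.coeff (2 * n) = 0 := by
          rw [hp', coeff_sub, coeff_C_mul, coeff_pow_of_natDegree_le hA,
            coeff_pow_of_natDegree_le hB, hAn, hBn]
          simp
        rw [← hn, coeff_natDegree, leadingCoeff_eq_zero] at this
        exact hp this
      set x₀ := (1 + ε) / (1 - ε) with hx₀
      set y₀ := 2 / (1 - ε) with hy₀
      have hxy0 : x₀ ^ 2 - ε * y₀ ^ 2 = 1 := by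
        rw [hx₀, hy₀]; field_simp; ring
      refine ⟨C x₀ * A + C (ε * y₀) * B, C x₀ * B + C y₀ * A, ?_, ?_, ?_, ?_⟩
      · exact natDegree_add_le_of_degree_le ((natDegree_C_mul_le _ _).trans hA)
          ((natDegree_C_mul_le _ _).trans hB)
      · exact natDegree_add_le_of_degree_le ((natDegree_C_mul_le _ _).trans hB)
          ((natDegree_C_mul_le _ _).trans hA)
      · rw [coeff_add, coeff_C_mul, coeff_C_mul, hBn, mul_zero, zero_add]
        exact mul_ne_zero (div_ne_zero h2 hε1) hAn
      · have h1 : p = C (x₀ ^ 2 - ε * y₀ ^ 2) * (A ^ 2 - C ε * B ^ 2) := by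
          rw [hxy0, C_1, one_mul, hp']
        rw [h1, C_sub, C_mul, C_mul, C_pow, C_pow]
        ring
    · exact ⟨A, B, hA, hB, hBn, hp'⟩
  refine ⟨ε, A, B, hε0, hA, hB, hBn, ?_, hp'⟩
  refine isCoprime_of_irreducible_dvd (fun h => ?_) fun q hq hqA hqB => ?_
  · rw [h.2] at hBn; exact hBn (coeff_zero _)
  · refine hq.not_isUnit (hs q ?_)
    obtain ⟨A', rfl⟩ := hqA
    obtain ⟨B', rfl⟩ := hqB
    rw [hp']
    exact ⟨A' ^ 2 - C ε * B' ^ 2, by ring⟩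

theorem exists_coprime_factor_or_sq_sub_mul_sq [Finite F] (h2 : (2 : F) ≠ 0) {p : F[X]} {n : ℕ}
    (hn : p.natDegree = 2 * n) (hs : Squarefree p) :
    (∃ P Q : F[X], P.Monic ∧ p = P * Q ∧ IsCoprime P Q ∧ Odd P.natDegree ∧ P.natDegree ≤ n) ∨
    ∃ (ε : F) (A B : F[X]), ε ≠ 0 ∧ A.natDegree ≤ n ∧ B.natDegree ≤ n ∧ B.coeff n ≠ 0 ∧
      IsCoprime A B ∧ p = A ^ 2 - C ε * B ^ 2 := by
  by_cases h : ∀ q : F[X], Irreducible q → q ∣ p → Even q.natDegree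
  · exact Or.inr (exists_eq_sq_sub_mul_sq h2 hn hs h)
  · left
    push Not at h
    obtain ⟨q, hq, ⟨r, rfl⟩, hd⟩ := h
    have hc : IsCoprime q r := (hq.coprime_iff_not_dvd).2 fun hd =>
      hq.not_isUnit (hs q (mul_dvd_mul_left q hd))
    have hr0 : r ≠ 0 := right_ne_zero_of_mul hs.ne_zero
    rw [natDegree_mul hq.ne_zero hr0] at hn
    have key : ∀ q r : F[X], q ≠ 0 → IsCoprime q r → Odd q.natDegree → q.natDegree ≤ n →
        ∃ P Q : F[X], P.Monic ∧ q * r = P * Q ∧ IsCoprime P Q ∧ Odd P.natDegree ∧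
          P.natDegree ≤ n := by
      intro q r hq hc hd hn
      have hl : q.leadingCoeff⁻¹ ≠ 0 := inv_ne_zero (leadingCoeff_ne_zero.2 hq)
      have hu : IsUnit (C q.leadingCoeff⁻¹) := (isUnit_C).2 hl.isUnit
      refine ⟨C q.leadingCoeff⁻¹ * q, C q.leadingCoeff * r, ?_, ?_, ?_, ?_, ?_⟩
      · rw [mul_comm]; exact monic_mul_leadingCoeff_inv hq
      · rw [mul_mul_mul_comm, ← C_mul, inv_mul_cancel₀ (leadingCoeff_ne_zero.2 hq), C_1, one_mul]
      · rw [isCoprime_mul_unit_left_left hu, isCoprime_mul_unit_left_right]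
        · exact hc
        · exact (isUnit_C).2 (leadingCoeff_ne_zero.2 hq).isUnit
      · rwa [natDegree_C_mul hl]
      · rwa [natDegree_C_mul hl]
    rw [Nat.not_even_iff_odd] at hd
    by_cases hle : q.natDegree ≤ n
    · exact key q r hq.ne_zero hc hd hle
    · rw [mul_comm]
      refine key r q hr0 hc.symm ?_ (by omega)
      rw [Nat.odd_iff] at hd ⊢
      omega

end FiniteField

section Lift

open Polynomial

variable {R : Type*} [CommRing R] {I : Ideal R}

theorem exists_map_mk_eq [hI : I.IsMaximal] (p : (R ⧸ I)[X]) :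
    ∃ q : R[X], q.map (Ideal.Quotient.mk I) = p ∧ q.natDegree = p.natDegree ∧ (p.Monic → q.Monic) := by
  have := Ideal.Quotient.nontrivial_iff.2 hI.ne_top
  have hp : p ∈ lifts (Ideal.Quotient.mk I) :=
    (mem_lifts p).2 (map_surjective _ Ideal.Quotient.mk_surjective p)
  by_cases hm : p.Monic
  · obtain ⟨q, h1, h2, h3⟩ := lifts_and_natDegree_eq_and_monic hp hm
    exact ⟨q, h1, h2, fun _ => h3⟩
  · obtain ⟨q, h1, h2⟩ := exists_degree_eq_of_mem_lifts hp
    exact ⟨q, h1, natDegree_eq_natDegree h2, fun h => absurd h hm⟩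

theorem coeff_mem_of_map_mk_eq_zero {p : R[X]} (h : p.map (Ideal.Quotient.mk I) = 0) (i : ℕ) :
    p.coeff i ∈ I := by
  rw [← Ideal.Quotient.eq_zero_iff_mem, ← coeff_map, h, coeff_zero]

theorem exists_eq_C_mul_add {π : R} (hπ : I ≤ Ideal.span {π} ⊔ I ^ 2) {p : R[X]}
    (h : ∀ i, p.coeff i ∈ I) : ∃ r z : R[X], p = C π * r + z ∧ ∀ i, z.coeff i ∈ I ^ 2 := by
  have h2 : p ∈ Ideal.map C I := Ideal.mem_map_C_iff.2 h
  have h3 := Ideal.map_mono (f := (C : R →+* R[X])) hπ h2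
  rw [Ideal.map_sup, Ideal.map_span, Set.image_singleton] at h3
  obtain ⟨a, ha, z, hz, rfl⟩ := Submodule.mem_sup.1 h3
  obtain ⟨r, rfl⟩ := Ideal.mem_span_singleton'.1 ha
  exact ⟨r, z, by ring, Ideal.mem_map_C_iff.1 hz⟩

theorem coeff_C_mul_mem_sq {π : R} (hπ : π ∈ I) {p : R[X]} (h : ∀ i, p.coeff i ∈ I) (i : ℕ) :
    (C π * p).coeff i ∈ I ^ 2 := by
  rw [coeff_C_mul, sq]
  exact Ideal.mul_mem_mul hπ (h i)

theorem exists_factor_or_eisenstein [hI : I.IsMaximal] [Finite (R ⧸ I)] {π : R} (hπI : π ∈ I)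
    (hπ : I ≤ Ideal.span {π} ⊔ I ^ 2) (h2 : (2 : R) ∉ I) {F : R[X]} {n : ℕ}
    (hn : F.natDegree ≤ 2 * n) (hl : F.coeff (2 * n) ∉ I)
    (hs : Squarefree (F.map (Ideal.Quotient.mk I))) :
    (∃ P q z : R[X], P.Monic ∧ Odd P.natDegree ∧ P.natDegree ≤ n ∧ F = P * q + C π + z ∧
      ∀ i, z.coeff i ∈ I ^ 2) ∨
    ∃ (ε : R) (A B q z : R[X]), ε ∉ I ∧ A.natDegree ≤ n ∧ B.natDegree ≤ n ∧ B.coeff n ∉ I ∧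
      F - A ^ 2 = C ε * B ^ 2 + C π * (1 + B * q) + z ∧ ∀ i, z.coeff i ∈ I ^ 2 := by
  let _ := Ideal.Quotient.field I
  have : Nontrivial R := (Submodule.nontrivial_iff R).1 ⟨I, ⊤, hI.ne_top⟩
  set ρ := Ideal.Quotient.mk I with hρ
  have hker : ∀ x, ρ x = 0 ↔ x ∈ I := fun x => Ideal.Quotient.eq_zero_iff_mem
  have hπ0 : ρ π = 0 := (hker π).2 hπI
  have hd : (F.map ρ).natDegree = 2 * n := by
    refine le_antisymm (natDegree_map_le.trans hn) (le_natDegree_of_ne_zero ?_)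
    rw [coeff_map]
    exact fun h => hl ((hker _).1 h)
  have h2' : (2 : R ⧸ I) ≠ 0 := fun h => h2 ((hker 2).1 (by rw [map_ofNat]; exact h))
  rcases exists_coprime_factor_or_sq_sub_mul_sq h2' hd hs with
    ⟨P₁, Q₁, hPm, hPQ, ⟨u, w, huw⟩, hPo, hPn⟩ | ⟨ε₁, A₁, B₁, hε, hA, hB, hBn, ⟨u, w, huw⟩, hp⟩
  · left
    obtain ⟨P₀, hP1, hP2, hP3⟩ := exists_map_mk_eq P₁
    obtain ⟨Q₀, hQ1, -, -⟩ := exists_map_mk_eq Q₁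
    have hP0 := hP3 hPm
    obtain ⟨r, z₀, hr, hz₀⟩ := exists_eq_C_mul_add hπ (p := F - P₀ * Q₀)
      (coeff_mem_of_map_mk_eq_zero (by
        rw [Polynomial.map_sub, Polynomial.map_mul, hP1, hQ1, hPQ, sub_self]))
    obtain ⟨b, hb1, hb2, -⟩ := exists_map_mk_eq ((w * (r.map ρ - 1)) %ₘ P₁)
    obtain ⟨s, hs1, -, -⟩ := exists_map_mk_eq
      (u * (r.map ρ - 1) + Q₁ * ((w * (r.map ρ - 1)) /ₘ P₁))
    rw [← hρ] at hP1 hQ1 hb1 hs1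
    have hkey : (r - b * Q₀ - 1 - P₀ * s).map ρ = 0 := by
      simp only [Polynomial.map_sub, Polynomial.map_mul, Polynomial.map_one, hb1, hQ1, hP1, hs1]
      have hdiv := modByMonic_add_div (w * (r.map ρ - 1)) P₁
      linear_combination (r.map ρ - 1) * (-huw) - Q₁ * hdiv
    set z₁ := r - b * Q₀ - 1 - P₀ * s with hz₁
    have hz1 := coeff_mem_of_map_mk_eq_zero hkey
    have hP1n : P₁ ≠ 1 := fun h => by rw [h, natDegree_one] at hPo; exact absurd hPo (by decide)
    have hbd : (C π * b).degree < P₀.degree := by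
      refine (degree_le_natDegree.trans (Nat.cast_le.2 (natDegree_C_mul_le _ _))).trans_lt ?_
      rw [degree_eq_natDegree hP0.ne_zero, hb2, hP2]
      exact Nat.cast_lt.2 (natDegree_modByMonic_lt _ hPm hP1n)
    have hdeg : (P₀ + C π * b).natDegree = P₁.natDegree := by
      rw [natDegree_add_eq_left_of_degree_lt hbd, hP2]
    refine ⟨P₀ + C π * b, Q₀ + C π * s, C π * (z₁ - C π * (b * s)) + z₀,
      hP0.add_of_left hbd, hdeg ▸ hPo, hdeg ▸ hPn, ?_, fun i => ?_⟩
    · rw [hz₁]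
      linear_combination hr
    · rw [coeff_add]
      refine add_mem (coeff_C_mul_mem_sq hπI (fun j => ?_) i) (hz₀ i)
      rw [coeff_sub, coeff_C_mul]
      exact sub_mem (hz1 j) (I.mul_mem_right _ hπI)
  · right
    obtain ⟨A, hA1, hA2, -⟩ := exists_map_mk_eq A₁
    obtain ⟨B, hB1, hB2, -⟩ := exists_map_mk_eq B₁
    obtain ⟨ε, hε1⟩ := Ideal.Quotient.mk_surjective (I := I) (-ε₁)
    have hε1' : ρ ε = -ε₁ := hε1
    obtain ⟨r, z₀, hr, hz₀⟩ := exists_eq_C_mul_add hπ (p := F - A ^ 2 - C ε * B ^ 2)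
      (coeff_mem_of_map_mk_eq_zero (by
        simp only [Polynomial.map_sub, Polynomial.map_mul, Polynomial.map_pow, map_C, hA1, hB1]
        rw [hε1, hp, C_neg]; ring))
    set c := (C (2 : R ⧸ I)⁻¹ * (r.map ρ - 1) * u) with hc
    obtain ⟨g, hg1, hg2, -⟩ := exists_map_mk_eq (c % B₁)
    obtain ⟨q, hq1, -, -⟩ := exists_map_mk_eq ((r.map ρ - 1) * w + 2 * A₁ * (c / B₁))
    have h22 : (2 : (R ⧸ I)[X]) * C (2 : R ⧸ I)⁻¹ = 1 := by
      rw [← map_ofNat (C : (R ⧸ I) →+* (R ⧸ I)[X]) 2, ← C_mul, mul_inv_cancel₀ h2', C_1]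
    rw [← hρ] at hA1 hB1 hg1 hq1
    have hkey : (r - 2 * A * g - 1 - B * q).map ρ = 0 := by
      simp only [Polynomial.map_sub, Polynomial.map_mul, Polynomial.map_one, Polynomial.map_ofNat,
        hg1, hA1, hB1, hq1]
      have hdiv := EuclideanDomain.div_add_mod c B₁
      linear_combination (r.map ρ - 1) * (-huw) - 2 * A₁ * hdiv -
        (r.map ρ - 1) * A₁ * u * h22 + 2 * A₁ * hc
    set z₁ := r - 2 * A * g - 1 - B * q with hz₁
    have hz1 := coeff_mem_of_map_mk_eq_zero hkey
    have hB0 : B₁ ≠ 0 := fun h => hBn (by rw [h, coeff_zero])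
    have hgn : g.natDegree ≤ n := by
      rw [hg2]
      exact (natDegree_le_natDegree (EuclideanDomain.mod_lt c hB0).le).trans hB
    refine ⟨ε, A + C π * g, B, q, C π * (z₁ - C π * g ^ 2) + z₀, ?_, ?_, hB2.trans_le hB, ?_, ?_,
      fun i => ?_⟩
    · rw [← hker, hε1', neg_eq_zero]; exact hε
    · exact natDegree_add_le_of_degree_le (hA2.trans_le hA) ((natDegree_C_mul_le _ _).trans hgn)
    · rw [← hker, ← coeff_map, hB1]; exact hBn
    · rw [hz₁]
      linear_combination hr
    · rw [coeff_add]
      refine add_mem (coeff_C_mul_mem_sq hπI (fun j => ?_) i) (hz₀ i)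
      rw [coeff_sub, coeff_C_mul]
      exact sub_mem (hz1 j) (I.mul_mem_right _ hπI)

end Lift

section Local

open Polynomial NumberField IsDedekindDomain

universe u

variable {k : Type u} [Field k] [NumberField k]

def LocalGood (v : HeightOneSpectrum (𝓞 k)) (f : k[X]) (n : ℕ) : Prop :=
  ∃ g₀ : k[X], g₀.natDegree ≤ n ∧ ∃ D : WithZero (Multiplicative ℤ), D ≠ 0 ∧
    ∀ g : k[X], g.natDegree ≤ n → (∀ i, v.valuation k ((g - g₀).coeff i) ≤ D) → LocallyEven v f g

variable {v : HeightOneSpectrum (𝓞 k)}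

theorem exists_uniformizer_sup :
    ∃ π : 𝓞 k, v.valuation k (π : k) = WithZero.exp (-1 : ℤ) ∧ π ∈ v.asIdeal ∧
      v.asIdeal ≤ Ideal.span {π} ⊔ v.asIdeal ^ 2 := by
  obtain ⟨π, hπ⟩ := v.intValuation_exists_uniformizer
  have hπ1 : π ∈ v.asIdeal := by
    rw [← v.intValuation_lt_one_iff_mem, hπ]; exact WithZero.exp_lt_exp.2 (by norm_num)
  have hπ2 : π ∉ v.asIdeal ^ 2 := by
    rw [← v.intValuation_le_pow_iff_mem, hπ, WithZero.exp_le_exp]; norm_num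
  refine ⟨π, by rw [v.valuation_of_algebraMap, hπ], hπ1, fun x hx => ?_⟩
  obtain ⟨d, e, he, h⟩ := Ideal.exists_mul_add_mem_pow_succ (P := v.asIdeal) (i := 1) v.ne_bot (a := π) (c := x)
    (by rwa [pow_one]) hπ2 (by rwa [pow_one])
  rw [← h]
  exact Submodule.add_mem_sup (Ideal.mem_span_singleton'.2 ⟨d, mul_comm _ _⟩) he

theorem valuation_map_coeff_lt {z : (𝓞 k)[X]} (hz : ∀ i, z.coeff i ∈ v.asIdeal ^ 2) (i : ℕ) :
    v.valuation k ((z.map (algebraMap (𝓞 k) k)).coeff i) < WithZero.exp (-1 : ℤ) := by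
  rw [coeff_map, v.valuation_of_algebraMap]
  refine ((v.intValuation_le_pow_iff_mem _ 2).2 (hz i)).trans_lt (WithZero.exp_lt_exp.2 ?_)
  norm_num

theorem valuation_map_coeff_le (z : (𝓞 k)[X]) (i : ℕ) :
    v.valuation k ((z.map (algebraMap (𝓞 k) k)).coeff i) ≤ 1 := by
  rw [coeff_map]; exact v.valuation_le_one _

theorem valuation_eq_one_of_notMem {x : 𝓞 k} (hx : x ∉ v.asIdeal) : v.valuation k (x : k) = 1 := by
  refine le_antisymm (v.valuation_le_one x) (not_lt.1 fun h => hx ?_)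
  exact (v.valuation_lt_one_iff_mem x).1 h

theorem localGood_of_squarefree {F : (𝓞 k)[X]} {n : ℕ} (hno : Odd n) (hn : F.natDegree ≤ 2 * n)
    (h2 : (2 : 𝓞 k) ∉ v.asIdeal) (hl : F.coeff (2 * n) ∉ v.asIdeal)
    (hs : Squarefree (F.map (Ideal.Quotient.mk v.asIdeal))) :
    LocalGood v (F.map (algebraMap (𝓞 k) k)) n := by
  obtain ⟨π, hπv, hπI, hπ⟩ := exists_uniformizer_sup (v := v)
  have := v.isMaximal
  have hfin : Finite (𝓞 k ⧸ v.asIdeal) := Ideal.finiteQuotientOfFreeOfNeBot _ v.ne_bot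
  set φ := algebraMap (𝓞 k) k
  have hπs := not_isSquare_uniformizer hπv
  have hf : (F.map φ).natDegree ≤ 2 * n := natDegree_map_le.trans hn
  rcases exists_factor_or_eisenstein hπI hπ h2 hn hl hs with
    ⟨P, q, z, hP, hPo, hPn, hF, hz⟩ | ⟨ε, A, B, q, z, hε, hA, hB, hBn, hF, hz⟩
  · obtain ⟨m, hm⟩ : ∃ m, (P.map φ).natDegree + 2 * m = n := by
      rw [hP.natDegree_map]
      obtain ⟨a, ha⟩ := hno
      obtain ⟨b, hb⟩ := hPo
      exact ⟨a - b, by omega⟩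
    obtain ⟨g₀, h1, h2⟩ := exists_locallyEven_of_factor (v := v) (f := F.map φ) hf (P := P.map φ)
      (q := q.map φ) (z := z.map φ) (y := (π : k)) (hP.map φ) (valuation_map_coeff_le P) hm
      (by rw [hF, Polynomial.map_add, Polynomial.map_add, Polynomial.map_mul, map_C])
      (by rw [hπv]; exact valuation_map_coeff_lt hz) hπs
    exact ⟨g₀, h1, 1, one_ne_zero, h2⟩
  · refine ⟨A.map φ, natDegree_map_le.trans hA, WithZero.exp (-2 : ℤ), WithZero.exp_ne_zero,
      fun g hg hgi => ?_⟩
    refine locallyEven_of_eisenstein (v := v) (f := F.map φ) hf (g₀ := A.map φ) (B := B.map φ)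
      (q := q.map φ) (z := z.map φ) (ε := (ε : k)) (π := (π : k)) (valuation_map_coeff_le A)
      (natDegree_map_le.trans hB) (valuation_map_coeff_le B) ?_ (valuation_eq_one_of_notMem hε)
      (valuation_map_coeff_le q) ?_ hπs ?_ ?_ hg fun i => ?_
    · rw [coeff_map]; exact valuation_eq_one_of_notMem hBn
    · rw [hπv]; exact WithZero.exp_lt_exp.2 (by norm_num)
    · rw [hπv]; exact valuation_map_coeff_lt hz
    · have := congr_arg (Polynomial.map φ) hF
      simpa only [Polynomial.map_sub, Polynomial.map_pow, Polynomial.map_add, Polynomial.map_mul,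
        map_C, Polynomial.map_one] using this
    · rw [hπv]
      exact (hgi i).trans_lt (WithZero.exp_lt_exp.2 (by norm_num))

theorem localGood_of_even {f : k[X]} {n : ℕ} (hn : Even n) (hf : f.natDegree ≤ 2 * n) :
    LocalGood v f n := by
  obtain ⟨π, hπv, -, -⟩ := exists_uniformizer_sup (v := v)
  obtain ⟨m, rfl⟩ := hn
  obtain ⟨g₀, h1, h2⟩ := exists_locallyEven_of_factor (v := v) (f := f) hf (P := 1) (m := m)
    (q := f - C (π : k)) (z := 0) (y := (π : k)) monic_one (valuation_coeff_one_le _)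
    (by rw [natDegree_one]; omega) (by ring) (fun i => by
      rw [coeff_zero, map_zero, hπv]; exact WithZero.exp_pos) (not_isSquare_uniformizer hπv)
  exact ⟨g₀, h1, 1, one_ne_zero, h2⟩

end Local

section Degree

open NumberField IsDedekindDomain

variable {k Z : Type*} [Field k] [NumberField k] [Field Z] [NumberField Z] [Algebra k Z]
  {v : HeightOneSpectrum (𝓞 k)} {u : HeightOneSpectrum (𝓞 Z)}

theorem valuation_algebraMap_eq_pow (hu : u.asIdeal.LiesOver v.asIdeal) (x : k) :
    u.valuation Z (algebraMap k Z x) = v.valuation k x ^ u.asIdeal.ramificationIdx (𝓞 k) := by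
  rw [← Ideal.ramificationIdx'_eq_ramificationIdx v.asIdeal u.asIdeal]
  · exact (HeightOneSpectrum.valuation_liesOver Z v u x).symm
  · exact v.ne_bot

theorem exists_sub_mem_pow (hu : u.asIdeal.LiesOver v.asIdeal)
    (he : u.asIdeal.ramificationIdx (𝓞 k) = 1) (hf : u.asIdeal.inertiaDeg (𝓞 k) = 1) (m : ℕ)
    (x : 𝓞 Z) : ∃ y : 𝓞 k, x - algebraMap (𝓞 k) (𝓞 Z) y ∈ u.asIdeal ^ m := by
  have hres : ∀ x : 𝓞 Z, ∃ y : 𝓞 k, x - algebraMap (𝓞 k) (𝓞 Z) y ∈ u.asIdeal := by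
    intro x
    have hvm := v.isMaximal
    have hum := u.isMaximal
    let _ := Ideal.Quotient.field v.asIdeal
    rw [Ideal.inertiaDeg_eq_of_isMaximal v.asIdeal u.asIdeal] at hf
    obtain ⟨e⟩ := (Module.nonempty_algEquiv_iff_finrank_eq_one).2 hf
    obtain ⟨y, hy⟩ := Ideal.Quotient.mk_surjective (e.symm (Ideal.Quotient.mk u.asIdeal x))
    refine ⟨y, (Ideal.Quotient.eq).1 ?_⟩
    have h1 := e.commutes (Ideal.Quotient.mk v.asIdeal y)
    have h2 : Ideal.Quotient.mk u.asIdeal x = e (Ideal.Quotient.mk v.asIdeal y) := by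
      rw [hy, e.apply_symm_apply]
    rw [h2]
    exact h1
  obtain ⟨π, hπ, -, -⟩ := exists_uniformizer_sup (v := v)
  have hπ' : u.valuation Z ((algebraMap (𝓞 k) (𝓞 Z) π : 𝓞 Z) : Z) = WithZero.exp (-1 : ℤ) := by
    have := valuation_algebraMap_eq_pow hu (π : k)
    rw [he, pow_one, hπ] at this
    rw [← this]
    congr 1
  induction m with
  | zero => exact ⟨0, by simp⟩
  | succ m ih =>
    obtain ⟨y, hy⟩ := ih
    have hv : u.intValuation (algebraMap (𝓞 k) (𝓞 Z) π ^ m) = WithZero.exp (-(m : ℤ)) := by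
      have h := u.valuation_of_algebraMap (K := Z) (algebraMap (𝓞 k) (𝓞 Z) π)
      rw [map_pow, ← h]
      refine (congr_arg (· ^ m) hπ').trans ?_
      rw [← WithZero.exp_nsmul]
      simp
    obtain ⟨t, e, he, ht⟩ := Ideal.exists_mul_add_mem_pow_succ u.ne_bot (i := m)
      (algebraMap (𝓞 k) (𝓞 Z) π ^ m) (x - algebraMap (𝓞 k) (𝓞 Z) y)
      ((u.intValuation_le_pow_iff_mem _ _).1 hv.le)
      (fun h => by
        have := (u.intValuation_le_pow_iff_mem _ _).2 h
        rw [hv, WithZero.exp_le_exp] at this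
        push_cast at this
        omega) hy
    obtain ⟨y', hy'⟩ := hres t
    refine ⟨y + π ^ m * y', ?_⟩
    have : x - algebraMap (𝓞 k) (𝓞 Z) (y + π ^ m * y') =
        algebraMap (𝓞 k) (𝓞 Z) π ^ m * (t - algebraMap (𝓞 k) (𝓞 Z) y') + e := by
      rw [map_add, map_mul, map_pow]
      linear_combination -ht
    rw [this, pow_succ]
    exact add_mem (Ideal.mul_mem_mul ((u.intValuation_le_pow_iff_mem _ _).1 hv.le) hy')
      (by rwa [← pow_succ])

theorem exists_valuation_sub_le (hu : u.asIdeal.LiesOver v.asIdeal)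
    (he : u.asIdeal.ramificationIdx (𝓞 k) = 1) (hf : u.asIdeal.inertiaDeg (𝓞 k) = 1) (x : Z)
    {D : WithZero (Multiplicative ℤ)} (hD : D ≠ 0) :
    ∃ y : k, u.valuation Z (x - algebraMap k Z y) ≤ D := by
  have hval : ∀ x : k, u.valuation Z (algebraMap k Z x) = v.valuation k x := fun x => by
    rw [valuation_algebraMap_eq_pow hu, he, pow_one]
  have hzint : ∀ (x : Z) (D : WithZero (Multiplicative ℤ)), u.valuation Z x ≤ 1 → D ≠ 0 →
      ∃ y : k, u.valuation Z (x - algebraMap k Z y) ≤ D := by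
    intro x D hx hD
    obtain ⟨a, ha⟩ := u.exists_valuation_sub_lt_of_integer hx (Units.mk0 D hD)
    obtain ⟨y, hy⟩ := exists_sub_mem_pow hu he hf (-WithZero.log D).toNat a
    refine ⟨(y : k), ?_⟩
    have h1 : u.valuation Z ((a : Z) - ((algebraMap (𝓞 k) (𝓞 Z) y : 𝓞 Z) : Z)) ≤ _ :=
      (u.valuation_of_algebraMap (K := Z) _).trans_le ((u.intValuation_le_pow_iff_mem _ _).2 hy)
    have h2 : WithZero.exp (-((-WithZero.log D).toNat : ℤ)) ≤ D := by
      conv_rhs => rw [← WithZero.exp_log hD]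
      rw [WithZero.exp_le_exp]; omega
    have h3 : x - algebraMap k Z (y : k) = (algebraMap (𝓞 Z) Z a - algebraMap (𝓞 Z) Z
        (algebraMap (𝓞 k) (𝓞 Z) y)) - (algebraMap (𝓞 Z) Z a - x) := by
      rw [show algebraMap (𝓞 Z) Z (algebraMap (𝓞 k) (𝓞 Z) y) = algebraMap k Z (y : k) from rfl]
      ring
    rw [h3]
    exact (Valuation.map_sub _ _ _).trans (max_le (h1.trans h2) ha.le)
  rcases eq_or_ne x 0 with rfl | hx
  · exact ⟨0, by simp⟩
  have hx0 : u.valuation Z x ≠ 0 := (Valuation.ne_zero_iff _).2 hx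
  obtain ⟨c, hc⟩ := v.valuation_surjective k (u.valuation Z x)
  have hc0 : algebraMap k Z c ≠ 0 := by
    rw [← (u.valuation Z).ne_zero_iff, hval, hc]; exact hx0
  obtain ⟨y, hy⟩ := hzint (x / algebraMap k Z c) (D / u.valuation Z x) (by
    rw [map_div₀, hval, hc, div_self hx0]) (div_ne_zero hD hx0)
  refine ⟨c * y, ?_⟩
  have : x - algebraMap k Z (c * y) = algebraMap k Z c * (x / algebraMap k Z c - algebraMap k Z y) := by
    rw [map_mul]; field_simp
  rw [this, map_mul, hval, hc]
  exact (mul_le_mul' le_rfl hy).trans_eq (mul_div_cancel₀ _ hx0)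

end Degree

section OddFactor

open Polynomial NumberField IsDedekindDomain

universe u

variable {k Z : Type u} [Field k] [NumberField k] [Field Z] [NumberField Z] [Algebra k Z]
  {v : HeightOneSpectrum (𝓞 k)} {u : HeightOneSpectrum (𝓞 Z)}

theorem exists_polynomial_valuation_sub_le (hu : u.asIdeal.LiesOver v.asIdeal)
    (he : u.asIdeal.ramificationIdx (𝓞 k) = 1) (hf : u.asIdeal.inertiaDeg (𝓞 k) = 1) (p : Z[X])
    {D : WithZero (Multiplicative ℤ)} (hD : D ≠ 0) :
    ∃ q : k[X], q.degree ≤ p.degree ∧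
      ∀ i, u.valuation Z ((p - q.map (algebraMap k Z)).coeff i) ≤ D := by
  choose y hy using fun i => exists_valuation_sub_le hu he hf (p.coeff i) hD
  have hc : ∀ i, (∑ j ∈ p.support, monomial j (y j)).coeff i = if i ∈ p.support then y i else 0 := by
    intro i
    simp [finsetSum_coeff, coeff_monomial]
  refine ⟨∑ j ∈ p.support, monomial j (y j), ?_, fun i => ?_⟩
  · refine (degree_le_iff_coeff_zero _ _).2 fun i hi => ?_
    rw [hc, if_neg]
    rw [mem_support_iff, not_not]
    exact coeff_eq_zero_of_degree_lt hi
  · rw [coeff_sub, coeff_map, hc]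
    split_ifs with h
    · exact hy i
    · rw [notMem_support_iff.1 h, map_zero, sub_zero, map_zero]; exact zero_le

theorem localGood_of_odd_factor (hu : u.asIdeal.LiesOver v.asIdeal)
    (he : u.asIdeal.ramificationIdx (𝓞 k) = 1) (hfu : u.asIdeal.inertiaDeg (𝓞 k) = 1) {f : k[X]}
    {n : ℕ} (hn : f.natDegree ≤ 2 * n) (hno : Odd n) {P Q : Z[X]} (hP : P.Monic)
    (hPi : ∀ i, u.valuation Z (P.coeff i) ≤ 1) (hPo : Odd P.natDegree) (hPn : P.natDegree ≤ n)
    (hPQ : IsCoprime P Q) (hf : f.map (algebraMap k Z) = P * Q) : LocalGood v f n := by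
  have hval : ∀ x : k, u.valuation Z (algebraMap k Z x) = v.valuation k x := fun x => by
    rw [valuation_algebraMap_eq_pow hu, he, pow_one]
  set φ := algebraMap k Z
  set V := u.valuation Z
  obtain ⟨m, hm⟩ : ∃ m, P.natDegree + 2 * m = n := by
    obtain ⟨a, ha⟩ := hno
    obtain ⟨b, hb⟩ := hPo
    exact ⟨a - b, by omega⟩
  have hP1 : P ≠ 1 := fun h => by rw [h, natDegree_one] at hPo; exact absurd hPo (by decide)
  obtain ⟨A₁, B₁, hB₁, hAB⟩ : ∃ A₁ B₁ : Z[X], B₁.degree < P.degree ∧ A₁ * P + B₁ * Q = -1 := by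
    obtain ⟨A, B, hAB⟩ := hPQ
    refine ⟨-A - ((B /ₘ P) * Q), -(B %ₘ P), ?_, ?_⟩
    · rw [degree_neg]; exact degree_modByMonic_lt _ hP
    · have := modByMonic_add_div B P
      linear_combination -hAB - Q * this
  obtain ⟨W₁, hW₁, hA⟩ := exists_valuation_coeff_le V A₁
  obtain ⟨W₂, hW₂, hB⟩ := exists_valuation_coeff_le V B₁
  obtain ⟨W₃, hW₃, hQ⟩ := exists_valuation_coeff_le V Q
  obtain ⟨π, hπ, -, -⟩ := exists_uniformizer_sup (v := v)
  have hW : W₁ * W₂ ≠ 0 := mul_ne_zero (zero_lt_one.trans_le hW₁).ne' (zero_lt_one.trans_le hW₂).ne'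
  obtain ⟨j, hj⟩ : ∃ j : ℕ, WithZero.exp (-1 : ℤ) ^ (2 * j + 1) * (W₁ * W₂) < 1 := by
    obtain ⟨l, hl⟩ : ∃ l : ℤ, W₁ * W₂ = WithZero.exp l := ⟨_, (WithZero.exp_log hW).symm⟩
    refine ⟨l.toNat, ?_⟩
    rw [hl, ← WithZero.exp_nsmul, ← WithZero.exp_add, ← WithZero.exp_zero, WithZero.exp_lt_exp]
    simp only [nsmul_eq_mul]
    push_cast
    omega
  set y : k := (π : k) ^ (2 * j + 1) with hy
  have hvy : v.valuation k y = WithZero.exp (-1 : ℤ) ^ (2 * j + 1) := by rw [hy, map_pow, hπ]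
  have hys : ¬ IsSquare (v.valuation k y) := by
    rw [hvy, pow_succ, pow_mul', ← hπ]
    rintro ⟨r, hr⟩
    have h0 : v.valuation k (π : k) ^ j ≠ 0 := by rw [hπ]; exact pow_ne_zero _ WithZero.exp_ne_zero
    refine not_isSquare_uniformizer hπ ⟨r / v.valuation k (π : k) ^ j, ?_⟩
    rw [div_mul_div_comm, ← hr, ← sq, mul_div_cancel_left₀ _ (pow_ne_zero _ h0)]
  have hVy : V (φ y) * (W₁ * W₂) < 1 := by rw [hval, hvy]; exact hj
  have hy0 : V (φ y) ≠ 0 := by rw [hval]; exact fun h => hys (h ▸ IsSquare.zero)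
  have hyW : V (φ y) * W₂ ≤ 1 := by
    refine le_trans (mul_le_mul' le_rfl ?_) hVy.le
    exact le_mul_of_one_le_left' hW₁
  have hy1 : V (φ y) ≤ 1 := le_trans (le_mul_of_one_le_right' hW₂) hyW
  have hyW₁ : V (φ y) * W₁ ≤ 1 := by
    refine le_trans (mul_le_mul' le_rfl ?_) hVy.le
    exact le_mul_of_one_le_right' hW₂
  set P' := P + C (φ y) * B₁ with hP'
  set Q' := Q + C (φ y) * A₁ with hQ'
  have hB₁' : (C (φ y) * B₁).degree < P.degree := by
    refine lt_of_le_of_lt ?_ hB₁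
    rw [← smul_eq_C_mul]
    exact degree_smul_le _ _
  have hP'm : P'.Monic := hP.add_of_left hB₁'
  have hP'd : P'.degree = P.degree := degree_add_eq_left_of_degree_lt hB₁'
  have hP'i : ∀ i, V (P'.coeff i) ≤ 1 := valuation_coeff_add_le V hPi fun i => by
    rw [coeff_C_mul, map_mul]; exact (mul_le_mul' le_rfl (hB i)).trans hyW
  have hQ'i : ∀ i, V (Q'.coeff i) ≤ W₃ := valuation_coeff_add_le V hQ fun i => by
    rw [coeff_C_mul, map_mul]; exact ((mul_le_mul' le_rfl (hA i)).trans hyW₁).trans hW₃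
  have hW₃0 : W₃ ≠ 0 := (zero_lt_one.trans_le hW₃).ne'
  set D := V (φ y) * WithZero.exp (-1 : ℤ) / W₃ with hD
  have hD0 : D ≠ 0 := div_ne_zero (mul_ne_zero hy0 WithZero.exp_ne_zero) hW₃0
  have hexp : WithZero.exp (-1 : ℤ) < (1 : WithZero (Multiplicative ℤ)) := by
    rw [← WithZero.exp_zero]; exact WithZero.exp_lt_exp.2 (by norm_num)
  have hDW : D * W₃ < V (φ y) := by
    rw [hD, div_mul_cancel₀ _ hW₃0]
    exact mul_lt_of_lt_one_right (zero_lt_iff.2 hy0) hexp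
  have hDy : D < V (φ y) := lt_of_le_of_lt (le_mul_of_one_le_right' hW₃) hDW
  obtain ⟨P₀, hP₀d, hP₀⟩ := exists_polynomial_valuation_sub_le hu he hfu (P' - X ^ P'.natDegree) hD0
  obtain ⟨Q₀, -, hQ₀⟩ := exists_polynomial_valuation_sub_le hu he hfu Q' hD0
  set d := P'.natDegree with hd
  have hd0 : d = P.natDegree := natDegree_eq_natDegree hP'd
  have hlt : P₀.degree < (X ^ d : k[X]).degree := by
    refine hP₀d.trans_lt ?_
    rw [degree_X_pow]
    have := degree_sub_lt_left (p := P') (q := X ^ d) (by rw [degree_X_pow, hd, degree_eq_natDegree hP'm.ne_zero])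
      hP'm.ne_zero (by rw [hP'm.leadingCoeff, leadingCoeff_X_pow])
    rwa [degree_eq_natDegree hP'm.ne_zero] at this
  set P₁ := X ^ d + P₀ with hP₁
  have hP₁m : P₁.Monic := (monic_X_pow d).add_of_left hlt
  have hP₁d : P₁.natDegree = P.natDegree := by
    rw [hP₁, natDegree_add_eq_left_of_degree_lt hlt, natDegree_X_pow, hd0]
  have hPe : ∀ i, V ((P' - P₁.map φ).coeff i) ≤ D := fun i => by
    rw [hP₁, Polynomial.map_add, Polynomial.map_pow, map_X, ← sub_sub]; exact hP₀ i
  have hP₁i : ∀ i, V ((P₁.map φ).coeff i) ≤ 1 := fun i => by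
    rw [← sub_sub_cancel P' (P₁.map φ), coeff_sub]
    exact (V.map_sub _ _).trans (max_le (hP'i i) ((hPe i).trans (hDy.le.trans hy1)))
  set z := f - P₁ * Q₀ - C y with hz
  have hzlt : ∀ i, V ((z.map φ).coeff i) < V (φ y) := by
    have hze : z.map φ = (P' - P₁.map φ) * Q' + P₁.map φ * (Q' - Q₀.map φ) -
        C (φ y) * (C (φ y) * (A₁ * B₁)) := by
      rw [hz, Polynomial.map_sub, Polynomial.map_sub, Polynomial.map_mul, map_C, hf, hP', hQ']
      linear_combination (-C (φ y)) * hAB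
    intro i
    rw [hze, coeff_sub, coeff_add]
    refine V.map_sub_lt (V.map_add_lt ?_ ?_) ?_
    · exact (valuation_coeff_mul_le V hPe hQ'i i).trans_lt hDW
    · exact (valuation_coeff_mul_le V hP₁i hQ₀ i).trans_lt (by rwa [one_mul])
    · rw [coeff_C_mul, coeff_C_mul, map_mul, map_mul]
      refine mul_lt_of_lt_one_right (zero_lt_iff.2 hy0) (lt_of_le_of_lt ?_ hVy)
      exact mul_le_mul' le_rfl (valuation_coeff_mul_le V hA hB i)
  obtain ⟨g₀, h1, h2⟩ := exists_locallyEven_of_factor (v := v) hn (P := P₁) (q := Q₀) (z := z)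
    (y := y) hP₁m (fun i => by rw [← hval, ← coeff_map]; exact hP₁i i) (hP₁d ▸ hm)
    (by rw [hz]; ring) (fun i => by rw [← hval, ← hval, ← coeff_map]; exact hzlt i) hys
  exact ⟨g₀, h1, 1, one_ne_zero, h2⟩

end OddFactor

section Decomposition

open NumberField IsDedekindDomain Polynomial MulAction
open scoped Pointwise

universe u

variable {k E : Type u} [Field k] [NumberField k] [Field E] [NumberField E] [Algebra k E]
  [IsGalois k E]

theorem card_stabilizer_asIdeal (v : HeightOneSpectrum (𝓞 k)) (W : HeightOneSpectrum (𝓞 E))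
    (hW : W.asIdeal.LiesOver v.asIdeal) :
    Nat.card (stabilizer Gal(E/k) W.asIdeal) =
      W.asIdeal.ramificationIdx (𝓞 k) * W.asIdeal.inertiaDeg (𝓞 k) := by
  have := v.isMaximal
  have : Finite (𝓞 k ⧸ v.asIdeal) := Ring.HasFiniteQuotients.finiteQuotient v.ne_bot
  rw [Ideal.card_stabilizer_eq v.asIdeal W.asIdeal,
    Ideal.ramificationIdxIn_eq_ramificationIdx v.asIdeal W.asIdeal Gal(E/k),
    Ideal.inertiaDegIn_eq_inertiaDeg v.asIdeal W.asIdeal Gal(E/k)]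

theorem exists_decompositionField (v : HeightOneSpectrum (𝓞 k)) (W : HeightOneSpectrum (𝓞 E))
    (hW : W.asIdeal.LiesOver v.asIdeal) :
    ∃ (Z : IntermediateField k E) (u : HeightOneSpectrum (𝓞 Z)), u.asIdeal.LiesOver v.asIdeal ∧
      u.asIdeal.ramificationIdx (𝓞 k) = 1 ∧ u.asIdeal.inertiaDeg (𝓞 k) = 1 ∧
      Module.finrank Z E = Nat.card (stabilizer Gal(E/k) W.asIdeal) ∧
      ∀ σ ∈ stabilizer Gal(E/k) W.asIdeal, ∀ z : Z, σ (z : E) = z := by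
  set D := stabilizer Gal(E/k) W.asIdeal with hD
  set Z : IntermediateField k E := FixedPoints.intermediateField D with hZ
  have hWm := W.isMaximal
  have hlies : W.asIdeal.LiesOver (W.asIdeal.under (𝓞 Z)) := inferInstance
  have hlies' : (W.asIdeal.under (𝓞 Z)).LiesOver v.asIdeal := by
    have := hW
    exact Ideal.LiesOver.tower_bot W.asIdeal _ v.asIdeal
  have hne : W.asIdeal.under (𝓞 Z) ≠ ⊥ := Ideal.ne_bot_of_liesOver_of_ne_bot v.ne_bot _
  have hm : (W.asIdeal.under (𝓞 Z)).IsMaximal := Ideal.IsMaximal.under (𝓞 Z) W.asIdeal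
  have hdec : IsDecompositionField k E W.asIdeal Z := inferInstanceAs
    (IsDecompositionField k E W.asIdeal
      (FixedPoints.intermediateField (stabilizer Gal(E/k) W.asIdeal) : IntermediateField k E))
  refine ⟨Z, ⟨W.asIdeal.under (𝓞 Z), hm.isPrime, hne⟩, hlies', ?_, ?_, ?_, fun σ hσ z => ?_⟩
  · exact IsDecompositionField.ramificationIdx_eq (𝓞 k) k E (p := v.asIdeal) W.asIdeal Z (𝓞 Z)
      (W.asIdeal.under (𝓞 Z)) v.ne_bot
  · exact IsDecompositionField.inertiaDeg_eq (𝓞 k) k E (p := v.asIdeal) W.asIdeal Z (𝓞 Z)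
      (W.asIdeal.under (𝓞 Z)) v.ne_bot
  · exact (IsGaloisGroup.card_eq_finrank D Z E).symm
  · exact z.2 ⟨σ, hσ⟩

theorem odd_natDegree_minpoly {K : Type u} [Field K] [NumberField K] [Algebra k K] [Algebra K E]
    [IsScalarTower k K E] {v : HeightOneSpectrum (𝓞 k)} {w : HeightOneSpectrum (𝓞 K)}
    {W : HeightOneSpectrum (𝓞 E)} (hw : w.asIdeal.LiesOver v.asIdeal)
    (hW : W.asIdeal.LiesOver w.asIdeal)
    (he : Odd (w.asIdeal.ramificationIdx (𝓞 k))) (hf : Odd (w.asIdeal.inertiaDeg (𝓞 k)))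
    {Z : IntermediateField k E}
    (hZ : Module.finrank Z E = Nat.card (stabilizer Gal(E/k) W.asIdeal))
    (hfix : ∀ σ ∈ stabilizer Gal(E/k) W.asIdeal, ∀ z : Z, σ (z : E) = z) {α : E}
    (hα : ∀ σ ∈ stabilizer Gal(E/K) W.asIdeal, σ α = α) : Odd (minpoly Z α).natDegree := by
  have hWv : W.asIdeal.LiesOver v.asIdeal := Ideal.LiesOver.trans W.asIdeal w.asIdeal v.asIdeal
  have hgal : IsGalois K E := IsGalois.tower_top_of_isGalois k K E
  rw [card_stabilizer_asIdeal v W hWv, Ideal.ramificationIdx_tower w.asIdeal W.asIdeal,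
    Ideal.inertiaDeg_tower w.asIdeal W.asIdeal, mul_mul_mul_comm,
    ← card_stabilizer_asIdeal w W hW] at hZ
  have hzint : IsIntegral Z α := Algebra.IsIntegral.isIntegral α
  rw [← IntermediateField.adjoin.finrank hzint]
  rw [← Module.finrank_mul_finrank Z (IntermediateField.adjoin Z {α}) E,
    ← IsGalois.card_fixingSubgroup_eq_finrank] at hZ
  have hmem : ∀ σ ∈ stabilizer Gal(E/K) W.asIdeal,
      σ.restrictScalars k ∈ stabilizer Gal(E/k) W.asIdeal := fun σ hσ => hσ
  let τ : stabilizer Gal(E/K) W.asIdeal →* Gal(E/Z) :=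
    { toFun := fun σ => AlgEquiv.ofRingEquiv (f := (σ : Gal(E/K)).toRingEquiv)
        fun z => hfix _ (hmem _ σ.2) z
      map_one' := by ext; rfl
      map_mul' := fun _ _ => by ext; rfl }
  have hτ : ∀ σ, τ σ ∈ (IntermediateField.adjoin Z {α}).fixingSubgroup := by
    intro σ
    rw [IntermediateField.mem_fixingSubgroup_iff]
    refine (IntermediateField.forall_mem_adjoin_smul_eq_self_iff Z (τ σ)).2 ?_
    rintro x rfl
    exact hα σ.1 σ.2
  have hdvd := Subgroup.card_dvd_of_injective (τ.codRestrict _ hτ) fun a b hab => by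
    have h1 := congr_arg Subtype.val hab
    ext x
    exact congr_arg (fun s : Gal(E/Z) => s x) h1
  obtain ⟨c, hc⟩ := hdvd
  have hpos : Nat.card (stabilizer Gal(E/K) W.asIdeal) ≠ 0 := Nat.card_pos.ne'
  rw [hc, mul_left_comm, mul_comm _ (Nat.card _)] at hZ
  have hodd : Odd (Module.finrank Z (IntermediateField.adjoin Z {α}) * c) := by
    rw [Nat.eq_of_mul_eq_mul_left (Nat.pos_of_ne_zero hpos) hZ]
    exact he.mul hf
  exact (Nat.odd_mul.1 hodd).1

theorem intValuation_smul_le (W : HeightOneSpectrum (𝓞 E)) {σ : Gal(E/k)}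
    (hσ : σ ∈ stabilizer Gal(E/k) W.asIdeal) (x : 𝓞 E) :
    W.intValuation (σ • x) ≤ W.intValuation x := by
  have hpow : ∀ (n : ℕ) (x : 𝓞 E), x ∈ W.asIdeal ^ n → σ • x ∈ W.asIdeal ^ n := by
    intro n x hx
    have h1 : σ • W.asIdeal ^ n = W.asIdeal ^ n := by
      rw [smul_pow', mem_stabilizer_iff.1 hσ]
    rw [← h1]
    exact Ideal.smul_mem_pointwise_smul σ x _ hx
  rcases eq_or_ne x 0 with rfl | hx
  · rw [smul_zero]
  obtain ⟨n, hn⟩ : ∃ n : ℕ, W.intValuation x = WithZero.exp (-(n : ℤ)) := by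
    have h0 := W.intValuation_ne_zero x hx
    have h1 := W.intValuation_le_one x
    refine ⟨(-WithZero.log (W.intValuation x)).toNat, ?_⟩
    rw [← WithZero.exp_log h0, ← WithZero.exp_zero, WithZero.exp_le_exp] at h1
    conv_lhs => rw [← WithZero.exp_log h0]
    rw [WithZero.exp_inj]
    omega
  rw [hn]
  exact (W.intValuation_le_pow_iff_mem _ _).2 (hpow n x ((W.intValuation_le_pow_iff_mem _ _).1 hn.le))

theorem valuation_apply_of_mem_stabilizer (W : HeightOneSpectrum (𝓞 E)) {σ : Gal(E/k)}
    (hσ : σ ∈ stabilizer Gal(E/k) W.asIdeal) (x : E) : W.valuation E (σ x) = W.valuation E x := by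
  have h : ∀ x : 𝓞 E, W.valuation E (σ (x : E)) = W.valuation E (x : E) := by
    intro x
    have h1 : W.intValuation (σ • x) = W.intValuation x := by
      refine le_antisymm (intValuation_smul_le W hσ x) ?_
      have h2 := intValuation_smul_le W (inv_mem hσ) (σ • x)
      rwa [inv_smul_smul] at h2
    have h3 := W.valuation_of_algebraMap (K := E) (σ • x)
    rw [h1, ← W.valuation_of_algebraMap (K := E) x] at h3
    exact h3
  obtain ⟨a, b, -, rfl⟩ := IsFractionRing.div_surjective (A := 𝓞 E) x
  rw [map_div₀, map_div₀, map_div₀, h, h]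

end Decomposition

section Dyadic

open NumberField IsDedekindDomain Polynomial MulAction
open scoped Pointwise

universe u

theorem sub_dvd_of_bezout {R : Type*} [CommRing R] [IsDomain R] {F A B : R[X]} {d α β : R}
    (h : A * F + B * derivative F = C d) (hα : F.eval α = 0) (hβ : F.eval β = 0) (hne : β ≠ α) :
    α - β ∣ d := by
  obtain ⟨H, hH⟩ := dvd_iff_isRoot.2 hα
  have h1 : H.eval β = 0 := by
    rw [hH, eval_mul, eval_sub, eval_X, eval_C] at hβ
    exact (mul_eq_zero.1 hβ).resolve_left (sub_ne_zero.2 hne)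
  have h2 : (derivative F).eval α = H.eval α := by
    rw [hH, derivative_mul]; simp
  have h3 := congr_arg (eval α) h
  rw [eval_add, eval_mul, eval_mul, hα, mul_zero, zero_add, eval_C, h2] at h3
  rw [← h3]
  refine Dvd.dvd.mul_left ?_ _
  have := sub_dvd_eval_sub α β H
  rwa [h1, sub_zero] at this

theorem exists_root_valuation_sub_lt {E Γ : Type*} [Field E] [LinearOrderedCommGroupWithZero Γ]
    (w : Valuation E Γ) {f : E[X]} (hf : f.Monic) (hs : f.Splits) {θ : E} {c : Γ}
    (h : w (f.eval θ) < c ^ f.natDegree) : ∃ α, f.eval α = 0 ∧ w (θ - α) < c := by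
  by_contra! hc
  refine absurd h (not_lt.2 ?_)
  rw [hs.natDegree_eq_card_roots]
  conv_rhs => rw [hs.eq_prod_roots_of_monic hf]
  rw [eval_multiset_prod, Multiset.map_map, map_multiset_prod, Multiset.map_map]
  have hroot : ∀ α ∈ f.roots, c ≤ w (θ - α) := fun α hα => hc α (mem_roots'.1 hα).2
  clear hs h hc
  generalize f.roots = s at hroot
  induction s using Multiset.induction with
  | empty => simp
  | cons a s ih =>
    rw [Multiset.card_cons, pow_succ', Multiset.map_cons, Multiset.prod_cons]
    refine mul_le_mul' ?_ (ih fun α hα => hroot α (Multiset.mem_cons_of_mem hα))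
    simpa using hroot a (Multiset.mem_cons_self a s)

theorem exists_sq_add_add_one_mem {k K : Type*} [Field k] [NumberField k] [Field K] [NumberField K]
    [Algebra k K] {v : HeightOneSpectrum (𝓞 k)} {w : HeightOneSpectrum (𝓞 K)}
    (hw : w.asIdeal.LiesOver v.asIdeal) (h2 : (2 : 𝓞 k) ∈ v.asIdeal)
    (hf : Even (w.asIdeal.inertiaDeg (𝓞 k))) : ∃ y : 𝓞 K, y ^ 2 + y + 1 ∈ w.asIdeal := by
  have hvm := v.isMaximal
  have hwm := w.isMaximal
  let _ : Field (𝓞 k ⧸ v.asIdeal) := Ideal.Quotient.field _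
  let _ : Field (𝓞 K ⧸ w.asIdeal) := Ideal.Quotient.field _
  have : Finite (𝓞 k ⧸ v.asIdeal) := Ring.HasFiniteQuotients.finiteQuotient v.ne_bot
  have : Finite (𝓞 K ⧸ w.asIdeal) := Ring.HasFiniteQuotients.finiteQuotient w.ne_bot
  have hchar : CharP (𝓞 k ⧸ v.asIdeal) 2 := by
    refine CharTwo.of_one_ne_zero_of_two_eq_zero one_ne_zero ?_
    have := Ideal.Quotient.eq_zero_iff_mem.2 h2
    rwa [map_ofNat] at this
  let _ := Fintype.ofFinite (𝓞 k ⧸ v.asIdeal)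
  let _ := Fintype.ofFinite (𝓞 K ⧸ w.asIdeal)
  let _ := Fintype.ofFinite (𝓞 K ⧸ w.asIdeal)ˣ
  obtain ⟨m, -, hm⟩ := FiniteField.card (𝓞 k ⧸ v.asIdeal) 2
  obtain ⟨r, hr⟩ := hf
  rw [Ideal.inertiaDeg_eq_of_isMaximal v.asIdeal w.asIdeal] at hr
  have hcard : Fintype.card (𝓞 K ⧸ w.asIdeal) = 4 ^ ((m : ℕ) * r) := by
    rw [Module.card_eq_pow_finrank (K := 𝓞 k ⧸ v.asIdeal), hr, hm, ← two_mul, ← pow_mul,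
      mul_left_comm, pow_mul]
    norm_num
  have h3 : 3 ∣ Fintype.card (𝓞 K ⧸ w.asIdeal)ˣ := by
    rw [← Nat.card_eq_fintype_card, Nat.card_units, Nat.card_eq_fintype_card, hcard]
    simpa using Nat.sub_dvd_pow_sub_pow 4 1 ((m : ℕ) * r)
  have : Fact (Nat.Prime 3) := ⟨Nat.prime_three⟩
  obtain ⟨x, hx⟩ := exists_prime_orderOf_dvd_card 3 h3
  obtain ⟨y, hy⟩ := Ideal.Quotient.mk_surjective (x : 𝓞 K ⧸ w.asIdeal)
  refine ⟨y, Ideal.Quotient.eq_zero_iff_mem.1 ?_⟩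
  rw [map_add, map_add, map_pow, map_one, hy]
  have h1 : (x : 𝓞 K ⧸ w.asIdeal) ^ 3 = 1 := by
    rw [← Units.val_pow_eq_pow_val, ← hx, pow_orderOf_eq_one, Units.val_one]
  have hne : (x : 𝓞 K ⧸ w.asIdeal) - 1 ≠ 0 := by
    rw [sub_ne_zero]
    intro h
    rw [Units.val_eq_one.1 h, orderOf_one] at hx
    omega
  refine (mul_eq_zero.1 (?_ : ((x : 𝓞 K ⧸ w.asIdeal) - 1) * _ = 0)).resolve_left hne
  linear_combination h1

theorem valuation_coeff_le_one_of_mul_eq {k Z : Type*} [Field k] [NumberField k] [Field Z]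
    [NumberField Z] [Algebra k Z] (u : HeightOneSpectrum (𝓞 Z)) {F : (𝓞 k)[X]} (hF : F.Monic)
    {P Q : Z[X]} (hP : P.Monic) (h : (F.map (algebraMap (𝓞 k) k)).map (algebraMap k Z) = P * Q)
    (i : ℕ) : u.valuation Z (P.coeff i) ≤ 1 := by
  have h1 : (F.map (algebraMap (𝓞 k) (𝓞 Z))).map (algebraMap (𝓞 Z) Z) = P * Q := by
    rw [← h, Polynomial.map_map, Polynomial.map_map]
    rfl
  obtain ⟨G, hG⟩ := IsIntegrallyClosed.eq_map_mul_C_of_dvd Z (hF.map (algebraMap (𝓞 k) (𝓞 Z)))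
    (Dvd.intro _ h1.symm)
  rw [hP.leadingCoeff, C_1, mul_one] at hG
  rw [← hG, coeff_map]
  exact u.valuation_le_one _

section

variable {k : Type u} [Field k] [NumberField k] {v : HeightOneSpectrum (𝓞 k)}

theorem localGood_of_unramified_factor {a : 𝓞 k} (ha : a ≠ 0) {F A B : (𝓞 k)[X]} {d : 𝓞 k}
    (hd : d ≠ 0) (hF : F.Monic) (hAB : A * F + B * derivative F = C d) {n : ℕ} (hno : Odd n)
    (hn : F.natDegree = 2 * n) {Z : Type u} [Field Z] [NumberField Z] [Algebra k Z]
    {u : HeightOneSpectrum (𝓞 Z)} (hu : u.asIdeal.LiesOver v.asIdeal)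
    (he : u.asIdeal.ramificationIdx (𝓞 k) = 1) (hfu : u.asIdeal.inertiaDeg (𝓞 k) = 1)
    {P Q : Z[X]} (hP : P.Monic) (hPo : Odd P.natDegree)
    (h : (F.map (algebraMap (𝓞 k) k)).map (algebraMap k Z) = P * Q) :
    LocalGood v (C (a : k) * F.map (algebraMap (𝓞 k) k)) n := by
  have hQ : Q.Monic := hP.of_mul_monic_left (h ▸ (hF.map _).map _)
  have hdeg : P.natDegree + Q.natDegree = 2 * n := by
    rw [← hP.natDegree_mul hQ, ← h, (hF.map _).natDegree_map, hF.natDegree_map, hn]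
  have hd' : algebraMap k Z (d : k) ≠ 0 := by
    rw [_root_.map_ne_zero]
    exact_mod_cast hd
  have hcop : IsCoprime P Q := by
    have h1 := congr_arg (fun p => (p.map (algebraMap (𝓞 k) k)).map (algebraMap k Z)) hAB
    simp only [Polynomial.map_add, Polynomial.map_mul, ← derivative_map, h, map_C,
      derivative_mul] at h1
    have h2 : C (algebraMap k Z (d : k)) * C (algebraMap k Z (d : k))⁻¹ = 1 := by
      rw [← C_mul, mul_inv_cancel₀ hd', C_1]
    refine ⟨C (algebraMap k Z (d : k))⁻¹ * ((A.map (algebraMap (𝓞 k) k)).map (algebraMap k Z) * Q +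
      (B.map (algebraMap (𝓞 k) k)).map (algebraMap k Z) * derivative Q),
      C (algebraMap k Z (d : k))⁻¹ * ((B.map (algebraMap (𝓞 k) k)).map (algebraMap k Z) *
        derivative P), ?_⟩
    rw [← h2]
    linear_combination C (algebraMap k Z (d : k))⁻¹ * h1
  have ha' : algebraMap k Z (a : k) ≠ 0 := by
    rw [_root_.map_ne_zero]
    exact_mod_cast ha
  have hunit : IsUnit (C (algebraMap k Z (a : k))) := isUnit_C.2 (isUnit_iff_ne_zero.2 ha')
  have hfd : (C (a : k) * F.map (algebraMap (𝓞 k) k)).natDegree ≤ 2 * n :=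
    (natDegree_C_mul_le _ _).trans (natDegree_map_le.trans hn.le)
  have hzint := fun i => valuation_coeff_le_one_of_mul_eq u hF hP h i
  have hzint' := fun i => valuation_coeff_le_one_of_mul_eq u hF hQ (h.trans (mul_comm P Q)) i
  rcases le_or_gt P.natDegree n with hle | hlt
  · refine localGood_of_odd_factor hu he hfu hfd hno hP hzint hPo hle
      ((isCoprime_mul_unit_left_right hunit P Q).2 hcop) ?_
    rw [Polynomial.map_mul, h, map_C]
    ring
  · have hQo : Odd Q.natDegree := by
      have : Even (P.natDegree + Q.natDegree) := hdeg ▸ even_two_mul n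
      exact Nat.not_even_iff_odd.1 fun h' => Nat.not_even_iff_odd.2 hPo
        ((Nat.even_add.1 this).2 h')
    refine localGood_of_odd_factor hu he hfu hfd hno hQ hzint' hQo (by omega)
      ((isCoprime_mul_unit_left_right hunit Q P).2 hcop.symm) ?_
    rw [Polynomial.map_mul, h, map_C]
    ring

theorem exists_isGalois_splits (F : k[X]) (hF : F ≠ 0) (K : Type u) [Field K] [NumberField K]
    [Algebra k K] : ∃ (E : Type u) (_ : Field E) (_ : NumberField E) (_ : Algebra k E)
      (_ : IsGalois k E) (_ : Algebra K E) (_ : IsScalarTower k K E), (F.map (algebraMap k E)).Splits := by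
  obtain ⟨x, hx⟩ := Field.exists_primitive_element k K
  have hxi : IsIntegral k x := Algebra.IsIntegral.isIntegral x
  have h0 : F * minpoly k x ≠ 0 := mul_ne_zero hF (minpoly.ne_zero hxi)
  have hs := SplittingField.splits (F * minpoly k x)
  have hfin : FiniteDimensional k (F * minpoly k x).SplittingField := inferInstance
  have hchar : CharZero (F * minpoly k x).SplittingField :=
    charZero_of_injective_algebraMap (algebraMap k _).injective
  have : Normal k (F * minpoly k x).SplittingField := Normal.of_isSplittingField (F * minpoly k x)
  have hgal : IsGalois k (F * minpoly k x).SplittingField := ⟨⟩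
  have hnf : NumberField (F * minpoly k x).SplittingField :=
    { to_charZero := hchar, to_finiteDimensional := FiniteDimensional.trans ℚ k _ }
  rw [Polynomial.map_mul, Polynomial.splits_mul (by simpa using hF)
    (by simpa using minpoly.ne_zero hxi)] at hs
  obtain ⟨φ⟩ := IntermediateField.nonempty_algHom_of_adjoin_splits
    (K := (F * minpoly k x).SplittingField) (S := {x})
    (fun s hs' => by rw [Set.mem_singleton_iff.1 hs']; exact ⟨hxi, hs.2⟩) hx
  exact ⟨_, inferInstance, hnf, inferInstance, hgal, φ.toRingHom.toAlgebra,
    @IsScalarTower.of_algebraMap_eq _ _ _ _ _ _ _ (φ.toRingHom.toAlgebra) _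
      fun x => (φ.commutes x).symm, hs.1⟩

theorem localGood_of_two_mem {a : 𝓞 k} (ha : a ≠ 0) {F A B : (𝓞 k)[X]} {d : 𝓞 k}
    (hd : d ≠ 0) (hF : F.Monic) (hAB : A * F + B * derivative F = C d) {n : ℕ} (hno : Odd n)
    (hn : F.natDegree = 2 * n) (h2 : (2 : 𝓞 k) ∈ v.asIdeal) :
    LocalGood v (C (a : k) * F.map (algebraMap (𝓞 k) k)) n := by
  by_contra hnot
  have ha' : v.valuation k (a : k) ≠ 0 := by rw [Valuation.ne_zero_iff]; exact_mod_cast ha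
  have hd' : v.valuation k (d : k) ≠ 0 := by rw [Valuation.ne_zero_iff]; exact_mod_cast hd
  have h20 : v.valuation k (2 : k) ≠ 0 := by rw [Valuation.ne_zero_iff]; exact two_ne_zero
  refine hnot ⟨0, by simp, v.valuation k (2 * a * d ^ n), ?_, fun g hgn hg => ?_⟩
  · rw [map_mul, map_mul, map_pow]
    exact mul_ne_zero (mul_ne_zero h20 ha') (pow_ne_zero _ hd')
  intro K _ _ _ θ hθ w hw
  simp only [sub_zero] at hg
  rcases Nat.even_or_odd (w.asIdeal.ramificationIdx (𝓞 k)) with he | he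
  · left
    intro x
    rw [valuation_algebraMap_eq_pow hw]
    exact he.isSquare_pow _
  rcases Nat.even_or_odd (w.asIdeal.inertiaDeg (𝓞 k)) with hf | hf
  · right
    refine ⟨?_, exists_sq_add_add_one_mem hw h2 hf⟩
    rw [w.asIdeal.over_def v.asIdeal, Ideal.mem_comap, map_ofNat] at h2
    exact h2
  exfalso
  obtain ⟨E, _, _, _, _, _, _, hs⟩ := exists_isGalois_splits (F.map (algebraMap (𝓞 k) k))
    (hF.map _).ne_zero K
  have hgal : IsGalois K E := IsGalois.tower_top_of_isGalois k K E
  obtain ⟨⟨W', hW1, hW2⟩⟩ := (inferInstance : Nonempty (w.asIdeal.primesOver (𝓞 E)))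
  obtain ⟨W, hW⟩ : ∃ W : HeightOneSpectrum (𝓞 E), W.asIdeal.LiesOver w.asIdeal :=
    ⟨⟨W', hW1, Ideal.ne_bot_of_liesOver_of_ne_bot w.ne_bot _⟩, hW2⟩
  have hWv : W.asIdeal.LiesOver v.asIdeal := Ideal.LiesOver.trans W.asIdeal w.asIdeal v.asIdeal
  have hpos : W.asIdeal.ramificationIdx (𝓞 k) ≠ 0 := (Ideal.ramificationIdx_pos _ _).ne'
  obtain ⟨α, hα, hlt⟩ : ∃ α, ((F.map (algebraMap (𝓞 k) k)).map (algebraMap k E)).eval α = 0 ∧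
      W.valuation E (algebraMap K E θ - α) < W.valuation E (algebraMap k E (d : k)) := by
    refine exists_root_valuation_sub_lt _ ((hF.map _).map _) hs ?_
    rw [(hF.map _).natDegree_map, hF.natDegree_map, hn]
    set T := algebraMap K E θ
    set V := W.valuation E
    set f := (F.map (algebraMap (𝓞 k) k)).map (algebraMap k E) with hf'
    have hVa : V (algebraMap k E (a : k)) ≠ 0 := by
      rw [valuation_algebraMap_eq_pow hWv]; exact pow_ne_zero _ ha'
    have hVd : V (algebraMap k E (d : k)) ≠ 0 := by
      rw [valuation_algebraMap_eq_pow hWv]; exact pow_ne_zero _ hd'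
    have h4 : V (algebraMap k E ((2 * 2 * a : 𝓞 k) : k)) < 1 := by
      rw [valuation_algebraMap_eq_pow hWv]
      exact pow_lt_one' ((v.valuation_lt_one_iff_mem _).2
        (v.asIdeal.mul_mem_right _ (v.asIdeal.mul_mem_right _ h2))) hpos
    have hδ : V (algebraMap k E (2 * a * d ^ n)) ^ 2 = V (algebraMap k E (a : k)) *
        (V (algebraMap k E ((2 * 2 * a : 𝓞 k) : k)) * V (algebraMap k E (d : k)) ^ (2 * n)) := by
      simp only [← map_pow, ← map_mul]
      congr 2
      have h22 : ((2 : 𝓞 k) : k) = 2 := map_ofNat (algebraMap (𝓞 k) k) 2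
      push_cast [h22]
      ring
    have hlt : V (algebraMap k E (2 * a * d ^ n)) ^ 2 <
        V (algebraMap k E (a : k)) * V (algebraMap k E (d : k)) ^ (2 * n) := by
      rw [hδ]
      refine (mul_lt_mul_iff_right₀ (zero_lt_iff.2 hVa)).2 ?_
      exact mul_lt_of_lt_one_left (zero_lt_iff.2 (pow_ne_zero _ hVd)) h4
    have hcoef : ∀ i, V ((g.map (algebraMap k E)).coeff i) ≤
        V (algebraMap k E (2 * a * d ^ n)) := by
      intro i
      rw [coeff_map, valuation_algebraMap_eq_pow hWv, valuation_algebraMap_eq_pow hWv]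
      exact pow_le_pow_left' (hg i) _
    have heq : V (algebraMap k E (a : k)) * V (f.eval T) =
        V ((g.map (algebraMap k E)).eval T) ^ 2 := by
      rw [← map_mul, ← map_pow]
      congr 1
      have := congr_arg (algebraMap K E) hθ
      rw [map_pow, ← aeval_algebraMap_apply, ← aeval_algebraMap_apply, map_mul, aeval_C] at this
      rw [hf', eval_map_algebraMap, eval_map_algebraMap]
      exact this
    rcases le_or_gt (V T) 1 with hT | hT
    · have h5 := pow_le_pow_left' (valuation_eval_le V hT hcoef) 2
      rw [← heq] at h5
      exact (mul_lt_mul_iff_right₀ (zero_lt_iff.2 hVa)).1 (h5.trans_lt hlt)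
    · exfalso
      have h5 := pow_le_pow_left' (valuation_eval_le_pow V hT.le (natDegree_map_le.trans hgn)
        hcoef) 2
      have h6 : V (f.eval T) = V T ^ (2 * n) := by
        refine valuation_eval_eq_pow V hT (natDegree_map_le.trans (natDegree_map_le.trans hn.le))
          (fun i => ?_) ?_
        · rw [coeff_map, coeff_map]
          rw [valuation_algebraMap_eq_pow hWv]
          exact pow_le_one' (v.valuation_le_one _) _
        · rw [← hn, coeff_map, coeff_map, hF.coeff_natDegree, map_one, map_one, map_one]
      have hT0 : 0 < V T ^ (2 * n) := zero_lt_iff.2 (pow_ne_zero _ (zero_lt_one.trans hT).ne')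
      rw [← heq, h6, mul_pow, ← pow_mul, mul_comm n 2] at h5
      have h7 := (mul_le_mul_iff_left₀ hT0).1 h5
      refine absurd (h7.trans_lt hlt) (not_lt.2 (mul_le_of_le_one_right' (pow_le_one' ?_ _)))
      rw [valuation_algebraMap_eq_pow hWv]
      exact pow_le_one' (v.valuation_le_one _) _
  obtain ⟨Z, u, hu, hue, huf, hZ, hfix⟩ := exists_decompositionField v W hWv
  have hmap : (F.map (algebraMap (𝓞 k) k)).map (algebraMap k E) =
      (F.map (algebraMap (𝓞 k) (𝓞 E))).map (algebraMap (𝓞 E) E) := by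
    rw [Polynomial.map_map, Polynomial.map_map]
    rfl
  have hαi : IsIntegral ℤ α := by
    refine isIntegral_trans (R := ℤ) (A := 𝓞 E) α
      ⟨F.map (algebraMap (𝓞 k) (𝓞 E)), hF.map _, ?_⟩
    rw [hmap, eval_map] at hα
    exact hα
  have hfixα : ∀ σ ∈ stabilizer Gal(E/K) W.asIdeal, σ α = α := by
    intro σ hσ
    by_contra hne
    have h1 : W.valuation E (algebraMap K E θ - σ α) <
        W.valuation E (algebraMap k E (d : k)) := by
      have h3 := valuation_apply_of_mem_stabilizer W hσ (algebraMap K E θ - α)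
      rw [map_sub, AlgEquiv.commutes] at h3
      rwa [h3]
    have h3 : W.valuation E (α - σ α) < W.valuation E (algebraMap k E (d : k)) := by
      have := Valuation.map_sub_lt _ h1 hlt
      rwa [sub_sub_sub_cancel_left] at this
    obtain ⟨α₀, hα₀⟩ : ∃ x : 𝓞 E, (x : E) = α := ⟨⟨α, hαi⟩, rfl⟩
    have hroot : ∀ x : 𝓞 E, ((F.map (algebraMap (𝓞 k) k)).map (algebraMap k E)).eval (x : E) = 0 →
        (F.map (algebraMap (𝓞 k) (𝓞 E))).eval x = 0 := by
      intro x hx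
      rw [hmap, eval_map_algebraMap, aeval_algebraMap_apply, coe_aeval_eq_eval] at hx
      exact (FaithfulSMul.algebraMap_injective (𝓞 E) E) (hx.trans (map_zero _).symm)
    have h4 : ((F.map (algebraMap (𝓞 k) k)).map (algebraMap k E)).eval (σ α) = 0 := by
      have h := aeval_algHom_apply (σ.restrictScalars k) α (F.map (algebraMap (𝓞 k) k))
      rw [← eval_map_algebraMap, ← eval_map_algebraMap, hα, map_zero] at h
      exact h
    have hσα : ((σ • α₀ : 𝓞 E) : E) = σ α := by rw [← hα₀]; rfl
    have h5 : α₀ - σ • α₀ ∣ algebraMap (𝓞 k) (𝓞 E) d := by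
      refine sub_dvd_of_bezout (F := F.map (algebraMap (𝓞 k) (𝓞 E)))
        (A := A.map (algebraMap (𝓞 k) (𝓞 E))) (B := B.map (algebraMap (𝓞 k) (𝓞 E))) ?_
        (hroot _ (hα₀ ▸ hα)) (hroot _ (hσα ▸ h4)) ?_
      · rw [derivative_map, ← Polynomial.map_mul, ← Polynomial.map_mul, ← Polynomial.map_add, hAB,
          map_C]
      · intro h
        rw [h, hα₀] at hσα
        exact hne hσα.symm
    obtain ⟨c, hc⟩ := h5
    have h6 : algebraMap k E (d : k) = (α - σ α) * (c : E) := by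
      rw [← hσα, ← hα₀]
      exact congr_arg (fun x : 𝓞 E => (x : E)) hc
    rw [h6, map_mul] at h3
    exact absurd h3 (not_lt.2 (mul_le_of_le_one_right' (W.valuation_le_one c)))
  have hodd := odd_natDegree_minpoly hw hW he hf hZ hfix hfixα
  have hZi : IsIntegral Z α := Algebra.IsIntegral.isIntegral α
  obtain ⟨Q, hQ⟩ := minpoly.dvd Z α (p := (F.map (algebraMap (𝓞 k) k)).map (algebraMap k Z)) (by
    rw [aeval_map_algebraMap, ← eval_map_algebraMap]
    exact hα)
  exact hnot (localGood_of_unramified_factor ha hd hF hAB hno hn hu hue huf (minpoly.monic hZi)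
    hodd hQ)

end

end Dyadic

section Global

open NumberField IsDedekindDomain Polynomial

universe u

variable {k : Type u} [Field k] [NumberField k]

theorem isRatSumFour_of_local (σ₀ : k →+* ℝ) {q : k[X]} (hm : q.Monic) (hirr : Irreducible q)
    (hreal : ∀ (σ : k →+* ℝ) (x : ℝ), (q.map σ).eval x ≠ 0) {c : ℤ} (hc : Odd c)
    (hloc : ∀ (K : Type u) [Field K] [NumberField K] [Algebra k K] (θ : K), aeval θ q = 0 →
      ∀ (v : HeightOneSpectrum (𝓞 k)) (w : HeightOneSpectrum (𝓞 K)),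
        w.asIdeal.LiesOver v.asIdeal →
        (((c ^ 2 + 2 : ℤ) : 𝓞 k) ∈ v.asIdeal →
          ∀ x : k, IsSquare (w.valuation K (algebraMap k K x))) ∧
        ((2 : 𝓞 k) ∈ v.asIdeal → (∀ x : k, IsSquare (w.valuation K (algebraMap k K x))) ∨
          ∃ y : 𝓞 K, y ^ 2 + y + 1 ∈ w.asIdeal)) : IsRatSumFour q := by
  refine Splits.isRatSumFour σ₀ hm hirr (splits_of_adjoinRoot ?_)
  have : Fact (Irreducible q) := ⟨hirr⟩
  have : Module.Finite k (AdjoinRoot q) := (AdjoinRoot.powerBasis hirr.ne_zero).finite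
  have : CharZero (AdjoinRoot q) := charZero_of_injective_algebraMap (algebraMap k _).injective
  have : NumberField (AdjoinRoot q) :=
    { to_charZero := inferInstance, to_finiteDimensional := FiniteDimensional.trans ℚ k _ }
  have hroot : aeval (AdjoinRoot.root q) q = 0 := by
    rw [AdjoinRoot.aeval_eq, AdjoinRoot.mk_self]
  have : IsTotallyComplex (AdjoinRoot q) := by
    refine ⟨fun v => InfinitePlace.not_isReal_iff_isComplex.1 fun hv => ?_⟩
    set τ := InfinitePlace.embedding_of_isReal hv
    refine hreal (τ.comp (algebraMap k _)) (τ (AdjoinRoot.root q)) ?_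
    rw [← Polynomial.map_map, eval_map, eval₂_hom, eval_map_algebraMap, hroot, map_zero]
  have hunder : ∀ P : HeightOneSpectrum (𝓞 (AdjoinRoot q)), ∃ v : HeightOneSpectrum (𝓞 k),
      P.asIdeal.LiesOver v.asIdeal := fun P => by
    have hPm := P.isMaximal
    refine ⟨⟨P.asIdeal.under (𝓞 k), (Ideal.IsMaximal.under (𝓞 k) P.asIdeal).isPrime, ?_⟩,
      inferInstance⟩
    exact Ideal.IsIntegral.comap_ne_bot _ P.ne_bot
  refine neg_one_of_local hc (fun P hP => ?_) fun P hP => ?_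
  · obtain ⟨v, hv⟩ := hunder P
    have h := (hloc _ _ hroot v P hv).1 (by
      rw [P.asIdeal.over_def v.asIdeal, Ideal.mem_comap, map_intCast]; exact hP)
      ((c ^ 2 + 2 : ℤ) : k)
    rwa [map_intCast] at h
  · obtain ⟨v, hv⟩ := hunder P
    refine ((hloc _ _ hroot v P hv).2 (by
      rw [P.asIdeal.over_def v.asIdeal, Ideal.mem_comap, map_ofNat]; exact hP)).imp_left fun h => ?_
    have := h 2
    rwa [map_ofNat] at this

theorem isSumFour_of_sq_sub (σ₀ : k →+* ℝ) {u a : k} (hneg : ∀ σ : k →+* ℝ, σ u ^ 2 < σ a)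
    (h6 : ∀ v : HeightOneSpectrum (𝓞 k), (6 : 𝓞 k) ∈ v.asIdeal →
      ¬ IsSquare (v.valuation k (u ^ 2 - a))) : IsSumFour a := by
  set p : k[X] := X ^ 2 + (C (-(2 * u)) * X + C a) with hp
  have hlt : (C (-(2 * u)) * X + C a).natDegree < 2 :=
    lt_of_le_of_lt natDegree_linear_le one_lt_two
  have hm : p.Monic := monic_X_pow_add (degree_lt_degree (by rwa [natDegree_X_pow]) |>.trans_le
    (degree_X_pow 2).le |>.trans_eq rfl)
  have hd : p.natDegree = 2 := by
    rw [hp, natDegree_add_eq_left_of_natDegree_lt (by rwa [natDegree_X_pow]), natDegree_X_pow]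
  have hreal : ∀ (σ : k →+* ℝ) (x : ℝ), (p.map σ).eval x ≠ 0 := by
    intro σ x hx
    simp only [hp, Polynomial.map_add, Polynomial.map_mul, Polynomial.map_pow, map_X, map_C,
      eval_add, eval_mul, eval_pow, eval_X, eval_C] at hx
    rw [map_neg, map_mul, map_ofNat] at hx
    nlinarith only [hneg σ, sq_nonneg (x - σ u), hx]
  have hirr : Irreducible p := by
    refine (irreducible_iff_roots_eq_zero_of_degree_le_three (by omega) (by omega)).2 ?_
    refine Multiset.eq_zero_of_forall_notMem fun x hx => ?_
    have h := (mem_roots'.1 hx).2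
    refine hreal σ₀ (σ₀ x) ?_
    rw [eval_map, eval₂_hom, h, map_zero]
  have key := isRatSumFour_of_local σ₀ hm hirr hreal (c := 1) odd_one ?_
  · have := (key.isSumFour σ₀).map (evalRingHom 0)
    simpa [hp] using this
  intro K _ _ _ θ hθ v w hw
  have hsq : (θ - algebraMap k K u) ^ 2 = algebraMap k K (u ^ 2 - a) := by
    simp only [hp, map_add, map_mul, map_pow, aeval_X, aeval_C, map_neg, map_ofNat] at hθ
    rw [map_sub, map_pow]
    linear_combination hθ
  obtain ⟨e, he, hval⟩ := exists_valuation_eq_pow v w hw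
  have hmain : (6 : 𝓞 k) ∈ v.asIdeal → ∀ x : k, IsSquare (w.valuation K (algebraMap k K x)) := by
    intro hv x
    rw [hval]
    refine isSquare_pow_of_not_isSquare (h6 v hv) ?_ _
    rw [← hval, ← hsq, map_pow]
    exact IsSquare.sq _
  refine ⟨fun h3 => hmain ?_, fun h2 => Or.inl (hmain ?_)⟩
  · have := v.asIdeal.mul_mem_left 2 h3
    norm_num at this
    exact this
  · have := v.asIdeal.mul_mem_left 3 h2
    norm_num at this
    exact this

theorem isSumFour_of_not_isSquare (σ₀ : k →+* ℝ) {a : k} (hpos : ∀ σ : k →+* ℝ, 0 < σ a)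
    (h6 : ∀ v : HeightOneSpectrum (𝓞 k), (6 : 𝓞 k) ∈ v.asIdeal →
      ¬ IsSquare (v.valuation k a)) : IsSumFour a := by
  refine isSumFour_of_sq_sub σ₀ (u := 0) (fun σ => by simpa using hpos σ) fun v hv => ?_
  rw [zero_pow two_ne_zero, zero_sub, Valuation.map_neg]
  exact h6 v hv

theorem not_isSquare_exp {m : ℤ} (hm : Odd m) : ¬ IsSquare (WithZero.exp m) := by
  rintro ⟨r, hr⟩
  have hr0 : r ≠ 0 := by rintro rfl; simp at hr
  rw [← WithZero.exp_log hr0, ← WithZero.exp_add, WithZero.exp_inj] at hr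
  obtain ⟨t, rfl⟩ := hm
  omega

theorem exists_valuation_eq_exp (v : HeightOneSpectrum (𝓞 k)) {x : 𝓞 k} (hx : x ≠ 0) :
    ∃ m : ℕ, v.valuation k (x : k) = WithZero.exp (-(m : ℤ)) := by
  have h0 : v.valuation k (x : k) ≠ 0 := by rw [Valuation.ne_zero_iff]; exact_mod_cast hx
  have h1 := v.valuation_le_one (K := k) x
  refine ⟨(-WithZero.log (v.valuation k (x : k))).toNat, ?_⟩
  rw [← WithZero.exp_log h0, ← WithZero.exp_zero, WithZero.exp_le_exp] at h1
  conv_lhs => rw [← WithZero.exp_log h0]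
  rw [WithZero.exp_inj]
  omega

theorem exists_not_isSquare_sq_sub (v : HeightOneSpectrum (𝓞 k)) {a : k} (ha : a ≠ 0) :
    ∃ U B : 𝓞 k, ¬ IsSquare (v.valuation k ((U : k) ^ 2 - B)) ∧
      ¬ IsSquare (v.valuation k (a * B)) := by
  obtain ⟨π, hπ, -⟩ := exists_uniformizer_sup (v := v)
  by_cases hs : IsSquare (v.valuation k a)
  · refine ⟨0, π, ?_, ?_⟩
    · have := not_isSquare_uniformizer (v := v) hπ
      simpa [Valuation.map_neg] using this
    · rintro ⟨r, hr⟩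
      obtain ⟨t, ht⟩ := hs
      have ha' : v.valuation k a ≠ 0 := by rwa [Valuation.ne_zero_iff]
      refine not_isSquare_uniformizer (v := v) hπ ⟨r / t, ?_⟩
      rw [div_mul_div_comm, ← hr, ← ht, map_mul, mul_div_cancel_left₀ _ ha']
  · obtain ⟨m, hm⟩ : ∃ m : ℕ, v.valuation k (2 : k) = WithZero.exp (-(m : ℤ)) :=
      exists_valuation_eq_exp v (x := 2) two_ne_zero
    refine ⟨1 + π ^ (m + 1), 1, ?_, by simpa using hs⟩
    have h1 : (((1 + π ^ (m + 1) : 𝓞 k) : k) ^ 2 - ((1 : 𝓞 k) : k)) =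
        2 * (π : k) ^ (m + 1) + (π : k) ^ (2 * m + 2) := by
      push_cast
      ring
    have h2 : v.valuation k (2 * (π : k) ^ (m + 1)) = WithZero.exp (-(2 * m + 1 : ℤ)) := by
      rw [map_mul, map_pow, hπ, hm, ← WithZero.exp_nsmul, ← WithZero.exp_add]
      congr 1
      simp
      ring
    have h3 : v.valuation k ((π : k) ^ (2 * m + 2)) = WithZero.exp (-(2 * m + 2 : ℤ)) := by
      rw [map_pow, hπ, ← WithZero.exp_nsmul]
      congr 1
      simp
    rw [h1, Valuation.map_add_eq_of_lt_left, h2]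
    · exact not_isSquare_exp (by rw [Int.odd_iff]; omega)
    · rw [h2, h3, WithZero.exp_lt_exp]
      omega

theorem exists_pow_sub_mem (S : Finset (HeightOneSpectrum (𝓞 k)))
    (c : HeightOneSpectrum (𝓞 k) → 𝓞 k) (N : HeightOneSpectrum (𝓞 k) → ℕ) :
    ∃ y : 𝓞 k, ∀ v ∈ S, v.valuation k ((y : k) - c v) ≤ WithZero.exp (-(N v : ℤ)) := by
  obtain ⟨y, hy⟩ := IsDedekindDomain.exists_forall_sub_mem_ideal (s := S)
    (fun v : HeightOneSpectrum (𝓞 k) => v.asIdeal) N (fun v _ => v.prime)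
    (fun v _ w _ h h' => h (HeightOneSpectrum.ext h')) (fun v => c v)
  refine ⟨y, fun v hv => ?_⟩
  have h1 := (v.intValuation_le_pow_iff_mem _ _).2 (hy v hv)
  rw [← v.valuation_of_algebraMap (K := k)] at h1
  exact h1

theorem exists_exp_lt {D : WithZero (Multiplicative ℤ)} (hD : D ≠ 0) :
    ∃ N : ℕ, WithZero.exp (-(N : ℤ)) < D := by
  refine ⟨(-WithZero.log D).toNat + 1, ?_⟩
  conv_rhs => rw [← WithZero.exp_log hD]
  rw [WithZero.exp_lt_exp]
  omega

theorem finite_setOf_mem {x : 𝓞 k} (hx : x ≠ 0) :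
    {v : HeightOneSpectrum (𝓞 k) | x ∈ v.asIdeal}.Finite := by
  refine (Ideal.finite_factors (I := Ideal.span {x}) ?_).subset fun v hv => ?_
  · rwa [Ne, Ideal.zero_eq_bot, Ideal.span_singleton_eq_bot]
  · exact Ideal.dvd_span_singleton.2 hv

theorem exists_forall_lt (f : (k →+* ℝ) → ℝ) : ∃ T : ℕ, ∀ σ, f σ < T := by
  obtain ⟨B, hB⟩ := (Set.finite_range f).bddAbove
  obtain ⟨T, hT⟩ := exists_nat_gt B
  exact ⟨T, fun σ => (hB ⟨σ, rfl⟩).trans_lt hT⟩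

/-- Totally positive elements are sums of four squares (Hilbert, Siegel). -/
theorem isSumFour_of_totally_pos (σ₀ : k →+* ℝ) {a : k} (hpos : ∀ σ : k →+* ℝ, 0 < σ a) :
    IsSumFour a := by
  have ha : a ≠ 0 := by rintro rfl; simpa using hpos σ₀
  choose U B hU hB using fun v : HeightOneSpectrum (𝓞 k) => exists_not_isSquare_sq_sub v ha
  have h0 : ∀ {z : WithZero (Multiplicative ℤ)}, ¬ IsSquare z → z ≠ 0 := by
    rintro z hz rfl
    exact hz IsSquare.zero
  have hBv : ∀ v : HeightOneSpectrum (𝓞 k), v.valuation k (B v : k) ≠ 0 := fun v => by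
    have := h0 (hB v)
    rw [map_mul] at this
    exact right_ne_zero_of_mul this
  have hN : ∀ v : HeightOneSpectrum (𝓞 k), ∃ N : ℕ,
      WithZero.exp (-(N : ℤ)) < v.valuation k ((U v : k) ^ 2 - B v) ∧
        WithZero.exp (-(N : ℤ)) < v.valuation k (B v : k) := fun v => by
    obtain ⟨N, hN⟩ := exists_exp_lt (h0 (hU v))
    obtain ⟨N', hN'⟩ := exists_exp_lt (hBv v)
    refine ⟨max N N', lt_of_le_of_lt ?_ hN, lt_of_le_of_lt ?_ hN'⟩ <;>
    · rw [WithZero.exp_le_exp]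
      simp
  choose N hN1 hN2 using hN
  have hfin := finite_setOf_mem (k := k) (x := 6) (by norm_num)
  set S := hfin.toFinset with hS
  obtain ⟨u, hu⟩ := exists_pow_sub_mem S U N
  obtain ⟨b₀, hb₀⟩ := exists_pow_sub_mem S B N
  set L := S.sup N
  obtain ⟨T, hT⟩ := exists_forall_lt fun σ : k →+* ℝ => σ (u : k) ^ 2 - σ (b₀ : k)
  set b : 𝓞 k := b₀ + 6 ^ L * T with hb
  have h6T : algebraMap (𝓞 k) k (6 ^ L * T) = 6 ^ L * T := by
    rw [map_mul, map_pow, map_ofNat, map_natCast]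
  have hbk : (b : k) = b₀ + 6 ^ L * T := by
    rw [← h6T]
    exact map_add (algebraMap (𝓞 k) k) _ _
  have hbv : ∀ v ∈ S, v.valuation k ((b : k) - B v) ≤ WithZero.exp (-(N v : ℤ)) := by
    intro v hv
    rw [hbk, add_sub_right_comm]
    refine Valuation.map_add_le _ (hb₀ v hv) ?_
    have h6 : v.intValuation (6 ^ L * T : 𝓞 k) ≤ WithZero.exp (-(N v : ℤ)) := by
      rw [v.intValuation_le_pow_iff_mem]
      refine Ideal.mul_mem_right _ _ (Ideal.pow_le_pow_right (Finset.le_sup hv) ?_)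
      exact Ideal.pow_mem_pow (hfin.mem_toFinset.1 hv) _
    rw [← v.valuation_of_algebraMap (K := k)] at h6
    exact h6T ▸ h6
  have hlt : ∀ σ : k →+* ℝ, σ (u : k) ^ 2 < σ (b : k) := by
    intro σ
    have h1 := hT σ
    rw [hbk, map_add, map_mul, map_pow, map_ofNat, map_natCast]
    have h2 : (1 : ℝ) ≤ 6 ^ L := one_le_pow₀ (by norm_num)
    have h3 : (0 : ℝ) ≤ T := Nat.cast_nonneg T
    nlinarith
  have hb0 : (b : k) ≠ 0 := by
    intro h
    have := hlt σ₀
    rw [h, map_zero] at this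
    exact absurd this (not_lt.2 (sq_nonneg _))
  have hbS : IsSumFour (b : k) := by
    refine isSumFour_of_sq_sub σ₀ hlt fun v hv => ?_
    have hvS : v ∈ S := hfin.mem_toFinset.2 hv
    have : v.valuation k ((u : k) ^ 2 - b) = v.valuation k ((U v : k) ^ 2 - B v) := by
      refine Valuation.map_eq_of_sub_lt _ (lt_of_le_of_lt ?_ (hN1 v))
      have h1 : ((u : k) ^ 2 - b - ((U v : k) ^ 2 - B v)) =
          ((u + U v : 𝓞 k) : k) * (u - U v) - (b - B v) := by
        push_cast
        ring
      rw [h1]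
      refine Valuation.map_sub_le _ ?_ (hbv v hvS)
      rw [map_mul]
      exact mul_le_of_le_one_of_le (v.valuation_le_one _) (hu v hvS)
    rw [this]
    exact hU v
  have habS : IsSumFour (a * b) := by
    refine isSumFour_of_not_isSquare σ₀ (fun σ => ?_) fun v hv => ?_
    · rw [map_mul]
      exact mul_pos (hpos σ) ((sq_nonneg _).trans_lt (hlt σ))
    · have hvS : v ∈ S := hfin.mem_toFinset.2 hv
      have : v.valuation k (b : k) = v.valuation k (B v : k) :=
        Valuation.map_eq_of_sub_lt _ ((hbv v hvS).trans_lt (hN2 v))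
      rw [map_mul, this, ← map_mul]
      exact hB v
  exact habS.of_mul hbS hb0

end Global

section Approximation

open NumberField IsDedekindDomain Polynomial

variable {k : Type*} [Field k] [NumberField k]

theorem exists_approx (S : Finset (HeightOneSpectrum (𝓞 k))) (c : HeightOneSpectrum (𝓞 k) → k)
    {D : HeightOneSpectrum (𝓞 k) → WithZero (Multiplicative ℤ)} (hD : ∀ v, D v ≠ 0) {δ : ℝ}
    (hδ : 0 < δ) : ∃ x : k, (∀ v ∈ S, v.valuation k (x - c v) ≤ D v) ∧
      ∀ σ : k →+* ℝ, |σ x| < δ := by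
  classical
  obtain ⟨m, hm⟩ := IsLocalization.exist_integer_multiples_of_finset
    (nonZeroDivisors (𝓞 k)) (S.image c)
  have hm0 : (m : 𝓞 k) ≠ 0 := nonZeroDivisors.ne_zero m.2
  set μ : k := algebraMap (𝓞 k) k m with hμ
  have hμ0 : μ ≠ 0 := by
    rw [hμ]
    exact (map_ne_zero_iff _ (FaithfulSMul.algebraMap_injective (𝓞 k) k)).2 hm0
  have hvμ : ∀ v : HeightOneSpectrum (𝓞 k), v.valuation k μ ≠ 0 := fun v => by
    rwa [Valuation.ne_zero_iff]
  have hz : ∀ v, ∃ z : 𝓞 k, v ∈ S → (z : k) = μ * c v := by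
    intro v
    by_cases hv : v ∈ S
    · obtain ⟨z, hz⟩ := hm (c v) (Finset.mem_image_of_mem c hv)
      exact ⟨z, fun _ => hz.trans (Algebra.smul_def _ _)⟩
    · exact ⟨0, fun h => absurd h hv⟩
  choose z hz using hz
  have hN : ∀ v : HeightOneSpectrum (𝓞 k), ∃ N : ℕ,
      WithZero.exp (-(N : ℤ)) < D v * v.valuation k μ ∧ WithZero.exp (-(N : ℤ)) < 1 := fun v => by
    obtain ⟨N, hN⟩ := exists_exp_lt (mul_ne_zero (hD v) (hvμ v))
    refine ⟨N + 1, lt_of_le_of_lt ?_ hN, ?_⟩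
    · rw [WithZero.exp_le_exp]
      push_cast
      omega
    · rw [← WithZero.exp_zero, WithZero.exp_lt_exp]
      push_cast
      omega
  choose N hN hN1 using hN
  obtain ⟨y, hy⟩ := exists_pow_sub_mem S z N
  set x₀ : k := y / μ
  have hx₀ : ∀ v ∈ S, v.valuation k (x₀ - c v) ≤ D v := by
    intro v hv
    have h1 : x₀ - c v = ((y : k) - z v) / μ := by
      rw [hz v hv, sub_div, mul_div_cancel_left₀ _ hμ0]
    rw [h1, map_div₀, div_le_iff₀ (zero_lt_iff.2 (hvμ v))]
    exact (hy v hv).trans (hN v).le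
  set M : ℕ := ∏ v ∈ S, (Ideal.absNorm v.asIdeal) ^ N v with hM
  have hM0 : 0 < M := Finset.prod_pos fun v _ => pow_pos
    (Nat.pos_of_ne_zero (Ideal.absNorm_eq_zero_iff.not.2 v.ne_bot)) _
  obtain ⟨T, hT⟩ := exists_forall_lt fun σ : k →+* ℝ => |σ x₀| / δ
  have hMv : ∀ v ∈ S, v.valuation k ((M * T : ℕ) : k) ≤ WithZero.exp (-(N v : ℤ)) := by
    intro v hv
    have h1 : v.intValuation ((M * T : ℕ) : 𝓞 k) ≤ WithZero.exp (-(N v : ℤ)) := by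
      rw [v.intValuation_le_pow_iff_mem]
      obtain ⟨r, hr⟩ : Ideal.absNorm v.asIdeal ^ N v ∣ M * T :=
        (Finset.dvd_prod_of_mem _ hv).mul_right T
      rw [hr, Nat.cast_mul, Nat.cast_pow]
      exact Ideal.mul_mem_right _ _ (Ideal.pow_mem_pow (Ideal.absNorm_mem _) _)
    rw [← v.valuation_of_algebraMap (K := k)] at h1
    exact (map_natCast (algebraMap (𝓞 k) k) (M * T)) ▸ h1
  have hden : (1 + (M * T : ℕ) : k) ≠ 0 := by
    have : ((1 + M * T : ℕ) : k) ≠ 0 := Nat.cast_ne_zero.2 (by omega)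
    rwa [Nat.cast_add, Nat.cast_one] at this
  refine ⟨x₀ / (1 + (M * T : ℕ)), fun v hv => ?_, fun σ => ?_⟩
  · have h1 : x₀ / (1 + (M * T : ℕ)) - c v =
        (x₀ - c v) - x₀ * (M * T : ℕ) / (1 + (M * T : ℕ)) := by
      field_simp
      ring
    rw [h1]
    refine Valuation.map_sub_le _ (hx₀ v hv) ?_
    have h2 : v.valuation k (1 + (M * T : ℕ) : k) = 1 := by
      rw [Valuation.map_one_add_of_lt]
      exact (hMv v hv).trans_lt (hN1 v)
    rw [map_div₀, h2, div_one, map_mul, map_div₀, div_mul_eq_mul_div,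
      div_le_iff₀ (zero_lt_iff.2 (hvμ v))]
    exact (mul_le_of_le_one_of_le (v.valuation_le_one y) (hMv v hv)).trans (hN v).le
  · have h1 := hT σ
    rw [div_lt_iff₀ hδ] at h1
    have h2 : (1 : ℝ) ≤ M := by exact_mod_cast hM0
    have h3 : (0 : ℝ) ≤ T := Nat.cast_nonneg T
    have h4 : (T : ℝ) ≤ M * T := by nlinarith
    rw [map_div₀, map_add, map_one, map_natCast, abs_div, Nat.cast_mul,
      abs_of_pos (by positivity : (0 : ℝ) < 1 + M * T), div_lt_iff₀ (by positivity)]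
    nlinarith

theorem exists_polynomial_approx (S : Finset (HeightOneSpectrum (𝓞 k)))
    (g : HeightOneSpectrum (𝓞 k) → k[X]) (n : ℕ) (hg : ∀ v, (g v).natDegree ≤ n)
    {D : HeightOneSpectrum (𝓞 k) → WithZero (Multiplicative ℤ)} (hD : ∀ v, D v ≠ 0) {δ : ℝ}
    (hδ : 0 < δ) : ∃ G : k[X], G.natDegree ≤ n ∧
      (∀ v ∈ S, ∀ i, v.valuation k ((G - g v).coeff i) ≤ D v) ∧
      ∀ (σ : k →+* ℝ) (i : ℕ), |σ (G.coeff i)| < δ := by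
  choose x hx hxσ using fun i : ℕ => exists_approx S (fun v => (g v).coeff i) hD hδ
  have hcoeff : ∀ i, (∑ j ∈ Finset.range (n + 1), C (x j) * X ^ j).coeff i =
      if i ≤ n then x i else 0 := by
    intro i
    simp [coeff_C_mul, coeff_X_pow]
  refine ⟨∑ j ∈ Finset.range (n + 1), C (x j) * X ^ j, ?_, fun v hv i => ?_, fun σ i => ?_⟩
  · rw [natDegree_le_iff_coeff_eq_zero]
    intro i hi
    rw [hcoeff, if_neg (by omega)]
  · rw [coeff_sub, hcoeff]
    split_ifs with hi
    · exact hx i v hv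
    · rw [coeff_eq_zero_of_natDegree_lt ((hg v).trans_lt (by omega)), sub_zero, map_zero]
      exact zero_le
  · rw [hcoeff]
    split_ifs
    · exact hxσ i σ
    · simpa using hδ

end Approximation

section Positive

open Polynomial

theorem leadingCoeff_nonneg_of_eval_nonneg {f : ℝ[X]} (h : ∀ x, 0 ≤ f.eval x) :
    0 ≤ f.leadingCoeff := by
  by_contra! hlt
  rcases le_or_gt f.degree 0 with hd | hd
  · rw [eq_C_of_degree_le_zero hd] at hlt h
    have := h 0
    rw [eval_C] at this
    rw [leadingCoeff_C] at hlt
    linarith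
  · obtain ⟨x, hx⟩ := ((f.tendsto_atBot_of_leadingCoeff_nonpos hd hlt.le).eventually
      (Filter.eventually_lt_atBot 0)).exists
    exact absurd hx (not_lt.2 (h x))

theorem even_natDegree_of_eval_nonneg {f : ℝ[X]} (h : ∀ x, 0 ≤ f.eval x) : Even f.natDegree := by
  by_contra! ho
  rw [Nat.not_even_iff_odd] at ho
  have hf : f ≠ 0 := by rintro rfl; simp at ho
  have h1 := leadingCoeff_nonneg_of_eval_nonneg h
  have h2 : 0 ≤ (f.comp (-X)).leadingCoeff :=
    leadingCoeff_nonneg_of_eval_nonneg fun x => by rw [eval_comp]; exact h _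
  rw [leadingCoeff_comp (by simp), leadingCoeff_neg, leadingCoeff_X, ho.neg_one_pow] at h2
  have h3 : f.leadingCoeff = 0 := by linarith
  exact hf (leadingCoeff_eq_zero.1 h3)

theorem eval_pos_of_separable {f : ℝ[X]} (hs : f.Separable) (h : ∀ x, 0 ≤ f.eval x) (x : ℝ) :
    0 < f.eval x := by
  refine lt_of_le_of_ne (h x) fun h0 => ?_
  have hmin : IsLocalMin (fun y => f.eval y) x :=
    Filter.Eventually.of_forall fun y => h0.symm.le.trans (h y)
  have h1 := hmin.hasDerivAt_eq_zero (f.hasDerivAt x)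
  obtain ⟨a, b, hab⟩ := hs
  have := congr_arg (eval x) hab
  rw [eval_add, eval_mul, eval_mul, ← h0, h1, mul_zero, mul_zero, eval_one, add_zero] at this
  exact zero_ne_one this

theorem eval_nonneg_of_rat {f : ℝ[X]} (h : ∀ q : ℚ, 0 ≤ f.eval (q : ℝ)) (x : ℝ) :
    0 ≤ f.eval x := by
  have hc : IsClosed {x : ℝ | 0 ≤ f.eval x} := isClosed_le continuous_const f.continuous
  exact hc.closure_subset_iff.2 (by rintro _ ⟨q, rfl⟩; exact h q) (Rat.denseRange_cast (𝕜 := ℝ) x)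

theorem abs_eval_le {g : ℝ[X]} {n : ℕ} (hg : g.natDegree ≤ n) {δ : ℝ} (hδ : ∀ i, |g.coeff i| ≤ δ)
    {x B : ℝ} (hB : ∀ i ≤ n, |x| ^ i ≤ B) : |g.eval x| ≤ (n + 1) * (δ * B) := by
  rw [eval_eq_sum_range' (Nat.lt_succ_of_le hg)]
  refine (Finset.abs_sum_le_sum_abs _ _).trans ?_
  have h0 : 0 ≤ δ := (abs_nonneg _).trans (hδ 0)
  have : ∀ i ∈ Finset.range (n + 1), |g.coeff i * x ^ i| ≤ δ * B := by
    intro i hi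
    rw [abs_mul, abs_pow]
    exact mul_le_mul (hδ i) (hB i (Nat.lt_succ_iff.1 (Finset.mem_range.1 hi))) (by positivity) h0
  refine (Finset.sum_le_card_nsmul _ _ _ this).trans ?_
  rw [Finset.card_range, nsmul_eq_mul]
  push_cast
  rfl

theorem exists_sq_eval_lt {f : ℝ[X]} {n : ℕ} (hn : f.natDegree = 2 * n)
    (hpos : ∀ x, 0 < f.eval x) : ∃ δ : ℝ, 0 < δ ∧ ∀ g : ℝ[X], g.natDegree ≤ n →
      (∀ i, |g.coeff i| < δ) →
        (∀ x, g.eval x ^ 2 < f.eval x) ∧ g.coeff n ^ 2 < f.coeff (2 * n) := by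
  have hf0 : f ≠ 0 := by rintro rfl; simpa using hpos 0
  have hlead : 0 < f.leadingCoeff := lt_of_le_of_ne
    (leadingCoeff_nonneg_of_eval_nonneg fun x => (hpos x).le)
    (leadingCoeff_ne_zero.2 hf0).symm
  have hrev : ∀ x : ℝ, x ≠ 0 → f.reverse.eval x⁻¹ * x ^ (2 * n) = f.eval x := by
    intro x hx
    have := invertibleOfNonzero hx
    have h := eval₂_reverse_mul_pow (RingHom.id ℝ) x f
    rwa [hn, invOf_eq_inv] at h
  have hrev0 : f.reverse.eval 0 = f.leadingCoeff := by
    rw [← coeff_zero_eq_eval_zero, coeff_zero_reverse]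
  have hrpos : ∀ x, 0 < f.reverse.eval x := by
    intro x
    rcases eq_or_ne x 0 with rfl | hx
    · rwa [hrev0]
    · have h := hrev x⁻¹ (inv_ne_zero hx)
      rw [inv_inv] at h
      have h2 := hpos x⁻¹
      rw [← h] at h2
      exact pos_of_mul_pos_left h2 (by rw [pow_mul]; positivity)
  have hcpt : ∀ p : ℝ[X], (∀ x, 0 < p.eval x) →
      ∃ ε, 0 < ε ∧ ∀ x ∈ Set.Icc (-1 : ℝ) 1, ε ≤ p.eval x := by
    intro p hp
    obtain ⟨x, -, hx⟩ := (isCompact_Icc (a := (-1 : ℝ)) (b := 1)).exists_isMinOn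
      ⟨0, by norm_num⟩ p.continuousOn
    exact ⟨_, hp x, hx⟩
  obtain ⟨ε₁, hε₁, h1⟩ := hcpt f hpos
  obtain ⟨ε₂, hε₂, h2⟩ := hcpt f.reverse hrpos
  obtain ⟨η, hη, hη1, hη2⟩ : ∃ η : ℝ, 0 < η ∧ η ^ 2 < ε₁ ∧ η ^ 2 < ε₂ := by
    have hε : 0 < min ε₁ ε₂ := lt_min hε₁ hε₂
    refine ⟨√(min ε₁ ε₂ / 2), Real.sqrt_pos.2 (by linarith), ?_⟩
    rw [Real.sq_sqrt (by linarith)]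
    exact ⟨by linarith [min_le_left ε₁ ε₂], by linarith [min_le_right ε₁ ε₂]⟩
  have hn1 : (0 : ℝ) < n + 1 := by positivity
  refine ⟨η / (n + 1), div_pos hη hn1, fun g hg hgc => ⟨fun x => ?_, ?_⟩⟩
  · rcases le_or_gt |x| 1 with hx | hx
    · have h3 := abs_eval_le hg (fun i => (hgc i).le) (x := x) (B := 1)
        fun i _ => pow_le_one₀ (abs_nonneg x) hx
      rw [mul_one, mul_div_cancel₀ _ hn1.ne'] at h3
      have h4 : g.eval x ^ 2 ≤ η ^ 2 := sq_le_sq' (abs_le.1 h3).1 (abs_le.1 h3).2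
      exact (h4.trans_lt hη1).trans_le (h1 x (abs_le.1 hx))
    · have hx0 : x ≠ 0 := by rintro rfl; simp at hx; linarith
      have h3 := abs_eval_le hg (fun i => (hgc i).le) (x := x) (B := |x| ^ n)
        fun i hi => pow_le_pow_right₀ hx.le hi
      rw [← mul_assoc, mul_div_cancel₀ _ hn1.ne'] at h3
      have h4 : g.eval x ^ 2 ≤ η ^ 2 * x ^ (2 * n) := by
        rw [← sq_abs, pow_mul, ← sq_abs x, ← pow_mul, mul_comm 2 n, pow_mul, ← mul_pow]
        exact pow_le_pow_left₀ (abs_nonneg _) h3 2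
      have hpow : 0 < x ^ (2 * n) := by rw [pow_mul]; positivity
      rw [← hrev x hx0]
      refine h4.trans_lt (mul_lt_mul_of_pos_right (hη2.trans_le (h2 _ (abs_le.1 ?_))) hpow)
      rw [abs_inv]
      exact inv_le_one_of_one_le₀ hx.le
  · have h3 : η / (n + 1) ≤ η := div_le_self hη.le (by linarith [(Nat.cast_nonneg n : (0 : ℝ) ≤ n)])
    have h4 := abs_le.1 ((hgc n).le.trans h3)
    have h5 := h2 0 (by norm_num)
    rw [hrev0, leadingCoeff, hn] at h5
    exact ((sq_le_sq' h4.1 h4.2).trans_lt hη2).trans_le h5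

end Positive

section Core

open NumberField IsDedekindDomain Polynomial

universe u

variable {k : Type u} [Field k] [NumberField k]

theorem isSumFour_sub_sq (σ₀ : k →+* ℝ) {f g : k[X]} {c : ℤ} (hc : Odd c) {n : ℕ}
    (hf : f.natDegree = 2 * n) (hg : g.natDegree ≤ n)
    (hlt : ∀ (σ : k →+* ℝ) (x : ℝ), (g.map σ).eval x ^ 2 < (f.map σ).eval x)
    (hlead : ∀ σ : k →+* ℝ, σ (g.coeff n) ^ 2 < σ (f.coeff (2 * n)))
    (hloc : ∀ v : HeightOneSpectrum (𝓞 k), ((2 * (c ^ 2 + 2) : ℤ) : 𝓞 k) ∈ v.asIdeal →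
      LocallyEven v f g) : IsSumFour (f - g ^ 2) := by
  have hcoeff : (f - g ^ 2).coeff (2 * n) = f.coeff (2 * n) - g.coeff n ^ 2 := by
    rw [coeff_sub, coeff_pow_of_natDegree_le hg]
  have hpos : ∀ σ : k →+* ℝ, 0 < σ ((f - g ^ 2).coeff (2 * n)) := fun σ => by
    rw [hcoeff, map_sub, map_pow, sub_pos]
    exact hlead σ
  have hne : (f - g ^ 2).coeff (2 * n) ≠ 0 := fun h => by
    have := hpos σ₀
    rw [h, map_zero] at this
    exact this.false
  have hdeg : (f - g ^ 2).natDegree = 2 * n :=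
    natDegree_eq_of_le_of_coeff_ne_zero
      ((natDegree_sub_le_of_le hf.le (natDegree_pow_le_of_le 2 hg)).trans (max_self _).le) hne
  have h0 : f - g ^ 2 ≠ 0 := fun h => hne (by rw [h, coeff_zero])
  refine IsRatSumFour.isSumFour σ₀ (isRatSumFour_of_factors _ h0 ?_ ?_)
  · rw [leadingCoeff, hdeg]
    exact isSumFour_of_totally_pos σ₀ hpos
  · intro q hm hirr hq
    refine isRatSumFour_of_local σ₀ hm hirr (fun σ x hx => ?_) hc ?_
    · have h1 : ((f - g ^ 2).map σ).eval x = 0 := by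
        obtain ⟨r, hr⟩ := hq
        rw [hr, Polynomial.map_mul, eval_mul, hx, zero_mul]
      rw [Polynomial.map_sub, Polynomial.map_pow, eval_sub, eval_pow] at h1
      linarith [hlt σ x]
    · intro K _ _ _ θ hθ v w hw
      have h1 : aeval θ f = aeval θ g ^ 2 := by
        obtain ⟨r, hr⟩ := hq
        rw [← sub_eq_zero, ← map_pow, ← map_sub, hr, map_mul, hθ, zero_mul]
      refine ⟨fun hs => ?_, fun h2 => ?_⟩
      · refine (hloc v ?_ K θ h1 w hw).resolve_right fun h => ?_
        · rw [Int.cast_mul]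
          exact v.asIdeal.mul_mem_left _ hs
        · have hs' : ((c ^ 2 + 2 : ℤ) : 𝓞 K) ∈ w.asIdeal := by
            rw [w.asIdeal.over_def v.asIdeal, Ideal.mem_comap, map_intCast] at hs
            exact hs
          obtain ⟨m, rfl⟩ := hc
          refine w.isPrime.ne_top ((Ideal.eq_top_iff_one _).2 ?_)
          have h3 : ((((2 * m + 1) ^ 2 + 2 : ℤ) : 𝓞 K)) -
              ((2 * m ^ 2 + 2 * m + 1 : ℤ) : 𝓞 K) * 2 = 1 := by
            push_cast
            ring
          rw [← h3]
          exact w.asIdeal.sub_mem hs' (w.asIdeal.mul_mem_left _ h.1)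
      · refine (hloc v ?_ K θ h1 w hw).imp_right And.right
        rw [Int.cast_mul]
        exact v.asIdeal.mul_mem_right _ (by exact_mod_cast h2)

theorem exists_pos_forall_le (δ : (k →+* ℝ) → ℝ) (hδ : ∀ σ, 0 < δ σ) :
    ∃ η : ℝ, 0 < η ∧ ∀ σ, η ≤ δ σ := by
  obtain ⟨T, hT⟩ := exists_forall_lt fun σ : k →+* ℝ => (δ σ)⁻¹
  refine ⟨((T : ℝ) + 1)⁻¹, by positivity, fun σ => ?_⟩
  exact inv_le_of_inv_le₀ (hδ σ) ((hT σ).le.trans (by linarith))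

theorem exists_odd_bad_prime {x : 𝓞 k} (hx : x ≠ 0) :
    ∃ c : ℤ, Odd c ∧ ∀ v : HeightOneSpectrum (𝓞 k), ((c ^ 2 + 2 : ℤ) : 𝓞 k) ∈ v.asIdeal →
      (2 : 𝓞 k) ∉ v.asIdeal ∧ x ∉ v.asIdeal := by
  have hN : Ideal.absNorm (Ideal.span {x}) ≠ 0 := by
    rwa [Ne, Ideal.absNorm_eq_zero_iff, Ideal.span_singleton_eq_bot]
  obtain ⟨e, c, hc, he⟩ := Nat.exists_eq_two_pow_mul_odd hN
  have key : ∀ v : HeightOneSpectrum (𝓞 k), (((c : ℤ) ^ 2 + 2 : ℤ) : 𝓞 k) ∈ v.asIdeal →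
      (2 : 𝓞 k) ∉ v.asIdeal := by
    intro v hs h2
    obtain ⟨m, rfl⟩ := hc
    refine v.isPrime.ne_top ((Ideal.eq_top_iff_one _).2 ?_)
    have h3 : (((((2 * m + 1 : ℕ) : ℤ) ^ 2 + 2 : ℤ) : 𝓞 k)) -
        ((2 * m ^ 2 + 2 * m + 1 : ℕ) : 𝓞 k) * 2 = 1 := by
      push_cast
      ring
    rw [← h3]
    exact v.asIdeal.sub_mem hs (v.asIdeal.mul_mem_left _ h2)
  refine ⟨c, by exact_mod_cast hc, fun v hs => ⟨key v hs, fun hxv => ?_⟩⟩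
  have h1 : ((Ideal.absNorm (Ideal.span {x}) : ℕ) : 𝓞 k) ∈ v.asIdeal :=
    (Ideal.span_singleton_le_iff_mem _).2 hxv (Ideal.absNorm_mem _)
  rw [he, Nat.cast_mul, Nat.cast_pow] at h1
  have h2 := key v hs
  rcases v.isPrime.mem_or_mem h1 with h | h
  · exact h2 (by exact_mod_cast v.isPrime.mem_of_pow_mem _ h)
  · refine h2 ?_
    have h4 : (((c : ℤ) ^ 2 + 2 : ℤ) : 𝓞 k) - (c : 𝓞 k) * (c : 𝓞 k) = 2 := by
      push_cast
      ring
    rw [← h4]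
    exact v.asIdeal.sub_mem hs (v.asIdeal.mul_mem_left _ h)

theorem localGood_of_not_mem {a : 𝓞 k} {F A B : (𝓞 k)[X]} {d : 𝓞 k}
    (hF : F.Monic) (hAB : A * F + B * derivative F = C d) {n : ℕ} (hno : Odd n)
    (hn : F.natDegree = 2 * n) {v : HeightOneSpectrum (𝓞 k)} (h2 : (2 : 𝓞 k) ∉ v.asIdeal)
    (ha : a * d ∉ v.asIdeal) :
    LocalGood v (C (a : k) * F.map (algebraMap (𝓞 k) k)) n := by
  have ha1 : a ∉ v.asIdeal := fun h => ha (v.asIdeal.mul_mem_right _ h)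
  have hd1 : d ∉ v.asIdeal := fun h => ha (v.asIdeal.mul_mem_left _ h)
  have hCF : (C a * F).map (algebraMap (𝓞 k) k) = C (a : k) * F.map (algebraMap (𝓞 k) k) := by
    rw [Polynomial.map_mul, map_C]
  rw [← hCF]
  refine localGood_of_squarefree hno ((natDegree_C_mul_le a F).trans hn.le) h2 ?_ ?_
  · rwa [coeff_C_mul, ← hn, hF.coeff_natDegree, mul_one]
  · have : v.asIdeal.IsMaximal := v.isMaximal
    let _ : Field (𝓞 k ⧸ v.asIdeal) := Ideal.Quotient.field _
    have ha2 : Ideal.Quotient.mk v.asIdeal a ≠ 0 := fun h => ha1 (Ideal.Quotient.eq_zero_iff_mem.1 h)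
    have hd2 : Ideal.Quotient.mk v.asIdeal d ≠ 0 := fun h => hd1 (Ideal.Quotient.eq_zero_iff_mem.1 h)
    have hsep : (F.map (Ideal.Quotient.mk v.asIdeal)).Separable := by
      have h := congrArg (Polynomial.map (Ideal.Quotient.mk v.asIdeal)) hAB
      rw [Polynomial.map_add, Polynomial.map_mul, Polynomial.map_mul, map_C,
        ← derivative_map] at h
      refine ⟨C (Ideal.Quotient.mk v.asIdeal d)⁻¹ * A.map (Ideal.Quotient.mk v.asIdeal),
        C (Ideal.Quotient.mk v.asIdeal d)⁻¹ * B.map (Ideal.Quotient.mk v.asIdeal), ?_⟩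
      rw [mul_assoc, mul_assoc, ← mul_add, h, ← C_mul, inv_mul_cancel₀ hd2, C_1]
    rw [Polynomial.map_mul, map_C]
    have hu : IsUnit (C (Ideal.Quotient.mk v.asIdeal a)) := isUnit_C.2 ha2.isUnit
    exact (Associated.squarefree_iff (associated_unit_mul_left _ _ hu)).2 hsep.squarefree

theorem exists_eq_sq_add_isSumFour (σ₀ : k →+* ℝ) {a : 𝓞 k} (ha : a ≠ 0) {F A B : (𝓞 k)[X]}
    {d : 𝓞 k} (hd : d ≠ 0) (hF : F.Monic) (hAB : A * F + B * derivative F = C d) {n : ℕ}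
    (hn : F.natDegree = 2 * n)
    (hpos : ∀ (σ : k →+* ℝ) (x : ℝ),
      0 < ((C (a : k) * F.map (algebraMap (𝓞 k) k)).map σ).eval x) :
    ∃ g h : k[X], C (a : k) * F.map (algebraMap (𝓞 k) k) = g ^ 2 + h ∧ IsSumFour h := by
  obtain ⟨c, hc, hcv⟩ := exists_odd_bad_prime (mul_ne_zero ha hd)
  set f := C (a : k) * F.map (algebraMap (𝓞 k) k) with hf
  have ha' : (a : k) ≠ 0 := by simpa using ha
  have hfn : f.natDegree = 2 * n := by
    rw [hf, natDegree_C_mul ha', hF.natDegree_map, hn]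
  have hs0 : ((2 * (c ^ 2 + 2) : ℤ) : 𝓞 k) ≠ 0 := by
    rw [Int.cast_ne_zero]
    positivity
  have hfin := finite_setOf_mem hs0
  have hgood : ∀ v : HeightOneSpectrum (𝓞 k), ((2 * (c ^ 2 + 2) : ℤ) : 𝓞 k) ∈ v.asIdeal →
      LocalGood v f n := by
    intro v hv
    rcases Nat.even_or_odd n with he | ho
    · exact localGood_of_even he hfn.le
    · by_cases h2 : (2 : 𝓞 k) ∈ v.asIdeal
      · exact localGood_of_two_mem ha hd hF hAB ho hn h2
      · rw [Int.cast_mul] at hv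
        have hs := (v.isPrime.mem_or_mem hv).resolve_left (by exact_mod_cast h2)
        exact localGood_of_not_mem hF hAB ho hn h2 (hcv v hs).2
  have hgood' : ∀ v : HeightOneSpectrum (𝓞 k), ∃ (g₀ : k[X]) (D : WithZero (Multiplicative ℤ)),
      g₀.natDegree ≤ n ∧ D ≠ 0 ∧ (((2 * (c ^ 2 + 2) : ℤ) : 𝓞 k) ∈ v.asIdeal →
        ∀ g : k[X], g.natDegree ≤ n → (∀ i, v.valuation k ((g - g₀).coeff i) ≤ D) →
          LocallyEven v f g) := by
    intro v
    by_cases hv : ((2 * (c ^ 2 + 2) : ℤ) : 𝓞 k) ∈ v.asIdeal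
    · obtain ⟨g₀, h0, D, hD, h⟩ := hgood v hv
      exact ⟨g₀, D, h0, hD, fun _ => h⟩
    · exact ⟨0, 1, by simp, one_ne_zero, fun h => absurd h hv⟩
  choose g₀ D hg₀ hD hloc using hgood'
  have hδ' : ∀ σ : k →+* ℝ, ∃ δ : ℝ, 0 < δ ∧ ∀ g : ℝ[X], g.natDegree ≤ n →
      (∀ i, |g.coeff i| < δ) → (∀ x, g.eval x ^ 2 < (f.map σ).eval x) ∧
        g.coeff n ^ 2 < (f.map σ).coeff (2 * n) := fun σ =>
    exists_sq_eval_lt (by rw [natDegree_map, hfn]) (hpos σ)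
  choose δ hδ0 hδ using hδ'
  obtain ⟨η, hη, hηδ⟩ := exists_pos_forall_le δ hδ0
  obtain ⟨g, hgn, hgv, hgσ⟩ := exists_polynomial_approx hfin.toFinset g₀ n hg₀ hD hη
  have hreal : ∀ σ : k →+* ℝ, _ := fun σ => hδ σ (g.map σ) (by rwa [natDegree_map]) fun i => by
    rw [coeff_map]
    exact (hgσ σ i).trans_le (hηδ σ)
  refine ⟨g, f - g ^ 2, by ring, isSumFour_sub_sq σ₀ hc hfn hgn (fun σ => (hreal σ).1)
    (fun σ => ?_) fun v hv => hloc v hv g hgn (hgv v (hfin.mem_toFinset.2 hv))⟩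
  have := (hreal σ).2
  rwa [coeff_map, coeff_map] at this

end Core

section FiveSquares

open NumberField IsDedekindDomain Polynomial

universe u

variable {k : Type u} [Field k] [NumberField k]

theorem exists_intCast_mul_map_eq (p : k[X]) :
    ∃ d : ℤ, d ≠ 0 ∧ ∃ P : (𝓞 k)[X], P.map (algebraMap (𝓞 k) k) = C (d : k) * p := by
  classical
  obtain ⟨b, hb⟩ := IsLocalization.exist_integer_multiples_of_finset (nonZeroDivisors (𝓞 k))
    ((Finset.range (p.natDegree + 1)).image p.coeff)
  have hb0 : (b : 𝓞 k) ≠ 0 := nonZeroDivisors.coe_ne_zero b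
  have hN : Ideal.absNorm (Ideal.span {(b : 𝓞 k)}) ≠ 0 := by
    rwa [Ne, Ideal.absNorm_eq_zero_iff, Ideal.span_singleton_eq_bot]
  obtain ⟨e, he⟩ := Ideal.mem_span_singleton.1 (Ideal.absNorm_mem (Ideal.span {(b : 𝓞 k)}))
  refine ⟨Ideal.absNorm (Ideal.span {(b : 𝓞 k)}), by exact_mod_cast hN, ?_⟩
  have hlift : C (((Ideal.absNorm (Ideal.span {(b : 𝓞 k)}) : ℕ) : ℤ) : k) * p ∈
      lifts (algebraMap (𝓞 k) k) := by
    rw [lifts_iff_coeff_lifts]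
    intro i
    rw [coeff_C_mul]
    by_cases hi : i < p.natDegree + 1
    · obtain ⟨z, hz⟩ := hb _ (Finset.mem_image_of_mem _ (Finset.mem_range.2 hi))
      refine ⟨e * z, ?_⟩
      have h1 : algebraMap (𝓞 k) k z = algebraMap (𝓞 k) k b * p.coeff i :=
        hz.trans (Algebra.smul_def _ _)
      have h2 := congrArg (algebraMap (𝓞 k) k) he
      rw [map_natCast, map_mul] at h2
      rw [Int.cast_natCast, h2, map_mul, h1]
      ring
    · exact ⟨0, by rw [coeff_eq_zero_of_natDegree_lt (by omega), mul_zero, map_zero]⟩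
  obtain ⟨P, hP⟩ := (mem_lifts _).1 hlift
  exact ⟨P, hP⟩

theorem exists_intCast_mul_map_eq_of_fintype {ι : Type*} [Fintype ι] (p : ι → k[X]) :
    ∃ d : ℤ, d ≠ 0 ∧ ∀ i, ∃ P : (𝓞 k)[X], P.map (algebraMap (𝓞 k) k) = C (d : k) * p i := by
  classical
  choose d hd P hP using fun i => exists_intCast_mul_map_eq (p i)
  refine ⟨∏ i, d i, Finset.prod_ne_zero_iff.2 fun i _ => hd i, fun i =>
    ⟨C ((∏ j ∈ Finset.univ.erase i, d j : ℤ) : 𝓞 k) * P i, ?_⟩⟩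
  rw [Polynomial.map_mul, map_C, hP, ← Finset.prod_erase_mul _ _ (Finset.mem_univ i), map_intCast,
    Int.cast_mul, C_mul, mul_assoc]

theorem separable_comp_C_mul_X {K : Type*} [Field K] {p : K[X]} (hp : p.Separable) {m : K}
    (hm : m ≠ 0) : (p.comp (C m * X)).Separable := by
  obtain ⟨A, B, h⟩ := hp
  refine ⟨A.comp (C m * X), B.comp (C m * X) * C m⁻¹, ?_⟩
  have h1 := congrArg (fun q : K[X] => q.comp (C m * X)) h
  simp only [add_comp, mul_comp, one_comp] at h1
  rw [derivative_comp, derivative_C_mul, derivative_X, mul_one, ← h1]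
  have h2 : (C m⁻¹ : K[X]) * C m = 1 := by rw [← C_mul, inv_mul_cancel₀ hm, C_1]
  linear_combination (B.comp (C m * X) * (derivative p).comp (C m * X)) * h2

theorem exists_bezout {F : (𝓞 k)[X]} (hF : (F.map (algebraMap (𝓞 k) k)).Separable) :
    ∃ (A B : (𝓞 k)[X]) (d : 𝓞 k), d ≠ 0 ∧ A * F + B * derivative F = C d := by
  obtain ⟨A, B, h⟩ := hF
  obtain ⟨d, hd, hP⟩ := exists_intCast_mul_map_eq_of_fintype ![A, B]
  obtain ⟨A', hA⟩ := hP 0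
  obtain ⟨B', hB⟩ := hP 1
  refine ⟨A', B', d, Int.cast_ne_zero.2 hd, ?_⟩
  apply map_injective (algebraMap (𝓞 k) k) (FaithfulSMul.algebraMap_injective (𝓞 k) k)
  rw [Polynomial.map_add, Polynomial.map_mul, Polynomial.map_mul, map_C, ← derivative_map, hA, hB]
  simp only [Matrix.cons_val_zero, Matrix.cons_val_one, map_intCast]
  linear_combination (d : k[X]) * h

theorem exists_integral_model {f : k[X]} (hf : f.Separable) {n : ℕ} (hn : f.natDegree = 2 * n) :
    ∃ (a : 𝓞 k) (F : (𝓞 k)[X]) (m : k), a ≠ 0 ∧ m ≠ 0 ∧ F.Monic ∧ F.natDegree = 2 * n ∧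
      (F.map (algebraMap (𝓞 k) k)).Separable ∧
      C (a : k) * F.map (algebraMap (𝓞 k) k) = (C (m ^ (n + 1)) ^ 2 * f.comp (C m⁻¹ * X)) := by
  have hb : f.leadingCoeff ≠ 0 := leadingCoeff_ne_zero.2 hf.ne_zero
  set b := f.leadingCoeff with hbdef
  obtain ⟨m, hm, hP⟩ := exists_intCast_mul_map_eq_of_fintype ![C b, C b⁻¹ * f]
  obtain ⟨P₀, hP₀⟩ := hP 0
  obtain ⟨P₁, hP₁⟩ := hP 1
  simp only [Matrix.cons_val_zero, Matrix.cons_val_one] at hP₀ hP₁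
  have hmk : (m : k) ≠ 0 := Int.cast_ne_zero.2 hm
  set p : k[X] := C ((m : k) ^ (2 * n) * b⁻¹) * f.comp (C (m : k)⁻¹ * X) with hp
  have hcoeff : ∀ i, p.coeff i = (m : k) ^ (2 * n) * b⁻¹ * (f.coeff i * ((m : k) ^ i)⁻¹) := by
    intro i
    rw [hp, coeff_C_mul, comp_C_mul_X_coeff, inv_pow]
  have hcoeff2 : p.coeff (2 * n) = 1 := by
    rw [hcoeff, ← hn, ← leadingCoeff, ← hbdef]
    field_simp
  have hdegle : p.natDegree ≤ 2 * n := by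
    rw [natDegree_le_iff_coeff_eq_zero]
    intro i hi
    rw [hcoeff, coeff_eq_zero_of_natDegree_lt (by omega)]
    ring
  have hdeg : p.natDegree = 2 * n :=
    natDegree_eq_of_le_of_coeff_ne_zero hdegle (by rw [hcoeff2]; exact one_ne_zero)
  have hmon : p.Monic := by rw [Monic, leadingCoeff, hdeg, hcoeff2]
  have hlift : p ∈ lifts (algebraMap (𝓞 k) k) := by
    rw [lifts_iff_coeff_lifts]
    intro i
    rcases lt_trichotomy i (2 * n) with hi | rfl | hi
    · obtain ⟨j, hj⟩ : ∃ j, 2 * n = i + (j + 1) := ⟨2 * n - i - 1, by omega⟩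
      refine ⟨(m : 𝓞 k) ^ j * P₁.coeff i, ?_⟩
      have h1 := congrArg (fun q : k[X] => q.coeff i) hP₁
      simp only [coeff_map, coeff_C_mul] at h1
      rw [map_mul, h1, map_pow, map_intCast, hcoeff, hj, pow_add]
      field_simp
      ring
    · exact ⟨1, by rw [hcoeff2, map_one]⟩
    · exact ⟨0, by rw [coeff_eq_zero_of_natDegree_lt (by omega), map_zero]⟩
  obtain ⟨F, hF, hFdeg, hFm⟩ := lifts_and_natDegree_eq_and_monic hlift hmon
  have ha : algebraMap (𝓞 k) k (m * P₀.coeff 0) = (m : k) ^ 2 * b := by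
    have h1 := congrArg (fun q : k[X] => q.coeff 0) hP₀
    simp only [coeff_map, coeff_C_mul, coeff_C_zero] at h1
    rw [map_mul, h1, map_intCast]
    ring
  refine ⟨m * P₀.coeff 0, F, m, fun h => ?_, hmk, hFm, hFdeg.trans hdeg, ?_, ?_⟩
  · rw [h, map_zero] at ha
    exact mul_ne_zero (pow_ne_zero 2 hmk) hb ha.symm
  · rw [hF, hp]
    have hu : (m : k) ^ (2 * n) * b⁻¹ ≠ 0 := mul_ne_zero (pow_ne_zero _ hmk) (inv_ne_zero hb)
    rw [Separable, derivative_C_mul]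
    exact (isCoprime_mul_unit_left (isUnit_C.2 hu.isUnit) _ _).2
      (separable_comp_C_mul_X hf (inv_ne_zero hmk))
  · change C (algebraMap (𝓞 k) k (m * P₀.coeff 0)) * _ = _
    rw [ha, hF, hp, ← mul_assoc, ← C_mul, ← C_pow]
    congr 2
    field_simp
    ring

theorem exists_five_squares_of_separable (σ₀ : k →+* ℝ) {f : k[X]} (hf : f.Separable)
    (h : ∀ (σ : k →+* ℝ) (x : ℝ), 0 ≤ (f.map σ).eval x) :
    ∃ A : Fin 5 → k[X], f = ∑ i, A i ^ 2 := by
  obtain ⟨n, hn⟩ := even_natDegree_of_eval_nonneg (h σ₀)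
  rw [natDegree_map, ← two_mul] at hn
  obtain ⟨a, F, m, ha, hm, hF, hFn, hsep, hfF⟩ := exists_integral_model hf hn
  obtain ⟨A, B, d, hd, hAB⟩ := exists_bezout hsep
  obtain ⟨g, h, hgh, p, q, r, s, hh⟩ := exists_eq_sq_add_isSumFour σ₀ ha hd hF hAB hFn
    fun σ x => by
      rw [hfF, Polynomial.map_mul, Polynomial.map_pow, map_C, Polynomial.map_comp, eval_mul,
        eval_pow, eval_C, eval_comp]
      have h0 : σ (m ^ (n + 1)) ≠ 0 := by
        rw [_root_.map_ne_zero]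
        exact pow_ne_zero _ hm
      have := eval_pos_of_separable (hf.map (f := σ)) (h σ)
      exact mul_pos (by positivity) (this _)
  have key : f = C ((m ^ (n + 1))⁻¹) ^ 2 *
      (C (a : k) * F.map (algebraMap (𝓞 k) k)).comp (C m * X) := by
    have h1 : (f.comp (C m⁻¹ * X)).comp (C m * X) = f := by
      rw [comp_assoc, mul_comp, C_comp, X_comp, ← mul_assoc, ← C_mul, inv_mul_cancel₀ hm, C_1,
        one_mul, comp_X]
    have h2 : (C ((m ^ (n + 1))⁻¹) : k[X]) * C (m ^ (n + 1)) = 1 := by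
      rw [← C_mul, inv_mul_cancel₀ (pow_ne_zero _ hm), C_1]
    rw [hfF, mul_comp, h1, pow_comp, C_comp, ← mul_assoc, ← mul_pow, h2, one_pow, one_mul]
  refine ⟨fun i => C ((m ^ (n + 1))⁻¹) * (![g, p, q, r, s] i).comp (C m * X), ?_⟩
  rw [key, hgh, hh]
  simp only [Fin.sum_univ_five, mul_pow, ← pow_comp, ← mul_add, ← add_comp]
  simp [add_assoc]

theorem nonneg_of_mul_self_mul_nonneg {p g : ℝ[X]} (hp : p ≠ 0)
    (h : ∀ x, 0 ≤ (p * p * g).eval x) (x : ℝ) : 0 ≤ g.eval x := by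
  by_contra! hx
  have hU : {y | g.eval y < 0} ∈ nhds x := (isOpen_lt g.continuous continuous_const).mem_nhds hx
  obtain ⟨y, hy, hyp⟩ := (infinite_of_mem_nhds x hU).exists_notMem_finset p.roots.toFinset
  have h1 : p.eval y ≠ 0 := fun h0 => hyp (Multiset.mem_toFinset.2 ((mem_roots hp).2 h0))
  have h2 := h y
  rw [eval_mul, eval_mul] at h2
  have h3 : 0 < p.eval y * p.eval y := mul_self_pos.2 h1
  have h4 : g.eval y < 0 := hy
  exact absurd h2 (not_le.2 (mul_neg_of_pos_of_neg h3 h4))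

theorem exists_five_squares (σ₀ : k →+* ℝ) {f : k[X]}
    (h : ∀ (σ : k →+* ℝ) (x : ℝ), 0 ≤ (f.map σ).eval x) :
    ∃ A : Fin 5 → k[X], f = ∑ i, A i ^ 2 := by
  obtain ⟨d, hd⟩ : ∃ d, f.natDegree = d := ⟨_, rfl⟩
  induction d using Nat.strong_induction_on generalizing f with
  | _ d ih =>
  rcases eq_or_ne f 0 with rfl | hf0
  · exact ⟨fun _ => 0, by simp⟩
  by_cases hs : Squarefree f
  · exact exists_five_squares_of_separable σ₀ (PerfectField.separable_iff_squarefree.2 hs) h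
  · simp only [Squarefree, not_forall] at hs
    obtain ⟨x, ⟨g, rfl⟩, hx⟩ := hs
    have hx0 : x ≠ 0 := by rintro rfl; simp at hf0
    have hg0 : g ≠ 0 := by rintro rfl; simp at hf0
    have hxd : 0 < x.natDegree := by
      refine Nat.pos_of_ne_zero fun h0 => hx ?_
      rw [eq_C_of_natDegree_eq_zero h0] at hx0 ⊢
      exact isUnit_C.2 (C_ne_zero.1 hx0).isUnit
    have hdeg : g.natDegree < d := by
      rw [← hd, natDegree_mul (mul_ne_zero hx0 hx0) hg0, natDegree_mul hx0 hx0]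
      omega
    obtain ⟨A, hA⟩ := ih _ hdeg (fun σ y => nonneg_of_mul_self_mul_nonneg
      (p := x.map σ) ((Polynomial.map_ne_zero_iff σ.injective).2 hx0) (fun y => by
        simpa only [Polynomial.map_mul] using h σ y) y) rfl
    refine ⟨fun i => x * A i, ?_⟩
    rw [hA, Finset.mul_sum]
    exact Finset.sum_congr rfl fun i _ => by ring

end FiveSquares

section Main

open NumberField Polynomial

universe u

variable {k : Type u} [Field k] [NumberField k]

theorem exists_real_embedding (htr : ∀ σ : k →+* ℂ, ∀ x : k, (σ x).im = 0) (φ : k →+* ℂ) :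
    ∃ σ : k →+* ℝ, ∀ x, (σ x : ℂ) = φ x := by
  have h : ComplexEmbedding.IsReal φ := by
    rw [ComplexEmbedding.isReal_iff]
    ext x
    exact Complex.conj_eq_iff_im.2 (htr φ x)
  exact ⟨h.embedding, h.coe_embedding_apply⟩

theorem exists_five_squares_integral (σ₀ : k →+* ℝ) {F : (𝓞 k)[X]}
    (h : ∀ (σ : k →+* ℝ) (x : k), 0 ≤ σ ((F.map (algebraMap (𝓞 k) k)).eval x)) :
    ∃ g : ℤ, g ≠ 0 ∧ ∃ Q : Fin 5 → (𝓞 k)[X], (g : (𝓞 k)[X]) ^ 2 * F = ∑ i, Q i ^ 2 := by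
  obtain ⟨A, hA⟩ := exists_five_squares σ₀ (f := F.map (algebraMap (𝓞 k) k)) fun σ x =>
    eval_nonneg_of_rat (fun q => by
      have h1 := h σ q
      rwa [← eval₂_hom, map_ratCast, ← eval_map] at h1) x
  obtain ⟨g, hg, hQ⟩ := exists_intCast_mul_map_eq_of_fintype A
  choose Q hQ using hQ
  refine ⟨g, hg, Q, map_injective (algebraMap (𝓞 k) k) (FaithfulSMul.algebraMap_injective (𝓞 k) k) ?_⟩
  rw [Polynomial.map_mul, Polynomial.map_pow, Polynomial.map_intCast, hA, Polynomial.map_sum,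
    Finset.mul_sum]
  refine Finset.sum_congr rfl fun i _ => ?_
  rw [Polynomial.map_pow, hQ, mul_pow, map_intCast]

theorem eval_nonneg_of_eq_sum_sq {F : (𝓞 k)[X]} {g : ℤ} (hg : g ≠ 0) {Q : Fin 5 → (𝓞 k)[X]}
    (h : (g : (𝓞 k)[X]) ^ 2 * F = ∑ i, Q i ^ 2) (σ : k →+* ℝ) (x : k) :
    0 ≤ σ ((F.map (algebraMap (𝓞 k) k)).eval x) := by
  have h1 := congrArg (fun p : (𝓞 k)[X] => σ ((p.map (algebraMap (𝓞 k) k)).eval x)) h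
  simp only [Polynomial.map_mul, Polynomial.map_pow, Polynomial.map_intCast, Polynomial.map_sum,
    eval_mul, eval_pow, eval_intCast, eval_finsetSum, map_mul, map_pow, map_sum, map_intCast] at h1
  have hg2 : (0 : ℝ) < (g : ℝ) ^ 2 := by positivity
  refine nonneg_of_mul_nonneg_right ?_ hg2
  rw [h1]
  exact Finset.sum_nonneg fun i _ => sq_nonneg _

theorem natDegree_le_of_sum_sq (σ₀ : k →+* ℝ) {n : ℕ} {Q : Fin n → (𝓞 k)[X]} {G : (𝓞 k)[X]}
    (h : G = ∑ i, Q i ^ 2) (i : Fin n) : (Q i).natDegree ≤ G.natDegree := by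
  have hinj := FaithfulSMul.algebraMap_injective (𝓞 k) k
  rcases eq_or_ne (Q i) 0 with h0 | h0
  · simp [h0]
  · obtain ⟨j, -, hj, hdeg, -⟩ := leadingCoeff_sum_sq σ₀
      (fun i => (Q i).map (algebraMap (𝓞 k) k)) ⟨i, (Polynomial.map_ne_zero_iff hinj).2 h0⟩
    have h1 := hj i
    have h2 : ∑ i, (Q i).map (algebraMap (𝓞 k) k) ^ 2 = G.map (algebraMap (𝓞 k) k) := by
      simp [h, Polynomial.map_sum]
    rw [h2, natDegree_map_eq_of_injective hinj] at hdeg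
    rw [natDegree_map_eq_of_injective hinj] at h1
    omega

theorem finite_setOf_sum_sq (htr : ∀ σ : k →+* ℂ, ∀ x : k, (σ x).im = 0) (n : ℕ) (G : (𝓞 k)[X]) :
    {Q : Fin n → (𝓞 k)[X] | G = ∑ i, Q i ^ 2}.Finite := by
  obtain ⟨φ₀⟩ := (inferInstance : Nonempty (k →+* ℂ))
  obtain ⟨σ₀, -⟩ := exists_real_embedding htr φ₀
  obtain ⟨B, hB⟩ : ∃ B : ℝ, ∀ (φ : k →+* ℂ) (x : Fin (G.natDegree + 1)),
      1 + ‖φ (algebraMap (𝓞 k) k (G.eval ((x : ℕ) : 𝓞 k)))‖ ≤ B := by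
    obtain ⟨B, hB⟩ := (Set.finite_range fun p : (k →+* ℂ) × Fin (G.natDegree + 1) =>
      1 + ‖p.1 (algebraMap (𝓞 k) k (G.eval ((p.2 : ℕ) : 𝓞 k)))‖).bddAbove
    exact ⟨B, fun φ x => hB ⟨(φ, x), rfl⟩⟩
  have hfin := Embeddings.finite_of_norm_le k ℂ B
  refine Set.Finite.of_injOn
    (f := fun (Q : Fin n → (𝓞 k)[X]) (i : Fin n) (x : Fin (G.natDegree + 1)) =>
      (((Q i).eval ((x : ℕ) : 𝓞 k) : 𝓞 k) : k)) ?_ ?_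
    (Set.Finite.pi' fun _ => Set.Finite.pi' fun _ => hfin)
  · intro Q hQ i x
    refine ⟨RingOfIntegers.isIntegral_coe _, fun φ => ?_⟩
    obtain ⟨σ, hσ⟩ := exists_real_embedding htr φ
    have hG : G = ∑ i, Q i ^ 2 := hQ
    have h1 : σ (algebraMap (𝓞 k) k (G.eval ((x : ℕ) : 𝓞 k))) =
        ∑ i, σ (algebraMap (𝓞 k) k ((Q i).eval ((x : ℕ) : 𝓞 k))) ^ 2 := by
      have h0 := congrArg (eval ((x : ℕ) : 𝓞 k)) hG
      rw [h0]
      simp only [eval_finsetSum, eval_pow, map_sum, map_pow]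
    have h2 := hB φ x
    rw [← hσ, Complex.norm_real, Real.norm_eq_abs] at h2 ⊢
    have h3 : σ (algebraMap (𝓞 k) k ((Q i).eval ((x : ℕ) : 𝓞 k))) ^ 2 ≤
        σ (algebraMap (𝓞 k) k (G.eval ((x : ℕ) : 𝓞 k))) := by
      rw [h1]
      exact Finset.single_le_sum
        (f := fun i => σ (algebraMap (𝓞 k) k ((Q i).eval ((x : ℕ) : 𝓞 k))) ^ 2)
        (fun i _ => sq_nonneg _) (Finset.mem_univ i)
    have h4 := le_abs_self (σ (algebraMap (𝓞 k) k (G.eval ((x : ℕ) : 𝓞 k))))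
    refine le_trans ?_ h2
    refine le_trans ?_ (add_le_add_right (h3.trans h4) 1)
    rw [← sq_abs]
    nlinarith [sq_nonneg (|σ (algebraMap (𝓞 k) k ((Q i).eval ((x : ℕ) : 𝓞 k)))| - 1)]
  · intro Q hQ R hR hQR
    funext i
    rw [← sub_eq_zero]
    refine eq_zero_of_natDegree_lt_card_of_eval_eq_zero (Q i - R i)
      (f := fun x : Fin (G.natDegree + 1) => ((x : ℕ) : 𝓞 k))
      (fun x y hxy => Fin.ext (Nat.cast_injective hxy)) (fun x => ?_) ?_
    · rw [eval_sub, sub_eq_zero]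
      exact RingOfIntegers.coe_injective (congrFun (congrFun hQR i) x)
    · rw [Fintype.card_fin, Nat.lt_succ_iff]
      exact (natDegree_sub_le_of_le (natDegree_le_of_sum_sq σ₀ hQ i)
        (natDegree_le_of_sum_sq σ₀ hR i)).trans (max_self _).le

end Main

end FiveSquares

open Polynomial

/-- Pourchet / positive-definiteness: over the ring of integers of a
totally real number field, a polynomial is positive definite iff a square integer
multiple of it is a sum of five squares, and each such representation is
finite-fold. -/
theorem pos_def_iff_five_squares
    (k : Type*) [Field k] [NumberField k]
    (htr : ∀ σ : k →+* ℂ, ∀ x : k, (σ x).im = 0)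
    (F : Polynomial (NumberField.RingOfIntegers k)) :
    ((∀ (σ : k →+* ℝ) (x : k),
        0 ≤ σ (Polynomial.eval x
          (F.map (algebraMap (NumberField.RingOfIntegers k) k)))) ↔
      ∃ (g : ℤ), g ≠ 0 ∧ ∃ Q : Fin 5 → Polynomial (NumberField.RingOfIntegers k),
        ((g : Polynomial (NumberField.RingOfIntegers k)) ^ 2) * F = ∑ i, (Q i) ^ 2) ∧
    (∀ g : ℤ, g ≠ 0 →
      {Q : Fin 5 → Polynomial (NumberField.RingOfIntegers k) |
        ((g : Polynomial (NumberField.RingOfIntegers k)) ^ 2) * F = ∑ i, (Q i) ^ 2}.Finite) := by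
  obtain ⟨φ₀⟩ := (inferInstance : Nonempty (k →+* ℂ))
  obtain ⟨σ₀, -⟩ := FiveSquares.exists_real_embedding htr φ₀
  refine ⟨⟨FiveSquares.exists_five_squares_integral σ₀, ?_⟩, fun g _ =>
    FiveSquares.finite_setOf_sum_sq htr 5 _⟩
  rintro ⟨g, hg, Q, h⟩
  exact FiveSquares.eval_nonneg_of_eq_sum_sq hg h
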